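/- The group F₂ × F₂ admits no C(6) small-cancellation presentation: for every set S and every symmetrized subset R of the free group F(S) satisfying the C(6) small-cancellation condition, the presented group ⟨S | R⟩ is not isomorphic to F₂ × F₂, where F₂ denotes the free group on two generators. -/

import Mathlib

/-- Length of the reduced word of an element of a free group. -/
def FG.len {S : Type*} [DecidableEq S] (g : FreeGroup S) : ℕ :=
  g.toWord.length

/-- `r` is cyclically reduced: every conjugate is at least as long. -/
def FG.CyclicallyReduced {S : Type*} [DecidableEq S] (r : FreeGroup S) : Prop :=
  ∀ g : FreeGroup S, FG.len r ≤ FG.len (g⁻¹ * r * g)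

/-- `R` is a symmetrized subset: every element is nontrivial and cyclically
reduced, `R` is closed under inversion and under cyclic permutation. -/
def FG.Symmetrized {S : Type*} [DecidableEq S] (R : Set (FreeGroup S)) : Prop :=
  (∀ r ∈ R, r ≠ 1 ∧ FG.CyclicallyReduced r) ∧
  (∀ r ∈ R, r⁻¹ ∈ R) ∧
  (∀ r ∈ R, ∀ u v : FreeGroup S,
      r = u * v → FG.len r = FG.len u + FG.len v → v * u ∈ R)

/-- `p` is a piece relative to `R`. -/
def FG.IsPiece {S : Type*} [DecidableEq S] (R : Set (FreeGroup S))
    (p : FreeGroup S) : Prop :=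
  p ≠ 1 ∧
  ∃ r₁ ∈ R, ∃ r₂ ∈ R, r₁ ≠ r₂ ∧
    (∃ v₁ : FreeGroup S, r₁ = p * v₁ ∧ FG.len r₁ = FG.len p + FG.len v₁) ∧
    (∃ v₂ : FreeGroup S, r₂ = p * v₂ ∧ FG.len r₂ = FG.len p + FG.len v₂)

/-- The C(6) small-cancellation condition: no relator is a reduced
concatenation of at most 5 pieces. -/
def FG.C6 {S : Type*} [DecidableEq S] (R : Set (FreeGroup S)) : Prop :=
  ¬ ∃ r ∈ R, ∃ ps : List (FreeGroup S),
      ps.length ≤ 5 ∧ (∀ p ∈ ps, FG.IsPiece R p) ∧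
      r = ps.prod ∧ FG.len r = (ps.map FG.len).sum

set_option linter.all false

namespace FC6
open Equiv
open Equiv.Perm (mul_apply)
open Finset (Ioo Ico mem_Ioo mem_Ico mem_filter mem_singleton mem_insert mem_union sum_congr card_le_card card_union_of_disjoint sum_le_sum card_pos mem_univ univ)
open List (map_congr_left map_map map_cons map_append map_eq_cons_iff mem_flatten length_map mem_map)
open FreeGroup (mul_mk)
open Multiplicative (toAdd)
open List (length_pos_iff)
open Function (support)
universe u v w

/-- Words over the alphabet `S`. -/
notation "Wd(" S ")" => List (S × Bool)
/-- Lists of pairs of words. -/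
notation "Fi(" S ")" => List (List (S × Bool) × List (S × Bool))
/-- Bi-infinite periodic readings of words over `S`. -/
notation "Rd(" S ")" => ℤ → S × Bool
/-- The class of a word in the free group. -/
notation "fgMk" => FreeGroup.mk

section perm
variable {D : Type} [Fintype D] [DecidableEq D]

/-- number of classes -/
noncomputable def cls {D : Type} (s : Setoid D) : ℕ := Nat.card (Quotient s)

theorem cls_mono {s t : Setoid D} (h : s ≤ t) : cls t ≤ cls s := by
  classical
  haveI : Finite (Quotient s) := Quotient.finite s
  refine Nat.card_le_card_of_surjective (Quotient.map' (s₁ := s) (s₂ := t) id (fun a b hab => h hab)) ?_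
  intro q
  induction q using Quotient.inductionOn' with
  | h a => exact ⟨Quotient.mk'' a, rfl⟩

/-- the relation identifying a and b -/
def pr {D : Type} (a b : D) : Setoid D :=
  Relation.EqvGen.setoid (fun x y => x = a ∧ y = b)

theorem pr_le {D : Type} {a b : D} {s : Setoid D} : pr a b ≤ s ↔ s a b := by
  constructor
  · intro h
    exact h (Relation.EqvGen.rel _ _ ⟨rfl, rfl⟩)
  · intro h
    refine Setoid.eqvGen_le ?_
    rintro x y ⟨rfl, rfl⟩
    exact h

theorem sup_pr_rel {D : Type} (a b : D) (s : Setoid D) : (s ⊔ pr a b) a b :=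
  pr_le.1 le_sup_right

theorem cls_sup_pr {s : Setoid D} {a b : D} (h : ¬ s a b) : cls (s ⊔ pr a b) + 1 = cls s := by
  classical
  haveI : Finite (Quotient s) := Quotient.finite s
  let φ : D → Quotient s := fun x => if s x b then Quotient.mk s a else Quotient.mk s x
  have hker : s ⊔ pr a b = Setoid.ker φ := by
    apply le_antisymm
    · refine sup_le ?_ ?_
      · intro x y hxy
        simp only [Setoid.ker_def, φ]
        have : s x b ↔ s y b := ⟨fun h => s.trans (s.symm hxy) h, fun h => s.trans hxy h⟩
        by_cases hx : s x b
        · rw [if_pos hx, if_pos (this.1 hx)]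
        · rw [if_neg hx, if_neg (fun h => hx (this.2 h))]
          exact Quotient.sound hxy
      · rw [pr_le]
        simp only [Setoid.ker_def, φ]
        rw [if_neg h, if_pos (s.refl b)]
    · intro x y hxy
      simp only [Setoid.ker_def, φ] at hxy
      have hs : ∀ {u v}, s u v → (s ⊔ pr a b) u v := fun h => (le_sup_left : s ≤ _) h
      have hab := sup_pr_rel a b s
      split_ifs at hxy with h1 h2 h2
      · exact hs (s.trans h1 (s.symm h2))
      · have := Quotient.exact hxy
        exact (s ⊔ pr a b).trans (hs h1) ((s ⊔ pr a b).trans ((s ⊔ pr a b).symm hab) (hs this))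
      · have := Quotient.exact hxy
        exact (s ⊔ pr a b).trans (hs this) ((s ⊔ pr a b).trans hab (hs (s.symm h2)))
      · exact hs (Quotient.exact hxy)
  rw [hker]
  unfold cls
  rw [Nat.card_congr (Setoid.quotientKerEquivRange φ)]
  have hr : Set.range φ = {Quotient.mk s b}ᶜ := by
    ext q
    induction q using Quotient.inductionOn with
    | h x =>
      simp only [Set.mem_range, Set.mem_compl_iff, Set.mem_singleton_iff, φ]
      constructor
      · rintro ⟨y, hy⟩ hq
        rw [hq] at hy
        split_ifs at hy with h1
        · exact h (Quotient.exact hy)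
        · exact h1 (Quotient.exact hy)
      · intro hx
        refine ⟨x, ?_⟩
        rw [if_neg]
        intro hxb
        exact hx (Quotient.sound hxb)
  rw [hr, Nat.card_coe_set_eq, Set.ncard_compl, Set.ncard_singleton]
  have : 0 < Nat.card (Quotient s) := by
    haveI : Nonempty (Quotient s) := ⟨Quotient.mk s a⟩
    exact Nat.card_pos
  omega

theorem cls_le_sup_pr (s : Setoid D) (a b : D) : cls s ≤ cls (s ⊔ pr a b) + 1 := by
  by_cases h : s a b
  · rw [sup_eq_left.2 (pr_le.2 h)]; omega
  · rw [cls_sup_pr h]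

/-- same cycle setoid -/
abbrev sc {D : Type} (σ : Perm D) : Setoid D := Perm.SameCycle.setoid σ

theorem sc_apply {D : Type} (σ : Perm D) (x : D) : sc σ x (σ x) := ⟨1, by simp⟩

theorem sc_le_of {D : Type} {σ : Perm D} {s : Setoid D} (h : ∀ x, s x (σ x)) : sc σ ≤ s := by
  intro x y hxy
  obtain ⟨i, rfl⟩ := hxy
  induction i using Int.induction_on with
  | zero => exact s.refl _
  | succ n ih =>
    refine s.trans ih ?_
    rw [add_comm, zpow_add, zpow_one]
    exact h _
  | pred n ih =>
    refine s.trans ih (s.symm ?_)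
    have := h ((σ ^ (-(n:ℤ) - 1)) x)
    rwa [← mul_apply, ← zpow_one_add, show 1 + (-(n:ℤ) - 1) = -n by ring] at this

theorem sc_inv {D : Type} (σ : Perm D) : sc σ⁻¹ = sc σ := by
  ext x y; exact Perm.sameCycle_inv

theorem swap_sc_of_not {σ : Perm D} {a b : D} (h : ¬ sc σ a b) : sc (swap a b * σ) a b := by
  classical
  have hp : 0 < Function.minimalPeriod σ a := by
    apply Function.minimalPeriod_pos_of_mem_periodicPts
    exact ⟨orderOf σ, orderOf_pos σ, by
      rw [Function.IsPeriodicPt, Function.IsFixedPt, ← Perm.coe_pow, pow_orderOf_eq_one]; rfl⟩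
  set p := Function.minimalPeriod σ a with hpd
  have hne : ∀ k, (σ ^ k) a ≠ b := by
    intro k hk
    exact h ⟨k, by simpa using hk⟩
  have key : ∀ k, k < p → ((swap a b * σ) ^ k) a = (σ ^ k) a := by
    intro k
    induction k with
    | zero => intro _; rfl
    | succ k ih =>
      intro hk
      rw [pow_succ', mul_apply, ih (by omega), mul_apply, ← mul_apply σ, ← pow_succ']
      refine swap_apply_of_ne_of_ne ?_ (hne _)
      intro hh
      have : Function.IsPeriodicPt σ (k+1) a := by
        rw [Function.IsPeriodicPt, Function.IsFixedPt, ← Perm.coe_pow]; exact hh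
      have := this.minimalPeriod_le (by omega)
      omega
  refine ⟨p, ?_⟩
  obtain ⟨q, hq⟩ : ∃ q, p = q + 1 := ⟨p - 1, by omega⟩
  have hpa : (σ ^ p) a = a := by
    have := Function.isPeriodicPt_minimalPeriod σ a
    rw [← hpd, Function.IsPeriodicPt, Function.IsFixedPt, ← Perm.coe_pow] at this
    exact this
  rw [zpow_natCast, hq, pow_succ', mul_apply, key q (by omega), mul_apply,
    ← mul_apply σ, ← pow_succ', ← hq, hpa, swap_apply_left]

theorem swap_not_sc {σ : Perm D} {a b : D} (hab : a ≠ b) (h : sc σ a b) :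
    ¬ sc (swap a b * σ) a b := by
  classical
  obtain ⟨i, -, hi⟩ := Perm.SameCycle.exists_pow_eq' h
  have hex : ∃ k, (σ ^ k) a = b := ⟨i, hi⟩
  let k := Nat.find hex
  have hk : (σ ^ k) a = b := Nat.find_spec hex
  have hmin : ∀ j < k, (σ ^ j) a ≠ b := fun j hj => Nat.find_min hex hj
  have hk0 : 0 < k := by
    rcases Nat.eq_zero_or_pos k with h0 | h0
    · rw [h0] at hk; exact absurd hk hab
    · exact h0
  have hna : ∀ j, 0 < j → j < k → (σ ^ j) a ≠ a := by
    intro j hj hjk hja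
    refine hmin (k - j) (by omega) ?_
    have : (σ ^ k) a = (σ ^ (k - j)) ((σ ^ j) a) := by
      rw [← mul_apply, ← pow_add]; congr 2; omega
    rw [hja] at this
    rw [← this, hk]
  have key : ∀ j, j < k → ((swap a b * σ) ^ j) a = (σ ^ j) a := by
    intro j
    induction j with
    | zero => intro _; rfl
    | succ j ih =>
      intro hj
      rw [pow_succ', mul_apply, ih (by omega), mul_apply, ← mul_apply σ, ← pow_succ']
      exact swap_apply_of_ne_of_ne (hna _ (by omega) hj) (hmin _ hj)
  have hper : ((swap a b * σ) ^ k) a = a := by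
    obtain ⟨q, hq⟩ : ∃ q, k = q + 1 := ⟨k - 1, by omega⟩
    rw [hq, pow_succ', mul_apply, key q (by omega), mul_apply,
      ← mul_apply σ, ← pow_succ', ← hq, hk, swap_apply_right]
  intro hs
  obtain ⟨m, -, hm⟩ := Perm.SameCycle.exists_pow_eq' hs
  have hmod : ((swap a b * σ) ^ (m % k)) a = b := by
    have this : ∀ t, (((swap a b * σ) ^ k) ^ t) a = a := by
      intro t
      induction t with
      | zero => rfl
      | succ t ih => rw [pow_succ, mul_apply, hper, ih]
    have h2 : ((swap a b * σ) ^ m) a = ((swap a b * σ) ^ (m % k)) a := by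
      conv_lhs => rw [← Nat.mod_add_div m k, pow_add, mul_apply, pow_mul, this]
    rw [← h2, hm]
  have hlt : m % k < k := Nat.mod_lt _ hk0
  rw [key _ hlt] at hmod
  exact hmin _ hlt hmod

theorem swap_mul_swap_mul (σ : Perm D) (a b : D) : swap a b * (swap a b * σ) = σ := by
  rw [← mul_assoc, swap_mul_self, one_mul]

theorem sc_swap_le (σ : Perm D) (a b : D) : sc (swap a b * σ) ≤ sc σ ⊔ pr a b := by
  apply sc_le_of
  intro x
  refine (sc σ ⊔ pr a b).trans ((le_sup_left : sc σ ≤ _) (sc_apply σ x)) ?_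
  rw [mul_apply]
  have hab := sup_pr_rel a b (sc σ)
  by_cases h1 : σ x = a
  · rw [h1, swap_apply_left]; exact hab
  · by_cases h2 : σ x = b
    · rw [h2, swap_apply_right]; exact (sc σ ⊔ pr a b).symm hab
    · rw [swap_apply_of_ne_of_ne h1 h2]

theorem sc_le_swap (σ : Perm D) (a b : D) : sc σ ≤ sc (swap a b * σ) ⊔ pr a b := by
  have := sc_swap_le (swap a b * σ) a b
  rwa [swap_mul_swap_mul] at this

theorem sc_swap_eq {σ : Perm D} {a b : D} (h : ¬ sc σ a b) :
    sc (swap a b * σ) = sc σ ⊔ pr a b := by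
  apply le_antisymm (sc_swap_le _ _ _)
  have h1 : pr a b ≤ sc (swap a b * σ) := pr_le.2 (swap_sc_of_not h)
  refine sup_le ?_ h1
  have := sc_le_swap σ a b
  rwa [sup_eq_left.2 h1] at this

/-- number of cycles -/
noncomputable def cyc {D : Type} (σ : Perm D) : ℤ := cls (sc σ)

theorem cyc_inv (σ : Perm D) : cyc σ⁻¹ = cyc σ := by unfold cyc; rw [sc_inv]

theorem cyc_swap_of_not {σ : Perm D} {a b : D} (h : ¬ sc σ a b) :
    cyc (swap a b * σ) = cyc σ - 1 := by
  unfold cyc; rw [sc_swap_eq h]; have := cls_sup_pr h; omega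

theorem cyc_swap_of {σ : Perm D} {a b : D} (hab : a ≠ b) (h : sc σ a b) :
    cyc (swap a b * σ) = cyc σ + 1 := by
  have := cyc_swap_of_not (swap_not_sc hab h)
  rw [swap_mul_swap_mul] at this
  omega

/-- number of components -/
noncomputable def kap {D : Type} (α β : Perm D) : ℤ := cls (sc α ⊔ sc β)

/-- twice genus -/
noncomputable def gen (α β : Perm D) : ℤ :=
  2 * kap α β + Fintype.card D - cyc α - cyc β - cyc (α⁻¹ * β)

theorem swap_inv_mul (α β : Perm D) (a b : D) :
    (swap a b * α)⁻¹ * (swap a b * β) = α⁻¹ * β := by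
  rw [mul_inv_rev, mul_assoc, ← mul_assoc _ (swap a b) β, swap_inv, swap_mul_self, one_mul]

theorem join_le_swap (α β : Perm D) (a b : D) :
    sc α ⊔ sc β ≤ (sc (swap a b * α) ⊔ sc (swap a b * β)) ⊔ pr a b := by
  refine sup_le ?_ ?_
  · exact (sc_le_swap α a b).trans (sup_le_sup_right le_sup_left _)
  · exact (sc_le_swap β a b).trans (sup_le_sup_right le_sup_right _)

theorem kap_swap_le_of_conn {α β : Perm D} {a b : D}
    (h : (sc (swap a b * α) ⊔ sc (swap a b * β)) a b) :
    kap (swap a b * α) (swap a b * β) ≤ kap α β := by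
  have := join_le_swap α β a b
  rw [sup_eq_left.2 (pr_le.2 h)] at this
  unfold kap
  exact_mod_cast cls_mono this

theorem kap_swap_le (α β : Perm D) (a b : D) :
    kap (swap a b * α) (swap a b * β) ≤ kap α β + 1 := by
  have h1 := cls_mono (join_le_swap α β a b)
  have h2 := cls_le_sup_pr (sc (swap a b * α) ⊔ sc (swap a b * β)) a b
  unfold kap
  omega

theorem gen_swap_le_two (α β : Perm D) (a b : D) :
    gen (swap a b * α) (swap a b * β) ≤ gen α β + 2 := by
  by_cases hab : a = b
  · subst hab
    simp only [swap_self, ← Perm.one_def, one_mul]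
    omega
  unfold gen
  rw [swap_inv_mul]
  by_cases h1 : sc α a b <;> by_cases h2 : sc β a b
  · rw [cyc_swap_of hab h1, cyc_swap_of hab h2]
    have := kap_swap_le α β a b
    omega
  · rw [cyc_swap_of hab h1, cyc_swap_of_not h2]
    have := kap_swap_le_of_conn (α := α) (β := β) ((le_sup_right : _ ≤ sc (swap a b * α) ⊔ _) (swap_sc_of_not h2))
    omega
  · rw [cyc_swap_of_not h1, cyc_swap_of hab h2]
    have := kap_swap_le_of_conn (α := α) (β := β) ((le_sup_left : _ ≤ _ ⊔ sc (swap a b * β)) (swap_sc_of_not h1))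
    omega
  · rw [cyc_swap_of_not h1, cyc_swap_of_not h2]
    have := kap_swap_le_of_conn (α := α) (β := β) ((le_sup_left : _ ≤ _ ⊔ sc (swap a b * β)) (swap_sc_of_not h1))
    omega

theorem gen_swap_le {α β : Perm D} {a b : D} (h : sc α a b ∨ sc β a b) :
    gen (swap a b * α) (swap a b * β) ≤ gen α β := by
  by_cases hab : a = b
  · subst hab
    simp only [swap_self, ← Perm.one_def, one_mul]
    omega
  unfold gen
  rw [swap_inv_mul]
  by_cases h1 : sc α a b <;> by_cases h2 : sc β a b
  · rw [cyc_swap_of hab h1, cyc_swap_of hab h2]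
    have := kap_swap_le α β a b
    omega
  · rw [cyc_swap_of hab h1, cyc_swap_of_not h2]
    have := kap_swap_le_of_conn (α := α) (β := β) ((le_sup_right : _ ≤ sc (swap a b * α) ⊔ _) (swap_sc_of_not h2))
    omega
  · rw [cyc_swap_of_not h1, cyc_swap_of hab h2]
    have := kap_swap_le_of_conn (α := α) (β := β) ((le_sup_left : _ ≤ _ ⊔ sc (swap a b * β)) (swap_sc_of_not h1))
    omega
  · tauto

theorem gen_swap_le_of_conn {α β : Perm D} {a b : D} (hab : a ≠ b) (h1 : sc α a b) (h2 : sc β a b)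
    (h : (sc (swap a b * α) ⊔ sc (swap a b * β)) a b) :
    gen (swap a b * α) (swap a b * β) ≤ gen α β - 2 := by
  unfold gen
  rw [swap_inv_mul, cyc_swap_of hab h1, cyc_swap_of hab h2]
  have := kap_swap_le_of_conn h
  omega

theorem gen_swap_le_of_disj {α β : Perm D} {a b : D} (h : ¬ (sc α ⊔ sc β) a b) :
    gen (swap a b * α) (swap a b * β) ≤ gen α β := by
  have h1 : ¬ sc α a b := fun hh => h ((le_sup_left : sc α ≤ _) hh)
  have h2 : ¬ sc β a b := fun hh => h ((le_sup_right : sc β ≤ _) hh)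
  unfold gen
  rw [swap_inv_mul, cyc_swap_of_not h1, cyc_swap_of_not h2]
  have : kap (swap a b * α) (swap a b * β) + 1 = kap α β := by
    unfold kap
    rw [sc_swap_eq h1, sc_swap_eq h2]
    have : sc α ⊔ pr a b ⊔ (sc β ⊔ pr a b) = (sc α ⊔ sc β) ⊔ pr a b := by
      rw [sup_sup_sup_comm, sup_idem]
    rw [this]
    have := cls_sup_pr h
    omega
  omega

/-- symmetric form: replace σ,ν by τ⁻¹,ν⁻¹ where ν = σ τ -/
theorem gen_sym (σ τ : Perm D) : gen σ (σ * τ) = gen τ⁻¹ (σ * τ)⁻¹ := by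
  unfold gen
  rw [cyc_inv, cyc_inv, inv_mul_cancel_left, inv_inv, mul_inv_rev, mul_inv_cancel_left, cyc_inv]
  have : kap σ (σ * τ) = kap τ⁻¹ (τ⁻¹ * σ⁻¹) := by
    rw [← mul_inv_rev]
    unfold kap
    rw [sc_inv, sc_inv]
    congr 2
    apply le_antisymm
    · refine sup_le ?_ le_sup_right
      apply sc_le_of
      intro x
      set s := sc τ ⊔ sc (σ * τ)
      have h1 : s (τ⁻¹ x) (σ x) := by
        have := (le_sup_right : sc (σ * τ) ≤ s) (sc_apply (σ * τ) (τ⁻¹ x))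
        simpa using this
      have h2 : s (τ⁻¹ x) x := by
        have := (le_sup_left : sc τ ≤ s) (sc_apply τ (τ⁻¹ x))
        simpa using this
      exact s.trans (s.symm h2) h1
    · refine sup_le ?_ le_sup_right
      apply sc_le_of
      intro x
      set s := sc σ ⊔ sc (σ * τ)
      have h1 : s x (σ (τ x)) := (le_sup_right : sc (σ * τ) ≤ s) (sc_apply (σ * τ) x)
      have h2 : s (τ x) (σ (τ x)) := (le_sup_left : sc σ ≤ s) (sc_apply σ (τ x))
      exact s.trans h1 (s.symm h2)
  rw [this]
  ring

theorem cls_bot : cls (⊥ : Setoid D) = Fintype.card D := by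
  unfold cls
  rw [← Nat.card_eq_fintype_card]
  refine Nat.card_congr ⟨Quotient.lift id (fun a b h => h), Quotient.mk ⊥, ?_, ?_⟩
  · intro q; induction q using Quotient.inductionOn with | h a => rfl
  · intro a; rfl

theorem cyc_one : cyc (1 : Perm D) = Fintype.card D := by
  unfold cyc
  have : sc (1 : Perm D) = ⊥ := by
    apply le_bot_iff.1
    apply sc_le_of
    intro x
    rfl
  rw [this, cls_bot]

theorem cyc_le_card (σ : Perm D) : cyc σ ≤ Fintype.card D := by
  unfold cyc
  rw [← cls_bot]
  exact_mod_cast cls_mono bot_le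

theorem gen_nonneg (α β : Perm D) : 0 ≤ gen α β := by
  obtain ⟨τ, rfl⟩ : ∃ τ, β = α * τ := ⟨α⁻¹ * β, by simp⟩
  obtain ⟨n, hn⟩ : ∃ n : ℕ, (Fintype.card D : ℤ) - cyc τ = n :=
    ⟨((Fintype.card D : ℤ) - cyc τ).toNat, by have := cyc_le_card τ; omega⟩
  induction n using Nat.strong_induction_on generalizing τ with
  | _ n ih =>
    by_cases hτ : τ = 1
    · subst hτ
      unfold gen
      rw [mul_one, inv_mul_cancel, cyc_one]
      unfold kap cyc
      rw [sup_idem]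
      omega
    · obtain ⟨a, ha⟩ : ∃ a, τ a ≠ a := by
        by_contra hh
        push Not at hh
        exact hτ (Perm.ext hh)
      have hsc : sc τ⁻¹ a (τ a) := by rw [sc_inv]; exact sc_apply τ a
      have h1 := gen_swap_le (α := τ⁻¹) (β := (α * τ)⁻¹) (Or.inl hsc)
      have hc := cyc_swap_of (Ne.symm ha) hsc
      rw [gen_sym]
      refine le_trans ?_ h1
      set τ' := τ * swap a (τ a) with hτ'
      have e1 : swap a (τ a) * τ⁻¹ = τ'⁻¹ := by rw [hτ', mul_inv_rev, swap_inv]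
      have e2 : swap a (τ a) * (α * τ)⁻¹ = (α * τ')⁻¹ := by
        rw [hτ', ← mul_assoc, mul_inv_rev _ (swap _ _), swap_inv]
      rw [e1] at hc ⊢
      rw [e2, ← gen_sym]
      rw [cyc_inv, cyc_inv] at hc
      refine ih (n-1) ?_ τ' ?_
      · have := cyc_le_card τ'; omega
      · have := cyc_le_card τ'; omega

end perm

section summ
variable {D D' : Type} [Fintype D] [DecidableEq D] [Fintype D'] [DecidableEq D']

/-- sum of setoids -/
def sumS {D D' : Type} (s : Setoid D) (t : Setoid D') : Setoid (D ⊕ D') where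
  r := fun x y => match x, y with
    | Sum.inl x, Sum.inl y => s x y
    | Sum.inr x, Sum.inr y => t x y
    | _, _ => False
  iseqv := by
    constructor
    · rintro (x | x)
      · exact s.refl x
      · exact t.refl x
    · rintro (x | x) (y | y) h
      · exact s.symm h
      · exact h
      · exact h
      · exact t.symm h
    · rintro (x | x) (y | y) (z | z) h h'
      all_goals first | exact s.trans h h' | exact t.trans h h' | exact h.elim | exact h'.elim

theorem sumS_le {s : Setoid D} {t : Setoid D'} {u : Setoid (D ⊕ D')} :
    sumS s t ≤ u ↔ s ≤ u.comap Sum.inl ∧ t ≤ u.comap Sum.inr := by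
  constructor
  · intro h
    exact ⟨fun x y hxy => h (x := Sum.inl x) (y := Sum.inl y) hxy, fun x y hxy => h (x := Sum.inr x) (y := Sum.inr y) hxy⟩
  · rintro ⟨h1, h2⟩ (x | x) (y | y) h
    · exact h1 h
    · exact h.elim
    · exact h.elim
    · exact h2 h

theorem sumS_sup (s s' : Setoid D) (t t' : Setoid D') :
    sumS s t ⊔ sumS s' t' = sumS (s ⊔ s') (t ⊔ t') := by
  apply le_antisymm
  · refine sup_le ?_ ?_
    · rw [sumS_le]
      exact ⟨fun x y h => (le_sup_left : s ≤ s ⊔ s') h, fun x y h => (le_sup_left : t ≤ t ⊔ t') h⟩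
    · rw [sumS_le]
      exact ⟨fun x y h => (le_sup_right : s' ≤ s ⊔ s') h, fun x y h => (le_sup_right : t' ≤ t ⊔ t') h⟩
  · rw [sumS_le]
    refine ⟨sup_le ?_ ?_, sup_le ?_ ?_⟩
    · exact (sumS_le.1 (le_sup_left : sumS s t ≤ sumS s t ⊔ sumS s' t')).1
    · exact (sumS_le.1 (le_sup_right : sumS s' t' ≤ sumS s t ⊔ sumS s' t')).1
    · exact (sumS_le.1 (le_sup_left : sumS s t ≤ sumS s t ⊔ sumS s' t')).2
    · exact (sumS_le.1 (le_sup_right : sumS s' t' ≤ sumS s t ⊔ sumS s' t')).2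

theorem sc_sumCongr (α : Perm D) (β : Perm D') : sc (Perm.sumCongr α β) = sumS (sc α) (sc β) := by
  apply le_antisymm
  · apply sc_le_of
    rintro (x | x)
    · exact sc_apply α x
    · exact sc_apply β x
  · rw [sumS_le]
    constructor
    · apply sc_le_of
      intro x
      exact sc_apply (Perm.sumCongr α β) (Sum.inl x)
    · apply sc_le_of
      intro x
      exact sc_apply (Perm.sumCongr α β) (Sum.inr x)

theorem cls_sumS (s : Setoid D) (t : Setoid D') : cls (sumS s t) = cls s + cls t := by
  have : Finite (Quotient s) := Quotient.finite s
  have : Finite (Quotient t) := Quotient.finite t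
  unfold cls
  rw [← Nat.card_sum]
  refine Nat.card_congr ⟨Quotient.lift (Sum.map (Quotient.mk s) (Quotient.mk t)) ?_,
    Sum.elim (Quotient.lift (fun x => Quotient.mk (sumS s t) (Sum.inl x)) ?_)
      (Quotient.lift (fun x => Quotient.mk (sumS s t) (Sum.inr x)) ?_), ?_, ?_⟩
  · rintro (x | x) (y | y) h
    · exact congrArg Sum.inl (Quotient.sound h)
    · exact h.elim
    · exact h.elim
    · exact congrArg Sum.inr (Quotient.sound h)
  · intro x y h
    exact Quotient.sound (s := sumS s t) (a := Sum.inl x) (b := Sum.inl y) h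
  · intro x y h
    exact Quotient.sound (s := sumS s t) (a := Sum.inr x) (b := Sum.inr y) h
  · intro q
    induction q using Quotient.inductionOn with
    | h x => rcases x with x | x <;> rfl
  · rintro (q | q)
    · induction q using Quotient.inductionOn with
      | h x => rfl
    · induction q using Quotient.inductionOn with
      | h x => rfl

theorem gen_sum (α β : Perm D) (α' β' : Perm D') :
    gen (Perm.sumCongr α α') (Perm.sumCongr β β') = gen α β + gen α' β' := by
  unfold gen kap cyc
  rw [Perm.sumCongr_inv, Perm.sumCongr_mul, sc_sumCongr, sc_sumCongr, sc_sumCongr, sumS_sup,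
    cls_sumS, cls_sumS, cls_sumS, cls_sumS, Fintype.card_sum]
  push_cast
  ring

theorem cls_equiv (e : D ≃ D') (s : Setoid D) (t : Setoid D') (h : ∀ x y, s x y ↔ t (e x) (e y)) :
    cls s = cls t := by
  unfold cls
  exact Nat.card_congr (Quotient.congr e h)

theorem gen_congr (e : D ≃ D') (α β : Perm D) : gen (e.permCongr α) (e.permCongr β) = gen α β := by
  have hsc : ∀ γ : Perm D, sc (e.permCongr γ) = (sc γ).comap e.symm := by
    intro γ
    apply le_antisymm
    · apply sc_le_of
      intro x
      have := sc_apply γ (e.symm x)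
      simpa [Setoid.comap_rel] using this
    · intro x y h
      have h2 : sc γ ≤ (sc (e.permCongr γ)).comap e := by
        apply sc_le_of
        intro z
        have := sc_apply (e.permCongr γ) (e z)
        simpa [Setoid.comap_rel] using this
      have := h2 h
      simpa [Setoid.comap_rel] using this
  have hcls : ∀ γ : Perm D, cyc (e.permCongr γ) = cyc γ := by
    intro γ
    unfold cyc
    rw [hsc]
    congr 1
    symm
    apply cls_equiv e
    intro x y
    simp [Setoid.comap_rel]
  have hk : kap (e.permCongr α) (e.permCongr β) = kap α β := by
    unfold kap
    rw [hsc, hsc]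
    congr 1
    symm
    apply cls_equiv e
    intro x y
    have : (sc α).comap e.symm ⊔ (sc β).comap e.symm = (sc α ⊔ sc β).comap e.symm := by
      apply le_antisymm
      · refine sup_le ?_ ?_
        · intro x y h; exact (le_sup_left : sc α ≤ sc α ⊔ sc β) h
        · intro x y h; exact (le_sup_right : sc β ≤ sc α ⊔ sc β) h
      · have h2 : sc α ⊔ sc β ≤ ((sc α).comap e.symm ⊔ (sc β).comap e.symm).comap e := by
          refine sup_le ?_ ?_
          · intro x y h
            apply (le_sup_left : (sc α).comap e.symm ≤ _ ⊔ (sc β).comap e.symm)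
            simpa [Setoid.comap_rel] using h
          · intro x y h
            apply (le_sup_right : (sc β).comap e.symm ≤ (sc α).comap e.symm ⊔ _)
            simpa [Setoid.comap_rel] using h
        intro x y h
        have := h2 h
        simpa [Setoid.comap_rel] using this
    rw [this]
    simp [Setoid.comap_rel]
  unfold gen
  rw [hk, hcls, hcls, Fintype.card_congr e]
  have : (e.permCongr α)⁻¹ * e.permCongr β = e.permCongr (α⁻¹ * β) := by
    rw [inv_mul_eq_iff_eq_mul]
    ext x; simp
  rw [this, hcls]

theorem gen_restrict (α β : Perm D) (p : D → Prop) [DecidablePred p] (hα : ∀ x, p (α x) ↔ p x)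
    (hβ : ∀ x, p (β x) ↔ p x) :
    gen (α.subtypePerm hα) (β.subtypePerm hβ)
      + gen (α.subtypePerm (p := fun x => ¬ p x) (fun x => not_congr (hα x)))
          (β.subtypePerm (p := fun x => ¬ p x) (fun x => not_congr (hβ x))) = gen α β := by
  rw [← gen_sum, ← gen_congr (Equiv.sumCompl p)]
  congr 1
  · ext x
    by_cases h : p x <;> simp [h, Equiv.permCongr_apply, Equiv.sumCompl_symm_apply_of_pos, Equiv.sumCompl_symm_apply_of_neg]
  · ext x
    by_cases h : p x <;> simp [h, Equiv.permCongr_apply, Equiv.sumCompl_symm_apply_of_pos, Equiv.sumCompl_symm_apply_of_neg]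

end summ

/-- A closed surface given by face permutation `σ`, edge involution `τ`, labels and the list of faces. -/
structure OK {E : Type u} (inv : E → E) {D : Type} (σ τ : Perm D) (lab : D → E) (fs : List (List D)) : Prop where
  ne : ∀ l ∈ fs, l ≠ []
  cyc : ∀ l ∈ fs, l.map σ = l.rotate 1
  nd : fs.flatten.Nodup
  all : ∀ d, d ∈ fs.flatten
  inv2 : ∀ d, τ (τ d) = d
  fpf : ∀ d, τ d ≠ d
  labt : ∀ d, lab (τ d) = inv (lab d)

/-- exists a surface of (twice) genus at most `g` with the given face words -/
def St {E : Type u} (inv : E → E) (g : ℤ) (Fs : List (List E)) : Prop :=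
  ∃ (D : Type) (_ : Fintype D) (_ : DecidableEq D) (σ τ : Perm D) (lab : D → E) (fs : List (List D)),
    OK inv σ τ lab fs ∧ (fs.map (List.map lab)).Perm Fs ∧ gen σ (σ * τ) ≤ g

theorem map_swap_id {D : Type} [DecidableEq D] {a b : D} {l : List D} (ha : a ∉ l) (hb : b ∉ l) :
    l.map (swap a b) = l := by
  conv_rhs => rw [← List.map_id l]
  apply map_congr_left
  intro x hx
  exact swap_apply_of_ne_of_ne (fun h => ha (h ▸ hx)) (fun h => hb (h ▸ hx))

theorem sc_of_chain {D : Type} {σ : Perm D} (u : List D) : ∀ (a c : D), (a :: u).map σ = u ++ [c] →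
    ∀ x ∈ a :: u, sc σ a x := by
  induction u with
  | nil =>
    intro a c h x hx
    simp at hx
    subst hx
    exact (sc σ).refl _
  | cons b u ih =>
    intro a c h x hx
    simp only [map_cons, List.cons_append, List.cons.injEq] at h
    have h2 := ih b c (by simpa using h.2)
    rcases List.mem_cons.1 hx with rfl | hx
    · exact (sc σ).refl _
    · have := sc_apply σ a
      rw [h.1] at this
      exact (sc σ).trans this (h2 x hx)

namespace OK
variable {E : Type u} {inv : E → E} {D : Type} {σ τ : Perm D} {lab : D → E} {fs : List (List D)}

theorem perm (h : OK inv σ τ lab fs) {fs' : List (List D)} (hp : fs.Perm fs') : OK inv σ τ lab fs' where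
  ne := fun l hl => h.ne l (hp.mem_iff.2 hl)
  cyc := fun l hl => h.cyc l (hp.mem_iff.2 hl)
  nd := (hp.flatten).nodup_iff.1 h.nd
  all := fun d => (hp.flatten).mem_iff.1 (h.all d)
  inv2 := h.inv2
  fpf := h.fpf
  labt := h.labt

theorem rot {l : List D} (h : OK inv σ τ lab (l :: fs)) (k : ℕ) : OK inv σ τ lab (l.rotate k :: fs) where
  ne := by
    intro l' hl'
    rcases List.mem_cons.1 hl' with rfl | hl'
    · have := h.ne l (by simp)
      rwa [Ne, List.rotate_eq_nil_iff]
    · exact h.ne l' (by simp [hl'])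
  cyc := by
    intro l' hl'
    rcases List.mem_cons.1 hl' with rfl | hl'
    · rw [List.map_rotate, h.cyc l (by simp), List.rotate_rotate, List.rotate_rotate, add_comm]
    · exact h.cyc l' (by simp [hl'])
  nd := by
    have : (l :: fs).flatten.Perm (l.rotate k :: fs).flatten := by
      simp only [List.flatten_cons]
      exact (List.rotate_perm l k).symm.append_right _
    exact this.nodup_iff.1 h.nd
  all := by
    have : (l :: fs).flatten.Perm (l.rotate k :: fs).flatten := by
      simp only [List.flatten_cons]
      exact (List.rotate_perm l k).symm.append_right _
    exact fun d => this.mem_iff.1 (h.all d)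
  inv2 := h.inv2
  fpf := h.fpf
  labt := h.labt

theorem sc_of_mem (h : OK inv σ τ lab fs) {l : List D} (hl : l ∈ fs) {x y : D} (hx : x ∈ l) (hy : y ∈ l) :
    sc σ x y := by
  rcases l with _ | ⟨a, u⟩
  · simp at hx
  · have := h.cyc _ hl
    rw [List.rotate_cons_succ, List.rotate_zero] at this
    have := sc_of_chain u a a this
    exact (sc σ).trans ((sc σ).symm (this x hx)) (this y hy)

theorem mem_apply (h : OK inv σ τ lab fs) {l : List D} (hl : l ∈ fs) {x : D} (hx : x ∈ l) : σ x ∈ l := by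
  have h1 : σ x ∈ l.map σ := List.mem_map_of_mem hx
  rw [h.cyc l hl] at h1
  exact List.mem_rotate.1 h1

theorem face_unique (h : OK inv σ τ lab fs) {l l' : List D} (hl : l ∈ fs) (hl' : l' ∈ fs) {x : D}
    (hx : x ∈ l) (hx' : x ∈ l') : l = l' := by
  by_contra hne
  have := (List.nodup_flatten.1 h.nd).2
  have hd := List.Pairwise.forall_of_forall_of_flip (R := fun a b => a ≠ b → List.Disjoint a b) (l := fs)
    (fun a _ hh => absurd rfl hh) (List.Pairwise.imp (fun {a b} hab => fun _ => hab) this)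
    (List.Pairwise.imp (fun {a b} hab => fun _ => List.Disjoint.symm hab) this) hl hl' hne
  exact hd hx hx'

theorem mem_apply_iff (h : OK inv σ τ lab fs) {l : List D} (hl : l ∈ fs) {x : D} : σ x ∈ l ↔ x ∈ l := by
  constructor
  · intro hx
    obtain ⟨l', hl', hx'⟩ := mem_flatten.1 (h.all x)
    have := h.face_unique hl hl' hx (h.mem_apply hl' hx')
    rwa [this]
  · exact h.mem_apply hl

theorem mem_iff_of_sc (h : OK inv σ τ lab fs) {l : List D} (hl : l ∈ fs) {x y : D} (hxy : sc σ x y) :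
    x ∈ l ↔ y ∈ l := by
  have : sc σ ≤ Setoid.ker (fun z => z ∈ l) := by
    apply sc_le_of
    intro z
    rw [Setoid.ker_def]
    exact propext (h.mem_apply_iff hl).symm
  have := this hxy
  rw [Setoid.ker_def] at this
  exact iff_of_eq this

/-- join two faces -/
theorem join [DecidableEq D] {a b : D} {u v : List D} (h : OK inv σ τ lab ((a :: u) :: (b :: v) :: fs)) :
    OK inv (swap a b * σ) τ lab ((a :: u ++ b :: v) :: fs) := by
  have hnd := h.nd
  simp only [List.flatten_cons] at hnd
  rw [List.nodup_append, List.nodup_append] at hnd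
  obtain ⟨hu, ⟨hv, hfs, hvfs⟩, hufs⟩ := hnd
  have hau : a ∉ u := (List.nodup_cons.1 hu).1
  have hbv : b ∉ v := (List.nodup_cons.1 hv).1
  have hbu : b ∉ u := fun hb => hufs b (by simp [hb]) b (by simp) rfl
  have hav : a ∉ v := fun ha => hufs a (by simp) a (by simp [ha]) rfl
  refine ⟨?_, ?_, ?_, ?_, h.inv2, h.fpf, h.labt⟩
  · intro l hl
    rcases List.mem_cons.1 hl with rfl | hl
    · simp
    · exact h.ne l (by simp [hl])
  · intro l hl
    rw [Perm.coe_mul, ← map_map]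
    rcases List.mem_cons.1 hl with rfl | hl
    · have h1 := h.cyc (a :: u) (by simp)
      have h2 := h.cyc (b :: v) (by simp)
      rw [map_append, h1, h2]
      simp only [List.rotate_cons_succ, List.rotate_zero, map_append, List.cons_append]
      rw [map_swap_id hau hbu, map_swap_id hav hbv]
      simp
    · have h3 := h.cyc l (by simp [hl])
      rw [h3]
      apply map_swap_id
      · rw [List.mem_rotate]
        intro ha
        exact hufs a (by simp) a (by simp only [List.mem_append, mem_flatten]; exact Or.inr ⟨l, hl, ha⟩) rfl
      · rw [List.mem_rotate]
        intro hb
        exact hvfs b (by simp) b (by simp only [mem_flatten]; exact ⟨l, hl, hb⟩) rfl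
  · have := h.nd
    simpa using this
  · have := h.all
    simpa using this

/-- split a face -/
theorem split [DecidableEq D] {a b : D} {u v : List D} (h : OK inv σ τ lab ((a :: u ++ b :: v) :: fs)) :
    OK inv (swap a b * σ) τ lab ((a :: u) :: (b :: v) :: fs) := by
  have hnd := h.nd
  simp only [List.flatten_cons] at hnd
  rw [List.nodup_append, List.nodup_append] at hnd
  obtain ⟨⟨hu, hv, huv⟩, hfs, hufs⟩ := hnd
  have hau : a ∉ u := (List.nodup_cons.1 hu).1
  have hbv : b ∉ v := (List.nodup_cons.1 hv).1
  have hbu : b ∉ u := fun hb => huv b (by simp [hb]) b (by simp) rfl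
  have hav : a ∉ v := fun ha => huv a (by simp) a (by simp [ha]) rfl
  have h1 := h.cyc (a :: u ++ b :: v) (by simp)
  rw [List.cons_append, List.rotate_cons_succ, List.rotate_zero, ← List.cons_append, map_append] at h1
  have h2 : (a :: u).map σ ++ (b :: v).map σ = (u ++ [b]) ++ (v ++ [a]) := by
    rw [h1]; simp
  obtain ⟨h3, h4⟩ := List.append_inj h2 (by simp)
  refine ⟨?_, ?_, ?_, ?_, h.inv2, h.fpf, h.labt⟩
  · intro l hl
    rcases List.mem_cons.1 hl with rfl | hl
    · simp
    · rcases List.mem_cons.1 hl with rfl | hl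
      · simp
      · exact h.ne l (by simp [hl])
  · intro l hl
    rw [Perm.coe_mul, ← map_map]
    rcases List.mem_cons.1 hl with rfl | hl
    · rw [h3]
      simp [map_swap_id hau hbu]
    · rcases List.mem_cons.1 hl with rfl | hl
      · rw [h4]
        simp [map_swap_id hav hbv]
      · have h3 := h.cyc l (by simp [hl])
        rw [h3]
        apply map_swap_id
        · rw [List.mem_rotate]
          intro ha
          exact hufs a (by simp) a (by simp only [mem_flatten]; exact ⟨l, hl, ha⟩) rfl
        · rw [List.mem_rotate]
          intro hb
          exact hufs b (by simp) b (by simp only [mem_flatten]; exact ⟨l, hl, hb⟩) rfl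
  · have := h.nd
    simpa using this
  · have := h.all
    simpa using this

/-- re-pair the edges at a common vertex -/
theorem swapt [DecidableEq D] (h : OK inv σ τ lab fs) {x y : D} (hxy : lab x = lab y) :
    OK inv σ (swap x y * τ * swap x y) lab fs := by
  have hl : ∀ d, lab (swap x y d) = lab d := by
    intro d
    by_cases h1 : d = x
    · rw [h1, swap_apply_left, hxy]
    · by_cases h2 : d = y
      · rw [h2, swap_apply_right, hxy]
      · rw [swap_apply_of_ne_of_ne h1 h2]
  refine ⟨h.ne, h.cyc, h.nd, h.all, ?_, ?_, ?_⟩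
  · intro d
    simp [h.inv2]
  · intro d hd
    simp only [mul_apply] at hd
    have := congrArg (swap x y) hd
    rw [swap_apply_self] at this
    exact h.fpf _ this
  · intro d
    simp only [mul_apply]
    rw [hl, h.labt, hl]

theorem gen_swapt [Fintype D] [DecidableEq D] (h : OK inv σ τ lab fs) {x y : D}
    (hv : sc (σ * τ) x y) : gen σ (σ * (swap x y * τ * swap x y)) ≤ gen σ (σ * τ) := by
  by_cases hxy : x = y
  · subst hxy
    simp only [swap_self, ← Perm.one_def, one_mul, mul_one, le_refl]
  by_cases hτ : τ x = y
  · have : swap x y * τ * swap x y = τ := by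
      have hy : τ y = x := by rw [← hτ, h.inv2]
      ext d
      simp only [mul_apply]
      by_cases h1 : d = x
      · rw [h1, swap_apply_left, hy, swap_apply_left, hτ]
      · by_cases h2 : d = y
        · rw [h2, swap_apply_right, hτ, swap_apply_right, hy]
        · rw [swap_apply_of_ne_of_ne h1 h2]
          apply swap_apply_of_ne_of_ne
          · intro hh; apply h2; rw [← h.inv2 d, hh, hτ]
          · intro hh; apply h1; rw [← h.inv2 d, hh, hy]
    rw [this]
  have hns : ¬ sc τ x y := by
    have hle : sc τ ≤ Setoid.ker (fun z => z = x ∨ z = τ x) := by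
      apply sc_le_of
      intro z
      rw [Setoid.ker_def]
      apply propext
      constructor
      · rintro (rfl | rfl)
        · right; rfl
        · left; exact h.inv2 _
      · rintro (h1 | h1)
        · right; rw [← h1, h.inv2]
        · left; exact τ.injective h1
    intro hh
    have := hle hh
    rw [Setoid.ker_def] at this
    have := (iff_of_eq this).1 (Or.inl rfl)
    rcases this with h1 | h1
    · exact hxy h1.symm
    · exact hτ h1.symm
  -- first step
  have s1 : gen σ (σ * (τ * swap x y)) ≤ gen σ (σ * τ) := by
    rw [gen_sym σ (τ * swap x y), gen_sym σ τ]
    have e1 : (τ * swap x y)⁻¹ = swap x y * τ⁻¹ := by rw [mul_inv_rev, swap_inv]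
    have e2 : (σ * (τ * swap x y))⁻¹ = swap x y * (σ * τ)⁻¹ := by
      rw [← mul_assoc, mul_inv_rev _ (swap x y), swap_inv]
    rw [e1, e2]
    apply gen_swap_le
    right
    rw [sc_inv]
    exact hv
  refine le_trans ?_ s1
  set τ1 := τ * swap x y with hτ1
  have e3 : swap x y * τ * swap x y = τ1 * swap (τ1⁻¹ x) (τ1⁻¹ y) := by
    rw [mul_assoc, ← hτ1]
    rw [swap_apply_apply]
    simp [mul_assoc]
  rw [e3]
  have hs1 : sc τ1 x y := by
    have := swap_sc_of_not (σ := τ⁻¹) (a := x) (b := y) (by rw [sc_inv]; exact hns)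
    rw [← sc_inv, hτ1, mul_inv_rev, swap_inv]
    exact this
  have hs2 : sc τ1 (τ1⁻¹ x) (τ1⁻¹ y) := by
    have h1 : sc τ1 (τ1⁻¹ x) x := by
      have := sc_apply τ1 (τ1⁻¹ x); simpa using this
    have h2 : sc τ1 (τ1⁻¹ y) y := by
      have := sc_apply τ1 (τ1⁻¹ y); simpa using this
    exact (sc τ1).trans h1 ((sc τ1).trans hs1 ((sc τ1).symm h2))
  set x' := τ1⁻¹ x
  set y' := τ1⁻¹ y
  rw [gen_sym σ (τ1 * swap x' y'), gen_sym σ τ1]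
  have e1 : (τ1 * swap x' y')⁻¹ = swap x' y' * τ1⁻¹ := by rw [mul_inv_rev, swap_inv]
  have e2 : (σ * (τ1 * swap x' y'))⁻¹ = swap x' y' * (σ * τ1)⁻¹ := by
    rw [← mul_assoc, mul_inv_rev _ (swap x' y'), swap_inv]
  rw [e1, e2]
  apply gen_swap_le
  left
  rw [sc_inv]
  exact hs2

theorem sub (h : OK inv σ τ lab fs) (p : D → Prop) (hσ : ∀ x, p (σ x) ↔ p x) (hτ : ∀ x, p (τ x) ↔ p x)
    {fs' : List (List D)} (hsub : ∀ l ∈ fs', l ∈ fs) (hnd : fs'.flatten.Nodup) (hp : ∀ x, x ∈ fs'.flatten ↔ p x) :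
    ∃ fs'' : List (List {x // p x}), OK inv (σ.subtypePerm hσ) (τ.subtypePerm hτ) (fun x => lab x.1) fs'' ∧
      fs''.map (List.map (fun x => lab x.1)) = fs'.map (List.map lab) := by
  have hex : ∃ fs'' : List (List {x // p x}), fs''.map (List.map Subtype.val) = fs' := by
    have : ∀ l ∈ fs', ∃ l' : List {x // p x}, l'.map Subtype.val = l := by
      intro l hl
      refine ⟨l.pmap Subtype.mk (fun x hx => (hp x).1 (mem_flatten.2 ⟨l, hl, hx⟩)), ?_⟩
      rw [List.map_pmap]
      simp
    clear hnd hp hsub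
    induction fs' with
    | nil => exact ⟨[], rfl⟩
    | cons l fs' ih =>
      obtain ⟨l', hl'⟩ := this l (by simp)
      obtain ⟨q, hq⟩ := ih (fun l hl => this l (by simp [hl]))
      exact ⟨l' :: q, by simp [hl', hq]⟩
  obtain ⟨fs'', rfl⟩ := hex
  refine ⟨fs'', ⟨?_, ?_, ?_, ?_, ?_, ?_, ?_⟩, ?_⟩
  · intro l hl hn
    subst hn
    exact h.ne [] (hsub _ (mem_map.2 ⟨[], hl, rfl⟩)) rfl
  · intro l hl
    have h1 := h.cyc _ (hsub _ (mem_map.2 ⟨l, hl, rfl⟩))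
    apply List.map_injective_iff.2 Subtype.val_injective
    rw [List.map_rotate, ← h1, map_map, map_map]
    rfl
  · rw [← List.map_flatten] at hnd
    exact List.Nodup.of_map _ hnd
  · intro d
    have := (hp d.1).2 d.2
    rw [← List.map_flatten, mem_map] at this
    obtain ⟨x, hx, hxd⟩ := this
    rwa [Subtype.ext hxd] at hx
  · intro d
    apply Subtype.ext
    simp [h.inv2]
  · intro d hd
    have := congrArg Subtype.val hd
    simp at this
    exact h.fpf _ this
  · intro d
    simp [h.labt]
  · rw [map_map]
    apply map_congr_left
    intro l _
    simp

/-- restrict to invariant sets of faces -/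
theorem parts [Fintype D] [DecidableEq D] {fs1 fs2 : List (List D)} (h : OK inv σ τ lab (fs1 ++ fs2))
    (hinv : ∀ x ∈ fs1.flatten, τ x ∈ fs1.flatten) :
    ∃ g1 g2 : ℤ, g1 + g2 = gen σ (σ * τ) ∧ 0 ≤ g1 ∧ 0 ≤ g2 ∧
      St inv g1 (fs1.map (List.map lab)) ∧ St inv g2 (fs2.map (List.map lab)) := by
  classical
  obtain ⟨p, hpd⟩ : ∃ p : D → Prop, ∀ x, p x ↔ x ∈ fs1.flatten := ⟨fun x => x ∈ fs1.flatten, fun x => Iff.rfl⟩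
  have hσ : ∀ x, p (σ x) ↔ p x := by
    intro x
    simp only [hpd, mem_flatten]
    constructor
    · rintro ⟨l, hl, hx⟩
      exact ⟨l, hl, (h.mem_apply_iff (by simp [hl])).1 hx⟩
    · rintro ⟨l, hl, hx⟩
      exact ⟨l, hl, (h.mem_apply_iff (by simp [hl])).2 hx⟩
  have hτ : ∀ x, p (τ x) ↔ p x := by
    intro x
    constructor
    · intro hx
      have := hinv _ ((hpd _).1 hx)
      rw [h.inv2] at this
      exact (hpd _).2 this
    · exact fun hx => (hpd _).2 (hinv x ((hpd _).1 hx))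
  have hnd := h.nd
  rw [List.flatten_append, List.nodup_append] at hnd
  obtain ⟨f1, hf1, e1⟩ := h.sub p hσ hτ (fs' := fs1) (fun l hl => by simp [hl]) hnd.1 (fun x => (hpd x).symm)
  obtain ⟨f2, hf2, e2⟩ := h.sub (fun x => ¬ p x) (fun x => not_congr (hσ x)) (fun x => not_congr (hτ x))
    (fs' := fs2) (fun l hl => by simp [hl]) hnd.2.1 (by
      intro x
      constructor
      · intro hx hx1
        exact hnd.2.2 x ((hpd _).1 hx1) x hx rfl
      · intro hx
        have := h.all x
        rw [List.flatten_append, List.mem_append] at this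
        exact this.resolve_left (fun h => hx ((hpd _).2 h)))
  have hστ : ∀ x, p ((σ * τ) x) ↔ p x := fun x => by rw [mul_apply, hσ, hτ]
  have hg := gen_restrict σ (σ * τ) p hσ hστ
  have m1 : (σ * τ).subtypePerm hστ = σ.subtypePerm hσ * τ.subtypePerm hτ := by
    ext x; rfl
  have m2 : (σ * τ).subtypePerm (p := fun x => ¬ p x) (fun x => not_congr (hστ x))
      = σ.subtypePerm (p := fun x => ¬ p x) (fun x => not_congr (hσ x))
        * τ.subtypePerm (p := fun x => ¬ p x) (fun x => not_congr (hτ x)) := by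
    ext x; rfl
  refine ⟨_, _, hg, gen_nonneg _ _, gen_nonneg _ _, ?_, ?_⟩
  · refine ⟨{x // p x}, Subtype.fintype p, inferInstance, σ.subtypePerm hσ, τ.subtypePerm hτ, _, f1, hf1, ?_, ?_⟩
    · rw [e1]
    · rw [← m1]
  · refine ⟨{x // ¬ p x}, Subtype.fintype (fun x => ¬ p x), inferInstance, _, _, _, f2, hf2, ?_, ?_⟩
    · rw [e2]
    · rw [← m2]

end OK

theorem perm_map_exists {α β : Type*} (f : α → β) : ∀ {l : List β} {m : List β}, l.Perm m →
    ∀ fs : List α, fs.map f = l → ∃ fs', fs.Perm fs' ∧ fs'.map f = m := by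
  intro l m h
  induction h with
  | nil => intro fs h; exact ⟨fs, List.Perm.refl _, h⟩
  | cons x h ih =>
    intro fs hfs
    obtain ⟨a, t, rfl, ha, ht⟩ := map_eq_cons_iff.1 hfs
    obtain ⟨t', h1, h2⟩ := ih t ht
    exact ⟨a :: t', h1.cons a, by simp [ha, h2]⟩
  | swap x y l =>
    intro fs hfs
    obtain ⟨a, t, rfl, ha, ht⟩ := map_eq_cons_iff.1 hfs
    obtain ⟨b, t', rfl, hb, ht'⟩ := map_eq_cons_iff.1 ht
    exact ⟨b :: a :: t', List.Perm.swap _ _ _, by simp [ha, hb, ht']⟩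
  | trans h1 h2 ih1 ih2 =>
    intro fs hfs
    obtain ⟨t, h1, h2⟩ := ih1 fs hfs
    obtain ⟨t', h3, h4⟩ := ih2 t h2
    exact ⟨t', h1.trans h3, h4⟩

theorem cyc_last {D : Type} {σ : Perm D} {l u u' : List D} {a d : D} (h : l.map σ = l.rotate 1)
    (h1 : l = u ++ [d]) (h2 : l = a :: u') : σ d = a := by
  have h3 : l.map σ = u' ++ [a] := by rw [h, h2, List.rotate_cons_succ, List.rotate_zero]
  rw [h1, map_append] at h3
  have := List.append_inj_right' h3 rfl
  simpa using this

theorem cyc_next {D : Type} {σ : Perm D} {u v : List D} {x y : D}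
    (h : (u ++ x :: y :: v).map σ = (u ++ x :: y :: v).rotate 1) : σ x = y := by
  have h4 := congrArg (fun l => l[u.length]?) h
  simp only [map_append, map_cons, List.map_nil] at h4
  rw [List.getElem?_append_right (by simp)] at h4
  rw [List.getElem?_rotate (by simp)] at h4
  rw [Nat.mod_eq_of_lt (by simp)] at h4
  rw [List.getElem?_append_right (by simp)] at h4
  simpa using h4

section
variable {E : Type u} {inv : E → E} {g g' : ℤ} {Fs Fs' : List (List E)}

theorem St.exact (h : St inv g Fs) : ∃ (D : Type) (_ : Fintype D) (_ : DecidableEq D) (σ τ : Perm D)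
    (lab : D → E) (fs : List (List D)),
    OK inv σ τ lab fs ∧ fs.map (List.map lab) = Fs ∧ gen σ (σ * τ) ≤ g := by
  obtain ⟨D, i1, i2, σ, τ, lab, fs, h1, h2, h3⟩ := h
  obtain ⟨fs', h4, h5⟩ := perm_map_exists _ h2 fs rfl
  exact ⟨D, i1, i2, σ, τ, lab, fs', h1.perm h4, h5, h3⟩

theorem St.mk {D : Type} [i1 : Fintype D] [i2 : DecidableEq D] {σ τ : Perm D} {lab : D → E} {fs : List (List D)}
    (h : OK inv σ τ lab fs) (hg : gen σ (σ * τ) ≤ g) : St inv g (fs.map (List.map lab)) :=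
  ⟨D, i1, i2, σ, τ, lab, fs, h, List.Perm.refl _, hg⟩

theorem St.mono (h : St inv g Fs) (hg : g ≤ g') : St inv g' Fs := by
  obtain ⟨D, i1, i2, σ, τ, lab, fs, h1, h2, h3⟩ := h
  exact ⟨D, i1, i2, σ, τ, lab, fs, h1, h2, h3.trans hg⟩

theorem St.perm (h : St inv g Fs) (hp : Fs.Perm Fs') : St inv g Fs' := by
  obtain ⟨D, i1, i2, σ, τ, lab, fs, h1, h2, h3⟩ := h
  exact ⟨D, i1, i2, σ, τ, lab, fs, h1, h2.trans hp, h3⟩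

theorem St.edge {s : E} (hi : inv (inv s) = s) : St inv 0 [[s, inv s]] := by
  have hok : OK inv (swap false true) (swap false true) (fun b => if b then inv s else s) [[false, true]] := by
    refine ⟨?_, ?_, ?_, ?_, ?_, ?_, ?_⟩
    · simp
    · simp
    · simp
    · simp
    · simp
    · decide
    · simp [hi]
  have := St.mk (g := 0) hok ?_
  · simpa using this
  · have e : swap false true * swap false true = 1 := by decide
    rw [e]
    unfold gen
    rw [cyc_one, mul_one, cyc_inv]
    have h1 : sc (swap false true) false true := ⟨1, by simp⟩
    have h2 : cyc (swap false true) = 1 := by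
      have h3 := cyc_swap_of_not (σ := (1 : Perm Bool)) (a := false) (b := true) (by
        rintro ⟨i, hi⟩
        simp at hi)
      rw [cyc_one, mul_one] at h3
      simp at h3
      omega
    have h3 : kap (swap false true) 1 ≤ cyc (swap false true) := by
      unfold kap cyc
      exact_mod_cast cls_mono le_sup_left
    rw [h2] at h3 ⊢
    simp
    omega

theorem OK.sum {D D' : Type} {σ τ : Perm D} {σ' τ' : Perm D'} {lab : D → E} {lab' : D' → E}
    {fs : List (List D)} {fs' : List (List D')} (h : OK inv σ τ lab fs) (h' : OK inv σ' τ' lab' fs') :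
    OK inv (Perm.sumCongr σ σ') (Perm.sumCongr τ τ') (Sum.elim lab lab')
      (fs.map (List.map Sum.inl) ++ fs'.map (List.map Sum.inr)) := by
  refine ⟨?_, ?_, ?_, ?_, ?_, ?_, ?_⟩
  · intro l hl
    rcases List.mem_append.1 hl with hl | hl
    · obtain ⟨m, hm, rfl⟩ := mem_map.1 hl
      simpa using h.ne m hm
    · obtain ⟨m, hm, rfl⟩ := mem_map.1 hl
      simpa using h'.ne m hm
  · intro l hl
    rcases List.mem_append.1 hl with hl | hl
    · obtain ⟨m, hm, rfl⟩ := mem_map.1 hl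
      rw [← List.map_rotate, ← h.cyc m hm]
      simp
    · obtain ⟨m, hm, rfl⟩ := mem_map.1 hl
      rw [← List.map_rotate, ← h'.cyc m hm]
      simp
  · rw [List.flatten_append, ← List.map_flatten, ← List.map_flatten, List.nodup_append]
    refine ⟨h.nd.map Sum.inl_injective, h'.nd.map Sum.inr_injective, ?_⟩
    intro a ha b hb
    obtain ⟨x, _, rfl⟩ := mem_map.1 ha
    obtain ⟨y, _, rfl⟩ := mem_map.1 hb
    simp
  · intro d
    rw [List.flatten_append, ← List.map_flatten, ← List.map_flatten, List.mem_append]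
    rcases d with d | d
    · left; exact List.mem_map_of_mem (h.all d)
    · right; exact List.mem_map_of_mem (h'.all d)
  · rintro (d | d) <;> simp [h.inv2, h'.inv2]
  · rintro (d | d) <;> simp [h.fpf, h'.fpf]
  · rintro (d | d) <;> simp [h.labt, h'.labt]

theorem sumCongr_mul' {D D' : Type} (σ τ : Perm D) (σ' τ' : Perm D') :
    Perm.sumCongr σ σ' * Perm.sumCongr τ τ' = Perm.sumCongr (σ * τ) (σ' * τ') := by
  simp

theorem St.rot {w : List E} (h : St inv g (w :: Fs)) (k : ℕ) : St inv g (w.rotate k :: Fs) := by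
  obtain ⟨D, i1, i2, σ, τ, lab, fs, h1, h2, h3⟩ := h.exact
  obtain ⟨l, fs, rfl, rfl, rfl⟩ := map_eq_cons_iff.1 h2
  have := St.mk (h1.rot k) h3
  simpa using this

theorem St.rot' {u v : List E} (h : St inv g ((u ++ v) :: Fs)) : St inv g ((v ++ u) :: Fs) := by
  have := h.rot u.length
  rwa [List.rotate_append_length_eq] at this

theorem St.ne_nil {w : List E} (h : St inv g Fs) (hw : w ∈ Fs) : w ≠ [] := by
  obtain ⟨D, i1, i2, σ, τ, lab, fs, h1, rfl, h3⟩ := h.exact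
  obtain ⟨l, hl, rfl⟩ := mem_map.1 hw
  simpa using h1.ne l hl

theorem OK.sc_split {D : Type} {σ τ : Perm D} {lab : D → E} {fs : List (List D)} {a b : D} {u v : List D}
    (h : OK inv σ τ lab ((a :: u ++ b :: v) :: fs)) : sc σ a b :=
  h.sc_of_mem (l := a :: u ++ b :: v) (by simp) (by simp) (by simp)

theorem St.split {u v : List E} (h : St inv g ((u ++ v) :: Fs)) (hu : u ≠ []) (hv : v ≠ []) :
    St inv g (u :: v :: Fs) := by
  obtain ⟨D, i1, i2, σ, τ, lab, fs, h1, h2, h3⟩ := h.exact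
  obtain ⟨l, fs, rfl, h4, rfl⟩ := map_eq_cons_iff.1 h2
  obtain ⟨u', v', rfl, rfl, rfl⟩ := List.map_eq_append_iff.1 h4
  rcases u' with _ | ⟨a, u'⟩
  · simp at hu
  rcases v' with _ | ⟨b, v'⟩
  · simp at hv
  have := St.mk (g := g) h1.split (by
    rw [mul_assoc]
    exact le_trans (gen_swap_le (Or.inl h1.sc_split)) h3)
  simpa using this

theorem St.join2 {u v : List E} (h : St inv g (u :: v :: Fs)) :
    St inv (g + 2) ((u ++ v) :: Fs) := by
  obtain ⟨D, i1, i2, σ, τ, lab, fs, h1, h2, h3⟩ := h.exact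
  obtain ⟨l, fs, rfl, rfl, h5⟩ := map_eq_cons_iff.1 h2
  obtain ⟨m, fs, rfl, rfl, rfl⟩ := map_eq_cons_iff.1 h5
  rcases l with _ | ⟨a, u'⟩
  · exact absurd rfl (h1.ne [] (by simp))
  rcases m with _ | ⟨b, v'⟩
  · exact absurd rfl (h1.ne [] (by simp))
  have := St.mk (g := g + 2) h1.join (by
    rw [mul_assoc]
    have := gen_swap_le_two σ (σ * τ) a b
    omega)
  simpa using this

theorem St.joinDisj {u v : List E} (h : St inv g (u :: Fs)) (h' : St inv g' (v :: Fs')) :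
    St inv (g + g') ((u ++ v) :: (Fs ++ Fs')) := by
  obtain ⟨D, i1, i2, σ, τ, lab, fs, h1, h2, h3⟩ := h.exact
  obtain ⟨D', i1', i2', σ', τ', lab', fs', h1', h2', h3'⟩ := h'.exact
  obtain ⟨l, fs, rfl, rfl, rfl⟩ := map_eq_cons_iff.1 h2
  obtain ⟨m, fs', rfl, rfl, rfl⟩ := map_eq_cons_iff.1 h2'
  rcases l with _ | ⟨a, u'⟩
  · exact absurd rfl (h1.ne [] (by simp))
  rcases m with _ | ⟨b, v'⟩
  · exact absurd rfl (h1'.ne [] (by simp))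
  have hs := h1.sum h1'
  have hp : (((a :: u') :: fs).map (List.map (Sum.inl : D → D ⊕ D')) ++
      ((b :: v') :: fs').map (List.map (Sum.inr : D' → D ⊕ D'))).Perm
      ((Sum.inl a :: u'.map Sum.inl) :: (Sum.inr b :: v'.map Sum.inr) ::
        (fs.map (List.map Sum.inl) ++ fs'.map (List.map Sum.inr))) := by
    simp only [map_cons, List.cons_append]
    apply List.Perm.cons
    exact List.perm_middle
  have hj := (hs.perm hp).join
  have := St.mk (g := g + g') hj (by
    rw [mul_assoc]
    refine le_trans (gen_swap_le_of_disj ?_) ?_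
    · rw [sumCongr_mul', sc_sumCongr, sc_sumCongr, sumS_sup]
      intro hh
      exact hh
    · rw [sumCongr_mul', gen_sum]; omega)
  simpa [Function.comp_def] using this

theorem map_subset_pair {D : Type} {τ : Perm D} {x y : D} (h1 : τ x = y) (h2 : τ y = x) :
    ∀ z ∈ [[x, y]].flatten, τ z ∈ [[x, y]].flatten := by
  intro z hz
  simp at hz
  rcases hz with rfl | rfl <;> simp [h1, h2]

theorem St.fold_aux (hi : ∀ s, inv (inv s) = s) {D : Type} [Fintype D] [DecidableEq D] {σ τ : Perm D} {lab : D → E}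
    {fs : List (List D)} {u : List D} {x y : D}
    (h1 : OK inv σ τ lab ((u ++ [x, y]) :: fs)) (h3 : gen σ (σ * τ) ≤ g) (hl : lab y = inv (lab x)) :
    ∃ τ' : Perm D, OK inv σ τ' lab ((u ++ [x, y]) :: fs) ∧ gen σ (σ * τ') ≤ g ∧ τ' x = y ∧ τ' y = x := by
  have hxy : σ x = y := cyc_next (u := u) (v := []) (h1.cyc _ (List.mem_cons_self))
  have hne : x ≠ y := by
    have := h1.nd
    intro hxy
    subst hxy
    simp [List.nodup_append] at this
  have hlab : lab (τ x) = lab y := by rw [h1.labt, hl]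
  refine ⟨swap (τ x) y * τ * swap (τ x) y, h1.swapt hlab, ?_, ?_, ?_⟩
  · refine le_trans (h1.gen_swapt ?_) h3
    refine ⟨1, ?_⟩
    simp [h1.inv2, hxy]
  · simp only [mul_apply]
    rw [swap_apply_of_ne_of_ne (h1.fpf x).symm hne, swap_apply_left]
  · simp only [mul_apply]
    rw [swap_apply_right, h1.inv2, swap_apply_of_ne_of_ne (h1.fpf x).symm hne]

theorem St.fold_nil (hi : ∀ s, inv (inv s) = s) {s : E} (h : St inv g ([s, inv s] :: Fs)) : St inv g Fs := by
  obtain ⟨D, i1, i2, σ, τ, lab, fs, h1, h2, h3⟩ := h.exact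
  obtain ⟨l, fs, rfl, h4, rfl⟩ := map_eq_cons_iff.1 h2
  obtain ⟨x, l, rfl, rfl, h5⟩ := map_eq_cons_iff.1 h4
  obtain ⟨y, l, rfl, hy, h6⟩ := map_eq_cons_iff.1 h5
  obtain rfl := List.map_eq_nil_iff.1 h6
  obtain ⟨τ', k1, k2, k3, k4⟩ := St.fold_aux hi (u := []) h1 h3 hy
  obtain ⟨g1, g2, e, p1, p2, -, p3⟩ := OK.parts (fs1 := [[x, y]]) (fs2 := fs) k1 (map_subset_pair k3 k4)
  exact p3.mono (by omega)

theorem St.fold (hi : ∀ s, inv (inv s) = s) {s : E} {u : List E} (hu : u ≠ [])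
    (h : St inv g ((u ++ [s, inv s]) :: Fs)) : St inv g (u :: Fs) := by
  obtain ⟨D, i1, i2, σ, τ, lab, fs, h1, h2, h3⟩ := h.exact
  obtain ⟨l, fs, rfl, h4, rfl⟩ := map_eq_cons_iff.1 h2
  obtain ⟨u', l, rfl, rfl, h4'⟩ := List.map_eq_append_iff.1 h4
  obtain ⟨x, l, rfl, rfl, h5⟩ := map_eq_cons_iff.1 h4'
  obtain ⟨y, l, rfl, hy, h6⟩ := map_eq_cons_iff.1 h5
  obtain rfl := List.map_eq_nil_iff.1 h6
  obtain ⟨τ', k1, k2, k3, k4⟩ := St.fold_aux hi h1 h3 hy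
  rcases u' with _ | ⟨a, u'⟩
  · simp at hu
  have k5 := k1.split
  have k6 := k5.perm (List.Perm.swap _ _ _)
  obtain ⟨g1, g2, e, p1, p2, -, p3⟩ := OK.parts (fs1 := [[x, y]]) (fs2 := (a :: u') :: fs) k6 (map_subset_pair k3 k4)
  have p4 := p3.mono (g' := g) (by
    rw [mul_assoc] at e
    have := gen_swap_le (Or.inl k1.sc_split) (α := σ) (β := σ * τ') (a := a) (b := x)
    omega)
  simpa using p4

/-- join two faces along a common edge -/
theorem OK.joinAdj {D : Type} [Fintype D] [DecidableEq D] {σ τ : Perm D} {lab : D → E}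
    {fs : List (List D)} {u v : List D} {d : D}
    (h : OK inv σ τ lab ((u ++ [d]) :: (τ d :: v) :: fs)) (hg : gen σ (σ * τ) ≤ g) :
    St inv g ((u.map lab ++ [lab d, inv (lab d)] ++ v.map lab) :: fs.map (List.map lab)) := by
  obtain ⟨a, u', hu⟩ : ∃ a u', u ++ [d] = a :: u' := by
    rcases u with _ | ⟨a, u'⟩
    · exact ⟨d, [], rfl⟩
    · exact ⟨a, u' ++ [d], rfl⟩
  have hσ : σ d = a := cyc_last (h.cyc _ List.mem_cons_self) rfl hu
  rw [hu] at h
  have hj := h.join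
  have := St.mk (g := g) hj (by
    rw [mul_assoc]
    refine le_trans (gen_swap_le (Or.inr ?_)) hg
    apply (sc (σ * τ)).symm
    exact ⟨1, by simp [h.inv2, hσ]⟩)
  rw [← hu] at this
  simpa [h.labt] using this

/-- cut along an edge both of whose sides are on the same face of a sphere -/
theorem OK.thin {D : Type} [Fintype D] [DecidableEq D] {σ τ : Perm D} {lab : D → E}
    {fs : List (List D)} {u v : List D} {d : D}
    (h : OK inv σ τ lab ((d :: u ++ [τ d] ++ v) :: fs)) (hg : gen σ (σ * τ) ≤ 0) (hv : v ≠ []) :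
    ∃ Rs1 Rs2, (Rs1 ++ Rs2).Perm (fs.map (List.map lab)) ∧
      St inv 0 ((lab d :: u.map lab ++ [inv (lab d)]) :: Rs1) ∧ St inv 0 (v.map lab :: Rs2) := by
  classical
  rcases v with _ | ⟨b, v⟩
  · exact absurd rfl hv
  have hσ : σ (τ d) = b := by
    have h2 := h.cyc _ (List.mem_cons_self)
    exact cyc_next (u := d :: u) (v := v) (by simpa using h2)
  have h' : OK inv σ τ lab ((d :: (u ++ [τ d]) ++ b :: v) :: fs) := by simpa using h
  have hdb : d ≠ b := by
    intro hdb
    subst hdb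
    have := h'.nd
    simp at this
  have s1 := h'.sc_split
  have s2 : sc (σ * τ) d b := ⟨1, by simp [hσ]⟩
  have hs := h'.split
  set σ' := swap d b * σ with hσ'
  have hle := gen_swap_le (Or.inl s1) (α := σ) (β := σ * τ) (a := d) (b := b)
  rw [← mul_assoc, ← hσ'] at hle
  have hnc : ¬ (sc σ' ⊔ sc (σ' * τ)) d b := by
    intro hc
    have := gen_swap_le_of_conn hdb s1 s2 (by rw [← mul_assoc]; exact hc)
    rw [← mul_assoc, ← hσ'] at this
    have := gen_nonneg σ' (σ' * τ)
    omega
  set J := sc σ' ⊔ sc (σ' * τ) with hJ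
  have J1 : ∀ x y, sc σ' x y → J x y := fun x y hh => (le_sup_left : sc σ' ≤ J) hh
  have J2 : ∀ x, J x (τ x) := by
    intro x
    have e1 : J x ((σ' * τ) x) := (le_sup_right : sc (σ' * τ) ≤ J) (sc_apply _ x)
    have e2 : J (τ x) (σ' (τ x)) := J1 _ _ (sc_apply _ _)
    exact J.trans e1 (J.symm e2)
  let P : List D → Bool := fun l => decide (∃ x ∈ l, J d x)
  have hP1 : P (d :: (u ++ [τ d])) = true := by
    simp only [P, decide_eq_true_eq]
    exact ⟨d, by simp, J.refl d⟩
  have hP2 : P (b :: v) = false := by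
    simp only [P, decide_eq_false_iff_not]
    rintro ⟨x, hx, hj⟩
    apply hnc
    exact J.trans hj (J.symm (J1 _ _ (hs.sc_of_mem (l := b :: v) (by simp) (by simp) hx)))
  let f1 := (d :: (u ++ [τ d])) :: fs.filter P
  let f2 := (b :: v) :: fs.filter (fun l => ! P l)
  have hperm0 : (fs.filter P ++ fs.filter (fun l => ! P l)).Perm fs := List.filter_append_perm P fs
  have hperm : (f1 ++ f2).Perm ((d :: (u ++ [τ d])) :: (b :: v) :: fs) := by
    simp only [f1, f2, List.cons_append]
    apply List.Perm.cons
    exact List.perm_middle.trans (hperm0.cons _)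
  have hok := hs.perm hperm.symm
  have hPall1 : ∀ l ∈ f1, P l = true := by
    intro l hl
    rcases List.mem_cons.1 hl with rfl | hl
    · exact hP1
    · exact (List.mem_filter.1 hl).2
  have hPall2 : ∀ l ∈ f2, P l = false := by
    intro l hl
    rcases List.mem_cons.1 hl with rfl | hl
    · exact hP2
    · simpa using (List.mem_filter.1 hl).2
  have hin : ∀ x, x ∈ f1.flatten ↔ J d x := by
    intro x
    constructor
    · intro hx
      obtain ⟨l, hl, hx⟩ := mem_flatten.1 hx
      have h1 := hPall1 l hl
      simp only [P, decide_eq_true_eq] at h1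
      obtain ⟨y, hy, hj⟩ := h1
      exact J.trans hj (J1 _ _ (hok.sc_of_mem (by simp [hl]) hy hx))
    · intro hj
      have := hok.all x
      rw [List.flatten_append, List.mem_append] at this
      rcases this with h1 | h1
      · exact h1
      · obtain ⟨l, hl, hx⟩ := mem_flatten.1 h1
        have h1 := hPall2 l hl
        simp only [P, decide_eq_false_iff_not] at h1
        exact absurd ⟨x, hx, hj⟩ h1
  obtain ⟨g1, g2, e, p1, p2, p3, p4⟩ := hok.parts (by
    intro x hx
    rw [hin] at hx ⊢
    exact J.trans hx (J2 x))
  refine ⟨(fs.filter P).map (List.map lab), (fs.filter (fun l => ! P l)).map (List.map lab), ?_, ?_, ?_⟩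
  · rw [← map_append]
    exact hperm0.map _
  · have := p3.mono (g' := 0) (by omega)
    simpa [f1, h.labt] using this
  · have := p4.mono (g' := 0) (by omega)
    simpa [f2] using this

end

/-- formal inverse of a word -/
def ebar {E : Type u} (inv : E → E) (w : List E) : List E := (w.map inv).reverse

section
variable {E : Type u} {inv : E → E} {g g' : ℤ} {Fs Fs' : List (List E)}

theorem ebar_append (u v : List E) : ebar inv (u ++ v) = ebar inv v ++ ebar inv u := by simp [ebar]

theorem ebar_ebar (hi : ∀ s, inv (inv s) = s) (u : List E) : ebar inv (ebar inv u) = u := by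
  simp [ebar, Function.comp_def, hi]

theorem ebar_ne_nil {u : List E} : ebar inv u ≠ [] ↔ u ≠ [] := by simp [ebar]

theorem ebar_length (u : List E) : (ebar inv u).length = u.length := by simp [ebar]

theorem St.tree (hi : ∀ s, inv (inv s) = s) : ∀ {w : List E}, w ≠ [] → St inv 0 [w ++ ebar inv w] := by
  intro w hw
  induction w with
  | nil => exact absurd rfl hw
  | cons s w ih =>
    rcases w with _ | ⟨t, w⟩
    · simpa [ebar] using St.edge (hi s)
    · have h1 := ih (by simp)
      have h2 := St.edge (inv := inv) (hi (inv s))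
      rw [hi] at h2
      have h3 := h1.joinDisj h2
      have h4 : St inv 0 ([((t :: w) ++ ebar inv (t :: w) ++ [inv s]) ++ [s]]) := by
        simpa using h3
      have h5 := h4.rot'
      simpa [ebar] using h5

theorem St.pair (hi : ∀ s, inv (inv s) = s) {w : List E} (hw : w ≠ []) : St inv 0 [w, ebar inv w] :=
  (St.tree hi hw).split hw (ebar_ne_nil.2 hw)

theorem St.torus (hi : ∀ s, inv (inv s) = s) {y z : List E} (hy : y ≠ []) (hz : z ≠ []) :
    St inv 2 [y ++ z ++ ebar inv y ++ ebar inv z] := by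
  have h1 := St.tree hi (w := y ++ z) (by simp [hy])
  have h2 := h1.split (by simp [hy]) (ebar_ne_nil.2 (by simp [hy]))
  rw [ebar_append] at h2
  have h3 := ((h2.perm (List.Perm.swap _ _ _)).rot').perm (List.Perm.swap _ _ _)
  have h4 := h3.join2
  simpa using h4

theorem St.lolly (hi : ∀ s, inv (inv s) = s) {u h r : List E} (hr : r ≠ []) (hs : St inv g (u :: Fs)) :
    St inv g ((u ++ (h ++ r ++ ebar inv h)) :: (Fs ++ [ebar inv r])) := by
  have h1 : St inv 0 [h ++ r ++ ebar inv h, ebar inv r] := by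
    have h1 := St.tree hi (w := h ++ r) (by simp [hr])
    rw [ebar_append] at h1
    have h2 : St inv 0 [(h ++ r) ++ (ebar inv r ++ ebar inv h)] := by simpa using h1
    have h3 := h2.rot'
    have h4 : St inv 0 [ebar inv r ++ (ebar inv h ++ (h ++ r))] := by simpa using h3
    have h5 := h4.split (ebar_ne_nil.2 hr) (by simp [hr])
    have h6 := (h5.perm (List.Perm.swap _ _ _)).rot'
    simpa using h6
  have h2 := hs.joinDisj h1
  rw [add_zero] at h2
  exact h2

theorem St.fold_mid (hi : ∀ s, inv (inv s) = s) {s : E} {u v : List E}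
    (h : St inv g ((u ++ [s, inv s] ++ v) :: Fs)) (hne : u ++ v ≠ []) : St inv g ((u ++ v) :: Fs) := by
  have h1 := h.rot'
  have h2 : St inv g (((v ++ u) ++ [s, inv s]) :: Fs) := by simpa using h1
  have h3 := h2.fold hi (by
    intro hh; apply hne
    simp at hh; simp [hh.1, hh.2])
  exact h3.rot'

theorem St.fold_mid_nil (hi : ∀ s, inv (inv s) = s) {s : E} {u v : List E}
    (h : St inv g ((u ++ [s, inv s] ++ v) :: Fs)) (hne : u ++ v = []) : St inv g Fs := by
  simp at hne
  obtain ⟨rfl, rfl⟩ := hne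
  exact St.fold_nil hi (by simpa using h)

end

/-- inverse letter -/
def linv {S : Type u} (x : S × Bool) : S × Bool := (x.1, !x.2)

theorem linv_linv {S : Type u} (x : S × Bool) : linv (linv x) = x := by simp [linv]

section
variable {S : Type u} {P : Type v}

/-- positions -/
structure Act (act : P → S × Bool → P) : Prop where
  back : ∀ p s, act (act p s) (linv s) = p

variable (act : P → S × Bool → P)

def einv (x : P × (S × Bool)) : P × (S × Bool) := (act x.1 x.2, linv x.2)

def pend (p : P) (w : Wd(S)) : P := w.foldl act p

def pw : P → Wd(S) → List (P × (S × Bool))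
  | _, [] => []
  | p, s :: w => (p, s) :: pw (act p s) w

variable {act}

theorem einv_einv (ha : Act act) (x) : einv act (einv act x) = x := by
  simp [einv, ha.back, linv_linv]

theorem pend_append (p : P) (u v : Wd(S)) : pend act p (u ++ v) = pend act (pend act p u) v := by
  simp [pend]

theorem pw_append (p : P) (u v : Wd(S)) : pw act p (u ++ v) = pw act p u ++ pw act (pend act p u) v := by
  induction u generalizing p with
  | nil => rfl
  | cons s u ih => simp [pw, ih, pend]

theorem pw_ne_nil {p : P} {w : Wd(S)} : pw act p w ≠ [] ↔ w ≠ [] := by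
  cases w <;> simp [pw]

theorem pw_snd (p : P) (w : Wd(S)) : (pw act p w).map Prod.snd = w := by
  induction w generalizing p with
  | nil => rfl
  | cons s u ih => simp [pw, ih]

theorem pw_length (p : P) (w : Wd(S)) : (pw act p w).length = w.length := by
  have := congrArg List.length (pw_snd (act := act) p w)
  simpa using this

theorem pend_ebar (ha : Act act) (p : P) (w : Wd(S)) : pend act (pend act p w) (ebar linv w) = p := by
  induction w generalizing p with
  | nil => rfl
  | cons s u ih =>
    have : ebar linv (s :: u) = ebar linv u ++ [linv s] := by simp [ebar]
    rw [this, pend_append]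
    have := ih (act p s)
    have e : pend act p (s :: u) = pend act (act p s) u := rfl
    rw [e, this]
    exact ha.back p s

theorem pw_ebar (ha : Act act) (p : P) (w : Wd(S)) :
    pw act (pend act p w) (ebar linv w) = ebar (einv act) (pw act p w) := by
  induction w generalizing p with
  | nil => rfl
  | cons s u ih =>
    have : ebar linv (s :: u) = ebar linv u ++ [linv s] := by simp [ebar]
    rw [this, pw_append]
    have e : pend act p (s :: u) = pend act (act p s) u := rfl
    rw [e, ih, pend_ebar ha]
    simp [pw, ebar, einv]

theorem St.red_step {g : ℤ} (ha : Act act) {Fs : List (List (P × (S × Bool)))} {p : P} {w w' : Wd(S)}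
    (hr : FreeGroup.Red.Step w w') (h : St (einv act) g (pw act p w :: Fs)) :
    (w' ≠ [] → St (einv act) g (pw act p w' :: Fs)) ∧ (w' = [] → St (einv act) g Fs) := by
  obtain ⟨⟩ := hr
  rename_i a c x b
  have e : pw act p (a ++ (x, b) :: (x, !b) :: c) =
      pw act p a ++ [(pend act p a, (x, b)), einv act (pend act p a, (x, b))] ++ pw act (pend act p a) c := by
    rw [pw_append]
    have hb := ha.back (pend act p a) (x, b)
    simp only [linv] at hb
    simp [pw, einv, linv, hb]
  rw [e] at h
  constructor
  · intro hne
    rw [pw_append]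
    apply h.fold_mid (einv_einv ha)
    rw [← pw_append]
    exact pw_ne_nil.2 hne
  · intro hne
    apply h.fold_mid_nil (einv_einv ha)
    rw [← pw_append, hne]
    rfl

theorem St.red {g : ℤ} (ha : Act act) {Fs : List (List (P × (S × Bool)))} {p : P} {w : Wd(S)}
    (hr : FreeGroup.Red w []) (h : St (einv act) g (pw act p w :: Fs)) : St (einv act) g Fs := by
  induction hr using Relation.ReflTransGen.head_induction_on with
  | refl => exact absurd rfl (h.ne_nil (w := pw act p []) (by simp))
  | head h1 h2 ih =>
    rename_i a c
    have h3 := h.red_step ha h1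
    by_cases hc : c = []
    · exact h3.2 hc
    · exact ih (h3.1 hc)

theorem St.mk_one {g : ℤ} (ha : Act act) {Fs : List (List (P × (S × Bool)))} {p : P} {w : Wd(S)}
    (hr : fgMk w = 1) (h : St (einv act) g (pw act p w :: Fs)) : St (einv act) g Fs := by
  have : FreeGroup.Red w [] := by
    have := FreeGroup.Red.exact.1 (hr.trans FreeGroup.one_eq_mk)
    obtain ⟨c, h1, h2⟩ := this
    rw [FreeGroup.Red.nil_iff.1 h2] at h1
    exact h1
  exact h.red ha this

/-- conjugate list -/
def cjl (l : Fi(S)) : Wd(S) :=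
  (l.map (fun x => x.1 ++ x.2 ++ ebar linv x.1)).flatten

theorem St.lollies {g : ℤ} (ha : Act act) {Fs : List (List (P × (S × Bool)))} {p : P}
    (l : Fi(S))
    (hl : ∀ x ∈ l, x.2 ≠ [] ∧ pend act (pend act p x.1) x.2 = pend act p x.1) {w : Wd(S)}
    (hw : pend act p w = p) (h : St (einv act) g (pw act p w :: Fs)) :
    St (einv act) g (pw act p (w ++ cjl l) :: (Fs ++ l.map (fun x => pw act (pend act p x.1) (ebar linv x.2)))) := by
  induction l generalizing w Fs with
  | nil => simpa [cjl] using h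
  | cons x l ih =>
    obtain ⟨h1, h2⟩ := hl x (by simp)
    have h3 := h.lolly (einv_einv ha) (h := pw act p x.1) (r := pw act (pend act p x.1) x.2) (pw_ne_nil.2 h1)
    have e1 : pend act p (x.1 ++ x.2 ++ ebar linv x.1) = p := by
      rw [pend_append, pend_append, h2, pend_ebar ha]
    have e2 : pw act p w ++ (pw act p x.1 ++ pw act (pend act p x.1) x.2 ++ ebar (einv act) (pw act p x.1))
        = pw act p (w ++ (x.1 ++ x.2 ++ ebar linv x.1)) := by
      rw [pw_append, hw, pw_append, pw_append, pend_append, h2, pw_ebar ha]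
    have e3 : ebar (einv act) (pw act (pend act p x.1) x.2) = pw act (pend act p x.1) (ebar linv x.2) := by
      rw [← pw_ebar ha, h2]
    rw [e2, e3] at h3
    have h4 := ih (fun y hy => hl y (by simp [hy])) (by rw [pend_append, hw, e1]) h3
    simpa [cjl] using h4

theorem mk_ebar (w : Wd(S)) : fgMk (ebar linv w) = (fgMk w)⁻¹ := by
  rw [FreeGroup.inv_mk]
  rfl

theorem mk_cjl (l : Fi(S)) :
    fgMk (cjl l) = (l.map (fun x => fgMk x.1 * fgMk x.2 * (fgMk x.1)⁻¹)).prod := by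
  induction l with
  | nil => rfl
  | cons x l ih =>
    have : cjl (x :: l) = (x.1 ++ x.2 ++ ebar linv x.1) ++ cjl l := by simp [cjl]
    rw [this, ← mul_mk, ih, ← mul_mk, ← mul_mk, mk_ebar]
    simp

/-- torus filling -/
theorem St.fillTorus (ha : Act act) {p : P} (l : Fi(S))
    (hl : ∀ x ∈ l, x.2 ≠ [] ∧ pend act (pend act p x.1) x.2 = pend act p x.1) {Y Z : Wd(S)}
    (hY : Y ≠ []) (hZ : Z ≠ []) (pY : pend act p Y = p) (pZ : pend act p Z = p)
    (hone : fgMk Y * fgMk Z * (fgMk Y)⁻¹ * (fgMk Z)⁻¹ * fgMk (cjl l) = 1) :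
    St (einv act) 2 (l.map (fun x => pw act (pend act p x.1) (ebar linv x.2))) := by
  have h1 := St.torus (einv_einv ha) (y := pw act p Y) (z := pw act p Z) (pw_ne_nil.2 hY) (pw_ne_nil.2 hZ)
  have e1 := pend_ebar ha p Y
  have e2 := pend_ebar ha p Z
  rw [pY] at e1
  rw [pZ] at e2
  have f1 := pw_ebar ha p Y
  have f2 := pw_ebar ha p Z
  rw [pY] at f1
  rw [pZ] at f2
  rw [← f1, ← f2] at h1
  have e3 : pw act p Y ++ pw act p Z ++ pw act p (ebar linv Y) ++ pw act p (ebar linv Z)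
      = pw act p (Y ++ Z ++ ebar linv Y ++ ebar linv Z) := by
    simp only [pw_append, pend_append, pY, pZ, e1]
  rw [e3] at h1
  have h2 := h1.lollies ha l hl (by rw [pend_append, pend_append, pend_append, pY, pZ, e1, e2])
  have h3 := h2.mk_one ha (by
    rw [← mul_mk, ← mul_mk, ← mul_mk, ← mul_mk, mk_ebar, mk_ebar]
    exact hone)
  simpa using h3

/-- disc filling -/
theorem St.fillDisc (ha : Act act) {p : P} (l : Fi(S))
    (hl : ∀ x ∈ l, x.2 ≠ [] ∧ pend act (pend act p x.1) x.2 = pend act p x.1) {w : Wd(S)}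
    (hw : w ≠ []) (pW : pend act p w = p)
    (hone : fgMk w * fgMk (cjl l) = 1) :
    St (einv act) 0 (pw act p (ebar linv w) :: l.map (fun x => pw act (pend act p x.1) (ebar linv x.2))) := by
  have h1 := St.pair (einv_einv ha) (w := pw act p w) (pw_ne_nil.2 hw)
  have f1 := pw_ebar ha p w
  rw [pW] at f1
  rw [← f1] at h1
  have h2 := h1.lollies ha l hl pW
  have h3 := h2.mk_one ha (by
    rw [← mul_mk]
    exact hone)
  simpa using h3

end

/-- the bi-infinite reading of a cyclic word -/
def rd {L : Type u} (w : List L) (hw : w ≠ []) (k : ℤ) : L :=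
  w[(k % w.length).toNat]'(by
    have : 0 < w.length := length_pos_iff.2 hw
    have h1 := Int.emod_nonneg k (b := w.length) (by omega)
    have h2 := Int.emod_lt_of_pos k (b := w.length) (by omega)
    omega)

section
variable {L : Type u}

theorem rd_natCast {w : List L} (hw : w ≠ []) {i : ℕ} (hi : i < w.length) : rd w hw i = w[i] := by
  unfold rd
  congr 1
  rw [Int.emod_eq_of_lt (by omega) (by omega)]
  simp

theorem rd_add_length {w : List L} (hw : w ≠ []) (k : ℤ) : rd w hw (k + w.length) = rd w hw k := by
  unfold rd
  congr 2
  simp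

theorem rd_congr {w : List L} (hw : w ≠ []) {k l : ℤ} (h : (w.length : ℤ) ∣ k - l) : rd w hw k = rd w hw l := by
  unfold rd
  congr 2
  exact (Int.emod_emod_of_dvd _ (dvd_refl _)).symm.trans (by
    rw [Int.emod_emod_of_dvd _ (dvd_refl _)]
    exact Int.emod_eq_emod_iff_emod_sub_eq_zero.2 (Int.emod_eq_zero_of_dvd h))

theorem rd_rotate {w : List L} (hw : w ≠ []) (i : ℕ) (k : ℤ) :
    rd (w.rotate i) (by simpa using hw) k = rd w hw (k + i) := by
  have hpos : 0 < w.length := length_pos_iff.2 hw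
  unfold rd
  rw [List.getElem_rotate]
  congr 1
  simp only [List.length_rotate]
  zify
  have h1 := Int.emod_nonneg k (b := w.length) (by omega)
  have h2 := Int.emod_nonneg (k + i) (b := w.length) (by omega)
  rw [Int.toNat_of_nonneg h1, Int.toNat_of_nonneg h2]
  simp

end

section
variable {S : Type u}

theorem rd_ebar {w : Wd(S)} (hw : w ≠ []) (k : ℤ) :
    rd (ebar linv w) (ebar_ne_nil.2 hw) k = linv (rd w hw (-1 - k)) := by
  have hpos : 0 < w.length := length_pos_iff.2 hw
  unfold rd ebar
  rw [List.getElem_reverse, List.getElem_map]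
  congr 2
  simp only [List.length_reverse, length_map]
  zify
  have h1 := Int.emod_nonneg k (b := w.length) (by omega)
  have h1' := Int.emod_lt_of_pos k (b := w.length) (by omega)
  have h2 := Int.emod_nonneg (-1 - k) (b := w.length) (by omega)
  have h3 : (-1 - k) % w.length = w.length - 1 - k % w.length := by
    have e : -1 - k = (w.length - 1 - k % w.length) + (w.length : ℤ) * (-(k / w.length) - 1) := by
      have := Int.emod_add_mul_ediv k w.length
      linear_combination this
    rw [e, Int.add_mul_emod_self_left]
    rw [Int.emod_eq_of_lt] <;> omega
  omega

/-- word-level piece -/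
def Pc (W : Set Wd(S)) (p : Wd(S)) : Prop :=
  p ≠ [] ∧ ∃ w₁ ∈ W, ∃ w₂ ∈ W, w₁ ≠ w₂ ∧ p <+: w₁ ∧ p <+: w₂

/-- word-level small cancellation data -/
structure SC (W : Set Wd(S)) : Prop where
  ne : ∀ w ∈ W, w ≠ []
  rot : ∀ w ∈ W, ∀ k, w.rotate k ∈ W
  bar : ∀ w ∈ W, ebar linv w ∈ W
  red : ∀ w, ∀ hw : w ∈ W, ∀ k, rd w (ne w hw) (k + 1) ≠ linv (rd w (ne w hw) k)
  c6 : ∀ w ∈ W, ∀ ps : List Wd(S), ps.length ≤ 5 → (∀ p ∈ ps, Pc W p) → w ≠ ps.flatten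

theorem eq_reduce_of_length [DecidableEq S] {w : Wd(S)}
    (h : w.length ≤ (FreeGroup.reduce w).length) : FreeGroup.reduce w = w :=
  (FreeGroup.reduce.red (L := w)).sublist.eq_of_length_le h

theorem toWord_mk_of_isReduced [DecidableEq S] {w : Wd(S)} (h : FreeGroup.IsReduced w) :
    (fgMk w).toWord = w := by
  rw [FreeGroup.toWord_mk]
  exact h.reduce_eq

theorem sc_of [DecidableEq S] {R : Set (FreeGroup S)} (hSym : FG.Symmetrized R) (hC6 : FG.C6 R) :
    SC {w | ∃ r ∈ R, r.toWord = w} := by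
  obtain ⟨h1, h2, h3⟩ := hSym
  have hne : ∀ w ∈ {w | ∃ r ∈ R, FreeGroup.toWord r = w}, w ≠ [] := by
    rintro w ⟨r, hr, rfl⟩ h
    exact (h1 r hr).1 (FreeGroup.toWord_eq_nil_iff.1 h)
  have hcut : ∀ r ∈ R, ∀ u v, r.toWord = u ++ v → ∃ r' ∈ R, r'.toWord = v ++ u := by
    intro r hr u v huv
    have hred : FreeGroup.IsReduced (u ++ v) := huv ▸ FreeGroup.isReduced_toWord
    have hu : FreeGroup.IsReduced u := List.IsChain.left_of_append hred
    have hv : FreeGroup.IsReduced v := List.IsChain.right_of_append hred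
    have er : r = fgMk u * fgMk v := by
      rw [mul_mk, ← huv, FreeGroup.mk_toWord]
    have h4 := h3 r hr _ _ er (by
      unfold FG.len
      rw [huv, toWord_mk_of_isReduced hu, toWord_mk_of_isReduced hv]; simp)
    refine ⟨_, h4, ?_⟩
    have h5 := (h1 r hr).2 (fgMk u)
    have e : (fgMk u)⁻¹ * r * fgMk u = fgMk v * fgMk u := by
      rw [er]; group
    rw [e, mul_mk] at h5
    rw [mul_mk, FreeGroup.toWord_mk]
    unfold FG.len at h5
    rw [huv, FreeGroup.toWord_mk] at h5
    apply eq_reduce_of_length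
    simp at h5 ⊢
    omega
  have hrot : ∀ w ∈ {w | ∃ r ∈ R, FreeGroup.toWord r = w}, ∀ k, w.rotate k ∈ {w | ∃ r ∈ R, FreeGroup.toWord r = w} := by
    rintro w ⟨r, hr, rfl⟩ k
    rw [← List.rotate_mod, List.rotate_eq_drop_append_take (Nat.mod_lt _ (length_pos_iff.2 (hne _ ⟨r, hr, rfl⟩))).le]
    exact hcut r hr _ _ (List.take_append_drop _ _).symm
  refine ⟨hne, hrot, ?_, ?_, ?_⟩
  · rintro w ⟨r, hr, rfl⟩
    refine ⟨r⁻¹, h2 r hr, ?_⟩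
    rw [FreeGroup.toWord_inv]
    rfl
  · intro w hw k heq
    have hwne := hne w hw
    have hpos : 0 < w.length := length_pos_iff.2 hwne
    have a1 := Int.emod_nonneg k (b := w.length) (by omega)
    have a2 := Int.emod_lt_of_pos k (b := w.length) (by omega)
    obtain ⟨r, hr, hrw⟩ := hrot w hw (k % w.length).toNat
    have hred : FreeGroup.IsReduced (w.rotate (k % w.length).toNat) := hrw ▸ FreeGroup.isReduced_toWord
    set i := (k % w.length).toNat with hi
    have hwr : w.rotate i ≠ [] := by simpa using hwne
    have e0 := rd_rotate hwne i 0
    have e1 := rd_rotate hwne i 1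
    have c0 : rd w hwne (0 + i) = rd w hwne k := by
      apply rd_congr
      rw [hi, Int.toNat_of_nonneg a1, zero_add]
      refine ⟨-(k / w.length), ?_⟩
      have := Int.emod_add_mul_ediv k w.length
      linear_combination this
    have c1 : rd w hwne (1 + i) = rd w hwne (k + 1) := by
      apply rd_congr
      rw [hi, Int.toNat_of_nonneg a1]
      refine ⟨-(k / w.length), ?_⟩
      have := Int.emod_add_mul_ediv k w.length
      linear_combination this
    rw [c0] at e0
    rw [c1] at e1
    rcases hc : w.rotate i with _ | ⟨x, _ | ⟨y, t⟩⟩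
    · exact hwr hc
    · have hlen : w.length = 1 := by
        have := congrArg List.length hc
        simpa using this
      have : rd w hwne (k + 1) = rd w hwne k := by
        have := rd_add_length hwne k
        rwa [hlen] at this
      rw [this] at heq
      have := congrArg Prod.snd heq
      simp [linv] at this
    · simp only [hc] at e0 e1
      have hlen : w.length = t.length + 2 := by
        have := congrArg List.length hc
        simpa using this
      have f0 := rd_natCast (w := x :: y :: t) (by simp) (i := 0) (by simp)
      have f1 := rd_natCast (w := x :: y :: t) (by simp) (i := 1) (by simp)
      simp only [Nat.cast_zero, Nat.cast_one] at f0 f1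
      rw [f0] at e0
      rw [f1] at e1
      simp at e0 e1
      rw [← e0, ← e1] at heq
      rw [hc] at hred
      have := (FreeGroup.isReduced_cons_cons.1 hred).1
      rw [heq] at this
      simp [linv] at this
  · rintro w ⟨r, hr, rfl⟩ ps hps hp heq
    apply hC6
    refine ⟨r, hr, ps.map FreeGroup.mk, by simpa using hps, ?_, ?_, ?_⟩
    · intro p hp'
      obtain ⟨q, hq, rfl⟩ := mem_map.1 hp'
      obtain ⟨hq1, w₁, ⟨r1, hr1, rfl⟩, w₂, ⟨r2, hr2, rfl⟩, hne12, ⟨v1, e1⟩, ⟨v2, e2⟩⟩ := hp q hq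
      have key : ∀ r : FreeGroup S, ∀ v, q ++ v = r.toWord → FreeGroup.IsReduced q ∧
          r = fgMk q * fgMk v ∧ FG.len r = FG.len (fgMk q) + FG.len (fgMk v) := by
        intro r v huv
        have hred : FreeGroup.IsReduced (q ++ v) := huv ▸ FreeGroup.isReduced_toWord
        have hu : FreeGroup.IsReduced q := List.IsChain.left_of_append hred
        have hv : FreeGroup.IsReduced v := List.IsChain.right_of_append hred
        refine ⟨hu, ?_, ?_⟩
        · rw [mul_mk, huv, FreeGroup.mk_toWord]
        · unfold FG.len
          rw [← huv, toWord_mk_of_isReduced hu, toWord_mk_of_isReduced hv]; simp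
      refine ⟨?_, r1, hr1, r2, hr2, fun h => hne12 (by rw [h]), ⟨_, (key r1 v1 e1).2⟩, ⟨_, (key r2 v2 e2).2⟩⟩
      intro h
      have := toWord_mk_of_isReduced (key r1 v1 e1).1
      rw [h, FreeGroup.toWord_one] at this
      exact hq1 this.symm
    · have : ∀ l : List Wd(S), (l.map FreeGroup.mk).prod = fgMk l.flatten := by
        intro l
        induction l with
        | nil => rfl
        | cons a l ih => simp [ih, mul_mk]
      rw [this, ← heq, FreeGroup.mk_toWord]
    · have hinf : ∀ q ∈ ps, FreeGroup.IsReduced q := by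
        intro q hq
        obtain ⟨hq1, w₁, ⟨r1, hr1, rfl⟩, w₂, -, -, ⟨v1, e1⟩, -⟩ := hp q hq
        have hred : FreeGroup.IsReduced (q ++ v1) := e1 ▸ FreeGroup.isReduced_toWord
        exact List.IsChain.left_of_append hred
      have : (ps.map FreeGroup.mk).map FG.len = ps.map List.length := by
        rw [map_map]
        apply map_congr_left
        intro q hq
        simp only [Function.comp, FG.len]
        rw [toWord_mk_of_isReduced (hinf q hq)]
      rw [this, ← List.length_flatten, ← heq]
      rfl

end

section
variable {S : Type u}

/-- the set of readings of relators -/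
def Rdg (W : Set Wd(S)) : Set Rd(S) := {f | ∃ w ∈ W, ∃ hw, f = rd w hw}

def shf (k : ℤ) (f : Rd(S)) : Rd(S) := fun i => f (i + k)

def mir (f : Rd(S)) : Rd(S) := fun i => linv (f (-i))

theorem shf_shf (a b : ℤ) (f : Rd(S)) : shf a (shf b f) = shf (a + b) f := by
  funext i; simp [shf, add_assoc]

theorem shf_zero (f : Rd(S)) : shf 0 f = f := by
  funext i; simp [shf]

theorem mir_mir (f : Rd(S)) : mir (mir f) = f := by
  funext i; simp [mir, linv_linv]

theorem mir_shf (k : ℤ) (f : Rd(S)) : mir (shf k f) = shf (-k) (mir f) := by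
  funext i; simp only [shf, mir]; congr 2; ring

/-- piece condition at `k` of length `m` -/
def PC (W : Set Wd(S)) (f : Rd(S)) (k : ℤ) (m : ℕ) : Prop :=
  ∃ f' ∈ Rdg W, f' ≠ shf k f ∧ ∀ i : ℕ, i < m → f' i = f (k + i)

variable {W : Set Wd(S)}

theorem rd_eq_unique (h : SC W) {w w' : Wd(S)} (hw : w ∈ W) (hw' : w' ∈ W)
    (e : rd w (h.ne w hw) = rd w' (h.ne w' hw')) : w = w' := by
  wlog hle : w.length ≤ w'.length generalizing w w'
  · exact (this hw' hw e.symm (by omega)).symm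
  by_contra hne
  have hpre : w <+: w' := by
    rw [List.prefix_iff_eq_take]
    apply List.ext_getElem
    · simp [hle]
    · intro i h1 h2
      rw [List.getElem_take, ← rd_natCast (h.ne w hw) h1, ← rd_natCast (h.ne w' hw') (by omega), e]
  refine h.c6 w hw [w] (by simp) ?_ (by simp)
  intro p hp
  simp at hp
  subst hp
  exact ⟨h.ne _ hw, p, hw, w', hw', hne, List.prefix_refl _, hpre⟩

open Classical in
/-- length of a reading -/
noncomputable def prd (W : Set Wd(S)) (f : Rd(S)) : ℕ :=
  if h : f ∈ Rdg W then (Classical.choose h).length else 0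

theorem prd_rd (h : SC W) {w : Wd(S)} (hw : w ∈ W) : prd W (rd w (h.ne w hw)) = w.length := by
  have hf : rd w (h.ne w hw) ∈ Rdg W := ⟨w, hw, h.ne w hw, rfl⟩
  unfold prd
  rw [dif_pos hf]
  obtain ⟨h1, h2, h3⟩ := Classical.choose_spec hf
  exact congrArg List.length (rd_eq_unique h hw h1 h3).symm

theorem Rdg.elim (h : SC W) {f : Rd(S)} (hf : f ∈ Rdg W) :
    ∃ w, ∃ hw : w ∈ W, f = rd w (h.ne w hw) ∧ prd W f = w.length := by
  obtain ⟨w, hw, h1, rfl⟩ := hf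
  exact ⟨w, hw, rfl, prd_rd h hw⟩

theorem prd_pos (h : SC W) {f : Rd(S)} (hf : f ∈ Rdg W) : 0 < prd W f := by
  obtain ⟨w, hw, rfl, e⟩ := Rdg.elim h hf
  rw [e]
  exact length_pos_iff.2 (h.ne w hw)

theorem prd_per (h : SC W) {f : Rd(S)} (hf : f ∈ Rdg W) (k : ℤ) : f (k + prd W f) = f k := by
  obtain ⟨w, hw, rfl, e⟩ := Rdg.elim h hf
  rw [e]
  exact rd_add_length _ k

theorem shf_prd (h : SC W) {f : Rd(S)} (hf : f ∈ Rdg W) : shf (prd W f) f = f := by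
  funext i
  exact prd_per h hf i

theorem shf_spec (h : SC W) {f : Rd(S)} (hf : f ∈ Rdg W) (k : ℤ) :
    shf k f ∈ Rdg W ∧ prd W (shf k f) = prd W f := by
  obtain ⟨w, hw, rfl, e⟩ := Rdg.elim h hf
  have hwne := h.ne w hw
  have hpos : 0 < w.length := length_pos_iff.2 hwne
  have a1 := Int.emod_nonneg k (b := w.length) (by omega)
  have : shf k (rd w hwne) = rd (w.rotate (k % w.length).toNat) (h.ne _ (h.rot w hw _)) := by
    funext i
    rw [rd_rotate hwne]
    unfold shf
    apply rd_congr
    rw [Int.toNat_of_nonneg a1]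
    refine ⟨k / w.length, ?_⟩
    have := Int.emod_add_mul_ediv k w.length
    linear_combination - this
  rw [this]
  refine ⟨⟨_, h.rot w hw _, _, rfl⟩, ?_⟩
  rw [prd_rd h (h.rot w hw _), e]
  simp

theorem shf_mem (h : SC W) {f : Rd(S)} (hf : f ∈ Rdg W) (k : ℤ) : shf k f ∈ Rdg W := (shf_spec h hf k).1

theorem prd_shf (h : SC W) {f : Rd(S)} (hf : f ∈ Rdg W) (k : ℤ) : prd W (shf k f) = prd W f :=
  (shf_spec h hf k).2

theorem mir_spec (h : SC W) {f : Rd(S)} (hf : f ∈ Rdg W) :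
    mir f ∈ Rdg W ∧ prd W (mir f) = prd W f := by
  obtain ⟨w, hw, rfl, e⟩ := Rdg.elim h hf
  have hb := h.bar w hw
  have : mir (rd w (h.ne w hw)) = shf (-1) (rd (ebar linv w) (h.ne _ hb)) := by
    funext i
    simp only [mir, shf]
    rw [rd_ebar (h.ne w hw)]
    congr 2
    ring
  rw [this]
  have hm : rd (ebar linv w) (h.ne _ hb) ∈ Rdg W := ⟨_, hb, _, rfl⟩
  refine ⟨shf_mem h hm _, ?_⟩
  rw [prd_shf h hm, prd_rd h hb, e, ebar_length]

theorem mir_mem (h : SC W) {f : Rd(S)} (hf : f ∈ Rdg W) : mir f ∈ Rdg W := (mir_spec h hf).1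

theorem prd_mir (h : SC W) {f : Rd(S)} (hf : f ∈ Rdg W) : prd W (mir f) = prd W f := (mir_spec h hf).2

theorem rdg_red (h : SC W) {f : Rd(S)} (hf : f ∈ Rdg W) (k : ℤ) : f (k + 1) ≠ linv (f k) := by
  obtain ⟨w, hw, rfl, e⟩ := Rdg.elim h hf
  exact h.red w hw k

/-- window of a reading -/
def win (f : Rd(S)) (k : ℤ) (m : ℕ) : Wd(S) := (List.range m).map (fun i : ℕ => f (k + i))

theorem win_add (f : Rd(S)) (k : ℤ) (m m' : ℕ) : win f k (m + m') = win f k m ++ win f (k + m) m' := by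
  unfold win
  rw [List.range_add, map_append, map_map]
  congr 1
  apply map_congr_left
  intro i _
  simp [add_assoc]

theorem rd_win {w : Wd(S)} (hw : w ≠ []) : win (rd w hw) 0 w.length = w := by
  apply List.ext_getElem
  · simp [win]
  · intro i h1 h2
    simp only [win, List.getElem_map, List.getElem_range, zero_add]
    exact rd_natCast hw h2

theorem win_shf (f : Rd(S)) (k a : ℤ) (m : ℕ) : win (shf a f) k m = win f (k + a) m := by
  unfold win shf
  apply map_congr_left
  intro i _
  congr 1; ring

theorem win_mem (h : SC W) {f : Rd(S)} (hf : f ∈ Rdg W) (a : ℤ) : win f a (prd W f) ∈ W := by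
  have h1 := shf_mem h hf a
  obtain ⟨w, hw, e1, e2⟩ := Rdg.elim h h1
  rw [prd_shf h hf] at e2
  have := win_shf f 0 a (prd W f)
  rw [zero_add] at this
  rw [← this, e1, e2, rd_win]
  exact hw

theorem rd_congr_word {w w' : Wd(S)} (hw : w ≠ []) (hw' : w' ≠ []) (e : w = w') : rd w hw = rd w' hw' := by
  subst e; rfl

theorem win_rdg (h : SC W) {f : Rd(S)} (hf : f ∈ Rdg W) (k : ℤ) :
    shf k f = rd (win f k (prd W f)) (h.ne _ (win_mem h hf k)) := by
  obtain ⟨w, hw, e1, e2⟩ := Rdg.elim h (shf_mem h hf k)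
  have e3 : win f k (prd W f) = w := by
    rw [← prd_shf h hf k, e2, ← zero_add k, ← win_shf, e1, rd_win]
  rw [e1]
  exact rd_congr_word _ _ e3.symm

theorem pc_piece (h : SC W) {f : Rd(S)} (hf : f ∈ Rdg W) {k : ℤ} {m : ℕ} (hm : 1 ≤ m) (hmn : m ≤ prd W f)
    (hp : PC W f k m) : Pc W (win f k m) := by
  obtain ⟨f', hf', hne, hag⟩ := hp
  have hw := win_mem h hf k
  have hw' := win_mem h hf' 0
  have hww : win f' 0 (prd W f') ≠ win f k (prd W f) := by
    intro hww
    apply hne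
    rw [win_rdg h hf k, ← shf_zero f', win_rdg h hf' 0]
    exact rd_congr_word _ _ (by simpa [shf_zero] using hww)
  have hlt : m ≤ prd W f' := by
    by_contra hlt
    push Not at hlt
    refine h.c6 _ hw' [win f' 0 (prd W f')] (by simp) ?_ (by simp)
    intro p hp
    simp at hp
    subst hp
    refine ⟨h.ne _ hw', _, hw', _, hw, hww, List.prefix_refl _, ?_⟩
    obtain ⟨d, hd⟩ := Nat.exists_eq_add_of_le (show prd W f' ≤ prd W f by omega)
    rw [hd, win_add]
    have : win f' 0 (prd W f') = win f k (prd W f') := by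
      unfold win
      apply map_congr_left
      intro i hi
      rw [zero_add]
      exact hag i (by have := List.mem_range.1 hi; omega)
    rw [this]
    exact List.prefix_append _ _
  have e3 : win f' 0 m = win f k m := by
    unfold win
    apply map_congr_left
    intro i hi
    rw [zero_add]
    exact hag i (by have := List.mem_range.1 hi; omega)
  refine ⟨?_, _, hw, _, hw', hww.symm, ?_, ?_⟩
  · intro h0
    have := congrArg List.length h0
    simp [win] at this
    omega
  · obtain ⟨d, hd⟩ := Nat.exists_eq_add_of_le hmn
    rw [hd, win_add]
    exact List.prefix_append _ _
  · obtain ⟨d, hd⟩ := Nat.exists_eq_add_of_le hlt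
    rw [hd, win_add, e3]
    exact List.prefix_append _ _

open Classical in
theorem cut_decomp (h : SC W) {f : Rd(S)} (hf : f ∈ Rdg W) (a : ℤ) (n : ℕ) (hn : n ≤ prd W f) (C : ℤ → Prop)
    (hseg : ∀ (k : ℤ) (m : ℕ), a ≤ k → k + m ≤ a + n → 1 ≤ m → (∀ j : ℤ, k < j → j < k + m → ¬ C j) → PC W f k m) :
    ∀ (m : ℕ) (k : ℤ), 1 ≤ m → a ≤ k → k + m ≤ a + n → ∃ ps : List Wd(S),
      ps.flatten = win f k m ∧ (∀ p ∈ ps, Pc W p) ∧ ps.length ≤ 1 + ((Ioo k (k + m)).filter C).card := by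
  intro m
  induction m using Nat.strong_induction_on with
  | _ m ih =>
    intro k hm hk hkm
    by_cases hc : ∃ j, k < j ∧ j < k + m ∧ C j
    · obtain ⟨j, h1, h2, h3⟩ := hc
      obtain ⟨m1, hm1⟩ : ∃ m1 : ℕ, j = k + m1 := ⟨(j - k).toNat, by omega⟩
      subst hm1
      obtain ⟨m2, rfl⟩ : ∃ m2 : ℕ, m = m1 + m2 := ⟨m - m1, by omega⟩
      obtain ⟨p1, a1, b1, c1⟩ := ih m1 (by omega) k (by omega) hk (by push_cast at *; omega)
      obtain ⟨p2, a2, b2, c2⟩ := ih m2 (by omega) (k + m1) (by omega) (by omega) (by push_cast at *; omega)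
      refine ⟨p1 ++ p2, ?_, ?_, ?_⟩
      · rw [List.flatten_append, a1, a2, win_add]
      · intro p hp
        rcases List.mem_append.1 hp with hp | hp
        · exact b1 p hp
        · exact b2 p hp
      · have hsub : ((Ioo k (k + m1)).filter C) ∪ ({(k + m1 : ℤ)} ∪ (Ioo (k + m1) (k + m1 + m2)).filter C)
            ⊆ (Ioo k (k + (m1 + m2 : ℕ))).filter C := by
          intro x hx
          simp only [mem_union, mem_filter, mem_Ioo, mem_singleton] at hx ⊢
          push_cast
          rcases hx with hx | hx | hx
          · exact ⟨⟨by omega, by omega⟩, hx.2⟩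
          · subst hx
            exact ⟨⟨by omega, by push_cast at *; omega⟩, h3⟩
          · exact ⟨⟨by omega, by omega⟩, hx.2⟩
        have hcard := card_le_card hsub
        rw [card_union_of_disjoint, card_union_of_disjoint] at hcard
        · simp only [Finset.card_singleton] at hcard
          rw [List.length_append]
          omega
        · rw [Finset.disjoint_left]
          intro x hx
          simp only [mem_singleton] at hx
          subst hx
          simp
        · rw [Finset.disjoint_left]
          intro x hx
          simp only [mem_union, mem_filter, mem_Ioo, mem_singleton] at hx ⊢
          omega
    · push Not at hc
      refine ⟨[win f k m], by simp, ?_, by simp⟩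
      intro p hp
      simp at hp
      subst hp
      exact pc_piece h hf hm (by omega) (hseg k m hk hkm hm hc)

open Classical in
theorem lemQ' (h : SC W) {f : Rd(S)} (hf : f ∈ Rdg W) (a : ℤ) (C : ℤ → Prop)
    (hseg : ∀ (k : ℤ) (m : ℕ), a ≤ k → k + m ≤ a + prd W f → 1 ≤ m → (∀ j : ℤ, k < j → j < k + m → ¬ C j) →
      PC W f k m) :
    5 ≤ ((Ioo a (a + prd W f)).filter C).card := by
  by_contra hlt
  obtain ⟨ps, h1, h2, h3⟩ := cut_decomp h hf a (prd W f) le_rfl C hseg (prd W f) a (prd_pos h hf) le_rfl le_rfl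
  exact h.c6 _ (win_mem h hf a) ps (by omega) h2 h1.symm

open Classical in
theorem lemQ (h : SC W) {f : Rd(S)} (hf : f ∈ Rdg W) (C : ℤ → Prop)
    (hper : ∀ k, C (k + prd W f) ↔ C k)
    (hseg : ∀ (k : ℤ) (m : ℕ), m ≤ prd W f → 1 ≤ m → (∀ j : ℤ, k < j → j < k + m → ¬ C j) → PC W f k m) :
    6 ≤ ((Ico (0 : ℤ) (prd W f)).filter C).card := by
  have key : ∀ a : ℤ, 5 ≤ ((Ioo a (a + (prd W f : ℤ))).filter C).card :=
    fun a : ℤ => lemQ' h hf a C (fun k m h1 h2 h3 h4 => hseg k m (by omega) h3 h4)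
  have hpos : 0 < prd W f := prd_pos h hf
  generalize prd W f = n at *
  have h0 := key 0
  obtain ⟨c, hc⟩ : ((Ioo (0 : ℤ) (0 + n)).filter C).Nonempty := by
    rw [← card_pos]; omega
  simp only [mem_filter, mem_Ioo] at hc
  have h1 := key c
  have hinj : (insert c ((Ioo c (c + n)).filter C)).card ≤ ((Ico (0 : ℤ) n).filter C).card := by
    apply Finset.card_le_card_of_injOn (fun x : ℤ => if x < (n : ℤ) then x else x - n)
    · intro x hx
      simp only [Finset.coe_insert, Set.mem_insert_iff, Finset.mem_coe, mem_filter, mem_Ioo] at hx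
      simp only [Finset.coe_filter, Set.mem_setOf_eq, mem_Ico]
      rcases hx with rfl | hx
      · rw [if_pos (by omega)]
        exact ⟨by omega, hc.2⟩
      · split_ifs with hlt
        · exact ⟨by omega, hx.2⟩
        · refine ⟨by omega, ?_⟩
          rw [← hper]
          simpa using hx.2
    · intro x hx y hy hxy
      simp only [Finset.coe_insert, Set.mem_insert_iff, Finset.mem_coe, mem_filter, mem_Ioo] at hx hy
      simp only at hxy
      split_ifs at hxy <;> omega
  rw [Finset.card_insert_of_notMem (by simp)] at hinj
  omega

end

section
variable {D : Type} [Fintype D] [DecidableEq D]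

open Classical in
theorem cls_sum (s : Setoid D) : (cls s : ℚ) = ∑ y : D, 1 / ((univ.filter (fun z => s y z)).card : ℚ) := by
  classical
  haveI : Fintype (Quotient s) := Fintype.ofFinite _
  rw [← Finset.sum_fiberwise univ (fun y => Quotient.mk s y)]
  have : ∀ q : Quotient s, ∑ y ∈ univ.filter (fun y => Quotient.mk s y = q),
      1 / ((univ.filter (fun z => s y z)).card : ℚ) = 1 := by
    intro q
    induction q using Quotient.inductionOn with
    | _ a =>
      have h1 : ∀ y ∈ univ.filter (fun y => Quotient.mk s y = Quotient.mk s a),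
          1 / ((univ.filter (fun z => s y z)).card : ℚ) =
            1 / ((univ.filter (fun y => Quotient.mk s y = Quotient.mk s a)).card : ℚ) := by
        intro y hy
        have hy' : s y a := Quotient.exact (mem_filter.1 hy).2
        congr 2
        apply congrArg
        ext z
        simp only [mem_filter, mem_univ, true_and]
        constructor
        · intro hz
          exact Quotient.sound (s.trans (s.symm hz) hy')
        · intro hz
          exact s.trans hy' (s.symm (Quotient.exact hz))
      rw [sum_congr rfl h1, Finset.sum_const, nsmul_eq_mul, mul_one_div_cancel]
      have : (univ.filter (fun y => Quotient.mk s y = Quotient.mk s a)).Nonempty := ⟨a, by simp⟩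
      have := card_pos.2 this
      positivity
  rw [sum_congr rfl (fun q _ => this q)]
  simp [cls]

theorem cyc_invol {τ : Perm D} (h2 : ∀ d, τ (τ d) = d) (hf : ∀ d, τ d ≠ d) : 2 * cyc τ = Fintype.card D := by
  classical
  have h := cls_sum (sc τ)
  have h1 : ∀ y : D, 1 / ((univ.filter (fun z => sc τ y z)).card : ℚ) = 1 / 2 := by
    intro y
    have : univ.filter (fun z => sc τ y z) = {y, τ y} := by
      ext z
      simp only [mem_filter, mem_univ, true_and, mem_insert, mem_singleton]
      constructor
      · intro hz
        have : sc τ ≤ Setoid.ker (fun x => (x = y ∨ x = τ y)) := by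
          apply sc_le_of
          intro x
          rw [Setoid.ker_def]
          apply propext
          constructor
          · rintro (rfl | rfl)
            · right; rfl
            · left; exact h2 _
          · rintro (h | h)
            · right; rw [← h, h2]
            · left; exact τ.injective h
        have := this hz
        rw [Setoid.ker_def] at this
        exact this ▸ (Or.inl rfl)
      · rintro (rfl | rfl)
        · exact (sc τ).refl _
        · exact sc_apply _ _
    rw [this, Finset.card_pair (fun h => hf y h.symm)]
    norm_num
  rw [sum_congr rfl (fun y _ => h1 y)] at h
  simp at h
  have h3 : ((2 * cyc τ : ℤ) : ℚ) = ((Fintype.card D : ℤ) : ℚ) := by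
    push_cast
    unfold cyc
    push_cast
    rw [h]; ring
  exact_mod_cast h3

theorem count_aux {σ τ : Perm D} (h2 : ∀ d, τ (τ d) = d) (hf : ∀ d, τ d ≠ d) (hν : ∀ y, σ (τ y) ≠ y) :
    ((univ.filter (fun y => σ (τ (σ (τ y))) ≠ y)).card : ℤ) + 12 * kap σ (σ * τ) ≤
      6 * cyc σ + 6 * gen σ (σ * τ) ∧
    (6 * cyc σ + 6 * gen σ (σ * τ) ≤
      ((univ.filter (fun y => σ (τ (σ (τ y))) ≠ y)).card : ℤ) + 12 * kap σ (σ * τ) →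
      ∀ y, σ (τ (σ (τ y))) ≠ y → σ (τ (σ (τ (σ (τ y))))) = y) := by
  classical
  have e1 : 6 * gen σ (σ * τ) = 12 * kap σ (σ * τ) + 3 * Fintype.card D - 6 * cyc σ - 6 * cyc (σ * τ) := by
    unfold gen
    rw [inv_mul_cancel_left]
    have := cyc_invol h2 hf
    linarith
  set o : D → ℚ := fun y => ((univ.filter (fun z => sc (σ * τ) y z)).card : ℚ) with ho
  have hs : (cyc (σ * τ) : ℚ) = ∑ y, 1 / o y := by
    rw [ho, ← cls_sum]
    simp [cyc]
  have s0 : ∀ y, sc (σ * τ) y y := fun y => (sc (σ * τ)).refl y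
  have s1 : ∀ y, sc (σ * τ) y (σ (τ y)) := fun y => sc_apply (σ * τ) y
  have s2 : ∀ y, sc (σ * τ) y (σ (τ (σ (τ y)))) := fun y => (sc (σ * τ)).trans (s1 y) (s1 _)
  have s3 : ∀ y, sc (σ * τ) y (σ (τ (σ (τ (σ (τ y)))))) := fun y => (sc (σ * τ)).trans (s2 y) (s1 _)
  have c2 : ∀ y, (2 : ℚ) ≤ o y := by
    intro y
    have : ({y, σ (τ y)} : Finset D) ⊆ univ.filter (fun z => sc (σ * τ) y z) := by
      intro z hz
      simp only [mem_insert, mem_singleton] at hz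
      rcases hz with rfl | rfl <;> simp [s0, s1]
    have := card_le_card this
    rw [Finset.card_pair (fun h => hν y h.symm)] at this
    simp only [ho]; exact_mod_cast this
  have c3 : ∀ y, σ (τ (σ (τ y))) ≠ y → (3 : ℚ) ≤ o y := by
    intro y hy
    have hsub : ({y, σ (τ y), σ (τ (σ (τ y)))} : Finset D) ⊆ univ.filter (fun z => sc (σ * τ) y z) := by
      intro z hz
      simp only [mem_insert, mem_singleton] at hz
      rcases hz with rfl | rfl | rfl <;> simp [s0, s1, s2]
    have := card_le_card hsub
    rw [Finset.card_eq_three.2 ⟨_, _, _, fun h => hν y h.symm, fun h => hy h.symm, fun h => hν _ h.symm, rfl⟩] at this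
    simp only [ho]; exact_mod_cast this
  have c4 : ∀ y, σ (τ (σ (τ y))) ≠ y → σ (τ (σ (τ (σ (τ y))))) ≠ y → (4 : ℚ) ≤ o y := by
    intro y hy hy3
    have hsub : (insert (σ (τ (σ (τ (σ (τ y)))))) ({y, σ (τ y), σ (τ (σ (τ y)))} : Finset D))
        ⊆ univ.filter (fun z => sc (σ * τ) y z) := by
      intro z hz
      simp only [mem_insert, mem_singleton] at hz
      rcases hz with rfl | rfl | rfl | rfl <;> simp [s0, s1, s2, s3]
    have := card_le_card hsub
    rw [Finset.card_insert_of_notMem, Finset.card_eq_three.2 ⟨_, _, _, fun h => hν y h.symm, fun h => hy h.symm, fun h => hν _ h.symm, rfl⟩] at this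
    · simp only [ho]; exact_mod_cast this
    · simp only [mem_insert, mem_singleton, not_or]
      refine ⟨hy3, ?_, hν _⟩
      intro h
      exact hy (τ.injective (σ.injective h))
  have hpt : ∀ y, 6 * (1 / o y) ≤ 3 - (if σ (τ (σ (τ y))) ≠ y then (1 : ℚ) else 0) := by
    intro y
    have hpos : 0 < o y := by linarith [c2 y]
    rw [mul_one_div, div_le_iff₀ hpos]
    split_ifs with hy
    · linarith [c3 y hy]
    · linarith [c2 y]
  have hcard : ((univ.filter (fun y => σ (τ (σ (τ y))) ≠ y)).card : ℚ) =
      ∑ y : D, (if σ (τ (σ (τ y))) ≠ y then (1 : ℚ) else 0) := by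
    rw [Finset.card_filter]
    push_cast
    rfl
  have hsum : ∑ y : D, (3 - (if σ (τ (σ (τ y))) ≠ y then (1 : ℚ) else 0)) =
      3 * (Fintype.card D : ℚ) - ((univ.filter (fun y => σ (τ (σ (τ y))) ≠ y)).card : ℚ) := by
    rw [Finset.sum_sub_distrib, hcard]
    simp [mul_comm]
  have hs6 : 6 * (cyc (σ * τ) : ℚ) = ∑ y, 6 * (1 / o y) := by rw [hs, Finset.mul_sum]
  constructor
  · have h1 := sum_le_sum (fun y (_ : y ∈ univ) => hpt y)
    rw [hsum, ← hs6] at h1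
    have h3 : 6 * cyc (σ * τ) ≤ 3 * (Fintype.card D : ℤ) -
      ((univ.filter (fun y => σ (τ (σ (τ y))) ≠ y)).card : ℤ) := by exact_mod_cast h1
    linarith
  · intro hle y hy
    by_contra hy3
    have h1 := Finset.sum_lt_sum (fun y (_ : y ∈ univ) => hpt y) ⟨y, mem_univ _, by
      have := c4 y hy hy3
      have hpos : 0 < o y := by linarith
      rw [mul_one_div, div_lt_iff₀ hpos, if_pos hy]
      linarith⟩
    rw [hsum, ← hs6] at h1
    have h3 : 6 * cyc (σ * τ) < 3 * (Fintype.card D : ℤ) -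
      ((univ.filter (fun y => σ (τ (σ (τ y))) ≠ y)).card : ℤ) := by exact_mod_cast h1
    linarith

/-- a finite family of representatives counts the classes -/
theorem cls_eq_of {ι : Type} [Fintype ι] (s : Setoid D) (f : D → ι) (hf : Function.Surjective f)
    (h : ∀ x y, s x y ↔ f x = f y) : cls s = Fintype.card ι := by
  unfold cls
  rw [← Nat.card_eq_fintype_card]
  refine Nat.card_congr (Equiv.ofBijective (Quotient.lift f (fun a b hab => (h a b).1 hab)) ⟨?_, ?_⟩)
  · intro a b
    induction a using Quotient.inductionOn with | _ a => ?_
    induction b using Quotient.inductionOn with | _ b => ?_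
    intro hab
    exact Quotient.sound ((h a b).2 hab)
  · intro i
    obtain ⟨x, hx⟩ := hf i
    exact ⟨Quotient.mk s x, hx⟩

theorem kap_pos [Nonempty D] (α β : Perm D) : 1 ≤ kap α β := by
  unfold kap cls
  haveI : Finite (Quotient (sc α ⊔ sc β)) := Quotient.finite _
  haveI : Nonempty (Quotient (sc α ⊔ sc β)) := ⟨Quotient.mk _ (Classical.arbitrary D)⟩
  have : 0 < Nat.card (Quotient (sc α ⊔ sc β)) := Nat.card_pos
  exact_mod_cast this

end

namespace OK
variable {E : Type u} {inv : E → E} {D : Type} {σ τ : Perm D} {lab : D → E} {fs : List (List D)}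

theorem cyc_eq [Fintype D] [DecidableEq D] (h : OK inv σ τ lab fs) : FC6.cyc σ = fs.length := by
  classical
  have hex : ∀ d : D, ∃ i : Fin fs.length, d ∈ fs[i] := by
    intro d
    obtain ⟨l, hl, hd⟩ := mem_flatten.1 (h.all d)
    obtain ⟨i, hi, rfl⟩ := List.mem_iff_getElem.1 hl
    exact ⟨⟨i, hi⟩, hd⟩
  choose f hf using hex
  have hdis := (List.nodup_flatten.1 h.nd).2
  rw [List.pairwise_iff_getElem] at hdis
  have huniq : ∀ (i j : Fin fs.length) (d : D), d ∈ fs[i] → d ∈ fs[j] → i = j := by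
    intro i j d hi hj
    rcases lt_trichotomy i j with hij | hij | hij
    · exact absurd hj (hdis i j i.2 j.2 hij hi)
    · exact hij
    · exact absurd hi (hdis j i j.2 i.2 hij hj)
  unfold FC6.cyc
  rw [cls_eq_of (sc σ) f, Fintype.card_fin]
  · intro i
    obtain ⟨d, hd⟩ := List.exists_mem_of_ne_nil _ (h.ne fs[i] (List.getElem_mem _))
    exact ⟨d, huniq _ _ d (hf d) hd⟩
  · intro x y
    constructor
    · intro hxy
      have := (h.mem_iff_of_sc (List.getElem_mem (f x).2) hxy).1 (hf x)
      exact huniq _ _ y this (hf y)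
    · intro hxy
      have h1 := hf x
      have h2 := hf y
      rw [← hxy] at h2
      exact h.sc_of_mem (List.getElem_mem (f x).2) h1 h2

end OK

section
variable {D : Type} {σ τ : Perm D}

theorem cyc_pow {l : List D} (hl : l ≠ []) (h : l.map σ = l.rotate 1) (k j : ℤ) :
    (σ ^ k) (rd l hl j) = rd l hl (j + k) := by
  have h1 : ∀ j, σ (rd l hl j) = rd l hl (j + 1) := by
    intro j
    have e1 := rd_rotate hl 1 j
    rw [Nat.cast_one] at e1
    rw [← e1]
    have : rd (l.map σ) (by simpa using hl) j = rd (l.rotate 1) (by simpa using hl) j := by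
      congr 1
    rw [← this]
    simp [rd]
  induction k using Int.induction_on generalizing j with
  | zero => simp
  | succ k ih => rw [add_comm (k : ℤ) 1, zpow_add, zpow_one, mul_apply, ih, h1]; congr 1; ring
  | pred k ih =>
    rw [sub_eq_neg_add, zpow_add, zpow_neg_one, mul_apply, ih, Perm.inv_eq_iff_eq, h1]; congr 1; ring

theorem mem_rd {l : List D} (hl : l ≠ []) {d : D} (hd : d ∈ l) : ∃ j : ℕ, d = rd l hl j := by
  obtain ⟨j, hj, rfl⟩ := List.mem_iff_getElem.1 hd
  exact ⟨j, (rd_natCast hl hj).symm⟩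

theorem rot_pow {l : List D} (h : l.map σ = l.rotate 1) {d : D} (hd : d ∈ l) :
    ∃ j : ℕ, (List.range l.length).map (fun k : ℕ => (σ ^ (k : ℤ)) d) = l.rotate j := by
  have hl := List.ne_nil_of_mem hd
  obtain ⟨j, rfl⟩ := mem_rd hl hd
  refine ⟨j, ?_⟩
  apply List.ext_getElem
  · simp
  · intro i h1 h2
    rw [List.getElem_map, List.getElem_range, cyc_pow hl h, ← rd_natCast (by simpa using hl) h2, rd_rotate hl]
    congr 1; ring

theorem pow_eq_self_iff {l : List D} (h : l.map σ = l.rotate 1) (hn : l.Nodup) {d : D} (hd : d ∈ l) (k : ℤ) :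
    (σ ^ k) d = d ↔ (l.length : ℤ) ∣ k := by
  have hl := List.ne_nil_of_mem hd
  obtain ⟨j, rfl⟩ := mem_rd hl hd
  have hpos : 0 < l.length := length_pos_iff.2 hl
  rw [cyc_pow hl h]
  constructor
  · intro he
    unfold rd at he
    rw [hn.getElem_inj_iff] at he
    have a1 := Int.emod_nonneg (j + k) (b := l.length) (by omega)
    have a2 := Int.emod_nonneg j (b := l.length) (by omega)
    have : ((j : ℤ) + k) % l.length = j % l.length := by omega
    have := Int.emod_eq_emod_iff_emod_sub_eq_zero.1 this
    have := Int.dvd_of_emod_eq_zero this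
    simpa using this
  · intro hk
    apply rd_congr
    simpa using hk

open Classical in
theorem countP_eq {l : List D} (h : l.map σ = l.rotate 1) {d : D} (hd : d ∈ l) (P : D → Prop) :
    l.countP (fun x => decide (P x)) = ((Ico (0 : ℤ) l.length).filter (fun k => P ((σ ^ k) d))).card := by
  obtain ⟨j, hj⟩ := rot_pow h hd
  have : (l.rotate j).countP (fun x => decide (P x)) = l.countP (fun x => decide (P x)) :=
    (List.rotate_perm l j).countP_eq _
  rw [← this, ← hj, List.countP_map]
  have e : Ico (0 : ℤ) l.length = (Finset.range l.length).map Nat.castEmbedding := by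
    ext x
    simp only [mem_Ico, Finset.mem_map, Finset.mem_range, Nat.castEmbedding_apply]
    constructor
    · intro hx; exact ⟨x.toNat, by omega, by omega⟩
    · rintro ⟨a, ha, rfl⟩; omega
  rw [e, Finset.filter_map, Finset.card_map, Finset.card_def, Finset.filter_val, Finset.range_val,
    Multiset.range, Multiset.filter_coe, Multiset.coe_card, List.countP_eq_length_filter]
  rfl

/-- reading of a dart -/
def rdS {L : Type u} (σ : Perm D) (ℓ : D → L) (d : D) : ℤ → L := fun k => ℓ ((σ ^ k) d)

variable {S : Type u} {ℓ : D → S × Bool}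

theorem rdS_pow (σ : Perm D) (ℓ : D → S × Bool) (k : ℤ) (d : D) : rdS σ ℓ ((σ ^ k) d) = shf k (rdS σ ℓ d) := by
  funext i
  simp only [rdS, shf, zpow_add, mul_apply]

theorem rdS_mem {W : Set Wd(S)} (hW : SC W) {l : List D} (h : l.map σ = l.rotate 1) {d : D} (hd : d ∈ l)
    (hlW : l.map ℓ ∈ W) : rdS σ ℓ d ∈ Rdg W ∧ prd W (rdS σ ℓ d) = l.length := by
  have hl := List.ne_nil_of_mem hd
  obtain ⟨j, rfl⟩ := mem_rd hl hd
  have e : rdS σ ℓ (rd l hl j) = shf j (rd (l.map ℓ) (hW.ne _ hlW)) := by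
    funext i
    simp only [rdS, shf]
    rw [cyc_pow hl h]
    simp [rd, add_comm]
  rw [e]
  have hm : rd (l.map ℓ) (hW.ne _ hlW) ∈ Rdg W := ⟨_, hlW, _, rfl⟩
  refine ⟨shf_mem hW hm _, ?_⟩
  rw [prd_shf hW hm, prd_rd hW hlW]
  simp

/-- the pairing across a run of contiguous corners -/
theorem run_pair (h2 : ∀ d, τ (τ d) = d) {y : D} {m : ℕ}
    (hc : ∀ k : ℕ, 0 < k → k < m → σ (τ (σ (τ ((σ ^ k) y)))) = (σ ^ k) y) :
    ∀ k : ℕ, k < m → τ ((σ ^ k) y) = (σ ^ (-(k : ℤ))) (τ y) := by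
  intro k
  induction k with
  | zero => intro _; simp
  | succ k ih =>
    intro hk
    have h1 := ih (by omega)
    have h3 := hc (k + 1) (by omega) hk
    have h4 : (σ ^ (k + 1)) y = σ ((σ ^ k) y) := by rw [pow_succ']; rfl
    rw [h4] at h3 ⊢
    have h5 : σ (τ (σ ((σ ^ k) y))) = τ ((σ ^ k) y) := by
      have := σ.injective h3
      rw [← h2 (σ (τ (σ ((σ ^ k) y)))), this]
    rw [h1] at h5
    have h6 : (σ ^ (-(k : ℤ))) (τ y) = σ ((σ ^ (-((k + 1 : ℕ) : ℤ))) (τ y)) := by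
      have : (-(k : ℤ)) = 1 + (-((k + 1 : ℕ) : ℤ)) := by push_cast; ring
      rw [this, zpow_add, zpow_one, mul_apply]

    rw [h6] at h5
    exact σ.injective h5

theorem run_agree (h2 : ∀ d, τ (τ d) = d) (hlab : ∀ d, ℓ (τ d) = linv (ℓ d)) {y : D} {m : ℕ}
    (hc : ∀ k : ℕ, 0 < k → k < m → σ (τ (σ (τ ((σ ^ k) y)))) = (σ ^ k) y) (k : ℕ) (hk : k < m) :
    mir (rdS σ ℓ (τ y)) k = rdS σ ℓ y k := by
  have := run_pair h2 hc k hk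
  simp only [mir, rdS]
  rw [← this, hlab, linv_linv, zpow_natCast]

theorem run_PC {W : Set Wd(S)} (hW : SC W) (h2 : ∀ d, τ (τ d) = d) (hlab : ∀ d, ℓ (τ d) = linv (ℓ d))
    {y : D} {m : ℕ} {k : ℤ}
    (hm : rdS σ ℓ (τ ((σ ^ k) y)) ∈ Rdg W) (hne : rdS σ ℓ ((σ ^ k) y) ≠ mir (rdS σ ℓ (τ ((σ ^ k) y))))
    (hc : ∀ j : ℤ, k < j → j < k + m → σ (τ (σ (τ ((σ ^ j) y)))) = (σ ^ j) y) :
    PC W (rdS σ ℓ y) k m := by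
  refine ⟨mir (rdS σ ℓ (τ ((σ ^ k) y))), mir_mem hW hm, ?_, ?_⟩
  · rw [← rdS_pow]
    exact hne.symm
  · intro i hi
    have := run_agree (σ := σ) (y := (σ ^ k) y) (m := m) h2 hlab (fun j hj hj2 => by
      have e : (σ ^ j) ((σ ^ k) y) = (σ ^ (j + k : ℤ)) y := by
        rw [zpow_add, mul_apply, zpow_natCast]
      rw [e]
      exact hc (j + k) (by omega) (by omega)) i hi
    rw [this, rdS_pow]
    simp [shf, add_comm]

/-- no monogons at interior vertices -/
theorem nu_ne {W : Set Wd(S)} (hW : SC W) (h2 : ∀ d, τ (τ d) = d) (hlab : ∀ d, ℓ (τ d) = linv (ℓ d)) {y : D}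
    (hm : rdS σ ℓ (τ y) ∈ Rdg W) : σ (τ y) ≠ y := by
  intro h
  have := rdg_red hW hm 0
  apply this
  simp only [rdS, zero_add, zpow_one, zpow_zero, Perm.one_apply]
  rw [h, hlab, linv_linv]

end

section
variable {E : Type v} {inv : E → E} {D : Type} {σ τ : Perm D} {lab : D → E} {fs : List (List D)}

open Classical in
theorem OK.card_filter [Fintype D] (h : OK inv σ τ lab fs) (P : D → Prop) :
    (univ.filter P).card = (fs.map (fun l => l.countP (fun x => decide (P x)))).sum := by
  have h1 : univ.filter P = (fs.flatten.filter (fun x => decide (P x))).toFinset := by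
    ext x
    simp only [mem_filter, mem_univ, true_and, List.mem_toFinset, List.mem_filter, decide_eq_true_eq]
    exact ⟨fun hx => ⟨h.all x, hx⟩, fun hx => hx.2⟩
  rw [h1, List.toFinset_card_of_nodup (h.nd.filter _), ← List.countP_eq_length_filter, List.countP_flatten]

end

section
variable {S : Type u} {D : Type} {σ τ : Perm D} {ℓ : D → S × Bool} {W : Set Wd(S)}

open Classical in
/-- hexagonality of one face -/
theorem face_six (hW : SC W) (h2 : ∀ d, τ (τ d) = d) (hlab : ∀ d, ℓ (τ d) = linv (ℓ d)) {l : List D}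
    (h : l.map σ = l.rotate 1) (hlW : l.map ℓ ∈ W) {y : D} (hy : y ∈ l) (C : D → Prop)
    (hm : ∀ z, sc σ y z → ∀ m, 0 < m → m ≤ l.length → (∀ j : ℕ, 0 < j → j < m → ¬ C ((σ ^ j) z)) → PC W (rdS σ ℓ z) 0 m) :
    6 ≤ l.countP (fun x => decide (C x)) := by
  rw [countP_eq h hy C]
  obtain ⟨hr, hp⟩ := rdS_mem hW h hy hlW
  have := lemQ hW hr (fun k => C ((σ ^ k) y)) ?_ ?_
  · rw [hp] at this
    exact this
  · intro k
    rw [hp, zpow_add, mul_apply]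
    have hl := List.ne_nil_of_mem hy
    obtain ⟨j, rfl⟩ := mem_rd hl hy
    rw [cyc_pow hl h _ (j : ℤ), rd_add_length]
  · intro k m h1 h3 h4
    rw [hp] at h1
    obtain ⟨f', hf', hne, hag⟩ := hm ((σ ^ k) y) ⟨k, rfl⟩ m h3 h1 (fun j hj hj2 => by
      rw [← zpow_natCast, ← mul_apply, ← zpow_add]
      exact h4 (j + k) (by omega) (by omega))
    refine ⟨f', hf', ?_, ?_⟩
    · rw [rdS_pow, shf_shf, zero_add] at hne
      exact hne
    · intro i hi
      rw [hag i hi, rdS_pow]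
      simp [shf, add_comm]

end

section
variable {E : Type v} {inv : E → E} {g : ℤ}

theorem St.fold_all (hi : ∀ s, inv (inv s) = s) : ∀ (u : List E) (s : E) (Fs : List (List E)),
    St inv g ((u ++ [s, inv s] ++ ebar inv u) :: Fs) → St inv g Fs := by
  intro u
  induction u using List.reverseRecOn with
  | nil => intro s Fs h; exact St.fold_nil hi (by simpa [ebar] using h)
  | append_singleton u x ih =>
    intro s Fs h
    apply ih x Fs
    have := St.fold_mid hi h (by simp)
    simpa [ebar_append, ebar] using this

theorem ebar_range {n : ℕ} (f : ℕ → E) :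
    ebar inv ((List.range n).map f) = (List.range n).map (fun k => inv (f (n - 1 - k))) := by
  unfold ebar
  apply List.ext_getElem
  · simp
  · intro i h1 h2
    simp at h1 h2
    simp

theorem exists_perm_cons_cons {α : Type*} [DecidableEq α] {l : List α} {a b : α} (ha : a ∈ l) (hb : b ∈ l) (hab : a ≠ b) :
    ∃ l', l.Perm (a :: b :: l') := by
  refine ⟨(l.erase a).erase b, ?_⟩
  have h1 := List.perm_cons_erase ha
  have h2 : b ∈ l.erase a := (List.mem_erase_of_ne hab.symm).2 hb
  exact h1.trans ((List.perm_cons_erase h2).cons a)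

theorem OK.zip {D : Type} [Fintype D] [DecidableEq D] {σ τ : Perm D} {lab : D → E} {fs : List (List D)}
    (hi : ∀ s, inv (inv s) = s) (h : OK inv σ τ lab fs) (hg : gen σ (σ * τ) ≤ g) {l1 l2 : List D} (h1 : l1 ∈ fs)
    (h2 : l2 ∈ fs) (hne : l1 ≠ l2) {d : D} (hd1 : d ∈ l1) (hd2 : τ d ∈ l2) (hlen : l1.length = l2.length)
    (hm : ∀ k : ℕ, lab ((σ ^ (k : ℤ)) (τ d)) = inv (lab ((σ ^ (-(k : ℤ))) d))) :
    ∃ fs', fs.Perm (l1 :: l2 :: fs') ∧ St inv g (fs'.map (List.map lab)) := by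
  obtain ⟨fs', hp⟩ := exists_perm_cons_cons h1 h2 hne
  refine ⟨fs', hp, ?_⟩
  have hk := h.perm hp
  obtain ⟨j1, hj1⟩ := rot_pow (h.cyc l1 h1) hd1
  obtain ⟨j2, hj2⟩ := rot_pow (h.cyc l2 h2) hd2
  obtain ⟨n, hn⟩ : ∃ n, l1.length = n + 1 := ⟨l1.length - 1, by
    have := List.length_pos_of_mem hd1; omega⟩
  rw [hn, List.range_succ_eq_map] at hj1
  rw [← hlen, hn, List.range_succ_eq_map] at hj2
  simp only [map_cons, map_map] at hj1 hj2
  have k1 := (((hk.rot (j1 + 1)).perm (List.Perm.swap _ _ _)).rot j2).perm (List.Perm.swap _ _ _)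
  rw [← List.rotate_rotate, ← hj1, ← hj2, List.rotate_cons_succ, List.rotate_zero] at k1
  simp only [Nat.cast_zero, zpow_zero, Perm.one_apply] at k1
  have k2 := OK.joinAdj k1 hg
  have hper : (σ ^ ((n : ℤ) + 1)) d = d := by
    have := (pow_eq_self_iff (h.cyc l1 h1) ((List.nodup_flatten.1 h.nd).1 l1 h1) hd1 (n + 1)).2 (by rw [hn]; push_cast; exact dvd_refl _)
    exact this
  refine St.fold_all hi (List.map lab (List.map ((fun k : ℕ => (σ ^ (k : ℤ)) d) ∘ Nat.succ) (List.range n))) (lab d) (fs'.map (List.map lab)) ?_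
  convert k2 using 3
  rw [map_map, ebar_range, map_map]
  apply map_congr_left
  intro k hk'
  have hkn := List.mem_range.1 hk'
  simp only [Function.comp]
  rw [hm]
  congr 2
  have : ((Nat.succ (n - 1 - k) : ℕ) : ℤ) = -((Nat.succ k : ℕ) : ℤ) + (n + 1) := by push_cast; omega
  rw [this, zpow_add, mul_apply, hper]

end

section
variable {S : Type u}

/-- a reading is never a shift of its mirror -/
theorem mir_ne_shf {W : Set Wd(S)} (hW : SC W) {f : Rd(S)} (hf : f ∈ Rdg W) (k : ℤ) :
    mir f ≠ shf k f := by
  intro h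
  rcases Int.even_or_odd' k with ⟨j, rfl | rfl⟩
  · have := congrFun h (-j)
    simp only [mir, shf, neg_neg] at this
    rw [show -j + 2 * j = j by ring] at this
    have h3 := congrArg Prod.snd this
    simp [linv] at h3
  · have := congrFun h (-j)
    simp only [mir, shf, neg_neg] at this
    rw [show -j + (2 * j + 1) = j + 1 by ring] at this
    exact rdg_red hW hf j this.symm

/-- non-contiguous corner -/
def nc {D : Type} (σ τ : Perm D) (y : D) : Prop := σ (τ (σ (τ y))) ≠ y

/-- hexagonal reduced surface -/
structure Hex (W : Set Wd(S)) {D : Type} (σ τ : Perm D) (ℓ : D → S × Bool) : Prop where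
  inv2 : ∀ d, τ (τ d) = d
  labt : ∀ d, ℓ (τ d) = linv (ℓ d)
  mem : ∀ d, rdS σ ℓ d ∈ Rdg W
  per : ∀ d, ∀ k : ℤ, (σ ^ k) d = d ↔ (prd W (rdS σ ℓ d) : ℤ) ∣ k
  red : ∀ d, rdS σ ℓ (τ d) ≠ mir (rdS σ ℓ d)
  deg : ∀ d, nc σ τ d → σ (τ (σ (τ (σ (τ d))))) = d
  six : ∀ d, ∀ s : Finset ℤ, (∀ k, k ∈ s ↔ 0 ≤ k ∧ k < prd W (rdS σ ℓ d) ∧ nc σ τ ((σ ^ k) d)) → s.card = 6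

theorem OK.rdS_spec {W : Set Wd(S)} (hW : SC W) {E : Type v} {inv : E → E} {pl : E → S × Bool} {D : Type}
    {σ τ : Perm D} {lab : D → E} {fs : List (List D)} (h : OK inv σ τ lab fs) {l : List D} (hl : l ∈ fs)
    (hw : l.map (pl ∘ lab) ∈ W) {d : D} (hd : d ∈ l) :
    rdS σ (pl ∘ lab) d ∈ Rdg W ∧ prd W (rdS σ (pl ∘ lab) d) = l.length ∧
      (∀ k : ℤ, (σ ^ k) d = d ↔ (prd W (rdS σ (pl ∘ lab) d) : ℤ) ∣ k) := by
  obtain ⟨a, b⟩ := rdS_mem hW (h.cyc l hl) hd hw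
  refine ⟨a, b, ?_⟩
  intro k
  rw [b]
  exact pow_eq_self_iff (h.cyc l hl) ((List.nodup_flatten.1 h.nd).1 l hl) hd k

open Classical in
theorem sum_ge_six {α : Type*} (l : List α) (f : α → ℕ) (h : ∀ x ∈ l, 6 ≤ f x) : 6 * l.length ≤ (l.map f).sum := by
  induction l with
  | nil => simp
  | cons a l ih =>
    have := h a (by simp)
    have := ih (fun x hx => h x (by simp [hx]))
    simp only [map_cons, List.sum_cons, List.length_cons]
    omega

theorem sum_eq_six {α : Type*} (l : List α) (f : α → ℕ) (h : ∀ x ∈ l, 6 ≤ f x) (hs : (l.map f).sum ≤ 6 * l.length) :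
    ∀ x ∈ l, f x = 6 := by
  induction l with
  | nil => simp
  | cons a l ih =>
    have h1 := h a (by simp)
    have h2 := sum_ge_six l f (fun x hx => h x (by simp [hx]))
    simp only [map_cons, List.sum_cons, List.length_cons] at hs
    intro x hx
    rcases List.mem_cons.1 hx with rfl | hx
    · omega
    · exact ih (fun x hx => h x (by simp [hx])) (by omega) x hx

theorem hex_of {W : Set Wd(S)} (hW : SC W) {E : Type v} {inv : E → E} {pl : E → S × Bool}
    (hpl : ∀ e, pl (inv e) = linv (pl e)) {D : Type} [Fintype D] [DecidableEq D] [Nonempty D]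
    {σ τ : Perm D} {lab : D → E} {fs : List (List D)} (h : OK inv σ τ lab fs) (hg : gen σ (σ * τ) ≤ 2)
    (hw : ∀ l ∈ fs, l.map (pl ∘ lab) ∈ W) (hred : ∀ d, rdS σ (pl ∘ lab) (τ d) ≠ mir (rdS σ (pl ∘ lab) d)) :
    Hex W σ τ (pl ∘ lab) ∧ ∀ x y, (sc σ ⊔ sc (σ * τ)) x y := by
  classical
  have hlab : ∀ d, (pl ∘ lab) (τ d) = linv ((pl ∘ lab) d) := by
    intro d; simp only [Function.comp, h.labt, hpl]
  have hmem : ∀ d, rdS σ (pl ∘ lab) d ∈ Rdg W := by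
    intro d
    obtain ⟨l, hl, hd⟩ := mem_flatten.1 (h.all d)
    exact (h.rdS_spec hW hl (hw l hl) hd).1
  have hred' : ∀ d, rdS σ (pl ∘ lab) d ≠ mir (rdS σ (pl ∘ lab) (τ d)) := by
    intro d
    have := hred (τ d)
    rwa [h.inv2] at this
  have hsix : ∀ l ∈ fs, 6 ≤ l.countP (fun x => decide (nc σ τ x)) := by
    intro l hl
    obtain ⟨y, hy⟩ := List.exists_mem_of_ne_nil _ (h.ne l hl)
    refine face_six hW h.inv2 hlab (h.cyc l hl) (hw l hl) hy (nc σ τ) ?_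
    intro z _ m hm _ hc
    refine run_PC hW h.inv2 hlab (hmem _) (hred' _) ?_
    intro j h1 h2
    have := hc j.toNat (by omega) (by omega)
    rw [← zpow_natCast, Int.toNat_of_nonneg (by omega)] at this
    simpa [nc] using this
  obtain ⟨c1, c2⟩ := count_aux h.inv2 h.fpf (fun y => nu_ne hW h.inv2 hlab (hmem (τ y)))
  have hN := h.card_filter (nc σ τ)
  have hN' : ∀ (i : DecidablePred (fun y => σ (τ (σ (τ y))) ≠ y)), (@Finset.filter D (fun y => σ (τ (σ (τ y))) ≠ y) i univ).card
      = (fs.map (List.countP fun x => decide (nc σ τ x))).sum := by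
    intro i
    rw [← hN]
    congr 1
    ext; simp [nc]
  rw [hN', h.cyc_eq] at c1 c2
  have hge := sum_ge_six fs _ hsix
  have hk := kap_pos σ (σ * τ)
  have hk1 : kap σ (σ * τ) = 1 := by omega
  have hall := sum_eq_six fs _ hsix (by omega)
  refine ⟨⟨h.inv2, hlab, hmem, ?_, hred, ?_, ?_⟩, ?_⟩
  · intro d
    obtain ⟨l, hl, hd⟩ := mem_flatten.1 (h.all d)
    exact (h.rdS_spec hW hl (hw l hl) hd).2.2
  · exact c2 (by omega)
  · intro d s hs
    obtain ⟨l, hl, hd⟩ := mem_flatten.1 (h.all d)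
    have := hall l hl
    rw [countP_eq (h.cyc l hl) hd] at this
    rw [← this]
    congr 1
    ext k
    rw [hs, (h.rdS_spec hW hl (hw l hl) hd).2.1]
    simp [and_assoc]
  · intro x y
    unfold kap cls at hk1
    haveI : Finite (Quotient (sc σ ⊔ sc (σ * τ))) := Quotient.finite _
    have hk2 : Nat.card (Quotient (sc σ ⊔ sc (σ * τ))) = 1 := by exact_mod_cast hk1
    obtain ⟨hs, -⟩ := Nat.card_eq_one_iff_unique.1 hk2
    exact Quotient.exact (hs.elim (Quotient.mk _ x) (Quotient.mk _ y))

end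

section
variable {S : Type u} {P : Type v} {act : P → S × Bool → P}

/-- closed path words -/
def CW (act : P → S × Bool → P) (e : List (P × (S × Bool))) : Prop := ∃ p w, w ≠ [] ∧ pend act p w = p ∧ e = pw act p w

theorem CW.rot1 {x : P × (S × Bool)} {e} (h : CW act (x :: e)) : CW act (e ++ [x]) ∧ ∀ y ∈ (e ++ [x]).head?, y.1 = act x.1 x.2 := by
  obtain ⟨p, w, h1, h2, h3⟩ := h
  rcases w with _ | ⟨s, w⟩
  · exact absurd rfl h1
  · simp only [pw, List.cons.injEq] at h3
    obtain ⟨rfl, rfl⟩ := h3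
    have h4 : pend act (act p s) w = p := h2
    refine ⟨⟨act p s, w ++ [s], by simp, ?_, ?_⟩, ?_⟩
    · rw [pend_append, h4]; rfl
    · rw [pw_append, h4]; rfl
    · rcases w with _ | ⟨t, w⟩
      · simp [pw]
        exact h4.symm
      · simp [pw]

theorem CW.rot {e : List (P × (S × Bool))} (h : CW act e) (k : ℕ) : CW act (e.rotate k) := by
  induction k with
  | zero => simpa using h
  | succ k ih =>
    rw [← List.rotate_rotate]
    rcases he : e.rotate k with _ | ⟨x, e'⟩
    · rw [he] at ih; simpa using ih
    · rw [he] at ih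
      rw [List.rotate_cons_succ, List.rotate_zero]
      exact ih.rot1.1

theorem OK.pos_next {D : Type} {σ τ : Perm D} {lab : D → P × (S × Bool)} {fs : List (List D)}
    (h : OK (einv act) σ τ lab fs) {l : List D} (hl : l ∈ fs) (hw : CW act (l.map lab)) {d : D} (hd : d ∈ l) :
    (lab (σ d)).1 = act (lab d).1 (lab d).2 := by
  obtain ⟨j, hj⟩ := rot_pow (h.cyc l hl) hd
  obtain ⟨j2, hj2⟩ := rot_pow (h.cyc l hl) (h.mem_apply hl hd)
  have h1 := hw.rot j
  rw [← List.map_rotate, ← hj] at h1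
  obtain ⟨n, hn⟩ : ∃ n, l.length = n + 1 := ⟨l.length - 1, by
    have := List.length_pos_of_mem hd; omega⟩
  rw [hn, List.range_succ_eq_map] at h1
  simp only [map_cons, map_map, Nat.cast_zero, zpow_zero, Perm.one_apply] at h1
  have h2 := h1.rot1.2
  rcases n with _ | n
  · have hp := (pow_eq_self_iff (h.cyc l hl) ((List.nodup_flatten.1 h.nd).1 l hl) hd 1).2 (by rw [hn]; simp)
    rw [zpow_one] at hp
    rw [hp]
    simpa using h2
  · rw [List.range_succ_eq_map] at h2
    simpa using h2

/-- every surface can be made reduced, keeping an invariant of its faces -/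
theorem T_run {W : Set Wd(S)} (hW : SC W) (ha : Act act) {A : Type*} [AddCommGroup A] (g : ℤ)
    (φ : List (P × (S × Bool)) → A) (hrot : ∀ w, φ (w.rotate 1) = φ w) (hbar : ∀ w, φ (ebar (einv act) w) = - φ w) :
    ∀ (n : ℕ) (Fs : List (List (P × (S × Bool)))), Fs.length = n → St (einv act) g Fs →
      (∀ e ∈ Fs, CW act e ∧ e.map Prod.snd ∈ W) →
    ∃ (D : Type) (_ : Fintype D) (_ : DecidableEq D) (σ τ : Perm D)
      (lab : D → P × (S × Bool)) (fs : List (List D)), OK (einv act) σ τ lab fs ∧ gen σ (σ * τ) ≤ g ∧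
      (∀ l ∈ fs, l.map lab ∈ Fs) ∧
      (fs.map (fun l => φ (l.map lab))).sum = (Fs.map φ).sum ∧
      ∀ d, rdS σ (Prod.snd ∘ lab) (τ d) ≠ mir (rdS σ (Prod.snd ∘ lab) d) := by
  have hrotk : ∀ (k : ℕ) w, φ (w.rotate k) = φ w := by
    intro k
    induction k with
    | zero => simp
    | succ k ih => intro w; rw [← List.rotate_rotate, hrot, ih]
  intro n
  induction n using Nat.strong_induction_on with
  | _ n ih =>
    intro Fs hn hSt hFs
    obtain ⟨D, i1, i2, σ, τ, lab, fs, h1, h2, h3⟩ := hSt.exact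
    by_cases hred : ∀ d, rdS σ (Prod.snd ∘ lab) (τ d) ≠ mir (rdS σ (Prod.snd ∘ lab) d)
    · refine ⟨D, i1, i2, σ, τ, lab, fs, h1, h3, ?_, ?_, hred⟩
      · intro l hl
        rw [← h2]
        exact List.mem_map_of_mem hl
      · rw [← h2, map_map]; rfl
    · push Not at hred
      obtain ⟨d, hd⟩ := hred
      have hcw : ∀ l ∈ fs, CW act (l.map lab) ∧ l.map (Prod.snd ∘ lab) ∈ W := by
        intro l hl
        have := hFs (l.map lab) (by rw [← h2]; exact List.mem_map_of_mem hl)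
        rwa [map_map] at this
      have hpos : ∀ d, (lab (σ d)).1 = act (lab d).1 (lab d).2 := by
        intro d
        obtain ⟨l, hl, hd⟩ := mem_flatten.1 (h1.all d)
        exact h1.pos_next hl (hcw l hl).1 hd
      obtain ⟨l1, hl1, hd1⟩ := mem_flatten.1 (h1.all d)
      obtain ⟨l2, hl2, hd2⟩ := mem_flatten.1 (h1.all (τ d))
      obtain ⟨m1, p1, -⟩ := h1.rdS_spec hW (pl := Prod.snd) hl1 (hcw l1 hl1).2 hd1
      obtain ⟨m2, p2, -⟩ := h1.rdS_spec hW (pl := Prod.snd) hl2 (hcw l2 hl2).2 hd2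
      have hlen : l1.length = l2.length := by rw [← p1, ← p2, hd, prd_mir hW m1]
      have hne : l1 ≠ l2 := by
        rintro rfl
        obtain ⟨k, hk⟩ := h1.sc_of_mem hl1 hd1 hd2
        rw [← hk, rdS_pow] at hd
        exact mir_ne_shf hW m1 k hd.symm
      have hm : ∀ k : ℕ, lab ((σ ^ (k : ℤ)) (τ d)) = einv act (lab ((σ ^ (-(k : ℤ))) d)) := by
        intro k
        have hsnd : ∀ k : ℕ, (lab ((σ ^ (k : ℤ)) (τ d))).2 = linv (lab ((σ ^ (-(k : ℤ))) d)).2 := by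
          intro k
          have := congrFun hd k
          simpa [rdS, mir] using this
        induction k with
        | zero => simpa using h1.labt d
        | succ k ihk =>
          apply Prod.ext
          · have e1 : (σ ^ ((k + 1 : ℕ) : ℤ)) (τ d) = σ ((σ ^ (k : ℤ)) (τ d)) := by
              push_cast
              rw [add_comm, zpow_add, zpow_one, mul_apply]
            have e2 : (σ ^ (-(k : ℤ))) d = σ ((σ ^ (-((k + 1 : ℕ) : ℤ))) d) := by
              have : (-(k : ℤ)) = 1 + (-((k + 1 : ℕ) : ℤ)) := by push_cast; ring
              rw [this, zpow_add, zpow_one, mul_apply]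
            rw [e1, hpos, ihk, e2]
            simp only [einv]
            rw [ha.back, hpos]
          · exact hsnd (k + 1)
      obtain ⟨fs', hp, hst⟩ := h1.zip (einv_einv ha) h3 hl1 hl2 hne hd1 hd2 hlen hm
      have hlen' : fs.length = fs'.length + 2 := by simpa using hp.length_eq
      have hfl : fs.length = n := by rw [← hn, ← h2, length_map]
      have hφ : φ (l2.map lab) = - φ (l1.map lab) := by
        obtain ⟨j1, hj1⟩ := rot_pow (h1.cyc l1 hl1) (d := σ d) (h1.mem_apply hl1 hd1)
        obtain ⟨j2, hj2⟩ := rot_pow (h1.cyc l2 hl2) hd2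
        rw [← hrotk j1 (l1.map lab), ← hrotk j2 (l2.map lab), ← List.map_rotate, ← List.map_rotate, ← hj1, ← hj2, ← hbar,
          map_map, map_map, ebar_range, hlen]
        congr 1
        apply map_congr_left
        intro k hk
        have hkn := List.mem_range.1 hk
        simp only [Function.comp]
        rw [hm]
        congr 2
        have hper : (σ ^ (l2.length : ℤ)) d = d :=
          (pow_eq_self_iff (h1.cyc l1 hl1) ((List.nodup_flatten.1 h1.nd).1 l1 hl1) hd1 _).2 (by rw [hlen])
        have e : σ d = (σ ^ (1 : ℤ)) d := by simp
        rw [e, ← mul_apply, ← zpow_add]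
        have : ((l2.length - 1 - k : ℕ) : ℤ) + 1 = - (k : ℤ) + l2.length := by omega
        rw [this, zpow_add, mul_apply, hper]
      have hpm := hp.map (List.map lab)
      rw [h2] at hpm
      simp only [map_cons] at hpm
      obtain ⟨D', i1', i2', σ', τ', lab', fs'', q1, q2, q3, q4, q5⟩ := ih (n - 2) (by omega) (fs'.map (List.map lab))
        (by rw [length_map]; omega) hst (fun e he => hFs e (hpm.mem_iff.2 (by simp [he])))
      refine ⟨D', i1', i2', σ', τ', lab', fs'', q1, q2, fun l hl => hpm.mem_iff.2 (by simp [q3 l hl]), ?_, q5⟩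
      rw [q4, (hpm.map φ).sum_eq]
      simp [hφ]

end

theorem OK.mapLab {E : Type u} {E' : Type v} {inv : E → E} {inv' : E' → E'} {f : E → E'} (hf : ∀ e, f (inv e) = inv' (f e))
    {D : Type} {σ τ : Perm D} {lab : D → E} {fs : List (List D)} (h : OK inv σ τ lab fs) : OK inv' σ τ (f ∘ lab) fs where
  ne := h.ne
  cyc := h.cyc
  nd := h.nd
  all := h.all
  inv2 := h.inv2
  fpf := h.fpf
  labt := by intro d; simp only [Function.comp, h.labt, hf]

theorem St.map {E : Type u} {E' : Type v} {inv : E → E} {inv' : E' → E'} {f : E → E'} (hf : ∀ e, f (inv e) = inv' (f e)) {g : ℤ}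
    {Fs : List (List E)} (h : St inv g Fs) : St inv' g (Fs.map (List.map f)) := by
  obtain ⟨D, i1, i2, σ, τ, lab, fs, h1, h2, h3⟩ := h.exact
  have := St.mk (h1.mapLab hf) h3
  rw [← h2, map_map]
  convert this using 2
  funext l
  simp

section
variable {S : Type u} {W : Set Wd(S)} {D : Type} {σ τ : Perm D} {ℓ : D → S × Bool}

/-- start vertex of a dart -/
def vx (σ τ : Perm D) (d : D) : Quotient (sc (σ * τ)) := Quotient.mk _ d

theorem vx_eq {σ τ : Perm D} {x y : D} : vx σ τ x = vx σ τ y ↔ sc (σ * τ) x y := Quotient.eq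

theorem vx_nu {σ τ : Perm D} (x : D) : vx σ τ (σ (τ x)) = vx σ τ x := by
  rw [vx_eq]
  exact (sc (σ * τ)).symm (sc_apply (σ * τ) x)

/-- paths in the surface -/
def TP (σ τ : Perm D) : Quotient (sc (σ * τ)) → List D → Quotient (sc (σ * τ)) → Prop
  | x, [], y => x = y
  | x, d :: γ, y => vx σ τ d = x ∧ TP σ τ (vx σ τ (τ d)) γ y

theorem TP_append {x y : Quotient (sc (σ * τ))} {u v : List D} :
    TP σ τ x (u ++ v) y ↔ ∃ z, TP σ τ x u z ∧ TP σ τ z v y := by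
  induction u generalizing x with
  | nil => simp [TP]
  | cons d u ih =>
    simp only [List.cons_append, TP, ih]
    tauto

theorem TP_det {x y z : Quotient (sc (σ * τ))} {u : List D} (h : TP σ τ x u y) (h' : TP σ τ x u z) : y = z := by
  induction u generalizing x with
  | nil => exact h.symm.trans h'
  | cons d u ih => exact ih h.2 h'.2

namespace Hex

theorem nu_ne (hW : SC W) (h : Hex W σ τ ℓ) (y : D) : σ (τ y) ≠ y := FC6.nu_ne hW h.inv2 h.labt (h.mem (τ y))

theorem nu3 (hW : SC W) (h : Hex W σ τ ℓ) {x y : D} (hxy : vx σ τ x = vx σ τ y) : y = x ∨ y = σ (τ x) ∨ y = σ (τ (σ (τ x))) := by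
  rw [vx_eq] at hxy
  have key : ∀ x, σ (τ (σ (τ (σ (τ x))))) = x ∨ σ (τ (σ (τ x))) = x := by
    intro x
    by_cases hn : nc σ τ x
    · exact Or.inl (h.deg x hn)
    · right; simpa [nc] using hn
  obtain ⟨k, rfl⟩ := hxy
  have hpos : ∀ k : ℕ, ((σ * τ) ^ k) x = x ∨ ((σ * τ) ^ k) x = σ (τ x) ∨ ((σ * τ) ^ k) x = σ (τ (σ (τ x))) := by
    intro k
    induction k with
    | zero => simp
    | succ k ih =>
      rw [pow_succ', mul_apply]
      rcases ih with e | e | e <;> rw [e]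
      · simp
      · simp
      · rcases key x with e' | e'
        · left; exact e'
        · right; left
          rw [e']; rfl
  have h6 : ((σ * τ) ^ (6 : ℕ)) x = x := by
    simp only [pow_succ, pow_zero, one_mul, mul_apply]
    rcases key x with e | e
    · rw [e, e]
    · rw [e, e, e]
  have : ((σ * τ) ^ k) x = ((σ * τ) ^ (k % 6).toNat) x := by
    have h6z : ((σ * τ) ^ (6 : ℤ)) x = x := by exact_mod_cast h6
    conv_lhs => rw [← Int.emod_add_mul_ediv k 6, zpow_add, zpow_mul, mul_apply]
    have h7 : (((σ * τ) ^ (6 : ℤ)) ^ (k / 6)) x = x := by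
      have := Equiv.Perm.zpow_apply_eq_self_of_apply_eq_self h6z (k / 6)
      exact this
    rw [h7, ← zpow_natCast, Int.toNat_of_nonneg (by omega)]
  rw [this]
  exact hpos _

theorem lab_ne (hW : SC W) (h : Hex W σ τ ℓ) (y : D) : ℓ (σ (τ y)) ≠ ℓ y := by
  have := rdg_red hW (h.mem (τ y)) 0
  simp only [rdS, zero_add, zpow_one, zpow_zero, Perm.one_apply, h.labt] at this
  rwa [linv_linv] at this

/-- local injectivity -/
theorem loc_inj (hW : SC W) (h : Hex W σ τ ℓ) {x y : D} (hxy : vx σ τ x = vx σ τ y) (hl : ℓ x = ℓ y) : x = y := by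
  rcases h.nu3 hW hxy with e | e | e
  · exact e.symm
  · rw [e] at hl
    exact absurd hl.symm (h.lab_ne hW x)
  · by_cases hn : nc σ τ x
    · have h3 := h.deg x hn
      rw [← e] at h3
      have := h.lab_ne hW y
      rw [h3] at this
      exact absurd hl this
    · rw [e]; simpa [nc, eq_comm] using hn

end Hex

/-- nonclosed path with trivial word -/
def Bad (W : Set Wd(S)) (σ τ : Perm D) (ℓ : D → S × Bool) (m : ℕ) : Prop :=
  ∃ x y γ Rs, TP σ τ x γ y ∧ x ≠ y ∧ (∀ r ∈ Rs, r ∈ W) ∧ St linv 0 (γ.map ℓ :: Rs) ∧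
    ((γ.map ℓ :: Rs).map (fun l => 2 * l.length - 1)).sum = m

end

section
variable {S : Type u} {W : Set Wd(S)} {D : Type} {σ τ : Perm D} {ℓ : D → S × Bool}

def mu {E : Type*} (Fs : List (List E)) : ℕ := (Fs.map (fun l => 2 * l.length - 1)).sum

theorem mu_perm {E : Type*} {Fs Fs' : List (List E)} (h : Fs.Perm Fs') : mu Fs = mu Fs' := (h.map _).sum_eq

theorem mu_cons {E : Type*} (l : List E) (Fs : List (List E)) : mu (l :: Fs) = (2 * l.length - 1) + mu Fs := by simp [mu]

theorem mu_append {E : Type*} (Fs Fs' : List (List E)) : mu (Fs ++ Fs') = mu Fs + mu Fs' := by simp [mu]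

theorem mu_map {E E' : Type*} (f : E → E') (Fs : List (List E)) : mu (Fs.map (List.map f)) = mu Fs := by
  simp [mu, map_map, Function.comp_def]

theorem TP_ne {x y : Quotient (sc (σ * τ))} {γ : List D} (h : TP σ τ x γ y) (hne : x ≠ y) : γ ≠ [] := by
  rintro rfl; exact hne h

theorem op_push {x y : Quotient (sc (σ * τ))} {g1 g2 : List D} {d : D} (hT : TP σ τ x (g1 ++ d :: g2) y) (hxy : x ≠ y)
    {D' : Type} [Fintype D'] [DecidableEq D'] {σ' τ' : Perm D'} {lab : D' → S × Bool} {b1 b2 : List D'} {d' : D'}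
    {Rfs : List (List D')} (h : OK linv σ' τ' lab ((b1 ++ d' :: b2) :: Rfs)) (hg : gen σ' (σ' * τ') ≤ 0)
    (h1 : b1.map lab = g1.map ℓ) (h2 : b2.map lab = g2.map ℓ) (hR : ∀ r ∈ Rfs, r.map lab ∈ W) {r r' : List D'} {j : ℕ} (hr : r ∈ Rfs)
    (hj : r.rotate j = τ' d' :: r') {v : List D} (hv : TP σ τ (vx σ τ d) v (vx σ τ (τ d))) (hl : r'.map lab = v.map ℓ)
    (hmin : ∀ m, m < mu ((b1 ++ d' :: b2) :: Rfs) → ¬ Bad W σ τ ℓ m) : False := by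
  classical
  obtain ⟨z1, hT1, hT2, hT3⟩ := TP_append.1 hT
  have hp : Rfs.Perm (r :: Rfs.erase r) := List.perm_cons_erase hr
  have k1 := (h.perm (hp.cons _)).rot (b1 ++ [d']).length
  rw [show b1 ++ d' :: b2 = (b1 ++ [d']) ++ b2 by simp, List.rotate_append_length_eq] at k1
  have k2 := ((k1.perm (List.Perm.swap _ _ _)).rot j).perm (List.Perm.swap _ _ _)
  rw [hj, ← List.append_assoc] at k2
  have k3 := OK.joinAdj k2 hg
  have hlen : r.length = r'.length + 1 := by rw [← List.length_rotate (n := j), hj]; rfl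
  have hTn : TP σ τ x (g1 ++ (v ++ g2)) y := TP_append.2 ⟨z1, hT1, TP_append.2 ⟨_, by rw [← hT2]; exact hv, hT3⟩⟩
  have hne := TP_ne hTn hxy
  have l1 := congrArg List.length h1
  have l2 := congrArg List.length h2
  have l3 := congrArg List.length hl
  simp only [length_map] at l1 l2 l3
  have k4 := k3.fold_mid linv_linv (by
    intro hh
    apply hne
    have := congrArg List.length hh
    simp only [List.length_append, length_map, List.length_nil] at this
    apply List.eq_nil_of_length_eq_zero
    simp only [List.length_append]; omega)
  rw [map_append, h1, h2, hl, List.append_assoc] at k4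
  have k5 := k4.rot'
  rw [List.append_assoc, ← map_append, ← map_append] at k5
  refine hmin (mu ((g1 ++ (v ++ g2)).map ℓ :: (Rfs.erase r).map (List.map lab))) ?_ ⟨x, y, _, _, hTn, hxy, ?_, k5, rfl⟩
  · rw [mu_cons, mu_cons, mu_map, mu_perm hp, mu_cons]
    have := List.length_pos_of_ne_nil hne
    simp only [List.length_append, length_map, List.length_cons] at this ⊢
    omega
  · intro e he
    obtain ⟨l, hl', rfl⟩ := mem_map.1 he
    exact hR l (List.mem_of_mem_erase hl')

theorem op_back {x y : Quotient (sc (σ * τ))} {g1 g2 : List D} {d : D} (hW : SC W) (hX : Hex W σ τ ℓ)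
    (hT : TP σ τ x (g1 ++ d :: τ d :: g2) y) (hxy : x ≠ y)
    {Rs : List Wd(S)} (hS : St linv 0 ((g1 ++ d :: τ d :: g2).map ℓ :: Rs)) (hR : ∀ r ∈ Rs, r ∈ W)
    (hmin : ∀ m, m < mu ((g1 ++ d :: τ d :: g2).map ℓ :: Rs) → ¬ Bad W σ τ ℓ m) : False := by
  obtain ⟨z1, hT1, hT2, hT3, hT4⟩ := TP_append.1 hT
  rw [hX.inv2, hT2] at hT4
  have hTn : TP σ τ x (g1 ++ g2) y := TP_append.2 ⟨z1, hT1, hT4⟩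
  have hne := TP_ne hTn hxy
  have k : St linv 0 ((g1.map ℓ ++ [ℓ d, linv (ℓ d)] ++ g2.map ℓ) :: Rs) := by
    convert hS using 2
    simp [hX.labt]
  have k2 := k.fold_mid linv_linv (by
    intro hh; apply hne
    rw [← map_append] at hh
    exact List.map_eq_nil_iff.1 hh)
  rw [← map_append] at k2
  refine hmin (mu ((g1 ++ g2).map ℓ :: Rs)) ?_ ⟨x, y, _, _, hTn, hxy, hR, k2, rfl⟩
  rw [mu_cons, mu_cons]
  have := List.length_pos_of_ne_nil hne
  simp only [List.length_append, length_map, List.length_cons] at this ⊢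
  omega

theorem op_turn {x y z : Quotient (sc (σ * τ))} {g1 c g2 : List D} (hW : SC W)
    (hT1 : TP σ τ x g1 z) (hT3 : TP σ τ z g2 y) (hxy : x ≠ y) (hc : c.map ℓ ∈ W)
    {Rs : List Wd(S)} (hS : St linv 0 ((g1 ++ c ++ g2).map ℓ :: Rs)) (hR : ∀ r ∈ Rs, r ∈ W)
    (hmin : ∀ m, m < mu ((g1 ++ c ++ g2).map ℓ :: Rs) → ¬ Bad W σ τ ℓ m) : False := by
  have hTn : TP σ τ x (g1 ++ g2) y := TP_append.2 ⟨z, hT1, hT3⟩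
  have hne := TP_ne hTn hxy
  have hcn := hW.ne _ hc
  rw [map_append] at hS
  have k1 := hS.rot'
  rw [map_append, ← List.append_assoc] at k1
  have k2 := k1.split (by
    intro hh; apply hne
    have := congrArg List.length hh
    apply List.eq_nil_of_length_eq_zero
    simp at this ⊢; exact ⟨this.2, this.1⟩) hcn
  have k3 := k2.rot'
  rw [← map_append] at k3
  refine hmin (mu ((g1 ++ g2).map ℓ :: c.map ℓ :: Rs)) ?_ ⟨x, y, _, _, hTn, hxy, ?_, k3, rfl⟩
  · rw [mu_cons, mu_cons, mu_cons]
    have := List.length_pos_of_ne_nil hne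
    have := List.length_pos_of_ne_nil hcn
    simp only [List.length_append, length_map, List.length_cons] at *
    omega
  · intro r hr
    rcases List.mem_cons.1 hr with rfl | hr
    · exact hc
    · exact hR r hr

theorem op_thin {x y : Quotient (sc (σ * τ))} {g1 u g2 : List D} {d1 d2 : D} (hW : SC W) (hX : Hex W σ τ ℓ)
    (hT : TP σ τ x (g1 ++ d1 :: (u ++ d2 :: g2)) y) (hxy : x ≠ y)
    {D' : Type} [Fintype D'] [DecidableEq D'] {σ' τ' : Perm D'} {lab : D' → S × Bool} {b1 c b2 : List D'} {e : D'}
    {Rfs : List (List D')} (h : OK linv σ' τ' lab ((b1 ++ e :: (c ++ τ' e :: b2)) :: Rfs)) (hg : gen σ' (σ' * τ') ≤ 0)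
    (h1 : b1.map lab = g1.map ℓ) (h2 : b2.map lab = g2.map ℓ) (h3 : c.map lab = u.map ℓ) (h4 : lab e = ℓ d1)
    (h5 : lab (τ' e) = ℓ d2) (hR : ∀ r ∈ Rfs, r.map lab ∈ W)
    (hmin : ∀ m, m < mu ((b1 ++ e :: (c ++ τ' e :: b2)) :: Rfs) → ¬ Bad W σ τ ℓ m) : False := by
  obtain ⟨z1, hT1, hT2, hT3⟩ := TP_append.1 hT
  obtain ⟨z2, hT4, hT5, hT6⟩ := TP_append.1 hT3
  have l1 := congrArg List.length h1
  have l2 := congrArg List.length h2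
  have l3 := congrArg List.length h3
  simp only [length_map] at l1 l2 l3
  have hd2 : vx σ τ (τ d1) = z2 → d2 = τ d1 := by
    intro hz
    apply hX.loc_inj hW (hT5.trans hz.symm)
    rw [← h5, h.labt, h4, hX.labt]
  have hz12 : vx σ τ (τ d1) = z2 → TP σ τ x (g1 ++ g2) y := by
    intro hz
    refine TP_append.2 ⟨z1, hT1, ?_⟩
    rw [hd2 hz, hX.inv2, hT2] at hT6
    exact hT6
  have k1 := h.rot b1.length
  rw [List.rotate_append_length_eq] at k1
  have hb21 : b2 ++ b1 ≠ [] ∨ vx σ τ (τ d1) ≠ z2 := by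
    by_contra hh
    push Not at hh
    have := TP_ne (hz12 hh.2) hxy
    apply this
    have := congrArg List.length hh.1
    apply List.eq_nil_of_length_eq_zero
    simp only [List.length_append, List.length_nil] at this ⊢
    omega
  by_cases hbn : b2 ++ b1 = []
  · -- inner word, directly
    have hz := hb21.resolve_left (not_not.2 hbn)
    simp at hbn
    obtain ⟨rfl, rfl⟩ := hbn
    have hun : u ≠ [] := TP_ne hT4 hz
    have k2 := St.mk h hg
    simp only [List.nil_append, map_cons, map_append, List.map_nil] at k2
    have k3 : St linv 0 ((c.map lab ++ [linv (lab e), linv (linv (lab e))] ++ []) :: Rfs.map (List.map lab)) := by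
      have := k2.rot 1
      simpa [linv_linv, h.labt] using this
    have k4 := k3.fold_mid linv_linv (by rw [h3]; simpa using hun)
    rw [List.append_nil, h3] at k4
    refine hmin (mu (u.map ℓ :: Rfs.map (List.map lab))) ?_ ⟨_, _, _, _, hT4, hz, ?_, k4, rfl⟩
    · rw [mu_cons, mu_cons, mu_map]
      have := List.length_pos_of_ne_nil hun
      simp only [List.length_append, length_map, List.length_cons] at this ⊢
      omega
    · intro e he
      obtain ⟨l, hl', rfl⟩ := mem_map.1 he
      exact hR l hl'
  · have k2 : OK linv σ' τ' lab ((e :: c ++ [τ' e] ++ (b2 ++ b1)) :: Rfs) := by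
      convert k1 using 2
      simp
    obtain ⟨Rs1, Rs2, p, s1, s2⟩ := k2.thin hg hbn
    have hRW : ∀ r ∈ Rs1 ++ Rs2, r ∈ W := by
      intro r hr
      obtain ⟨l, hl', rfl⟩ := mem_map.1 (p.mem_iff.1 hr)
      exact hR l hl'
    have hmu : mu Rs1 + mu Rs2 = mu Rfs := by
      rw [← mu_append, mu_perm p, mu_map]
    by_cases hz : vx σ τ (τ d1) = z2
    · have hTn := hz12 hz
      rw [map_append, h1, h2] at s2
      have s3 := s2.rot'
      rw [← map_append] at s3
      refine hmin (mu ((g1 ++ g2).map ℓ :: Rs2)) ?_ ⟨_, _, _, _, hTn, hxy, fun r hr => hRW r (by simp [hr]), s3, rfl⟩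
      rw [mu_cons, mu_cons]
      have := List.length_pos_of_ne_nil (TP_ne hTn hxy)
      simp only [List.length_append, length_map, List.length_cons] at this ⊢
      omega
    · have hun : u ≠ [] := TP_ne hT4 hz
      have k3 : St linv 0 ((c.map lab ++ [linv (lab e), linv (linv (lab e))] ++ []) :: Rs1) := by
        have := s1.rot 1
        simpa [linv_linv, h.labt] using this
      have k4 := k3.fold_mid linv_linv (by rw [h3]; simpa using hun)
      rw [List.append_nil, h3] at k4
      refine hmin (mu (u.map ℓ :: Rs1)) ?_ ⟨_, _, _, _, hT4, hz, fun r hr => hRW r (by simp [hr]), k4, rfl⟩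
      rw [mu_cons, mu_cons]
      have := List.length_pos_of_ne_nil hun
      simp only [List.length_append, length_map, List.length_cons] at this ⊢
      omega

theorem op_zip {x y : Quotient (sc (σ * τ))} {γ : List D} (hW : SC W)
    (hT : TP σ τ x γ y) (hxy : x ≠ y)
    {D' : Type} [Fintype D'] [DecidableEq D'] {σ' τ' : Perm D'} {lab : D' → S × Bool} {b : List D'}
    {Rfs : List (List D')} (h : OK linv σ' τ' lab (b :: Rfs)) (hg : gen σ' (σ' * τ') ≤ 0)
    (h1 : b.map lab = γ.map ℓ) (hR : ∀ r ∈ Rfs, r.map lab ∈ W) {r1 r2 : List D'} {d : D'} (hr1 : r1 ∈ Rfs) (hr2 : r2 ∈ Rfs)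
    (hd1 : d ∈ r1) (hd2 : τ' d ∈ r2) (hm : rdS σ' lab (τ' d) = mir (rdS σ' lab d))
    (hmin : ∀ m, m < mu (b :: Rfs) → ¬ Bad W σ τ ℓ m) : False := by
  have hr1' : r1 ∈ b :: Rfs := by simp [hr1]
  have hr2' : r2 ∈ b :: Rfs := by simp [hr2]
  obtain ⟨m1, p1, -⟩ := h.rdS_spec hW (pl := id) hr1' (by simpa using hR r1 hr1) hd1
  obtain ⟨m2, p2, -⟩ := h.rdS_spec hW (pl := id) hr2' (by simpa using hR r2 hr2) hd2
  simp only [Function.id_comp] at m1 p1 m2 p2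
  have hlen : r1.length = r2.length := by rw [← p1, ← p2, hm, prd_mir hW m1]
  have hne : r1 ≠ r2 := by
    rintro rfl
    obtain ⟨k, hk⟩ := h.sc_of_mem hr1' hd1 hd2
    rw [← hk, rdS_pow] at hm
    exact mir_ne_shf hW m1 k hm.symm
  obtain ⟨fs', hp, hst⟩ := h.zip linv_linv hg hr1' hr2' hne hd1 hd2 hlen (by
    intro k
    have := congrFun hm k
    simpa [rdS, mir] using this)
  have hnd := h.nd
  rw [List.flatten_cons, List.nodup_append] at hnd
  have hbne := h.ne b (by simp)
  obtain ⟨x0, hx0⟩ := List.exists_mem_of_ne_nil _ hbne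
  have hbR : b ∉ Rfs := fun hb => hnd.2.2 x0 hx0 x0 (mem_flatten.2 ⟨b, hb, hx0⟩) rfl
  have hb : b ∈ fs' := by
    have := hp.mem_iff.1 (List.mem_cons_self (a := b) (l := Rfs))
    simp only [List.mem_cons] at this
    rcases this with rfl | rfl | hh
    · exact absurd hr1 hbR
    · exact absurd hr2 hbR
    · exact hh
  have hp' : fs'.Perm (b :: fs'.erase b) := List.perm_cons_erase hb
  have hp2 : Rfs.Perm (r1 :: r2 :: fs'.erase b) := by
    have h1 : (b :: Rfs).Perm (b :: r1 :: r2 :: fs'.erase b) := by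
      refine hp.trans (((hp'.cons r2).cons r1).trans ?_)
      exact ((List.Perm.swap b r2 _).cons r1).trans (List.Perm.swap b r1 _)
    exact h1.cons_inv
  have hst' := hst.perm (hp'.map (List.map lab))
  rw [map_cons, h1] at hst'
  refine hmin (mu (γ.map ℓ :: (fs'.erase b).map (List.map lab))) ?_ ⟨_, _, _, _, hT, hxy, ?_, hst', rfl⟩
  · have hb2 : b.length = γ.length := by simpa using congrArg List.length h1
    rw [mu_cons, mu_cons, mu_perm hp2, mu_cons, mu_cons, mu_map, length_map, hb2]
    have := List.length_pos_of_mem hd1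
    omega
  · intro e he
    obtain ⟨l, hl', rfl⟩ := mem_map.1 he
    exact hR l (hp2.mem_iff.2 (by simp [hl']))

end

section
variable {S : Type u} {W : Set Wd(S)} {D : Type} {σ τ : Perm D} {ℓ : D → S × Bool}
  {D' : Type} {σ' τ' : Perm D'} {lab : D' → S × Bool}

theorem nc_nu {σ τ : Perm D} {y : D} : nc σ τ (σ (τ y)) ↔ nc σ τ y := by
  unfold nc
  rw [not_iff_not]
  constructor
  · intro h
    exact τ.injective (σ.injective h)
  · intro h
    rw [h]

theorem nc_vx {σ τ : Perm D} {x y : D} (h : vx σ τ x = vx σ τ y) : nc σ τ x ↔ nc σ τ y := by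
  rw [vx_eq] at h
  have hle : sc (σ * τ) ≤ (Setoid.ker (nc σ τ)) := by
    apply sc_le_of
    intro x
    show nc σ τ x = nc σ τ (σ (τ x))
    exact propext nc_nu.symm
  exact iff_of_eq (hle h)

/-- data of a fully reduced nonclosed path diagram -/
structure Rn (W : Set Wd(S)) (σ τ : Perm D) (ℓ : D → S × Bool) (σ' τ' : Perm D') (lab : D' → S × Bool)
    (L : ℕ) (γ : ℕ → D) (b : ℕ → D') : Prop where
  Lpos : 0 < L
  inv2 : ∀ d, τ' (τ' d) = d
  labt : ∀ d, lab (τ' d) = linv (lab d)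
  next : ∀ i, i + 1 < L → σ' (b i) = b (i + 1)
  wrap : σ' (b (L - 1)) = b 0
  inj : ∀ i j, i < L → j < L → b i = b j → i = j
  lb : ∀ i, i < L → lab (b i) = ℓ (γ i)
  path : ∀ i, i + 1 < L → vx σ τ (τ (γ i)) = vx σ τ (γ (i + 1))
  noback : ∀ i, i + 1 < L → γ (i + 1) ≠ τ (γ i)
  nothin : ∀ i j, i < L → j < L → τ' (b i) ≠ b j
  mem : ∀ d, (∀ i, i < L → d ≠ b i) → rdS σ' lab d ∈ Rdg W
  push1 : ∀ i, i < L → rdS σ' lab (τ' (b i)) ≠ rdS σ ℓ (τ (γ i))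
  push2 : ∀ i, i < L → rdS σ' lab (τ' (b i)) ≠ mir (rdS σ ℓ (γ i))
  noturn : ∀ j m : ℕ, j ≤ L → m ≤ j → 0 < m → (∀ k : ℕ, k < m → (σ ^ k) (τ (γ (j - 1))) = τ (γ (j - 1 - k))) →
    m < prd W (rdS σ ℓ (τ (γ (j - 1))))
  nozip : ∀ d, (∀ i, i < L → d ≠ b i) → (∀ i, i < L → τ' d ≠ b i) → rdS σ' lab d ≠ mir (rdS σ' lab (τ' d))

def Lt (σ : Perm D) (γ : ℕ → D) (i : ℕ) : Prop := γ i ≠ σ (γ (i - 1))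
def Rt (σ τ : Perm D) (γ : ℕ → D) (i : ℕ) : Prop := σ (τ (γ i)) ≠ τ (γ (i - 1))

/-- cuts on the boundary of a relator face -/
def Cut (σ : Perm D) (σ' τ' : Perm D') (L : ℕ) (γ : ℕ → D) (b : ℕ → D') (x : D') : Prop :=
  nc σ' τ' x ∨ (∃ i, 1 ≤ i ∧ i < L ∧ Lt σ γ i ∧ x = τ' (b (i - 1))) ∨ x = τ' (b (L - 1))

namespace Rn
variable {L : ℕ} {γ : ℕ → D} {b : ℕ → D'}

theorem step (h : Rn W σ τ ℓ σ' τ' lab L γ b) {t : ℕ} (h1 : 1 ≤ t) (h2 : t < L) (hn : ¬ nc σ' τ' (b t)) :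
    σ' (τ' (b t)) = τ' (b (t - 1)) := by
  have h3 := h.next (t - 1) (by omega)
  rw [show t - 1 + 1 = t by omega] at h3
  have h4 : σ' (τ' (σ' (τ' (b t)))) = b t := by simpa [nc] using hn
  rw [← h3] at h4
  have h5 := σ'.injective h4
  rw [h3] at h5
  rw [← h5, h.inv2]

theorem step0 (h : Rn W σ τ ℓ σ' τ' lab L γ b) (hn : ¬ nc σ' τ' (b 0)) :
    σ' (τ' (b 0)) = τ' (b (L - 1)) := by
  have h3 := h.wrap
  have h4 : σ' (τ' (σ' (τ' (b 0)))) = b 0 := by simpa [nc] using hn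
  rw [← h3] at h4
  have h5 := σ'.injective h4
  rw [h3] at h5
  rw [← h5, h.inv2]

theorem ncb (h : Rn W σ τ ℓ σ' τ' lab L γ b) {t : ℕ} (h1 : 1 ≤ t) (h2 : t < L) :
    nc σ' τ' (τ' (b (t - 1))) ↔ nc σ' τ' (b t) := by
  have h3 := h.next (t - 1) (by omega)
  rw [show t - 1 + 1 = t by omega] at h3
  rw [← nc_nu, h.inv2, h3]

theorem outb (h : Rn W σ τ ℓ σ' τ' lab L γ b) {t : ℕ} (h2 : t < L) : ∀ i, i < L → τ' (b t) ≠ b i := fun i hi => h.nothin t i h2 hi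

theorem nu_ne (hW : SC W) (h : Rn W σ τ ℓ σ' τ' lab L γ b) (y : D') : σ' (τ' y) ≠ y := by
  by_cases hy : ∀ i, i < L → τ' y ≠ b i
  · exact FC6.nu_ne hW h.inv2 h.labt (h.mem _ hy)
  · push Not at hy
    obtain ⟨i, hi, he⟩ := hy
    intro hh
    rw [he] at hh
    have hy2 : y = τ' (b i) := by rw [← he, h.inv2]
    rw [hy2] at hh
    by_cases hi2 : i + 1 < L
    · rw [h.next i hi2] at hh
      exact h.nothin i (i + 1) hi hi2 hh.symm
    · have : i = L - 1 := by omega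
      rw [this, h.wrap] at hh
      exact h.nothin (L - 1) 0 (by omega) h.Lpos hh.symm

theorem types (hW : SC W) (hX : Hex W σ τ ℓ) (h : Rn W σ τ ℓ σ' τ' lab L γ b) {t : ℕ} (h1 : 1 ≤ t) (h2 : t < L) :
    (Rt σ τ γ t → nc σ τ (γ t)) ∧ (Rt σ τ γ t → ¬ Lt σ γ t) ∧ (¬ Rt σ τ γ t → (nc σ τ (γ t) ↔ Lt σ γ t)) := by
  have hp := h.path (t - 1) (by omega)
  have hb := h.noback (t - 1) (by omega)
  rw [show t - 1 + 1 = t by omega] at hp hb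
  have h3 := hX.nu3 hW hp
  have h4 := hX.nu3 hW hp.symm
  have hinv := hX.inv2 (γ (t - 1))
  have hinv2 := hX.inv2 (γ t)
  have hd := hX.deg (γ t)
  unfold Rt Lt
  rw [hinv] at h3
  unfold nc at *
  refine ⟨?_, ?_, ?_⟩
  · intro hr hn
    rcases h4 with e | e | e
    · exact hb e.symm
    · exact hr e.symm
    · rw [hn] at e; exact hb e.symm
  · intro hr hl
    rcases h3 with e | e | e
    · exact hb e
    · exact hl e
    · by_cases hn : nc σ τ (τ (γ (t - 1)))
      · have := hX.deg _ hn
        rw [hinv, ← e] at this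
        exact hr this
      · unfold nc at hn
        rw [hinv, not_not] at hn
        exact hb (e.trans hn)
  · intro hr
    rw [not_not] at hr
    rw [hr, hinv]
    exact ⟨fun a => a.symm, fun a => a.symm⟩

open Classical in
theorem face (hW : SC W) (hX : Hex W σ τ ℓ) (h : Rn W σ τ ℓ σ' τ' lab L γ b) {l : List D'} (hc : l.map σ' = l.rotate 1)
    (hlW : l.map lab ∈ W) (hl0 : ∀ z ∈ l, ∀ i, i < L → z ≠ b i) (hcl : ∀ y ∈ l, ∀ z, sc σ' y z → z ∈ l) (hne : l ≠ []) :
    6 ≤ l.countP (fun x => decide (Cut σ σ' τ' L γ b x)) := by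
  obtain ⟨y, hy⟩ := List.exists_mem_of_ne_nil _ hne
  refine face_six hW h.inv2 h.labt hc hlW hy _ ?_
  intro z hz m hm hml hno
  have hzl := hcl y hy z hz
  have hz0 := hl0 z hzl
  by_cases hcase : ∀ i, i < L → τ' z ≠ b i
  · refine run_PC hW h.inv2 h.labt (k := 0) (by simpa using h.mem _ hcase) (by simpa using h.nozip z hz0 hcase) ?_
    intro j h1 h2
    have := hno j.toNat (by omega) (by omega)
    rw [← zpow_natCast, Int.toNat_of_nonneg (by omega)] at this
    by_contra hh
    exact this (Or.inl hh)
  · push Not at hcase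
    obtain ⟨i, hi, he⟩ := hcase
    have hz2 : z = τ' (b i) := by rw [← he, h.inv2]
    have key : ∀ j : ℕ, j < m → j ≤ i ∧ (σ' ^ j) z = τ' (b (i - j)) ∧ (σ ^ (-(j : ℤ))) (γ i) = γ (i - j) := by
      intro j
      induction j with
      | zero => intro _; simpa using hz2
      | succ j ih =>
        intro hj
        obtain ⟨a1, a2, a3⟩ := ih (by omega)
        have hn := hno (j + 1) (by omega) hj
        rw [Cut, not_or, not_or] at hn
        obtain ⟨n1, n2, n3⟩ := hn
        have hs : (σ' ^ (j + 1)) z = σ' (τ' (b (i - j))) := by rw [pow_succ', mul_apply, a2]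
        rw [hs] at n1 n2 n3
        rw [nc_nu] at n1
        have hij : i - j ≠ 0 := by
          intro h0
          rw [h0] at n1 n3
          exact n3 (h.step0 n1)
        have hst := h.step (t := i - j) (by omega) (by omega) n1
        have e1 : i - j - 1 = i - (j + 1) := by omega
        rw [hst] at n2
        have hlt : ¬ Lt σ γ (i - j) := fun hh => n2 ⟨i - j, by omega, by omega, hh, rfl⟩
        unfold Lt at hlt
        rw [not_not] at hlt
        refine ⟨by omega, by rw [hs, hst, e1], ?_⟩
        have e2 : (-((j + 1 : ℕ) : ℤ)) = -1 + -(j : ℤ) := by push_cast; ring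
        rw [e2, zpow_add, mul_apply, a3, hlt, e1, zpow_neg_one, Perm.inv_def, Equiv.symm_apply_apply]
    refine ⟨mir (rdS σ ℓ (γ i)), mir_mem hW (hX.mem _), ?_, ?_⟩
    · rw [shf_zero, hz2]
      exact (h.push2 i hi).symm
    · intro j hj
      obtain ⟨a1, a2, a3⟩ := key j hj
      simp only [mir, rdS, zero_add, zpow_natCast]
      rw [a2, a3, h.labt, h.lb _ (by omega)]

open Classical in
/-- the relator side estimate -/
theorem left_count (hW : SC W) (hX : Hex W σ τ ℓ) [Fintype D'] [DecidableEq D'] (h : Rn W σ τ ℓ σ' τ' lab L γ b) {Rfs : List (List D')}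
    (hO : OK linv σ' τ' lab ((List.range L).map b :: Rfs)) (hg : gen σ' (σ' * τ') ≤ 0) (hR : ∀ l ∈ Rfs, l.map lab ∈ W) :
    ((Ico 1 L).filter (fun i => nc σ' τ' (b i))).card + 5 ≤
      ((Ico 1 L).filter (fun i => Lt σ γ i ∧ ¬ nc σ' τ' (b i))).card := by
  haveI : Nonempty D' := ⟨b 0⟩
  have hdis : ∀ l ∈ Rfs, ∀ z ∈ l, ∀ i, i < L → z ≠ b i := by
    intro l hl z hz i hi he
    have hnd := hO.nd
    rw [List.flatten_cons, List.nodup_append] at hnd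
    exact hnd.2.2 (b i) (mem_map.2 ⟨i, List.mem_range.2 hi, rfl⟩) z (mem_flatten.2 ⟨l, hl, hz⟩) he.symm
  have hin : ∀ x, x ∈ (List.range L).map b ↔ ∃ i, i < L ∧ x = b i := by
    intro x; simp [eq_comm]
  have hsix : ∀ l ∈ Rfs, 6 ≤ l.countP (fun x => decide (Cut σ σ' τ' L γ b x)) := by
    intro l hl
    have hl' : l ∈ (List.range L).map b :: Rfs := by simp [hl]
    exact h.face hW hX (hO.cyc l hl') (hR l hl) (hdis l hl) (fun y hy z hz => (hO.mem_iff_of_sc hl' hz).1 hy) (hO.ne l hl')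
  have hsum := sum_ge_six Rfs _ hsix
  have hcard : ∀ P : D' → Prop, (Rfs.map (fun l => l.countP (fun x => decide (P x)))).sum =
      (univ.filter (fun x => P x ∧ ∀ i, i < L → x ≠ b i)).card := by
    intro P
    have hcf := hO.card_filter (fun x => P x ∧ ∀ i, i < L → x ≠ b i)
    refine Eq.trans ?_ (Eq.trans hcf.symm (by congr))
    rw [map_cons, List.sum_cons]
    have h0 : ((List.range L).map b).countP (fun x => @decide (P x ∧ ∀ i, i < L → x ≠ b i) (propDecidable _)) = 0 := by
      rw [List.countP_eq_zero]
      intro x hx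
      obtain ⟨i, hi, rfl⟩ := (hin x).1 hx
      simp
      intro _
      exact ⟨i, hi, rfl⟩
    rw [h0, zero_add]
    congr 1
    apply map_congr_left
    intro l hl
    apply List.countP_congr
    intro x hx
    have := hdis l hl x hx
    simp
    intro _ i hi
    exact this i hi
  rw [hcard] at hsum
  obtain ⟨c1, -⟩ := count_aux h.inv2 hO.fpf (h.nu_ne hW)
  have hk := kap_pos σ' (σ' * τ')
  rw [hO.cyc_eq] at c1
  simp only [List.length_cons] at c1
  -- splitting of the noncontiguous darts
  have hs1 : (univ.filter (fun x => nc σ' τ' x ∧ ∀ i, i < L → x ≠ b i)).card +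
      ((Ico 1 L).filter (fun i => nc σ' τ' (b i))).card ≤ (univ.filter (fun y => σ' (τ' (σ' (τ' y))) ≠ y)).card := by
    rw [← Finset.card_image_of_injOn (s := (Ico 1 L).filter (fun i => nc σ' τ' (b i))) (f := b), ← card_union_of_disjoint]
    · apply card_le_card
      intro x hx
      simp only [mem_union, mem_filter, mem_univ, true_and, Finset.mem_image] at hx ⊢
      rcases hx with hx | ⟨i, hi, rfl⟩
      · exact hx.1
      · exact hi.2
    · rw [Finset.disjoint_left]
      intro x hx hx'
      simp only [mem_filter, mem_univ, true_and, Finset.mem_image, mem_Ico] at hx hx'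
      obtain ⟨i, hi, rfl⟩ := hx'
      exact hx.2 i hi.1.2 rfl
    · intro i hi j hj hij
      simp only [Finset.coe_filter, mem_Ico, Set.mem_setOf_eq] at hi hj
      exact h.inj i j hi.1.2 hj.1.2 hij
  have hs2 : (univ.filter (fun x => Cut σ σ' τ' L γ b x ∧ ∀ i, i < L → x ≠ b i)).card ≤
      (univ.filter (fun x => nc σ' τ' x ∧ ∀ i, i < L → x ≠ b i)).card +
      ((Ico 1 L).filter (fun i => Lt σ γ i ∧ ¬ nc σ' τ' (b i))).card + 1 := by
    refine le_trans (b := ((univ.filter (fun x => nc σ' τ' x ∧ ∀ i, i < L → x ≠ b i)) ∪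
      ((Ico 1 L).filter (fun i => Lt σ γ i ∧ ¬ nc σ' τ' (b i))).image (fun i => τ' (b (i - 1))) ∪ {τ' (b (L - 1))}).card) ?_ ?_
    · apply card_le_card
      intro x hx
      simp only [mem_union, mem_filter, mem_univ, true_and, Finset.mem_image, mem_singleton, mem_Ico] at hx ⊢
      obtain ⟨hc, h0⟩ := hx
      by_cases hn : nc σ' τ' x
      · exact Or.inl (Or.inl ⟨hn, h0⟩)
      · rcases hc with hc | ⟨i, i1, i2, i3, i4⟩ | hc
        · exact absurd hc hn
        · refine Or.inl (Or.inr ⟨i, ⟨⟨i1, i2⟩, i3, ?_⟩, i4.symm⟩)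
          rw [← h.ncb i1 i2, ← i4]
          exact hn
        · exact Or.inr hc
    · refine (Finset.card_union_le _ _).trans ?_
      rw [Finset.card_singleton]
      refine Nat.add_le_add_right ((Finset.card_union_le _ _).trans ?_) 1
      exact Nat.add_le_add_left Finset.card_image_le _
  have hs1' : ((univ.filter (fun x => nc σ' τ' x ∧ ∀ i, i < L → x ≠ b i)).card : ℤ) +
      ((Ico 1 L).filter (fun i => nc σ' τ' (b i))).card ≤ (univ.filter (fun y => σ' (τ' (σ' (τ' y))) ≠ y)).card := by exact_mod_cast hs1
  have c1' : ((univ.filter (fun y => σ' (τ' (σ' (τ' y))) ≠ y)).card : ℤ) + 12 * kap σ' (σ' * τ') ≤ 6 * ((Rfs.length + 1 : ℕ) : ℤ) + 6 * gen σ' (σ' * τ') := by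
    convert c1
  push_cast at c1'
  omega

end Rn
end

section
variable {S : Type u} {W : Set Wd(S)} {D : Type} {σ τ : Perm D} {ℓ : D → S × Bool}
  {D' : Type} {σ' τ' : Perm D'} {lab : D' → S × Bool} {L : ℕ} {γ : ℕ → D} {b : ℕ → D'}

open Classical in
theorem card_rev (i j : ℕ) (hij : i < j) (P : ℕ → Prop) (Q : ℤ → Prop)
    (h : ∀ t, i < t → t < j → (P t ↔ Q ((j : ℤ) - t))) :
    ((Ioo (0 : ℤ) ((j - i : ℕ) : ℤ)).filter Q).card = ((Ioo i j).filter P).card := by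
  symm
  refine Finset.card_bij (fun t _ => (j : ℤ) - t) ?_ ?_ ?_
  · intro t ht
    simp only [mem_filter, mem_Ioo] at ht ⊢
    exact ⟨⟨by omega, by omega⟩, (h t ht.1.1 ht.1.2).1 ht.2⟩
  · intro t _ t' _ he
    simpa using he
  · intro k hk
    simp only [mem_filter, mem_Ioo] at hk
    refine ⟨((j : ℤ) - k).toNat, ?_, ?_⟩
    · have h1 : ((((j : ℤ) - k).toNat : ℕ) : ℤ) = j - k := by omega
      simp only [mem_filter, mem_Ioo]
      refine ⟨⟨by omega, by omega⟩, (h _ (by omega) (by omega)).2 ?_⟩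
      rw [h1, show (j : ℤ) - (j - k) = k by ring]
      exact hk.2
    · show (j : ℤ) - ((((j : ℤ) - k).toNat : ℕ) : ℤ) = k
      omega

open Classical in
/-- the surface side estimate between consecutive right turns -/
theorem Rn.run_count (hW : SC W) (hX : Hex W σ τ ℓ) (h : Rn W σ τ ℓ σ' τ' lab L γ b) {i j : ℕ} (hij : i < j) (hjL : j ≤ L)
    (hno : ∀ t, i < t → t < j → ¬ Rt σ τ γ t) (hi : i = 0 ∨ Rt σ τ γ i) (hj : j = L ∨ Rt σ τ γ j) :
    ((Ioo i j).filter (fun t => Lt σ γ t)).card ≤ ((Ioo i j).filter (fun t => nc σ' τ' (b t))).card +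
      (if i = 0 then 1 else 0) + (if j = L then 1 else 0) := by
  obtain ⟨y, hy⟩ : ∃ y, y = τ (γ (j - 1)) := ⟨_, rfl⟩
  have hrun : ∀ k : ℕ, k < j - i → (σ ^ k) y = τ (γ (j - 1 - k)) := by
    intro k
    induction k with
    | zero => intro _; simp [hy]
    | succ k ih =>
      intro hk
      have := hno (j - 1 - k) (by omega) (by omega)
      unfold Rt at this
      rw [not_not] at this
      rw [pow_succ', mul_apply, ih (by omega), this]
      congr 2
  have hmn := h.noturn j (j - i) hjL (by omega) (by omega) (by rw [← hy]; exact hrun)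
  rw [← hy] at hmn
  have hf := hX.mem y
  obtain ⟨n, hn⟩ : ∃ n, n = prd W (rdS σ ℓ y) := ⟨_, rfl⟩
  obtain ⟨m, hm⟩ : ∃ m, m = j - i := ⟨_, rfl⟩
  rw [← hn] at hmn
  rw [← hm] at hmn hrun
  have hQ := lemQ' hW hf 0 (fun k => k = m ∨ (0 < k ∧ k < m ∧ nc σ' τ' (b (j - k.toNat))) ∨ ((m : ℤ) < k ∧ nc σ τ ((σ ^ k) y))) (by
    intro k m' hk0 hkn hm' hseg
    by_cases hkm : k < m
    · have hle : k + m' ≤ m := by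
        by_contra hh
        exact hseg m hkm (by omega) (Or.inl rfl)
      obtain ⟨k, rfl⟩ := Int.eq_ofNat_of_zero_le hk0
      have key : ∀ q : ℕ, q < m' → (σ' ^ q) (τ' (b (j - 1 - k))) = τ' (b (j - 1 - (k + q))) := by
        intro q
        induction q with
        | zero => intro _; simp
        | succ q ih =>
          intro hq
          have h1 := hseg (k + (q + 1 : ℕ)) (by omega) (by omega)
          rw [not_or, not_or] at h1
          have h2 : ¬ nc σ' τ' (b (j - 1 - (k + q))) := by
            intro hh
            refine h1.2.1 ⟨by omega, by omega, ?_⟩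
            rw [show j - ((k : ℤ) + ((q + 1 : ℕ) : ℤ)).toNat = j - 1 - (k + q) by omega]
            exact hh
          rw [pow_succ', mul_apply, ih (by omega), h.step (by omega) (by omega) h2]
          congr 2
      refine ⟨rdS σ' lab (τ' (b (j - 1 - k))), h.mem _ (h.outb (by omega)), ?_, ?_⟩
      · rw [← rdS_pow, zpow_natCast, hrun k (by omega)]
        exact h.push1 _ (by omega)
      · intro q hq
        have e1 : rdS σ' lab (τ' (b (j - 1 - k))) (q : ℤ) = lab ((σ' ^ q) (τ' (b (j - 1 - k)))) := by simp [rdS]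
        have e2 : rdS σ ℓ y ((k : ℤ) + q) = ℓ ((σ ^ (k + q)) y) := by
          simp only [rdS]
          rw [← Nat.cast_add, zpow_natCast]
        rw [e1, e2, key q hq, hrun (k + q) (by omega), h.labt, hX.labt, h.lb _ (by omega)]
    · refine run_PC hW hX.inv2 hX.labt (hX.mem _) ?_ ?_
      · have := hX.red (τ ((σ ^ k) y))
        rwa [hX.inv2] at this
      · intro q h1 h2
        have h3 := hseg q h1 h2
        rw [not_or, not_or] at h3
        by_contra hh
        exact h3.2.2 ⟨by omega, hh⟩)
  have hsix := hX.six y ((Ico (0 : ℤ) n).filter (fun k => nc σ τ ((σ ^ k) y))) (by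
    intro k; rw [← hn]; simp [and_assoc])
  rw [← hn, zero_add] at hQ
  -- counting
  have hcL : ((Ioo (0 : ℤ) m).filter (fun k => nc σ τ ((σ ^ k) y))).card = ((Ioo i j).filter (fun t => Lt σ γ t)).card := by
    rw [hm]
    apply card_rev i j hij
    intro t h1 h2
    rw [← (h.types hW hX (t := t) (by omega) (by omega)).2.2 (hno t h1 h2)]
    have e : (j : ℤ) - t = ((j - t : ℕ) : ℤ) := by omega
    rw [e, zpow_natCast, hrun (j - t) (by omega)]
    have hp := h.path (t - 1) (by omega)
    rw [show t - 1 + 1 = t by omega] at hp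
    rw [show j - 1 - (j - t) = t - 1 by omega]
    exact (nc_vx hp).symm
  have hcB : ((Ioo (0 : ℤ) m).filter (fun k => nc σ' τ' (b (j - k.toNat)))).card = ((Ioo i j).filter (fun t => nc σ' τ' (b t))).card := by
    rw [hm]
    apply card_rev i j hij
    intro t h1 h2
    rw [show j - ((j : ℤ) - t).toNat = t by omega]
  have hlast : i ≠ 0 → nc σ τ ((σ ^ (m : ℤ)) y) := by
    intro h0
    have hR := hi.resolve_left h0
    have h1 := (h.types hW hX (t := i) (by omega) (by omega)).1 hR
    have e : (σ ^ (m : ℤ)) y = σ (τ (γ i)) := by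
      rw [zpow_natCast, show m = (m - 1) + 1 by omega, pow_succ', mul_apply, hrun (m - 1) (by omega)]
      congr 3; omega
    rw [e, nc_nu]
    exact h1
  have hfirst : j ≠ L → nc σ τ ((σ ^ (0 : ℤ)) y) := by
    intro h0
    have hR := hj.resolve_left h0
    have h1 := (h.types hW hX (t := j) (by omega) (by omega)).1 hR
    have hp := h.path (j - 1) (by omega)
    rw [show j - 1 + 1 = j by omega] at hp
    rw [zpow_zero, Perm.one_apply, hy]
    exact (nc_vx hp).2 h1
  -- decomposition of the six corners
  have hdec : (Ico (0 : ℤ) n).filter (fun k => nc σ τ ((σ ^ k) y)) =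
      (((Ioo (0 : ℤ) m).filter (fun k => nc σ τ ((σ ^ k) y))) ∪ ((Ioo (m : ℤ) n).filter (fun k => nc σ τ ((σ ^ k) y)))) ∪
      (({0, (m : ℤ)} : Finset ℤ).filter (fun k => nc σ τ ((σ ^ k) y))) := by
    rw [← Finset.filter_union, ← Finset.filter_union]
    congr 1
    ext k
    simp only [mem_Ico, mem_union, mem_Ioo, mem_insert, mem_singleton]
    omega
  have hD : ((Ioo (0 : ℤ) m).filter (fun k => nc σ τ ((σ ^ k) y))).card + ((Ioo (m : ℤ) n).filter (fun k => nc σ τ ((σ ^ k) y))).card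
      + (({0, (m : ℤ)} : Finset ℤ).filter (fun k => nc σ τ ((σ ^ k) y))).card = 6 := by
    rw [← hsix, hdec, card_union_of_disjoint, card_union_of_disjoint]
    · rw [Finset.disjoint_left]
      intro k h1 h2
      simp only [mem_filter, mem_Ioo] at h1 h2
      omega
    · rw [Finset.disjoint_left]
      intro k h1 h2
      simp only [mem_filter, mem_Ioo, mem_union, mem_insert, mem_singleton] at h1 h2
      omega
  have hE : (if i = 0 then 0 else 1) + (if j = L then 0 else 1) ≤ (({0, (m : ℤ)} : Finset ℤ).filter (fun k => nc σ τ ((σ ^ k) y))).card := by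
    have hm0 : (0 : ℤ) ≠ m := by omega
    rw [Finset.filter_insert, Finset.filter_singleton]
    by_cases a1 : i = 0 <;> by_cases a2 : j = L
    · simp [a1, a2]
    · rw [if_pos (hfirst a2)]
      simp [a1, a2]
    · rw [if_pos (hlast a1)]
      simp only [a1, a2, if_true, if_false, add_zero]
      apply card_pos.2
      refine ⟨(m : ℤ), ?_⟩
      split_ifs <;> simp
    · rw [if_pos (hlast a1), if_pos (hfirst a2)]
      simp [a1, a2, Finset.card_pair hm0]
  have hU : ((Ioo (0 : ℤ) n).filter (fun k : ℤ => k = m ∨ (0 < k ∧ k < m ∧ nc σ' τ' (b (j - k.toNat))) ∨ ((m : ℤ) < k ∧ nc σ τ ((σ ^ k) y)))).card ≤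
      1 + ((Ioo (0 : ℤ) m).filter (fun k => nc σ' τ' (b (j - k.toNat)))).card + ((Ioo (m : ℤ) n).filter (fun k => nc σ τ ((σ ^ k) y))).card := by
    refine le_trans (card_le_card (t := ({(m : ℤ)} ∪ (Ioo (0 : ℤ) m).filter (fun k => nc σ' τ' (b (j - k.toNat)))) ∪
      (Ioo (m : ℤ) n).filter (fun k => nc σ τ ((σ ^ k) y))) ?_) ?_
    · intro k hk
      simp only [mem_filter, mem_Ioo, mem_union, mem_singleton] at hk ⊢
      obtain ⟨⟨h1, h2⟩, h3⟩ := hk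
      rcases h3 with h3 | ⟨a, b', c⟩ | ⟨a, c⟩
      · exact Or.inl (Or.inl h3)
      · exact Or.inl (Or.inr ⟨⟨a, b'⟩, c⟩)
      · exact Or.inr ⟨⟨a, h2⟩, c⟩
    · refine (Finset.card_union_le _ _).trans (Nat.add_le_add_right ((Finset.card_union_le _ _).trans ?_) _)
      rw [Finset.card_singleton]
  have hQ' : 5 ≤ ((Ioo (0 : ℤ) n).filter (fun k : ℤ => k = m ∨ (0 < k ∧ k < m ∧ nc σ' τ' (b (j - k.toNat))) ∨ ((m : ℤ) < k ∧ nc σ τ ((σ ^ k) y)))).card := by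
    convert hQ
  rw [← hcL, ← hcB]
  split_ifs at hE ⊢ <;> omega

open Classical in
theorem Rn.right_count (hW : SC W) (hX : Hex W σ τ ℓ) (h : Rn W σ τ ℓ σ' τ' lab L γ b) : ∀ j, 1 ≤ j → j ≤ L → (j = L ∨ Rt σ τ γ j) →
    ((Ico 1 j).filter (fun t => Lt σ γ t)).card ≤ ((Ico 1 j).filter (fun t => nc σ' τ' (b t))).card +
      1 + (if j = L then 1 else 0) := by
  intro j
  induction j using Nat.strong_induction_on with
  | _ j ih =>
    intro h1 h2 h3
    obtain ⟨i, hi, hi2, hmax⟩ : ∃ i, i < j ∧ (i = 0 ∨ Rt σ τ γ i) ∧ ∀ t, i < t → t < j → ¬ Rt σ τ γ t := by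
      have hex : ∃ i, i ≤ j - 1 ∧ (i = 0 ∨ Rt σ τ γ i) := ⟨0, by omega, Or.inl rfl⟩
      obtain ⟨i0, h0, h0'⟩ := hex
      refine ⟨Nat.findGreatest (fun i => i = 0 ∨ Rt σ τ γ i) (j - 1), ?_, ?_, ?_⟩
      · have := Nat.findGreatest_le (P := fun i => i = 0 ∨ Rt σ τ γ i) (j - 1)
        omega
      · exact Nat.findGreatest_spec (P := fun i => i = 0 ∨ Rt σ τ γ i) h0 h0'
      · intro t ht1 ht2 hR
        exact Nat.findGreatest_is_greatest ht1 (by omega) (Or.inr hR)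
    have hr := h.run_count hW hX hi h2 hmax hi2 h3
    have split : ∀ P : ℕ → Prop, 1 ≤ i → ((Ico 1 j).filter P).card = ((Ico 1 i).filter P).card + (({i} : Finset ℕ).filter P).card + ((Ioo i j).filter P).card := by
      intro P hi1
      rw [← card_union_of_disjoint, ← card_union_of_disjoint, ← Finset.filter_union, ← Finset.filter_union]
      · congr 2
        ext t
        simp only [mem_Ico, mem_union, mem_singleton, mem_Ioo]
        omega
      · rw [Finset.disjoint_left]
        intro k h1 h2
        simp only [mem_filter, mem_Ioo, mem_union, mem_Ico, mem_singleton] at h1 h2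
        omega
      · rw [Finset.disjoint_left]
        intro k h1 h2
        simp only [mem_filter, mem_Ioo, mem_union, mem_Ico, mem_singleton] at h1 h2
        omega
    by_cases hi0 : i = 0
    · subst hi0
      have e : Ioo 0 j = Ico 1 j := by ext t; simp only [mem_Ico, mem_Ioo]; omega
      rw [e] at hr
      simpa using hr
    · have hRi := hi2.resolve_left hi0
      have hnl := (h.types hW hX (t := i) (by omega) (by omega)).2.1 hRi
      have := ih i hi (by omega) (by omega) (Or.inr hRi)
      rw [split _ (by omega), split (fun t => nc σ' τ' (b t)) (by omega)]
      have e0 : (({i} : Finset ℕ).filter (fun t => Lt σ γ t)).card = 0 := by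
        rw [Finset.filter_singleton, if_neg hnl]; rfl
      rw [if_neg (by omega)] at this hr
      omega

theorem Rn.false (hW : SC W) (hX : Hex W σ τ ℓ) [Fintype D'] [DecidableEq D'] (h : Rn W σ τ ℓ σ' τ' lab L γ b) {Rfs : List (List D')}
    (hO : OK linv σ' τ' lab ((List.range L).map b :: Rfs)) (hg : gen σ' (σ' * τ') ≤ 0) (hR : ∀ l ∈ Rfs, l.map lab ∈ W) : False := by
  classical
  have h1 := h.left_count hW hX hO hg hR
  have h2 := h.right_count hW hX L h.Lpos le_rfl (Or.inl rfl)
  rw [if_pos rfl] at h2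
  have h3 : ((Ico 1 L).filter (fun i => Lt σ γ i ∧ ¬ nc σ' τ' (b i))).card ≤ ((Ico 1 L).filter (fun t => Lt σ γ t)).card := by
    apply card_le_card
    intro t ht
    simp only [mem_filter] at ht ⊢
    tauto
  have h1' : ((Ico 1 L).filter (fun i => nc σ' τ' (b i))).card + 5 ≤
      ((Ico 1 L).filter (fun i => Lt σ γ i ∧ ¬ nc σ' τ' (b i))).card := by convert h1
  have h2' : ((Ico 1 L).filter (fun t => Lt σ γ t)).card ≤ ((Ico 1 L).filter (fun t => nc σ' τ' (b t))).card + 1 + 1 := by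
    convert h2
  omega

end

theorem rng_split {α : Type*} (f : ℕ → α) (m n : ℕ) :
    (List.range (m + n)).map f = (List.range m).map f ++ (List.range n).map (fun k => f (m + k)) := by
  rw [List.range_add, map_append, map_map]; rfl

theorem rng_split1 {α : Type*} (f : ℕ → α) {i L : ℕ} (h : i < L) :
    (List.range L).map f = (List.range i).map f ++ f i :: (List.range (L - i - 1)).map (fun k => f (i + 1 + k)) := by
  conv_lhs => rw [show L = i + (1 + (L - i - 1)) by omega, rng_split, rng_split]
  simp [add_assoc]

theorem list_fn {α : Type*} (l : List α) (h : l ≠ []) : ∃ f : ℕ → α, l = (List.range l.length).map f := by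
  refine ⟨fun i => l.getD i (l.head h), ?_⟩
  apply List.ext_getElem
  · simp
  · intro i h1 h2
    simp [List.getElem?_eq_getElem h1]

section
variable {S : Type u} {W : Set Wd(S)} {D : Type} {σ τ : Perm D} {ℓ : D → S × Bool}

theorem TP_rng (f : ℕ → D) (V : ℕ → Quotient (sc (σ * τ))) : ∀ (m : ℕ)
    (h : ∀ k, k < m → vx σ τ (f k) = V k ∧ vx σ τ (τ (f k)) = V (k + 1)), TP σ τ (V 0) ((List.range m).map f) (V m) := by
  intro m
  induction m with
  | zero => intro h; simp [TP]
  | succ m ih =>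
    intro h
    rw [List.range_succ, map_append]
    refine TP_append.2 ⟨V m, ih (fun k hk => h k (by omega)), ?_⟩
    simp only [map_cons, List.map_nil, TP]
    exact h m (by omega)

theorem TP_path {x y : Quotient (sc (σ * τ))} {γ : ℕ → D} {L : ℕ} (h : TP σ τ x ((List.range L).map γ) y) {i : ℕ} (hi : i + 1 < L) :
    vx σ τ (τ (γ i)) = vx σ τ (γ (i + 1)) := by
  rw [rng_split1 γ (show i < L by omega), rng_split1 (fun k => γ (i + 1 + k)) (show 0 < L - i - 1 by omega)] at h
  obtain ⟨z, -, h1⟩ := TP_append.1 h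
  simp only [List.range_zero, List.map_nil, List.nil_append, TP] at h1
  simpa using h1.2.1.symm

theorem bad_false (hW : SC W) (hX : Hex W σ τ ℓ) : ∀ m, ¬ Bad W σ τ ℓ m := by
  intro m
  induction m using Nat.strong_induction_on with
  | _ m ih =>
  rintro ⟨x, y, γl, Rs, hT, hxy, hRs, hS, hm⟩
  have hmin : ∀ m' < m, ¬ Bad W σ τ ℓ m' := ih
  clear ih
  obtain ⟨D', i1, i2, σ', τ', lab, fs, hO, hfs, hg⟩ := hS.exact
  have hγ := TP_ne hT hxy
  rcases fs with _ | ⟨bl, Rfs⟩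
  · simp at hfs
  simp only [map_cons, List.cons.injEq] at hfs
  obtain ⟨hbl, hRf⟩ := hfs
  have hlen : bl.length = γl.length := by simpa using congrArg List.length hbl
  obtain ⟨γ, eγ⟩ := list_fn γl hγ
  obtain ⟨b, eb⟩ := list_fn bl (by intro h; rw [h] at hlen; exact hγ (List.length_eq_zero_iff.1 hlen.symm))
  rw [hlen] at eb
  generalize hL : γl.length = L at *
  have hLpos : 0 < L := by rw [← hL]; exact length_pos_iff.2 hγ
  subst eγ eb
  clear hL hlen hγ
  have hR : ∀ l ∈ Rfs, l.map lab ∈ W := by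
    intro l hl
    apply hRs
    rw [← hRf]
    exact List.mem_map_of_mem hl
  have lb : ∀ i, i < L → lab (b i) = ℓ (γ i) := by
    intro i hi
    have := congrArg (fun l => l[i]?) hbl
    simpa [hi] using this
  have hcyc := hO.cyc _ (List.mem_cons_self)
  have next : ∀ i, i + 1 < L → σ' (b i) = b (i + 1) := by
    intro i hi
    have := congrArg (fun l => l[i]?) hcyc
    simp only [map_map] at this
    rw [List.getElem?_rotate (by simp; omega)] at this
    simpa [show i < L by omega, hi, Nat.mod_eq_of_lt hi] using this
  have wrap : σ' (b (L - 1)) = b 0 := by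
    have := congrArg (fun l => l[L - 1]?) hcyc
    simp only [map_map] at this
    rw [List.getElem?_rotate (by simp; omega)] at this
    simpa [show L - 1 < L by omega, show L - 1 + 1 = L by omega, hLpos] using this
  have nd := hO.nd
  rw [List.flatten_cons, List.nodup_append] at nd
  have inj : ∀ i j, i < L → j < L → b i = b j → i = j := by
    intro i j hi hj e
    exact List.inj_on_of_nodup_map nd.1 (List.mem_range.2 hi) (List.mem_range.2 hj) e
  have inR : ∀ d, (∀ i, i < L → d ≠ b i) → ∃ r ∈ Rfs, d ∈ r := by
    intro d hd
    have := hO.all d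
    rw [List.flatten_cons, List.mem_append] at this
    rcases this with h | h
    · obtain ⟨i, hi, e⟩ := mem_map.1 h
      exact absurd e.symm (hd i (List.mem_range.1 hi))
    · exact mem_flatten.1 h
  have spec : ∀ r ∈ Rfs, ∀ d ∈ r, rdS σ' lab d ∈ Rdg W ∧ prd W (rdS σ' lab d) = r.length := by
    intro r hr d hd
    have := hO.rdS_spec hW (pl := id) (List.mem_cons_of_mem _ hr) (by simpa using hR r hr) hd
    exact ⟨this.1, this.2.1⟩
  have hmu1 : mu ((List.range L).map b :: Rfs) = m := by
    rw [← mu_map lab, map_cons, hbl, hRf]; exact hm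
  have hmu2 : mu (((List.range L).map γ).map ℓ :: Rs) = m := hm
  have nothin : ∀ i j, i < j → j < L → τ' (b i) ≠ b j := by
    intro i j hij hj e
    have hO' := hO
    have hT' := hT
    have hmu' := hmu1
    have s : ∀ {α : Type} (f : ℕ → α), (List.range L).map f = (List.range i).map f ++ f i :: ((List.range (j - i - 1)).map (fun k => f (i + 1 + k)) ++
        f j :: (List.range (L - j - 1)).map (fun k => f (j + 1 + k))) := by
      intro α f
      rw [rng_split1 f (show i < L by omega), rng_split1 (fun k => f (i + 1 + k)) (show j - i - 1 < L - i - 1 by omega)]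
      rw [show i + 1 + (j - i - 1) = j by omega]
      congr 4
      rw [show L - i - 1 - (j - i - 1) - 1 = L - j - 1 by omega]
      apply map_congr_left
      intro k _
      congr 1; omega
    rw [s] at hO' hT' hmu'
    rw [← e] at hO' hmu'
    refine op_thin hW hX hT' hxy hO' hg ?_ ?_ ?_ (lb i (by omega)) (by rw [e]; exact lb j hj) hR (by rw [hmu']; exact hmin)
    all_goals
      rw [map_map, map_map]
      apply map_congr_left
      intro k hk
      have := List.mem_range.1 hk
      exact lb _ (by omega)
  have nothin' : ∀ i j, i < L → j < L → τ' (b i) ≠ b j := by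
    intro i j hi hj e
    rcases lt_trichotomy i j with h | h | h
    · exact nothin i j h hj e
    · subst h; exact hO.fpf _ e
    · exact nothin j i h hi (by rw [← e, hO.inv2])
  -- push
  have push : ∀ i, i < L → ∀ v : ℕ → D, ∀ V : ℕ → Quotient (sc (σ * τ)), V 0 = vx σ τ (γ i) →
      (∀ n : ℕ, n + 1 = prd W (rdS σ' lab (τ' (b i))) → V n = vx σ τ (τ (γ i))) →
      (∀ k, vx σ τ (v k) = V k ∧ vx σ τ (τ (v k)) = V (k + 1)) →
      (∀ k : ℕ, lab ((σ' ^ (k + 1)) (τ' (b i))) = ℓ (v k)) → False := by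
    intro i hi v V h0 hn hV hl
    obtain ⟨r, hr, hd⟩ := inR (τ' (b i)) (fun j hj => nothin' i j hi hj)
    obtain ⟨s1, s2⟩ := spec r hr _ hd
    obtain ⟨j, hj⟩ := rot_pow (hO.cyc r (List.mem_cons_of_mem _ hr)) hd
    obtain ⟨n, hn1⟩ : ∃ n, n + 1 = r.length := ⟨r.length - 1, by have := prd_pos hW s1; omega⟩
    have hO' := hO
    have hT' := hT
    have hmu' := hmu1
    rw [rng_split1 _ hi] at hO' hT' hmu'
    have hj' : r.rotate j = τ' (b i) :: (List.range n).map (fun k => (σ' ^ (k + 1)) (τ' (b i))) := by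
      rw [← hj, ← hn1, List.range_succ_eq_map, map_cons, map_map]
      congr 1
    have hTv := TP_rng v V n (fun k _ => hV k)
    rw [h0, hn n (by rw [s2, hn1])] at hTv
    refine op_push hT' hxy hO' hg ?_ ?_ hR hr hj' hTv ?_ (by rw [hmu']; exact hmin)
    · rw [map_map, map_map]
      apply map_congr_left
      intro k hk
      have := List.mem_range.1 hk
      exact lb _ (by omega)
    · rw [map_map, map_map]
      apply map_congr_left
      intro k hk
      have := List.mem_range.1 hk
      exact lb _ (by omega)
    · rw [map_map, map_map]
      apply map_congr_left
      intro k hk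
      exact hl k
  have vt : ∀ d, vx σ τ (τ d) = vx σ τ (σ d) := by
    intro d
    have := vx_nu (σ := σ) (τ := τ) (τ d)
    rw [hX.inv2] at this
    exact this.symm
  refine Rn.false (L := L) (γ := γ) (b := b) hW hX (σ' := σ') (τ' := τ') (lab := lab) ?_ hO hg hR
  constructor
  · exact hLpos
  · exact hO.inv2
  · exact hO.labt
  · exact next
  · exact wrap
  · exact inj
  · exact lb
  · intro i hi; exact TP_path hT hi
  · intro i hi e
    have s : ∀ {α : Type} (f : ℕ → α), (List.range L).map f = (List.range i).map f ++ f i :: f (i + 1) ::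
        (List.range (L - i - 1 - 0 - 1)).map (fun k => f (i + 1 + (0 + 1 + k))) := by
      intro α f
      rw [rng_split1 f (show i < L by omega), rng_split1 (fun k => f (i + 1 + k)) (show 0 < L - i - 1 by omega)]
      simp
    have hT' := hT
    have hS' := hS
    have hmu' := hmu2
    rw [s γ, e] at hT' hS' hmu'
    exact op_back hW hX hT' hxy hS' hRs (by rw [hmu']; exact hmin)
  · exact nothin'
  · intro d hd
    obtain ⟨r, hr, hd⟩ := inR d hd
    exact (spec r hr d hd).1
  · intro i hi e
    refine push i hi (fun k => (σ ^ (k + 1)) (τ (γ i))) (fun k => vx σ τ ((σ ^ (k + 1)) (τ (γ i)))) ?_ ?_ ?_ ?_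
    · simp only [zero_add, pow_one]; exact vx_nu _
    · intro n hn
      have h1 := (hX.per (τ (γ i)) (n + 1 : ℕ)).2 (by rw [← e, ← hn])
      rw [zpow_natCast] at h1
      simp only [h1]
    · intro k
      refine ⟨rfl, ?_⟩
      show vx σ τ (τ ((σ ^ (k + 1)) (τ (γ i)))) = vx σ τ ((σ ^ (k + 1 + 1)) (τ (γ i)))
      rw [vt, ← mul_apply, ← pow_succ']
    · intro k
      have := congrFun e ((k + 1 : ℕ) : ℤ)
      simpa only [rdS, zpow_natCast] using this
  · intro i hi e
    refine push i hi (fun k => τ ((σ ^ (-((k + 1 : ℕ) : ℤ))) (γ i))) (fun k => vx σ τ ((σ ^ (-((k : ℕ) : ℤ))) (γ i))) ?_ ?_ ?_ ?_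
    · simp
    · intro n hn
      have h1 := (hX.per (γ i) (n + 1 : ℕ)).2 (by rw [hn, e, prd_mir hW (hX.mem _)])
      have h2 : (σ ^ (-((n : ℕ) : ℤ))) (γ i) = σ (γ i) := by
        conv_lhs => rw [← h1, ← mul_apply, ← zpow_add]
        rw [show -(n : ℤ) + ((n + 1 : ℕ) : ℤ) = 1 by push_cast; ring, zpow_one]
      simp only [h2, vt]
    · intro k
      constructor
      · rw [vt, ← mul_apply, ← zpow_one_add]
        congr 3; push_cast; ring
      · simp only [hX.inv2]
    · intro k
      have := congrFun e ((k + 1 : ℕ) : ℤ)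
      simp only [rdS, zpow_natCast, mir] at this
      rw [this, hX.labt]
  · intro j n hj hn hn0 hrun
    by_contra hle
    rw [not_lt] at hle
    set y0 := τ (γ (j - 1)) with hy0
    set p := prd W (rdS σ ℓ y0) with hp
    have hppos : 0 < p := prd_pos hW (hX.mem _)
    have hper : (σ ^ p) y0 = y0 := by
      have := (hX.per y0 (p : ℤ)).2 (dvd_refl _)
      rwa [zpow_natCast] at this
    have hγ' : ∀ k, k < p → γ (j - p + k) = τ ((σ ^ (p - 1 - k)) y0) := by
      intro k hk
      rw [hrun (p - 1 - k) (by omega), hX.inv2]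
      congr 1; omega
    have s : ∀ {α : Type} (f : ℕ → α), (List.range L).map f = (List.range (j - p)).map f ++ (List.range p).map (fun k => f (j - p + k)) ++
        (List.range (L - j)).map (fun k => f (j + k)) := by
      intro α f
      conv_lhs => rw [show L = (j - p) + p + (L - j) by omega, rng_split, rng_split]
      congr 1
      apply map_congr_left
      intro k _
      congr 1; omega
    have ec : (List.range p).map (fun k => γ (j - p + k)) = (List.range p).map (fun k => τ ((σ ^ (p - 1 - k)) y0)) := by
      apply map_congr_left
      intro k hk
      exact hγ' k (List.mem_range.1 hk)
    have hT' := hT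
    have hS' := hS
    have hmu' := hmu2
    rw [s γ, ec] at hT' hS' hmu'
    obtain ⟨z', hT1, hT3⟩ := TP_append.1 hT'
    obtain ⟨z, hT1, hT2⟩ := TP_append.1 hT1
    have hV := TP_rng (σ := σ) (τ := τ) (fun k => τ ((σ ^ (p - 1 - k)) y0)) (fun k => vx σ τ ((σ ^ (p - k)) y0)) p (by
      intro k hk
      constructor
      · rw [vt, ← mul_apply, ← pow_succ']
        congr 3; omega
      · simp only [hX.inv2]
        congr 3; omega)
    have hz : z = vx σ τ y0 := by
      have h2 := hT2
      rw [rng_split1 _ hppos] at h2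
      simp only [List.range_zero, List.map_nil, List.nil_append, TP] at h2
      rw [← h2.1, vt, ← mul_apply, ← pow_succ', show p - 1 - 0 + 1 = p by omega, hper]
    simp only [Nat.sub_zero, hper, Nat.sub_self, pow_zero, Perm.one_apply] at hV
    rw [hz] at hT2 hT1
    have hz' := TP_det hT2 hV
    rw [hz'] at hT3
    refine op_turn hW hT1 hT3 hxy ?_ hS' hRs (by rw [hmu']; exact hmin)
    have := hW.bar _ (win_mem hW (hX.mem y0) 0)
    rw [← hp] at this
    unfold win at this
    rw [ebar_range] at this
    convert this using 1
    rw [map_map]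
    apply map_congr_left
    intro k hk
    simp only [Function.comp, hX.labt, rdS, zero_add, zpow_natCast]
  · intro d hd1 hd2 e
    obtain ⟨r1, hr1, h1⟩ := inR d hd1
    obtain ⟨r2, hr2, h2⟩ := inR _ hd2
    refine op_zip hW hT hxy hO hg hbl hR hr1 hr2 h1 h2 ?_ (by rw [hmu1]; exact hmin)
    rw [e, mir_mir]

end

section
variable {S : Type u} {P : Type v} {act : P → S × Bool → P}

/-- the face rotation on darts with positions -/
def dS (ha : Act act) : Perm (P × Rd(S)) where
  toFun x := (act x.1 (x.2 0), shf 1 x.2)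
  invFun x := (act x.1 (linv (x.2 (-1))), shf (-1) x.2)
  left_inv := by
    intro x
    refine Prod.ext ?_ ?_
    · simp only [shf]; simpa using ha.back x.1 (x.2 0)
    · simp only [shf_shf]; simp [shf_zero]
  right_inv := by
    intro x
    refine Prod.ext ?_ ?_
    · simp only [shf]
      have := ha.back x.1 (linv (x.2 (-1)))
      rw [linv_linv] at this
      simpa using this
    · simp only [shf_shf]; simp [shf_zero]

/-- orientation reversal on darts with positions -/
def dB (act : P → S × Bool → P) (x : P × Rd(S)) : P × Rd(S) := (act x.1 (x.2 0), mir x.2)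

theorem dS_apply (ha : Act act) (x) : dS ha x = (act x.1 (x.2 0), shf 1 x.2) := rfl

theorem dS_fst (ha : Act act) (x) : (dS ha x).1 = act x.1 (x.2 0) := rfl

theorem dS_pow_snd (ha : Act act) (x) (k : ℤ) : ((dS ha ^ k) x).2 = shf k x.2 := by
  induction k using Int.induction_on with
  | zero => simp [shf_zero]
  | succ i ih =>
    rw [add_comm, zpow_add, mul_apply, zpow_one, dS_apply]
    simp only [ih, shf_shf]
  | pred i ih =>
    rw [sub_eq_add_neg, add_comm, zpow_add, mul_apply, zpow_neg, zpow_one, ]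
    have : ((dS ha)⁻¹ ((dS ha ^ (-(i : ℤ))) x)).2 = shf (-1) ((dS ha ^ (-(i : ℤ))) x).2 := rfl
    rw [this, ih, shf_shf]

theorem dB_dB (ha : Act act) (x) : dB act (dB act x) = x := by
  refine Prod.ext ?_ ?_
  · simp only [dB, mir]; simpa using ha.back x.1 (x.2 0)
  · simp [dB, mir_mir]

theorem dB_snd0 (x : P × Rd(S)) : (dB act x).2 0 = linv (x.2 0) := by simp [dB, mir]

theorem dB_fst (x : P × Rd(S)) : (dB act x).1 = act x.1 (x.2 0) := rfl

theorem dB_inj (ha : Act act) {x y} (h : dB act x = dB act y) : x = y := by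
  rw [← dB_dB ha x, h, dB_dB ha]

theorem dS_dB (ha : Act act) (x) : dS ha (dB act (dS ha x)) = dB act x := by
  refine Prod.ext ?_ ?_
  · rw [dS_fst, dB_snd0, dB_fst, ha.back]; rfl
  · simp only [dS_apply, dB, mir_shf, shf_shf]; simp [shf_zero]

theorem dB_dS (ha : Act act) (x) : dB act (dS ha x) = (dS ha)⁻¹ (dB act x) := by
  rw [Perm.eq_inv_iff_eq, dS_dB]

/-- three distinct positive darts at a position -/
def Dg (F : P × Rd(S) → ℤ) (g : P) : Prop :=
  ∃ x y z, F x = 1 ∧ F y = 1 ∧ F z = 1 ∧ x.1 = g ∧ y.1 = g ∧ z.1 = g ∧ x ≠ y ∧ y ≠ z ∧ x ≠ z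

/-- the chain of a flat plane or torus -/
structure Flat (W : Set Wd(S)) (ha : Act act) (F : P × Rd(S) → ℤ) : Prop where
  one : ∀ x, F x = 1 ∨ F x = 0 ∨ F x = -1
  mem : ∀ x, F x = 1 → x.2 ∈ Rdg W
  sig : ∀ x, F (dS ha x) = F x
  bar : ∀ x, F (dB act x) = - F x
  uniq : ∀ x y, F x = 1 → F y = 1 → x.1 = y.1 → x.2 0 = y.2 0 → x = y
  part : ∀ x, F x = 1 → ∃ y, F y = 1 ∧ y.1 = act x.1 (x.2 0) ∧ y.2 0 = linv (x.2 0)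
  conn : ∀ x y y' z, F x = 1 → F y = 1 → F y' = 1 → F z = 1 → y.1 = act x.1 (x.2 0) → y.2 0 = linv (x.2 0) →
    y'.1 = act (dS ha y).1 ((dS ha y).2 0) → y'.2 0 = linv ((dS ha y).2 0) → z.1 = x.1 →
    z = x ∨ z = dS ha y ∨ z = dS ha y'
  six : ∀ x, F x = 1 → ∀ s : Finset ℤ, (∀ k, k ∈ s ↔ 0 ≤ k ∧ k < prd W x.2 ∧ Dg F ((dS ha ^ k) x).1) → s.card = 6
  pc : ∀ x, F x = 1 → ∀ (k : ℤ) (m : ℕ), (∀ j : ℤ, k < j → j < k + m → ¬ Dg F ((dS ha ^ j) x).1) → PC W x.2 k m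

section
variable {W : Set Wd(S)} {D : Type} {σ τ : Perm D} {lab : D → P × (S × Bool)}

/-- dart with position -/
def xd (σ : Perm D) (lab : D → P × (S × Bool)) (d : D) : P × Rd(S) := ((lab d).1, rdS σ (Prod.snd ∘ lab) d)

theorem xd_snd0 (d : D) : (xd σ lab d).2 0 = (lab d).2 := by simp [xd, rdS]

theorem xd_sig (ha : Act act) (hp : ∀ d, (lab (σ d)).1 = act (lab d).1 (lab d).2) (d : D) :
    xd σ lab (σ d) = dS ha (xd σ lab d) := by
  refine Prod.ext ?_ ?_
  · rw [dS_fst, xd_snd0]; exact hp d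
  · have := rdS_pow σ (Prod.snd ∘ lab) 1 d
    simpa [xd, dS_apply] using this

theorem xd_pow (ha : Act act) (hp : ∀ d, (lab (σ d)).1 = act (lab d).1 (lab d).2) (d : D) (k : ℤ) :
    xd σ lab ((σ ^ k) d) = (dS ha ^ k) (xd σ lab d) := by
  induction k using Int.induction_on with
  | zero => simp
  | succ i ih =>
    rw [add_comm, zpow_add, zpow_add, mul_apply, mul_apply, zpow_one, zpow_one, xd_sig ha hp, ih]
  | pred i ih =>
    rw [sub_eq_add_neg, add_comm, zpow_add, zpow_add, mul_apply, mul_apply, ← ih, zpow_neg_one, zpow_neg_one,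
      Perm.eq_inv_iff_eq, ← xd_sig ha hp]
    simp

set_option maxHeartbeats 1000000 in
open Classical in
theorem flat_of [Fintype D] (hW : SC W) (ha : Act act) (hX : Hex W σ τ (Prod.snd ∘ lab))
    (hp : ∀ d, (lab (σ d)).1 = act (lab d).1 (lab d).2) (ht : ∀ d, lab (τ d) = einv act (lab d))
    (hinj : ∀ d d', (lab d).1 = (lab d').1 → vx σ τ d = vx σ τ d')
    {F : P × Rd(S) → ℤ}
    (hF : ∀ x, F x = ∑ d, ((if xd σ lab d = x then 1 else 0) - (if dB act (xd σ lab d) = x then 1 else 0))) :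
    Flat W ha F := by
  have hvx : ∀ d d', vx σ τ d = vx σ τ d' → (lab d).1 = (lab d').1 := by
    intro d d' h
    have hk : ∀ d, (lab (σ (τ d))).1 = (lab d).1 := by
      intro d
      rw [hp, ht]
      exact ha.back _ _
    rcases hX.nu3 hW h with e | e | e
    · rw [e]
    · rw [e, hk]
    · rw [e, hk, hk]
  have hxi : ∀ d d', (lab d).1 = (lab d').1 → (lab d).2 = (lab d').2 → d = d' := fun d d' h1 h2 =>
    hX.loc_inj hW (hinj _ _ h1) h2
  have hi : ∀ d d', xd σ lab d = xd σ lab d' → d = d' := by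
    intro d d' h
    have h0 : (lab d).1 = (lab d').1 := by
      have h0 := congrArg Prod.fst h
      exact h0
    apply hxi _ _ h0
    rw [← xd_snd0 (σ := σ), h, xd_snd0]
  have htp : ∀ d, (lab (τ d)).1 = act (lab d).1 (lab d).2 := fun d => by rw [ht]; rfl
  have htl : ∀ d, (lab (τ d)).2 = linv (lab d).2 := fun d => by rw [ht]; rfl
  have hneg : ∀ d d', xd σ lab d ≠ dB act (xd σ lab d') := by
    intro d d' h
    have h1 : (lab d).1 = (lab (τ d')).1 := by
      have := congrArg Prod.fst h
      rw [dB_fst, xd_snd0] at this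
      rw [htp]; exact this
    have h2 : (lab d).2 = (lab (τ d')).2 := by
      have := congrFun (congrArg Prod.snd h) 0
      rw [dB_snd0, xd_snd0, xd_snd0] at this
      rw [htl]; exact this
    have h3 := hxi _ _ h1 h2
    rw [h3] at h
    exact hX.red d' (congrArg Prod.snd h)
  have hFp : ∀ d, F (xd σ lab d) = 1 := by
    intro d
    rw [hF, Finset.sum_eq_single d]
    · rw [if_pos rfl, if_neg (fun h => hneg _ _ h.symm)]; rfl
    · intro b _ hb
      rw [if_neg (fun h => hb (hi _ _ h)), if_neg (fun h => hneg _ _ h.symm)]; rfl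
    · simp
  have hFn : ∀ d, F (dB act (xd σ lab d)) = -1 := by
    intro d
    rw [hF, Finset.sum_eq_single d]
    · rw [if_pos rfl, if_neg (fun h => hneg _ _ h)]; rfl
    · intro b _ hb
      rw [if_neg (fun h => hneg _ _ h), if_neg (fun h => hb (hi _ _ (dB_inj ha h)))]; rfl
    · simp
  have hF0 : ∀ x, (∀ d, xd σ lab d ≠ x) → (∀ d, dB act (xd σ lab d) ≠ x) → F x = 0 := by
    intro x h1 h2
    rw [hF]
    apply Finset.sum_eq_zero
    intro d _
    rw [if_neg (h1 d), if_neg (h2 d)]; rfl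
  have hcase : ∀ x, (∃ d, xd σ lab d = x) ∨ (∃ d, dB act (xd σ lab d) = x) ∨ ((∀ d, xd σ lab d ≠ x) ∧ (∀ d, dB act (xd σ lab d) ≠ x)) := by
    intro x
    by_cases h1 : ∃ d, xd σ lab d = x
    · exact Or.inl h1
    by_cases h2 : ∃ d, dB act (xd σ lab d) = x
    · exact Or.inr (Or.inl h2)
    push Not at h1 h2
    exact Or.inr (Or.inr ⟨h1, h2⟩)
  have hF1 : ∀ x, F x = 1 → ∃ d, xd σ lab d = x := by
    intro x hx
    rcases hcase x with h | ⟨d, rfl⟩ | ⟨h1, h2⟩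
    · exact h
    · rw [hFn] at hx; norm_num at hx
    · rw [hF0 x h1 h2] at hx; norm_num at hx
  have hdg : ∀ d, Dg F (lab d).1 ↔ nc σ τ d := by
    intro d
    constructor
    · rintro ⟨x, y, z, hx, hy, hz, ex, ey, ez, n1, n2, n3⟩ hn
      obtain ⟨a, rfl⟩ := hF1 x hx
      obtain ⟨b, rfl⟩ := hF1 y hy
      obtain ⟨c, rfl⟩ := hF1 z hz
      have hh : ∀ a, (lab a).1 = (lab d).1 → a = d ∨ a = σ (τ d) := by
        intro a h
        rcases hX.nu3 hW (hinj _ _ h.symm) with e | e | e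
        · exact Or.inl e
        · exact Or.inr e
        · rw [hn] at e; exact Or.inl e
      have m1 : a ≠ b := fun e => n1 (by rw [e])
      have m2 : b ≠ c := fun e => n2 (by rw [e])
      have m3 : a ≠ c := fun e => n3 (by rw [e])
      clear hF1 hcase hF0 hFn hFp hneg
      rcases hh a ex with e1 | e1 <;> rcases hh b ey with e2 | e2 <;> rcases hh c ez with e3 | e3 <;>
        first
        | exact m1 (e1.trans e2.symm)
        | exact m2 (e2.trans e3.symm)
        | exact m3 (e1.trans e3.symm)
    · intro hn
      refine ⟨xd σ lab d, xd σ lab (σ (τ d)), xd σ lab (σ (τ (σ (τ d)))), hFp _, hFp _, hFp _, rfl, ?_, ?_, ?_, ?_, ?_⟩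
      · exact hvx _ _ (vx_nu d)
      · exact hvx _ _ ((vx_nu _).trans (vx_nu d))
      · exact fun h => hX.nu_ne hW d (hi _ _ h).symm
      · exact fun h => hX.nu_ne hW _ (hi _ _ h).symm
      · exact fun h => hn (hi _ _ h).symm
  refine ⟨?_, ?_, ?_, ?_, ?_, ?_, ?_, ?_, ?_⟩
  · intro x
    rcases hcase x with ⟨d, rfl⟩ | ⟨d, rfl⟩ | ⟨h1, h2⟩
    · exact Or.inl (hFp d)
    · exact Or.inr (Or.inr (hFn d))
    · exact Or.inr (Or.inl (hF0 x h1 h2))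
  · intro x hx
    obtain ⟨d, rfl⟩ := hF1 x hx
    exact hX.mem d
  · have hs : ∀ d, xd σ lab (σ⁻¹ d) = (dS ha)⁻¹ (xd σ lab d) := by
      intro d
      rw [Perm.eq_inv_iff_eq, ← xd_sig ha hp]; simp
    intro x
    rcases hcase x with ⟨d, rfl⟩ | ⟨d, rfl⟩ | ⟨h1, h2⟩
    · rw [← xd_sig ha hp, hFp, hFp]
    · have : dS ha (dB act (xd σ lab d)) = dB act (xd σ lab (σ⁻¹ d)) := by
        rw [← dS_dB ha (xd σ lab (σ⁻¹ d)), ← xd_sig ha hp]; simp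
      rw [this, hFn, hFn]
    · rw [hF0 x h1 h2]
      apply hF0
      · intro d h
        apply h1 (σ⁻¹ d)
        rw [hs, h]; simp
      · intro d h
        apply h2 (σ d)
        rw [xd_sig ha hp, dB_dS, h]; simp
  · intro x
    rcases hcase x with ⟨d, rfl⟩ | ⟨d, rfl⟩ | ⟨h1, h2⟩
    · rw [hFp, hFn]
    · rw [dB_dB ha, hFp, hFn]; rfl
    · rw [hF0 x h1 h2, hF0]; · rfl
      · intro d h
        exact h2 d (by rw [h, dB_dB ha])
      · intro d h
        exact h1 d (dB_inj ha h)
  · intro x y hx hy h1 h2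
    obtain ⟨a, rfl⟩ := hF1 x hx
    obtain ⟨b, rfl⟩ := hF1 y hy
    rw [xd_snd0, xd_snd0] at h2
    rw [hxi _ _ h1 h2]
  · intro x hx
    obtain ⟨a, rfl⟩ := hF1 x hx
    refine ⟨xd σ lab (τ a), hFp _, ?_, ?_⟩
    · rw [xd_snd0]; exact htp a
    · rw [xd_snd0, xd_snd0]; exact htl a
  · intro x y y' z hx hy hy' hz e1 e2 e3 e4 e5
    obtain ⟨a, rfl⟩ := hF1 x hx
    obtain ⟨b, rfl⟩ := hF1 y hy
    obtain ⟨c, rfl⟩ := hF1 y' hy'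
    obtain ⟨d, rfl⟩ := hF1 z hz
    rw [← xd_sig ha hp, xd_snd0] at e3
    rw [← xd_sig ha hp, xd_snd0, xd_snd0] at e4
    rw [xd_snd0] at e1
    rw [xd_snd0, xd_snd0] at e2
    have hb : b = τ a := hxi _ _ (by rw [htp]; exact e1) (by rw [htl]; exact e2)
    have hc : c = τ (σ b) := hxi _ _ (by rw [htp]; exact e3) (by rw [htl]; exact e4)
    rw [← xd_sig ha hp, ← xd_sig ha hp, hc, hb]
    rcases hX.nu3 hW (hinj _ _ e5.symm) with e | e | e
    · left; rw [e]
    · right; left; rw [e]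
    · right; right; rw [e]
  · intro x hx s hs
    obtain ⟨a, rfl⟩ := hF1 x hx
    apply hX.six a s
    intro k
    rw [hs k, ← xd_pow ha hp, ← hdg]
    rfl
  · intro x hx k m hc
    obtain ⟨a, rfl⟩ := hF1 x hx
    refine run_PC hW hX.inv2 hX.labt (hX.mem _) ?_ ?_
    · have := hX.red (τ ((σ ^ k) a))
      rw [hX.inv2] at this
      exact this
    · intro j h1 h2
      have := hc j h1 h2
      rw [← xd_pow ha hp] at this
      have h3 := (not_congr (hdg ((σ ^ j) a))).1 this
      simpa [nc] using h3

end
end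

section
variable {S : Type u} {P : Type v} {act : P → S × Bool → P} {P' : Type w} {act' : P' → S × Bool → P'}

theorem dS_equiv (ha : Act act) (ha' : Act act') {q : P → P'} (hq : ∀ p s, q (act p s) = act' (q p) s) (x) :
    (fun x : P × Rd(S) => (q x.1, x.2)) (dS ha x) = dS ha' (q x.1, x.2) := by
  simp [dS_apply, hq]

theorem dS_pow_equiv (ha : Act act) (ha' : Act act') {q : P → P'} (hq : ∀ p s, q (act p s) = act' (q p) s) (x) (k : ℤ) :
    (q ((dS ha ^ k) x).1, ((dS ha ^ k) x).2) = (dS ha' ^ k) (q x.1, x.2) := by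
  induction k using Int.induction_on generalizing x with
  | zero => simp
  | succ i ih =>
    rw [zpow_add, zpow_add, mul_apply, mul_apply, zpow_one, zpow_one, ih, ← dS_equiv ha ha' hq]
  | pred i ih =>
    rw [sub_eq_add_neg, zpow_add, zpow_add, mul_apply, mul_apply, zpow_neg_one, zpow_neg_one, ih]
    congr 1
    rw [Perm.eq_inv_iff_eq, ← dS_equiv ha ha' hq]
    simp

theorem dg_transfer {q : P → P'} {F : P × Rd(S) → ℤ} {F' : P' × Rd(S) → ℤ} {g : P}
    (h : ∀ f, F (g, f) = F' (q g, f)) : Dg F g ↔ Dg F' (q g) := by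
  constructor
  · rintro ⟨⟨_, x⟩, ⟨_, y⟩, ⟨_, z⟩, hx, hy, hz, h0, h1, h2, n1, n2, n3⟩
    simp only at h0 h1 h2
    rw [h0] at hx n1 n3
    rw [h1] at hy n1 n2
    rw [h2] at hz n2 n3
    refine ⟨(q g, x), (q g, y), (q g, z), ?_, ?_, ?_, rfl, rfl, rfl, ?_, ?_, ?_⟩
    · rw [← h, hx]
    · rw [← h, hy]
    · rw [← h, hz]
    · simpa using n1
    · simpa using n2
    · simpa using n3
  · rintro ⟨⟨_, x⟩, ⟨_, y⟩, ⟨_, z⟩, hx, hy, hz, rfl, h1, h2, n1, n2, n3⟩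
    simp only at h1 h2
    subst h1 h2
    refine ⟨(g, x), (g, y), (g, z), ?_, ?_, ?_, rfl, rfl, rfl, ?_, ?_, ?_⟩
    · rw [h, hx]
    · rw [h, hy]
    · rw [h, hz]
    · simpa using n1
    · simpa using n2
    · simpa using n3

theorem Flat.transfer {W : Set Wd(S)} (ha : Act act) {F : P × Rd(S) → ℤ}
    (H : ∀ X : Set P, X.Finite → ∃ (P' : Type w) (act' : P' → S × Bool → P') (ha' : Act act') (q : P → P')
      (F' : P' × Rd(S) → ℤ), (∀ p s, q (act p s) = act' (q p) s) ∧ Flat W ha' F' ∧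
      ∀ g ∈ X, ∀ f, F (g, f) = F' (q g, f)) : Flat W ha F := by
  refine ⟨?_, ?_, ?_, ?_, ?_, ?_, ?_, ?_, ?_⟩
  · intro x
    obtain ⟨P', act', ha', q, F', hq, hf, he⟩ := H {x.1} (Set.finite_singleton _)
    have := he x.1 rfl x.2
    rw [show F x = _ from this]
    exact hf.one _
  · intro x hx
    obtain ⟨P', act', ha', q, F', hq, hf, he⟩ := H {x.1} (Set.finite_singleton _)
    have := he x.1 rfl x.2
    exact hf.mem (q x.1, x.2) (this.symm.trans hx)
  · intro x
    obtain ⟨P', act', ha', q, F', hq, hf, he⟩ := H {x.1, (dS ha x).1} (by simp)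
    have h1 := he x.1 (by simp) x.2
    have h2 := he (dS ha x).1 (by simp) (dS ha x).2
    have h3 := dS_equiv ha ha' hq x
    simp only at h3 h1 h2
    rw [h3, hf.sig] at h2
    exact h2.trans h1.symm
  · intro x
    obtain ⟨P', act', ha', q, F', hq, hf, he⟩ := H {x.1, (dB act x).1} (by simp)
    have h1 := he x.1 (by simp) x.2
    have h2 := he (dB act x).1 (by simp) (dB act x).2
    have h3 : (q (dB act x).1, (dB act x).2) = dB act' (q x.1, x.2) := by simp [dB, hq]
    rw [h3, hf.bar, ← h1] at h2
    exact h2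
  · intro x y hx hy e1 e2
    obtain ⟨P', act', ha', q, F', hq, hf, he⟩ := H {x.1, y.1} (by simp)
    have h1 := he x.1 (by simp) x.2
    have h2 := he y.1 (by simp) y.2
    have := hf.uniq (q x.1, x.2) (q y.1, y.2) (h1.symm.trans hx) (h2.symm.trans hy) (by simp [e1]) e2
    exact Prod.ext e1 (Prod.ext_iff.1 this).2
  · intro x hx
    obtain ⟨P', act', ha', q, F', hq, hf, he⟩ := H {x.1, act x.1 (x.2 0)} (by simp)
    have h1 := he x.1 (by simp) x.2
    obtain ⟨y, hy, e1, e2⟩ := hf.part (q x.1, x.2) (h1.symm.trans hx)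
    refine ⟨(act x.1 (x.2 0), y.2), ?_, rfl, e2⟩
    rw [he _ (by simp), hq]
    simp only at e1
    rw [← e1]; exact hy
  · intro x y y' z hx hy hy' hz e1 e2 e3 e4 e5
    obtain ⟨P', act', ha', q, F', hq, hf, he⟩ := H {x.1, y.1, y'.1, z.1} (by simp)
    have h1 := he x.1 (by simp) x.2
    have h2 := he y.1 (by simp) y.2
    have h3 := he y'.1 (by simp) y'.2
    have h4 := he z.1 (by simp) z.2
    have k1 : (dS ha y).1 = x.1 := by rw [dS_fst, e1, e2, ha.back]
    have k2 : (dS ha y').1 = x.1 := by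
      rw [dS_fst, e3, e4, ha.back, k1]
    have := hf.conn (q x.1, x.2) (q y.1, y.2) (q y'.1, y'.2) (q z.1, z.2) (h1.symm.trans hx) (h2.symm.trans hy)
      (h3.symm.trans hy') (h4.symm.trans hz) (by simp [e1, hq]) e2 (by
        have h5 := dS_equiv ha ha' hq y
        simp only at h5
        rw [← h5]
        simp only [e3, hq]) e4 (by simp [e5])
    rcases this with e | e | e
    · left; exact Prod.ext e5 (Prod.ext_iff.1 e).2
    · right; left; exact Prod.ext (e5.trans k1.symm) (Prod.ext_iff.1 e).2
    · right; right; exact Prod.ext (e5.trans k2.symm) (Prod.ext_iff.1 e).2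
  · intro x hx s hs
    obtain ⟨P', act', ha', q, F', hq, hf, he⟩ := H ({x.1} ∪ (fun k : ℤ => ((dS ha ^ k) x).1) '' (Ico 0 (prd W x.2 : ℤ) : Set ℤ))
      ((Set.finite_singleton _).union ((Finset.finite_toSet _).image _))
    have h1 := he x.1 (by simp) x.2
    apply hf.six (q x.1, x.2) (h1.symm.trans hx) s
    intro k
    rw [hs k]
    refine and_congr_right fun h1 => and_congr_right fun h2 => ?_
    rw [← dS_pow_equiv ha ha' hq]
    apply dg_transfer
    intro f
    apply he
    right
    exact ⟨k, by simp only [Finset.coe_Ico, Set.mem_Ico]; exact ⟨h1, h2⟩, rfl⟩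
  · intro x hx k m hc
    obtain ⟨P', act', ha', q, F', hq, hf, he⟩ := H ({x.1} ∪ (fun k : ℤ => ((dS ha ^ k) x).1) '' (Ioo k (k + m) : Set ℤ))
      ((Set.finite_singleton _).union ((Finset.finite_toSet _).image _))
    have h1 := he x.1 (by simp) x.2
    apply hf.pc (q x.1, x.2) (h1.symm.trans hx) k m
    intro j j1 j2 hd
    apply hc j j1 j2
    rw [← dS_pow_equiv ha ha' hq] at hd
    refine (dg_transfer (q := q) ?_).2 hd
    intro f
    apply he
    right
    exact ⟨j, by simp only [Finset.coe_Ioo, Set.mem_Ioo]; exact ⟨j1, j2⟩, rfl⟩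

end

theorem sum_range_shift {A : Type*} [AddCommGroup A] (g : ℤ → A) (n : ℕ) (h : g n = g 0) :
    ∑ k ∈ Finset.range n, g ((k : ℤ) + 1) = ∑ k ∈ Finset.range n, g k := by
  have h1 := Finset.sum_range_succ (fun k : ℕ => g k) n
  have h2 := Finset.sum_range_succ' (fun k : ℕ => g k) n
  rw [h1] at h2
  simp only [Nat.cast_zero, Nat.cast_add, Nat.cast_one, h] at h2
  exact (add_right_cancel h2).symm

theorem rd_map {E : Type u} {E' : Type v} (f : E → E') {w : List E} (hw : w ≠ []) (k : ℤ) :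
    rd (w.map f) (by simpa using hw) k = f (rd w hw k) := by
  unfold rd
  simp

theorem rd_ebar' {E : Type u} {inv : E → E} {w : List E} (hw : w ≠ []) (k : ℤ) :
    rd (ebar inv w) (ebar_ne_nil.2 hw) k = inv (rd w hw (-1 - k)) := by
  have hpos : 0 < w.length := length_pos_iff.2 hw
  unfold rd ebar
  simp only [List.getElem_reverse, List.getElem_map, length_map, List.length_reverse]
  congr 2
  have h1 := Int.emod_nonneg k (b := w.length) (by omega)
  have h2 := Int.emod_lt_of_pos k (b := w.length) (by omega)
  have h3 : (-1 - k) % (w.length : ℤ) = w.length - 1 - k % w.length := by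
    have : (-1 - k) = (w.length - 1 - k % w.length) + w.length * (- (k / w.length) - 1) := by
      have := Int.emod_add_mul_ediv k w.length
      linear_combination this
    rw [this, Int.add_mul_emod_self_left, Int.emod_eq_of_lt (by omega) (by omega)]
  rw [h3]
  omega

section
variable {S : Type u} {P : Type v} {act : P → S × Bool → P} {A : Type*} [AddCommGroup A]

/-- dart number `k` of a closed path -/
def XX (w : List (P × (S × Bool))) (hw : w ≠ []) (k : ℤ) : P × Rd(S) :=
  ((rd w hw k).1, fun i => (rd w hw (i + k)).2)

theorem XX_snd0 (w : List (P × (S × Bool))) (hw : w ≠ []) (k : ℤ) : (XX w hw k).2 0 = (rd w hw k).2 := by simp [XX]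

theorem XX_rotate (w : List (P × (S × Bool))) (hw : w ≠ []) (k : ℤ) :
    XX (w.rotate 1) (by simpa using hw) k = XX w hw (k + 1) := by
  unfold XX
  have h : ∀ k, rd (w.rotate 1) (by simpa using hw) k = rd w hw (k + 1) := fun k => by
    rw [rd_rotate hw]; rfl
  simp only [h, add_assoc]

theorem XX_len (w : List (P × (S × Bool))) (hw : w ≠ []) (k : ℤ) : XX w hw (k + w.length) = XX w hw k := by
  unfold XX
  simp only [← add_assoc, rd_add_length]

theorem XX_ebar (w : List (P × (S × Bool))) (hw : w ≠ []) (k : ℤ) :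
    XX (ebar (einv act) w) (ebar_ne_nil.2 hw) k = dB act (XX w hw (-1 - k)) := by
  refine Prod.ext ?_ ?_
  · rw [dB_fst, XX_snd0]
    simp only [XX, rd_ebar' hw]
    rfl
  · funext i
    simp only [XX, rd_ebar' hw, dB, mir, einv]
    congr 3; ring

open Classical in
/-- value of a test function on the chain of a closed path -/
noncomputable def phs (act : P → S × Bool → P) (g : P × Rd(S) → A) (w : List (P × (S × Bool))) : A :=
  if hw : w ≠ [] then ∑ k ∈ Finset.range w.length, (g (XX w hw k) - g (dB act (XX w hw k))) else 0

theorem phs_ne (g : P × Rd(S) → A) {w : List (P × (S × Bool))} (hw : w ≠ []) :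
    phs act g w = ∑ k ∈ Finset.range w.length, (g (XX w hw k) - g (dB act (XX w hw k))) := by
  unfold phs; rw [dif_pos hw]

theorem phs_rot (g : P × Rd(S) → A) (w : List (P × (S × Bool))) : phs act g (w.rotate 1) = phs act g w := by
  by_cases hw : w = []
  · simp [hw]
  rw [phs_ne g hw, phs_ne g (by simpa using hw), List.length_rotate]
  have hrot : ∀ k : ℤ, XX (w.rotate 1) (by simpa using hw) k = XX w hw (k + 1) := XX_rotate w hw
  rw [sum_congr rfl (fun k _ => by rw [hrot])]
  refine sum_range_shift (fun k => g (XX w hw k) - g (dB act (XX w hw k))) w.length ?_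
  have := XX_len w hw 0
  rw [zero_add] at this
  simp only [this]

theorem phs_bar (ha : Act act) (g : P × Rd(S) → A) (w : List (P × (S × Bool))) :
    phs act g (ebar (einv act) w) = - phs act g w := by
  by_cases hw : w = []
  · simp [hw, ebar, phs]
  rw [phs_ne g hw, phs_ne g (ebar_ne_nil.2 hw), ebar_length, ← Finset.sum_neg_distrib,
    ← Finset.sum_range_reflect _ w.length]
  apply sum_congr rfl
  intro k hk
  rw [Finset.mem_range] at hk
  have h1 : XX (ebar (einv act) w) (ebar_ne_nil.2 hw) ((w.length - 1 - k : ℕ) : ℤ) = dB act (XX w hw k) := by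
    rw [XX_ebar w hw, ← XX_len w hw]
    congr 2
    omega
  rw [h1, dB_dB ha, neg_sub]

/-- value of a test function on the chain of a filling -/
noncomputable def chn (act : P → S × Bool → P) (g : P × Rd(S) → A) (p : P)
    (l : Fi(S)) : A :=
  (l.map (fun x => phs act g (pw act (pend act p x.1) x.2))).sum

/-- `w` can be filled from `p` with chain `c` -/
def Fil (W : Set Wd(S)) (act : P → S × Bool → P) (g : P × Rd(S) → A) (p : P) (w : FreeGroup S) (c : A) : Prop :=
  ∃ l : Fi(S), (∀ x ∈ l, x.2 ∈ W) ∧ fgMk (cjl l) = w ∧ chn act g p l = c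

variable {W : Set Wd(S)} {g : P × Rd(S) → A} {p : P}

theorem Fil.mul {w w' : FreeGroup S} {c c' : A} (h : Fil W act g p w c) (h' : Fil W act g p w' c') :
    Fil W act g p (w * w') (c + c') := by
  obtain ⟨l, h1, h2, h3⟩ := h
  obtain ⟨l', h1', h2', h3'⟩ := h'
  refine ⟨l ++ l', ?_, ?_, ?_⟩
  · intro x hx
    rcases List.mem_append.1 hx with h | h
    · exact h1 x h
    · exact h1' x h
  · rw [mk_cjl, map_append, List.prod_append, ← mk_cjl, ← mk_cjl, h2, h2']
  · rw [chn, map_append, List.sum_append, ← chn, ← chn, h3, h3']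

theorem Fil.one : Fil W act g p 1 0 := ⟨[], by simp, rfl, rfl⟩

theorem Fil.conj {v : Wd(S)} {w : FreeGroup S} {c : A} (h : Fil W act g (pend act p v) w c) :
    Fil W act g p (fgMk v * w * (fgMk v)⁻¹) c := by
  obtain ⟨l, h1, h2, h3⟩ := h
  refine ⟨l.map (fun x => (v ++ x.1, x.2)), ?_, ?_, ?_⟩
  · intro x hx
    obtain ⟨y, hy, rfl⟩ := mem_map.1 hx
    exact h1 y hy
  · rw [← h2]
    clear h1 h2 h3
    induction l with
    | nil =>
      have : fgMk (cjl ([] : Fi(S))) = 1 := rfl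
      simp only [List.map_nil, this]
      group
    | cons x l ih =>
      rw [mk_cjl] at ih ⊢
      rw [mk_cjl] at ih ⊢
      simp only [map_cons, List.prod_cons, ih, ← mul_mk]
      group
  · rw [← h3, chn, chn, map_map]
    congr 1
    apply map_congr_left
    intro x _
    simp only [Function.comp, pend_append]

theorem Fil.inv (ha : Act act) (hW : SC W) (hr : ∀ r ∈ W, ∀ p, pend act p r = p) {w : FreeGroup S} {c : A} (h : Fil W act g p w c) :
    Fil W act g p w⁻¹ (-c) := by
  obtain ⟨l, h1, h2, h3⟩ := h
  refine ⟨(l.map (fun x => (x.1, ebar linv x.2))).reverse, ?_, ?_, ?_⟩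
  · intro x hx
    obtain ⟨y, hy, rfl⟩ := mem_map.1 (List.mem_reverse.1 hx)
    exact hW.bar _ (h1 y hy)
  · rw [← h2, mk_cjl, mk_cjl, List.prod_inv_reverse, List.map_reverse]
    congr 2
    rw [map_map, map_map]
    apply map_congr_left
    intro x _
    simp only [Function.comp, mk_ebar]
    group
  · rw [← h3, chn, chn, List.map_reverse, List.sum_reverse, map_map]
    clear h2 h3
    induction l with
    | nil => simp
    | cons x l ih =>
      rw [map_cons, List.sum_cons, ih (fun y hy => h1 y (by simp [hy])), map_cons, List.sum_cons, neg_add]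
      congr 1
      simp only [Function.comp]
      have h4 := hr x.2 (h1 x (by simp)) (pend act p x.1)
      have h5 := pw_ebar ha (pend act p x.1) x.2
      rw [h4] at h5
      rw [h5, phs_bar ha]

/-- every element of the normal closure has a filling -/
theorem exists_fill (hW : SC W) {w : FreeGroup S} (hw : w ∈ Subgroup.normalClosure (fgMk '' W)) :
    ∃ l : Fi(S), (∀ x ∈ l, x.2 ∈ W) ∧ fgMk (cjl l) = w := by
  have ha : Act (fun (p : PUnit.{1}) (s : S × Bool) => p) := ⟨fun _ _ => rfl⟩
  suffices h : Fil (A := ℤ) W (fun (p : PUnit.{1}) (s : S × Bool) => p) 0 PUnit.unit w 0 by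
    obtain ⟨l, h1, h2, -⟩ := h
    exact ⟨l, h1, h2⟩
  rw [Subgroup.normalClosure] at hw
  induction hw using Subgroup.closure_induction with
  | mem x hx =>
    rw [Group.mem_conjugatesOfSet_iff] at hx
    obtain ⟨a, ⟨r, hr, rfl⟩, hc⟩ := hx
    obtain ⟨c, rfl⟩ := isConj_iff.1 hc
    refine ⟨[(Quot.out c, r)], by simpa using hr, ?_, ?_⟩
    · rw [mk_cjl]
      have : fgMk (Quot.out c) = c := Quot.out_eq c
      simp only [map_cons, List.map_nil, List.prod_cons, List.prod_nil, mul_one, this]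
    · simp [chn, phs]
  | one => exact Fil.one
  | mul x y _ _ h1 h2 => simpa using h1.mul h2
  | inv x _ h => simpa using h.inv ha hW (fun _ _ _ => rfl)

end

/-- discrete Heisenberg group -/
@[ext] structure Hs where
  a : ℤ
  b : ℤ
  c : ℤ

namespace Hs

instance : Mul Hs := ⟨fun x y => ⟨x.a + y.a, x.b + y.b, x.c + y.c + x.a * y.b⟩⟩
instance : One Hs := ⟨⟨0, 0, 0⟩⟩
instance : Inv Hs := ⟨fun x => ⟨-x.a, -x.b, x.a * x.b - x.c⟩⟩

@[simp] theorem mul_a (x y : Hs) : (x * y).a = x.a + y.a := rfl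
@[simp] theorem mul_b (x y : Hs) : (x * y).b = x.b + y.b := rfl
@[simp] theorem mul_c (x y : Hs) : (x * y).c = x.c + y.c + x.a * y.b := rfl
@[simp] theorem one_a : (1 : Hs).a = 0 := rfl
@[simp] theorem one_b : (1 : Hs).b = 0 := rfl
@[simp] theorem one_c : (1 : Hs).c = 0 := rfl
@[simp] theorem inv_a (x : Hs) : (x⁻¹).a = -x.a := rfl
@[simp] theorem inv_b (x : Hs) : (x⁻¹).b = -x.b := rfl
@[simp] theorem inv_c (x : Hs) : (x⁻¹).c = x.a * x.b - x.c := rfl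

instance : Group Hs := Group.ofLeftAxioms
  (by intro x y z; ext <;> simp <;> ring)
  (by intro x; ext <;> simp)
  (by intro x; ext <;> simp)

/-- central part -/
def kk (x : Hs) : ℤ := if x.a = 0 ∧ x.b = 0 then x.c else 0

theorem kk_conj (x y : Hs) : kk (y * x * y⁻¹) = kk x := by
  unfold kk
  have h1 : (y * x * y⁻¹).a = x.a := by simp
  have h2 : (y * x * y⁻¹).b = x.b := by simp
  rw [h1, h2]
  split_ifs with h
  · simp [h.1, h.2]; ring
  · rfl

theorem kk_inv (x : Hs) : kk x⁻¹ = - kk x := by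
  unfold kk
  simp only [inv_a, inv_b, neg_eq_zero, inv_c]
  split_ifs with h
  · simp [h.1]
  · rfl

end Hs

section
variable {S : Type u}

/-- letter to Heisenberg -/
def hlt (p q : S → ℤ) (s : S × Bool) : Hs := cond s.2 ⟨p s.1, q s.1, 0⟩ (⟨p s.1, q s.1, 0⟩ : Hs)⁻¹

def hH (p q : S → ℤ) : FreeGroup S →* Hs := FreeGroup.lift (fun s => ⟨p s, q s, 0⟩)

theorem hH_mk (p q : S → ℤ) (w : Wd(S)) : hH p q (fgMk w) = (w.map (hlt p q)).prod := by
  rw [hH, FreeGroup.lift_mk]; rfl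

theorem hlt_linv (p q : S → ℤ) (s : S × Bool) : hlt p q (linv s) = (hlt p q s)⁻¹ := by
  obtain ⟨s, b⟩ := s
  cases b <;> simp [hlt, linv]

/-- area invariant of a word -/
def kw (p q : S → ℤ) (w : Wd(S)) : ℤ := Hs.kk (hH p q (fgMk w))

theorem kw_rot (p q : S → ℤ) (w : Wd(S)) : kw p q (w.rotate 1) = kw p q w := by
  rcases w with _ | ⟨s, w⟩
  · rfl
  · simp only [List.rotate_cons_succ, List.rotate_zero, kw]
    rw [← Hs.kk_conj _ (hH p q (fgMk [s])), ← map_inv, ← map_mul, ← map_mul, ← mul_mk]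
    have : (fgMk (s :: w)) = fgMk [s] * fgMk w := by rw [mul_mk]; rfl
    rw [this]
    congr 2
    group

theorem kw_bar (p q : S → ℤ) (w : Wd(S)) : kw p q (ebar linv w) = - kw p q w := by
  rw [kw, mk_ebar, map_inv, Hs.kk_inv, kw]

end

section
variable {D : Type} {σ τ : Perm D}

theorem TP_rev (hi : ∀ d, τ (τ d) = d) {x y : Quotient (sc (σ * τ))} {γ : List D} (h : TP σ τ x γ y) :
    TP σ τ y (ebar τ γ) x := by
  induction γ generalizing x with
  | nil => exact h.symm
  | cons d γ ih =>
    have : ebar τ (d :: γ) = ebar τ γ ++ [τ d] := by simp [ebar]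
    rw [this, TP_append]
    refine ⟨_, ih h.2, rfl, ?_⟩
    rw [hi]; exact h.1

theorem TP_conn (hi : ∀ d, τ (τ d) = d) (hc : ∀ x y, (sc σ ⊔ sc (σ * τ)) x y) (x y : D) : ∃ γ, TP σ τ (vx σ τ x) γ (vx σ τ y) := by
  let s : Setoid D := {
    r := fun x y => ∃ γ, TP σ τ (vx σ τ x) γ (vx σ τ y)
    iseqv := ⟨fun x => ⟨[], rfl⟩, fun ⟨γ, h⟩ => ⟨_, TP_rev hi h⟩, fun ⟨γ, h⟩ ⟨γ', h'⟩ => ⟨γ ++ γ', TP_append.2 ⟨_, h, h'⟩⟩⟩ }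
  have h1 : sc σ ≤ s := sc_le_of (fun x => ⟨[x], rfl, by
    have := vx_nu (σ := σ) (τ := τ) (τ x)
    rw [hi] at this
    exact this.symm⟩)
  have h2 : sc (σ * τ) ≤ s := sc_le_of (fun x => ⟨[], (vx_nu x).symm⟩)
  exact (sup_le h1 h2) (hc x y)

theorem TP_face (hi : ∀ d, τ (τ d) = d) {l : List D} (hl : l ≠ []) (h : l.map σ = l.rotate 1) :
    ∃ x, TP σ τ x l x := by
  have hr : l = (List.range l.length).map (fun k : ℕ => (σ ^ (k : ℤ)) (rd l hl 0)) := by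
    apply List.ext_getElem
    · simp
    · intro i h1 h2
      rw [List.getElem_map, List.getElem_range, cyc_pow hl h, ← rd_natCast hl h1]; simp
  have h1 := TP_rng (σ := σ) (τ := τ) (fun k : ℕ => (σ ^ (k : ℤ)) (rd l hl 0)) (fun k : ℕ => vx σ τ ((σ ^ (k : ℤ)) (rd l hl 0))) l.length ?_
  · rw [← hr] at h1
    refine ⟨vx σ τ ((σ ^ ((0 : ℕ) : ℤ)) (rd l hl 0)), ?_⟩
    have h2 : (σ ^ ((l.length : ℕ) : ℤ)) (rd l hl 0) = (σ ^ ((0 : ℕ) : ℤ)) (rd l hl 0) := by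
      rw [cyc_pow hl h, rd_add_length]; simp
    simp only [h2] at h1
    exact h1
  · intro k hk
    refine ⟨rfl, ?_⟩
    have := vx_nu (σ := σ) (τ := τ) (τ ((σ ^ (k : ℤ)) (rd l hl 0)))
    rw [hi] at this
    rw [← this]
    congr 1
    rw [← mul_apply, ← zpow_one_add, add_comm]
    push_cast
    rfl

theorem sum_flatten_univ [Fintype D] {fs : List (List D)} (hn : fs.flatten.Nodup) (ha : ∀ d, d ∈ fs.flatten)
    {A : Type*} [AddCommGroup A] (f : D → A) : ∑ d, f d = (fs.map (fun l => (l.map f).sum)).sum := by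
  classical
  have h1 : (univ : Finset D) = fs.flatten.toFinset := by
    ext d; simpa using ha d
  rw [h1, List.sum_toFinset _ hn, List.map_flatten, List.sum_flatten, map_map]
  rfl

/-- holonomy -/
theorem hol [Fintype D] {S : Type u} (p q : S → ℤ) {ℓ : D → S × Bool} {fs : List (List D)} (h : OK linv σ τ ℓ fs)
    (x0 : Quotient (sc (σ * τ))) (hc : ∀ d, ∃ γ, TP σ τ x0 γ (vx σ τ d))
    (hf : ∀ l ∈ fs, (hH p q (fgMk (l.map ℓ))).a = 0 ∧ (hH p q (fgMk (l.map ℓ))).b = 0) :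
    ∃ γ, TP σ τ x0 γ x0 ∧ (hH p q (fgMk (γ.map ℓ))).a = (fs.map (fun l => kw p q (l.map ℓ))).sum ∧
      (hH p q (fgMk (γ.map ℓ))).b = 0 := by
  let hw : List D → Hs := fun γ => hH p q (fgMk (γ.map ℓ))
  have hw_app : ∀ γ γ', hw (γ ++ γ') = hw γ * hw γ' := by
    intro γ γ'
    simp only [hw]
    rw [← map_mul, mul_mk, map_append]
  have hw_bar : ∀ γ, hw (ebar τ γ) = (hw γ)⁻¹ := by
    intro γ
    simp only [hw]
    rw [← map_inv, ← mk_ebar]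
    congr 2
    simp [ebar, h.labt]
  have hw_one : ∀ d, hw [d] = hlt p q (ℓ d) := by
    intro d; simp only [hw]; rw [hH_mk]; simp
  have hw_t : ∀ d, hw [τ d] = (hw [d])⁻¹ := by
    intro d; rw [hw_one, hw_one, h.labt, hlt_linv]
  let Λ : AddSubgroup (ℤ × ℤ) := {
    carrier := {v | ∃ γ, TP σ τ x0 γ x0 ∧ (hw γ).a = v.1 ∧ (hw γ).b = v.2}
    add_mem' := by
      rintro v v' ⟨γ, h1, h2, h3⟩ ⟨γ', h1', h2', h3'⟩
      exact ⟨γ ++ γ', TP_append.2 ⟨_, h1, h1'⟩, by rw [hw_app]; simp [h2, h2'], by rw [hw_app]; simp [h3, h3']⟩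
    zero_mem' := ⟨[], rfl, rfl, rfl⟩
    neg_mem' := by
      rintro v ⟨γ, h1, h2, h3⟩
      exact ⟨_, TP_rev h.inv2 h1, by rw [hw_bar]; simp [h2], by rw [hw_bar]; simp [h3]⟩ }
  let mk : ℤ × ℤ →+ (ℤ × ℤ) ⧸ Λ := QuotientAddGroup.mk' Λ
  suffices hs : mk ((fs.map (fun l => kw p q (l.map ℓ))).sum, 0) = 0 by
    have : ((fs.map (fun l => kw p q (l.map ℓ))).sum, (0 : ℤ)) ∈ Λ := (QuotientAddGroup.eq_zero_iff _).1 hs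
    exact this
  have hc' : ∀ x : Quotient (sc (σ * τ)), ∃ γ, TP σ τ x0 γ x := by
    intro x
    induction x using Quotient.inductionOn with
    | h d => exact hc d
  choose pth hpth using hc'
  let u : Quotient (sc (σ * τ)) → (ℤ × ℤ) ⧸ Λ := fun x => mk ((hw (pth x)).a, (hw (pth x)).b)
  have hu : ∀ d, u (vx σ τ (τ d)) = u (vx σ τ d) + mk ((hw [d]).a, (hw [d]).b) := by
    intro d
    simp only [u]
    rw [← map_add, ← sub_eq_zero, ← map_sub]
    apply (QuotientAddGroup.eq_zero_iff _).2
    refine ⟨pth (vx σ τ (τ d)) ++ ([τ d] ++ ebar τ (pth (vx σ τ d))), ?_, ?_, ?_⟩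
    · rw [TP_append]
      refine ⟨_, hpth _, rfl, ?_⟩
      rw [h.inv2]
      exact TP_rev h.inv2 (hpth _)
    · rw [hw_app, hw_app, hw_bar, hw_t]; simp; ring
    · rw [hw_app, hw_app, hw_bar, hw_t]; simp; ring
  let t : ℤ → ℤ := fun n => n * (n - 1) / 2
  have ht : ∀ a b, t (a + b) = t a + t b + a * b := by
    intro a b
    have e : ∀ n, 2 * t n = n * (n - 1) := by
      intro n
      apply Int.mul_ediv_cancel'
      have := Int.even_mul_pred_self n
      exact this.two_dvd
    have := e (a + b)
    have := e a
    have := e b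
    nlinarith
  have t0 : t 0 = 0 := by simp [t]
  let Ψ : D → (ℤ × ℤ) ⧸ Λ := fun d => (hw [d]).b • u (vx σ τ d) + mk ((hw [d]).c, t (hw [d]).b)
  have hΨ : ∀ d, Ψ d + Ψ (τ d) = 0 := by
    intro d
    simp only [Ψ]
    rw [hu, hw_t]
    simp only [Hs.inv_b, Hs.inv_c, smul_add, neg_smul, ← map_zsmul, ]
    have e1 : t (- (hw [d]).b) = (hw [d]).b * (hw [d]).b - t (hw [d]).b := by
      have := ht (hw [d]).b (-(hw [d]).b)
      rw [add_neg_cancel, t0] at this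
      linarith
    have e2 : mk ((hw [d]).c, t (hw [d]).b) + (-mk ((hw [d]).b • ((hw [d]).a, (hw [d]).b))
        + mk ((hw [d]).a * (hw [d]).b - (hw [d]).c, t (-(hw [d]).b))) = 0 := by
      rw [← map_neg, ← map_add, ← map_add, e1]
      rw [← map_zero mk]
      congr 1
      ext
      · simp; ring
      · simp; ring
    rw [← e2]
    abel
  have hsum : ∑ d, Ψ d = 0 := by
    apply Finset.sum_involution (fun d _ => τ d)
    · intro d _; exact hΨ d
    · intro d _ _; exact h.fpf d
    · intro d _; simp
    · intro d _; exact h.inv2 d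
  have hpath : ∀ (γ : List D) x y, TP σ τ x γ y → (γ.map Ψ).sum = (hw γ).b • u x + mk ((hw γ).c, t (hw γ).b) := by
    intro γ
    induction γ with
    | nil =>
      intro x y _
      have : hw [] = 1 := rfl
      rw [this]
      simp only [List.map_nil, List.sum_nil, Hs.one_b, Hs.one_c, zero_smul, t0, zero_add]
      exact (map_zero mk).symm
    | cons d γ ih =>
      rintro x y ⟨rfl, h2⟩
      rw [map_cons, List.sum_cons, ih _ _ h2, hu]
      have e : hw (d :: γ) = hw [d] * hw γ := hw_app [d] γ
      rw [e]
      simp only [Ψ, Hs.mul_b, Hs.mul_c, ht]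
      rw [smul_add (hw γ).b (u (vx σ τ d)), add_zsmul, ← map_zsmul mk (hw γ).b ((hw [d]).a, (hw [d]).b)]
      have e2 : mk ((hw [d]).c, t (hw [d]).b) + (mk ((hw γ).b • ((hw [d]).a, (hw [d]).b)) + mk ((hw γ).c, t (hw γ).b))
        = mk ((hw [d]).c + (hw γ).c + (hw [d]).a * (hw γ).b, t (hw [d]).b + t (hw γ).b + (hw [d]).b * (hw γ).b) := by
        rw [← map_add, ← map_add]
        congr 1
        ext
        · simp; ring
        · simp; ring
      rw [← e2]
      abel
  rw [sum_flatten_univ h.nd h.all] at hsum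
  rw [← hsum]
  have hface : ∀ l ∈ fs, (l.map Ψ).sum = mk (kw p q (l.map ℓ), 0) := by
    intro l hl
    obtain ⟨x, hx⟩ := TP_face h.inv2 (h.ne l hl) (h.cyc l hl)
    rw [hpath l x x hx]
    have h1 : (hw l).b = 0 := (hf l hl).2
    have h2 : kw p q (l.map ℓ) = (hw l).c := by
      unfold kw Hs.kk
      rw [if_pos (hf l hl)]
    rw [h1, h2, t0, zero_smul, zero_add]
  rw [map_congr_left hface]
  clear hface hsum hpath
  have : ∀ L : List (List D), mk ((L.map (fun l => kw p q (l.map ℓ))).sum, 0) = (L.map (fun l => mk (kw p q (l.map ℓ), 0))).sum := by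
    intro L
    induction L with
    | nil => exact map_zero mk
    | cons l L ih =>
      rw [map_cons, List.sum_cons, map_cons, List.sum_cons, ← ih, ← map_add]
      simp
  exact this fs

end

theorem lsum_fst {A B : Type*} [AddCommGroup A] [AddCommGroup B] (l : List (A × B)) : l.sum.1 = (l.map Prod.fst).sum := by
  induction l with
  | nil => rfl
  | cons a l ih => simp [ih]

theorem lsum_snd {A B : Type*} [AddCommGroup A] [AddCommGroup B] (l : List (A × B)) : l.sum.2 = (l.map Prod.snd).sum := by
  induction l with
  | nil => rfl
  | cons a l ih => simp [ih]

theorem lsum_neg {α A : Type*} [AddCommGroup A] (l : List α) (f : α → A) : - (l.map f).sum = (l.map (fun x => - f x)).sum := by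
  induction l with
  | nil => simp
  | cons a l ih => simp only [map_cons, List.sum_cons, ← ih]; abel

section
variable {S : Type u} {W : Set Wd(S)} {D : Type} {σ τ : Perm D}

theorem closed_of_trivial {ℓ : D → S × Bool} (hW : SC W) (hX : Hex W σ τ ℓ) {x y : Quotient (sc (σ * τ))} {γ : List D}
    (hT : TP σ τ x γ y) (hγ : fgMk (γ.map ℓ) ∈ Subgroup.normalClosure (fgMk '' W)) : x = y := by
  by_contra hxy
  obtain ⟨l, h1, h2⟩ := exists_fill hW hγ
  have hne : γ ≠ [] := by rintro rfl; exact hxy hT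
  have ha : Act (fun (p : PUnit.{1}) (s : S × Bool) => p) := ⟨fun _ _ => rfl⟩
  have h3 := St.fillDisc ha (p := PUnit.unit) l (fun x hx => ⟨hW.ne _ (h1 x hx), rfl⟩)
    (w := ebar linv (γ.map ℓ)) (ebar_ne_nil.2 (by simpa using hne)) rfl (by rw [mk_ebar, h2]; exact inv_mul_cancel _)
  have h4 := St.map (inv' := linv) (f := Prod.snd) (fun _ => rfl) h3
  rw [map_cons, pw_snd, ebar_ebar linv_linv] at h4
  refine bad_false hW hX _ ⟨x, y, γ, _, hT, hxy, ?_, h4, rfl⟩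
  intro r hr
  simp only [mem_map] at hr
  obtain ⟨_, ⟨z, hz, rfl⟩, rfl⟩ := hr
  rw [pw_snd]
  exact hW.bar _ (h1 z hz)

end

section
variable {S : Type u} {P : Type v} {act : P → S × Bool → P}

open Classical in
/-- dart indicator -/
noncomputable def dlt (x : P × Rd(S)) : P × Rd(S) → ℤ := fun y => if x = y then 1 else 0

variable {D : Type} {σ τ : Perm D} {lab : D → P × (S × Bool)}

theorem XX_xd {l : List D} (hl : l ≠ []) (h : l.map σ = l.rotate 1) (k : ℤ) :
    XX (l.map lab) (by simpa using hl) k = xd σ lab (rd l hl k) := by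
  have hr : ∀ k, rd (l.map lab) (by simpa using hl) k = lab (rd l hl k) := rd_map lab hl
  refine Prod.ext ?_ ?_
  · simp only [XX, hr, xd]
  · funext i
    simp only [XX, hr, xd, rdS, Function.comp]
    rw [cyc_pow hl h, add_comm]

theorem phs_xd {l : List D} (hl : l ≠ []) (h : l.map σ = l.rotate 1) {A : Type*} [AddCommGroup A] (g : P × Rd(S) → A) :
    phs act g (l.map lab) = (l.map (fun d => g (xd σ lab d) - g (dB act (xd σ lab d)))).sum := by
  rw [phs_ne g (by simpa using hl)]
  have : ∀ k : ℕ, g (XX (l.map lab) (by simpa using hl) k) - g (dB act (XX (l.map lab) (by simpa using hl) k)) =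
      (fun d => g (xd σ lab d) - g (dB act (xd σ lab d))) (rd l hl k) := by
    intro k; rw [XX_xd hl h]
  rw [sum_congr rfl (fun k _ => this k), length_map]
  generalize (fun d => g (xd σ lab d) - g (dB act (xd σ lab d))) = f
  rw [← Fin.sum_univ_eq_sum_range (fun k : ℕ => f (rd l hl k)), ← List.sum_ofFn]
  congr 1
  apply List.ext_getElem
  · simp
  · intro i h1 h2
    rw [List.getElem_ofFn, List.getElem_map]
    congr 1
    exact rd_natCast hl (by simpa using h2)

end

section
variable {S : Type u} {W : Set Wd(S)} {G : Type w} [Group G] (π : FreeGroup S →* G)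

theorem hH_ab (α β : G →* Multiplicative ℤ) (w : FreeGroup S) :
    (hH (fun s => toAdd (α (π (FreeGroup.of s)))) (fun s => toAdd (β (π (FreeGroup.of s)))) w).a
      = toAdd (α (π w)) ∧
    (hH (fun s => toAdd (α (π (FreeGroup.of s)))) (fun s => toAdd (β (π (FreeGroup.of s)))) w).b
      = toAdd (β (π w)) := by
  induction w using FreeGroup.induction_on with
  | C1 => simp
  | of s => simp [hH]
  | inv_of s h => simp [h.1, h.2]
  | mul x y h1 h2 => simp [h1.1, h1.2, h2.1, h2.2]

theorem hs_central {x y : Hs} (h : x.a = 0) (h' : x.b = 0) : y * x * y⁻¹ = x := by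
  ext <;> simp [h, h']
  ring

theorem kw_cjl (p q : S → ℤ) (l : Fi(S))
    (h : ∀ x ∈ l, (hH p q (fgMk x.2)).a = 0 ∧ (hH p q (fgMk x.2)).b = 0) :
    (hH p q (fgMk (cjl l))).a = 0 ∧ (hH p q (fgMk (cjl l))).b = 0 ∧
    (hH p q (fgMk (cjl l))).c = (l.map (fun x => kw p q x.2)).sum := by
  rw [mk_cjl]
  induction l with
  | nil => simp
  | cons x l ih =>
    obtain ⟨i1, i2, i3⟩ := ih (fun y hy => h y (by simp [hy]))
    obtain ⟨j1, j2⟩ := h x (by simp)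
    simp only [map_cons, List.prod_cons, List.sum_cons]
    rw [map_mul, map_mul, map_mul, map_inv, hs_central j1 j2]
    refine ⟨by rw [Hs.mul_a, i1, j1, add_zero], by rw [Hs.mul_b, i2, j2, add_zero], ?_⟩
    simp only [Hs.mul_c, i3, j1, kw, Hs.kk, j2]
    simp

variable {P : Type v} {act : P → S × Bool → P} {q : G → P}

theorem pend_q (hq : ∀ g s, q (g * π (fgMk [s])) = act (q g) s) (g : G) (w : Wd(S)) :
    pend act (q g) w = q (g * π (fgMk w)) := by
  induction w generalizing g with
  | nil =>
    have : fgMk ([] : Wd(S)) = 1 := rfl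
    rw [this, map_one, mul_one]; rfl
  | cons s w ih =>
    have h1 : pend act (q g) (s :: w) = pend act (act (q g) s) w := rfl
    have h2 : fgMk (s :: w) = fgMk [s] * fgMk w := by rw [mul_mk]; rfl
    rw [h1, ← hq, ih, h2, map_mul, mul_assoc]

set_option maxHeartbeats 1000000 in
theorem torus_flat (hW : SC W) (hker : π.ker = Subgroup.normalClosure (fgMk '' W)) (ha : Act act)
    (hq : ∀ g s, q (g * π (fgMk [s])) = act (q g) s) (hqs : Function.Surjective q)
    {α β : G →* Multiplicative ℤ} {y z : G} (αy : toAdd (α y) = 1) (βy : toAdd (β y) = 0)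
    (αz : toAdd (α z) = 0) (βz : toAdd (β z) = 1)
    (qy : q y = q 1) (qz : q z = q 1) (hK : ∀ g g', q g = q g' → ∃ s t : ℤ, g' = y ^ s * z ^ t * g)
    {Y Z : Wd(S)} (hY : π (fgMk Y) = y) (hZ : π (fgMk Z) = z) {c : P × Rd(S) → ℤ}
    (hc : Fil W act dlt (q 1) (fgMk Y * fgMk Z * (fgMk Y)⁻¹ * (fgMk Z)⁻¹) c) :
    Flat W ha c := by
  have hWk : ∀ r ∈ W, π (fgMk r) = 1 := by
    intro r hr
    have : fgMk r ∈ π.ker := by rw [hker]; exact Subgroup.subset_normalClosure ⟨r, hr, rfl⟩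
    exact this
  have hr : ∀ r ∈ W, ∀ p, pend act p r = p := by
    intro r hr p
    obtain ⟨g, rfl⟩ := hqs p
    rw [pend_q π hq, hWk r hr, mul_one]
  obtain ⟨l, hl1, hl2, hl3⟩ := hc.inv ha hW hr
  have hYn : Y ≠ [] := by
    rintro rfl
    have : fgMk ([] : Wd(S)) = 1 := rfl
    rw [this, map_one] at hY
    rw [← hY] at αy; simp at αy
  have hZn : Z ≠ [] := by
    rintro rfl
    have : fgMk ([] : Wd(S)) = 1 := rfl
    rw [this, map_one] at hZ
    rw [← hZ] at βz; simp at βz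
  have hT := St.fillTorus ha (p := q 1) l (fun x hx => ⟨hW.ne _ (hl1 x hx), hr _ (hl1 x hx) _⟩) hYn hZn
    (by rw [pend_q π hq, hY, one_mul, qy]) (by rw [pend_q π hq, hZ, one_mul, qz]) (by rw [hl2]; group)
  -- letter functions
  let a : S → ℤ := fun s => toAdd (α (π (FreeGroup.of s)))
  let b : S → ℤ := fun s => toAdd (β (π (FreeGroup.of s)))
  have hab : ∀ w, (hH a b w).a = toAdd (α (π w)) ∧ (hH a b w).b = toAdd (β (π w)) := hH_ab π α β
  have hba : ∀ w, (hH b a w).a = toAdd (β (π w)) ∧ (hH b a w).b = toAdd (α (π w)) := hH_ab π β α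
  have hWab : ∀ r ∈ W, (hH a b (fgMk r)).a = 0 ∧ (hH a b (fgMk r)).b = 0 := by
    intro r hr
    rw [(hab _).1, (hab _).2, hWk r hr]; simp
  have hWba : ∀ r ∈ W, (hH b a (fgMk r)).a = 0 ∧ (hH b a (fgMk r)).b = 0 := by
    intro r hr
    rw [(hba _).1, (hba _).2, hWk r hr]; simp
  let φ : List (P × (S × Bool)) → (P × Rd(S) → ℤ) × ℤ × ℤ := fun w =>
    (phs act dlt w, kw a b (w.map Prod.snd), kw b a (w.map Prod.snd))
  have hφr : ∀ w, φ (w.rotate 1) = φ w := by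
    intro w
    simp only [φ, phs_rot, List.map_rotate, kw_rot]
  have hφb : ∀ w, φ (ebar (einv act) w) = - φ w := by
    intro w
    have : (ebar (einv act) w).map Prod.snd = ebar linv (w.map Prod.snd) := by
      simp [ebar, einv, Function.comp_def]
    simp only [φ, phs_bar ha, this, kw_bar]
    rfl
  obtain ⟨D, i1, i2, σ, τ, lab, fs, hOK, hg, hmem, hsum, hred⟩ := T_run hW ha 2 φ hφr hφb _ _ rfl hT (by
    intro e he
    obtain ⟨x, hx, rfl⟩ := mem_map.1 he
    have := hW.bar _ (hl1 x hx)
    exact ⟨⟨_, _, hW.ne _ this, hr _ this _, rfl⟩, by rw [pw_snd]; exact this⟩)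
  have hfs : ∀ l' ∈ fs, CW act (l'.map lab) ∧ l'.map (Prod.snd ∘ lab) ∈ W := by
    intro l' hl'
    obtain ⟨x, hx, e⟩ := mem_map.1 (hmem l' hl')
    have := hW.bar _ (hl1 x hx)
    rw [← map_map, ← e]
    exact ⟨⟨_, _, hW.ne _ this, hr _ this _, rfl⟩, by rw [pw_snd]; exact this⟩
  -- total chain
  have hφx : ∀ x ∈ l, φ (pw act (pend act (q 1) x.1) (ebar linv x.2)) =
      - (phs act dlt (pw act (pend act (q 1) x.1) x.2), kw a b x.2, kw b a x.2) := by
    intro x hx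
    have h4 := hr x.2 (hl1 x hx) (pend act (q 1) x.1)
    have h5 := pw_ebar ha (pend act (q 1) x.1) x.2
    rw [h4] at h5
    rw [h5, hφb]
    simp only [φ, pw_snd]
  have hs1 : (fs.map (fun l => phs act dlt (l.map lab))).sum = c := by
    have h1 := congrArg Prod.fst hsum
    rw [lsum_fst, lsum_fst, map_map, map_map, map_map] at h1
    refine Eq.trans ?_ (h1.trans ?_)
    · rfl
    · rw [map_congr_left (g := fun x => - phs act dlt (pw act (pend act (q 1) x.1) x.2))]
      · rw [← neg_neg c, ← hl3, chn, ← lsum_neg]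
      · intro x hx
        simp only [Function.comp, hφx x hx, Prod.fst_neg]
  have hone : ∀ p' q', (∀ r ∈ W, (hH p' q' (fgMk r)).a = 0 ∧ (hH p' q' (fgMk r)).b = 0) →
      (l.map (fun x => - kw p' q' x.2)).sum = (hH p' q' (fgMk Y)).a * (hH p' q' (fgMk Z)).b
        - (hH p' q' (fgMk Y)).b * (hH p' q' (fgMk Z)).a := by
    intro p' q' hh
    have h1 := (kw_cjl p' q' l (fun x hx => hh _ (hl1 x hx))).2.2
    rw [hl2] at h1
    rw [← lsum_neg, ← h1]
    generalize fgMk Y = y'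
    generalize fgMk Z = z'
    simp
    ring
  have hs2 : (fs.map (fun l => kw a b (l.map (Prod.snd ∘ lab)))).sum = 1 := by
    have h1 := congrArg (fun v => v.2.1) hsum
    simp only [lsum_snd, lsum_fst, map_map] at h1
    refine Eq.trans ?_ (h1.trans ?_)
    · congr 1
      apply map_congr_left
      intro l' _
      simp only [Function.comp, φ, map_map]
    · rw [map_congr_left (g := fun x => - kw a b x.2)]
      · rw [hone a b hWab, (hab _).1, (hab _).2, (hab _).1, (hab _).2, hY, hZ, αy, βy, αz, βz]; norm_num
      · intro x hx
        simp only [Function.comp, hφx x hx, Prod.fst_neg, Prod.snd_neg]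
  have hs3 : (fs.map (fun l => kw b a (l.map (Prod.snd ∘ lab)))).sum = -1 := by
    have h1 := congrArg (fun v => v.2.2) hsum
    simp only [lsum_snd, lsum_fst, map_map] at h1
    refine Eq.trans ?_ (h1.trans ?_)
    · congr 1
      apply map_congr_left
      intro l' _
      simp only [Function.comp, φ, map_map]
    · rw [map_congr_left (g := fun x => - kw b a x.2)]
      · rw [hone b a hWba, (hba _).1, (hba _).2, (hba _).1, (hba _).2, hY, hZ, αy, βy, αz, βz]; norm_num
      · intro x hx
        simp only [Function.comp, hφx x hx, Prod.fst_neg, Prod.snd_neg]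
  have hne : Nonempty D := by
    rcases fs with _ | ⟨l', fs⟩
    · simp at hs2
    · have := hOK.ne l' (by simp)
      obtain ⟨d, _⟩ := List.exists_mem_of_ne_nil _ this
      exact ⟨d⟩
  obtain ⟨hX, hcon⟩ := hex_of (inv := einv act) (pl := Prod.snd) hW (fun _ => rfl) hOK hg (fun l' hl' => (hfs l' hl').2) hred
  have hOK' := OK.mapLab (f := Prod.snd) (inv' := linv) (fun _ => rfl) hOK
  have hpos : ∀ d, (lab (σ d)).1 = act (lab d).1 (lab d).2 := by
    intro d
    obtain ⟨l', hl', hd⟩ := mem_flatten.1 (hOK.all d)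
    exact hOK.pos_next hl' (hfs l' hl').1 hd
  have hvx : ∀ d d', vx σ τ d = vx σ τ d' → (lab d).1 = (lab d').1 := by
    intro d d' h
    rw [vx_eq] at h
    let s : Setoid D := Setoid.ker (fun d => (lab d).1)
    have : sc (σ * τ) ≤ s := sc_le_of (fun d => by
      show (lab d).1 = (lab (σ (τ d))).1
      rw [hpos, hOK.labt]
      exact (ha.back _ _).symm)
    exact this h
  have hTP : ∀ (γ : List D) d d', TP σ τ (vx σ τ d) γ (vx σ τ d') → pend act (lab d).1 (γ.map (Prod.snd ∘ lab)) = (lab d').1 := by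
    intro γ
    induction γ with
    | nil => intro d d' h; exact hvx _ _ h
    | cons e γ ih =>
      intro d d' h
      have h2 := ih _ _ h.2
      rw [← h2, ← hvx _ _ h.1, hOK.labt]
      rfl
  refine flat_of hW ha hX hpos hOK.labt ?_ ?_
  · intro d d' hdd
    obtain ⟨γ, hγ⟩ := TP_conn hOK.inv2 hcon d d'
    obtain ⟨g, hg'⟩ := hqs (lab d).1
    have key : ∀ (γ : List D) e, (lab e).1 = q g → TP σ τ (vx σ τ e) γ (vx σ τ d') →
      ∃ s t : ℤ, π (fgMk (γ.map (Prod.snd ∘ lab))) = g⁻¹ * (y ^ s * z ^ t) * g ∧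
        toAdd (α (π (fgMk (γ.map (Prod.snd ∘ lab))))) = s ∧
        toAdd (β (π (fgMk (γ.map (Prod.snd ∘ lab))))) = t := by
      intro γ e he h
      have h1 := hTP γ e d' h
      rw [he, ← hdd, ← hg', pend_q π hq] at h1
      obtain ⟨s, t, hst⟩ := hK _ _ h1.symm
      have e1 : π (fgMk (γ.map (Prod.snd ∘ lab))) = g⁻¹ * (y ^ s * z ^ t) * g := by
        rw [mul_assoc, ← hst]; group
      refine ⟨s, t, e1, ?_, ?_⟩
      · rw [e1]; simp [αy, αz]
      · rw [e1]; simp [βy, βz]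
    let H : Subgroup G := {
      carrier := {h | ∃ γ, TP σ τ (vx σ τ d') γ (vx σ τ d') ∧ π (fgMk (γ.map (Prod.snd ∘ lab))) = h}
      mul_mem' := by
        rintro _ _ ⟨γ, h1, rfl⟩ ⟨γ', h2, rfl⟩
        exact ⟨γ ++ γ', TP_append.2 ⟨_, h1, h2⟩, by rw [map_append, ← mul_mk, map_mul]⟩
      one_mem' := ⟨[], rfl, map_one π⟩
      inv_mem' := by
        rintro _ ⟨γ, h1, rfl⟩
        refine ⟨_, TP_rev hOK.inv2 h1, ?_⟩
        rw [← map_inv, ← mk_ebar]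
        congr 2
        simp [ebar, hOK.labt, einv] }
    have hcd : ∀ d, ∃ γ, TP σ τ (vx σ τ d') γ (vx σ τ d) := fun d => TP_conn hOK.inv2 hcon _ _
    obtain ⟨γ1, a1, a2, a3⟩ := hol a b hOK' (vx σ τ d') hcd (fun l' hl' => hWab _ (hfs l' hl').2)
    obtain ⟨γ2, b1, b2, b3⟩ := hol b a hOK' (vx σ τ d') hcd (fun l' hl' => hWba _ (hfs l' hl').2)
    rw [hs2, (hab _).1] at a2
    rw [(hab _).2] at a3
    rw [hs3, (hba _).1] at b2
    rw [(hba _).2] at b3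
    obtain ⟨s, t, c1, c2, c3⟩ := key γ d hg'.symm hγ
    have hmemH := H.mul_mem (H.zpow_mem (⟨γ1, a1, rfl⟩ : _ ∈ H) s) (H.zpow_mem (⟨γ2, b1, rfl⟩ : _ ∈ H) (-t))
    obtain ⟨γ', d1, d2⟩ := hmemH
    obtain ⟨s', t', f1, f2, f3⟩ := key γ' d' (by rw [← hdd, hg']) d1
    have es : s' = s := by
      rw [← f2, d2]
      simp [a2, b3]
    have et : t' = t := by
      rw [← f3, d2]
      simp [a3, b2]
    subst es et
    refine closed_of_trivial hW hX (γ := γ ++ ebar τ γ') (TP_append.2 ⟨_, hγ, TP_rev hOK.inv2 d1⟩) ?_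
    rw [← hker, MonoidHom.mem_ker, map_append, ← mul_mk, map_mul]
    have : (ebar τ γ').map (Prod.snd ∘ lab) = ebar linv (γ'.map (Prod.snd ∘ lab)) := by
      simp [ebar, hOK.labt, einv]
    rw [this, mk_ebar, map_inv, c1, f1]
    group
  · intro x
    rw [← hs1]
    have : ∀ l ∈ fs, phs act dlt (l.map lab) = (l.map (fun d => dlt (xd σ lab d) - dlt (dB act (xd σ lab d)))).sum :=
      fun l hl => phs_xd (hOK.ne l hl) (hOK.cyc l hl) dlt
    rw [map_congr_left this, ← sum_flatten_univ hOK.nd hOK.all, Finset.sum_apply]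
    rfl

end

section
variable {S : Type u}

/-- darts of a filling -/
noncomputable def dts (l : Fi(S)) : List (Wd(S) × Rd(S)) :=
  open Classical in
  l.flatMap (fun x => if hw : x.2 ≠ [] then
    (List.range x.2.length).map (fun k : ℕ => (x.1 ++ x.2.take k, shf k (rd x.2 hw))) else [])

/-- position words of a filling -/
def pos (l : Fi(S)) : Set Wd(S) :=
  {v | ∃ d ∈ dts l, v = d.1 ∨ v = d.1 ++ [d.2 0]}

/-- readings of a filling -/
def rds (l : Fi(S)) : Set Rd(S) :=
  {f | ∃ d ∈ dts l, f = d.2 ∨ f = mir d.2}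

theorem pos_fin (l : Fi(S)) : (pos l).Finite := by
  have h1 : ({d | d ∈ dts l} : Set (Wd(S) × Rd(S))).Finite := List.finite_toSet _
  refine ((h1.image (fun d => d.1)).union (h1.image (fun d => d.1 ++ [d.2 0]))).subset ?_
  rintro v ⟨d, hd, h | h⟩
  · exact Or.inl ⟨d, hd, h.symm⟩
  · exact Or.inr ⟨d, hd, h.symm⟩

theorem rds_fin (l : Fi(S)) : (rds l).Finite := by
  have h1 : ({d | d ∈ dts l} : Set (Wd(S) × Rd(S))).Finite := List.finite_toSet _
  refine ((h1.image (fun d => d.2)).union (h1.image (fun d => mir d.2))).subset ?_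
  rintro v ⟨d, hd, h | h⟩
  · exact Or.inl ⟨d, hd, h.symm⟩
  · exact Or.inr ⟨d, hd, h.symm⟩

theorem rds_mem {W : Set Wd(S)} (hW : SC W) {l : Fi(S)}
    (hl : ∀ x ∈ l, x.2 ∈ W) {f} (hf : f ∈ rds l) : f ∈ Rdg W := by
  obtain ⟨d, hd, h⟩ := hf
  have h1 : d.2 ∈ Rdg W := by
    unfold dts at hd
    obtain ⟨x, hx, hd⟩ := List.mem_flatMap.1 hd
    rw [dif_pos (hW.ne _ (hl x hx))] at hd
    obtain ⟨k, _, rfl⟩ := mem_map.1 hd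
    exact shf_mem hW ⟨x.2, hl x hx, hW.ne _ (hl x hx), rfl⟩ _
  rcases h with rfl | rfl
  · exact h1
  · exact mir_mem hW h1

variable {P : Type v} {act : P → S × Bool → P} {A : Type*} [AddCommGroup A]

theorem pw_get (p : P) (w : Wd(S)) (k : ℕ) (hk : k < w.length) :
    (pw act p w)[k]'(by rw [pw_length]; exact hk) = (pend act p (w.take k), w[k]) := by
  induction w generalizing p k with
  | nil => simp at hk
  | cons s w ih =>
    rcases k with _ | k
    · rfl
    · simp only [pw, List.getElem_cons_succ]
      rw [ih _ _ (by simpa using hk)]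
      rfl

theorem XX_pw (p : P) {w : Wd(S)} (hw : w ≠ []) {k : ℕ} (hk : k < w.length) :
    XX (pw act p w) (pw_ne_nil.2 hw) k = (pend act p (w.take k), shf k (rd w hw)) := by
  refine Prod.ext ?_ ?_
  · simp only [XX]
    rw [rd_natCast _ (by rw [pw_length]; exact hk), pw_get _ _ _ hk]
  · funext i
    simp only [XX, shf]
    have h1 := rd_map Prod.snd (pw_ne_nil.2 hw : pw act p w ≠ []) (i + k)
    rw [← h1]
    have : ∀ (w' : Wd(S)) (h : w' ≠ []), w' = w → rd w' h (i + k) = rd w hw (i + k) := by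
      rintro w' h rfl; rfl
    exact this _ _ (pw_snd _ _)

theorem lsum_range (f : ℕ → A) (n : ℕ) : ((List.range n).map f).sum = ∑ k ∈ Finset.range n, f k := by
  induction n with
  | zero => simp
  | succ n ih => rw [List.range_succ, map_append, List.sum_append, ih, Finset.sum_range_succ]; simp

theorem chn_dts (g : P × Rd(S) → A) (p : P) (l : Fi(S)) :
    chn act g p l = ((dts l).map (fun d => g (pend act p d.1, d.2) - g (dB act (pend act p d.1, d.2)))).sum := by
  induction l with
  | nil => rfl
  | cons x l ih =>
    have e : dts (x :: l) = dts [x] ++ dts l := by simp [dts]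
    have e2 : chn act g p (x :: l) = chn act g p [x] + chn act g p l := by simp [chn]
    rw [e, e2, map_append, List.sum_append, ih]
    congr 1
    simp only [chn, map_cons, List.map_nil, List.sum_cons, List.sum_nil, add_zero, dts, List.flatMap_cons, List.flatMap_nil,
      List.append_nil]
    by_cases hw : x.2 = []
    · simp [hw, pw, phs]
    · rw [dif_pos hw, phs_ne g (pw_ne_nil.2 hw), map_map, lsum_range, pw_length]
      apply sum_congr rfl
      intro k hk
      rw [XX_pw _ hw (Finset.mem_range.1 hk)]
      simp only [Function.comp, pend_append]

theorem chn_dlt (p : P) (l : Fi(S)) (x) :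
    chn act dlt p l x = ((dts l).map (fun d => dlt (pend act p d.1, d.2) x - dlt (dB act (pend act p d.1, d.2)) x)).sum := by
  rw [chn_dts]
  generalize dts l = ds
  induction ds with
  | nil => rfl
  | cons d ds ih => rw [map_cons, List.sum_cons, Pi.add_apply, ih]; rfl

theorem dlt_ne {x y : P × Rd(S)} (h : x ≠ y) : dlt x y = 0 := if_neg h
theorem dlt_self (x : P × Rd(S)) : dlt x x = 1 := if_pos rfl

theorem chn_supp {p : P} {l : Fi(S)} {x} (h : chn act dlt p l x ≠ 0) :
    (∃ v ∈ pos l, pend act p v = x.1) ∧ x.2 ∈ rds l := by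
  rw [chn_dlt] at h
  by_contra hn
  apply h
  apply List.sum_eq_zero
  intro z hz
  obtain ⟨d, hd, rfl⟩ := mem_map.1 hz
  rw [dlt_ne, dlt_ne, sub_zero]
  · rintro rfl
    refine hn ⟨⟨d.1 ++ [d.2 0], ⟨d, hd, Or.inr rfl⟩, ?_⟩, ⟨d, hd, Or.inr rfl⟩⟩
    rw [pend_append]; rfl
  · rintro rfl
    exact hn ⟨⟨d.1, ⟨d, hd, Or.inl rfl⟩, rfl⟩, ⟨d, hd, Or.inl rfl⟩⟩

theorem pend_equiv {P' : Type w} {act' : P' → S × Bool → P'} {q : P → P'} (hq : ∀ p s, q (act p s) = act' (q p) s) (p : P) (v : Wd(S)) :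
    pend act' (q p) v = q (pend act p v) := by
  induction v generalizing p with
  | nil => rfl
  | cons s v ih =>
    have h1 : pend act' (q p) (s :: v) = pend act' (act' (q p) s) v := rfl
    rw [h1, ← hq, ih]; rfl

theorem chn_q {P' : Type w} {act' : P' → S × Bool → P'} {q : P → P'} (hq : ∀ p s, q (act p s) = act' (q p) s) (p : P)
    (l : Fi(S)) (g : P) (f : Rd(S))
    (h : ∀ v ∈ pos l, q (pend act p v) = q g → pend act p v = g) :
    chn act' dlt (q p) l (q g, f) = chn act dlt p l (g, f) := by
  rw [chn_dlt, chn_dlt]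
  congr 1
  apply map_congr_left
  intro d hd
  have h1 := h d.1 ⟨d, hd, Or.inl rfl⟩
  have h2 := h (d.1 ++ [d.2 0]) ⟨d, hd, Or.inr rfl⟩
  rw [pend_append] at h2
  have h2' : q (act (pend act p d.1) (d.2 0)) = q g → act (pend act p d.1) (d.2 0) = g := h2
  congr 1
  · unfold dlt
    congr 1
    simp only [Prod.mk.injEq, pend_equiv hq, eq_iff_iff]
    exact ⟨fun ⟨a, b⟩ => ⟨h1 a, b⟩, fun ⟨a, b⟩ => ⟨by rw [a], b⟩⟩
  · unfold dlt dB
    congr 1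
    simp only [Prod.mk.injEq, pend_equiv hq, eq_iff_iff, ← hq]
    exact ⟨fun ⟨a, b⟩ => ⟨h2' a, b⟩, fun ⟨a, b⟩ => ⟨by rw [a], b⟩⟩

theorem chn_bar (ha : Act act) (p : P) (l : Fi(S)) (x) :
    chn act dlt p l (dB act x) = - chn act dlt p l x := by
  rw [chn_dlt, chn_dlt, lsum_neg]
  congr 1
  apply map_congr_left
  intro d hd
  have h1 : ∀ y, dlt y (dB act x) = dlt (dB act y) x := by
    intro y
    unfold dlt
    congr 1
    rw [eq_iff_iff]
    exact ⟨fun h => by rw [h, dB_dB ha], fun h => by rw [← h, dB_dB ha]⟩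
  rw [h1, h1, dB_dB ha]; ring

theorem XX_next (ha : Act act) {w : List (P × (S × Bool))} (hc : CW act w) (hw : w ≠ []) (k : ℤ) :
    XX w hw (k + 1) = dS ha (XX w hw k) := by
  have key : ∀ w (hc : CW act w) (hw : w ≠ []), (rd w hw 1).1 = act (rd w hw 0).1 (rd w hw 0).2 := by
    intro w hc hw
    rcases w with _ | ⟨x, e⟩
    · exact absurd rfl hw
    have h2 := hc.rot1.2
    have h3 : rd (x :: e) hw 0 = x := by
      have := rd_natCast (w := x :: e) hw (i := 0) (by simp)
      simpa using this
    rw [h3]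
    apply h2
    rcases e with _ | ⟨y, e⟩
    · have := rd_add_length (w := [x]) hw 0
      simp at this
      simp [this, h3]
    · have := rd_natCast (w := x :: y :: e) hw (i := 1) (by simp)
      simp at this
      simp [this]
  refine Prod.ext ?_ ?_
  · rw [dS_fst, XX_snd0]
    simp only [XX]
    have hr : ∀ (m : ℕ) (j : ℤ), rd (w.rotate m) (by simpa using hw) j = rd w hw (j + m) := by
      intro m j
      exact rd_rotate hw m j
    have hpos : 0 < w.length := length_pos_iff.2 hw
    have a1 := Int.emod_nonneg k (b := w.length) (by omega)
    have hk := key (w.rotate (k % w.length).toNat) (hc.rot _) (by simpa using hw)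
    rw [hr, hr] at hk
    have e : ∀ j : ℤ, rd w hw (j + ((k % w.length).toNat : ℕ)) = rd w hw (k + j) := by
      intro j
      apply rd_congr
      rw [Int.toNat_of_nonneg a1]
      have := Int.emod_add_mul_ediv k w.length
      exact ⟨-(k / w.length), by rw [mul_neg]; omega⟩
    rw [e, e] at hk
    simpa using hk
  · funext i
    simp only [XX, dS_apply, shf]
    congr 2; ring

theorem phs_sig (ha : Act act) (g : P × Rd(S) → A) {w : List (P × (S × Bool))} (hc : CW act w) :
    phs act (fun x => g (dS ha x)) w = phs act g w := by
  by_cases hw : w = []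
  · simp [phs, hw]
  have hw' : w ≠ [] := hw
  rw [phs_ne _ hw', phs_ne _ hw', Finset.sum_sub_distrib, Finset.sum_sub_distrib]
  have h0 := XX_len w hw' 0
  rw [zero_add] at h0
  congr 1
  · rw [← sum_range_shift (fun k => g (XX w hw' k)) w.length (by simp only [h0])]
    apply sum_congr rfl
    intro k _
    rw [XX_next ha hc]
  · have e : ∀ k : ℤ, g (dB act (XX w hw' k)) = g (dS ha (dB act (XX w hw' (k + 1)))) := by
      intro k
      rw [XX_next ha hc, dS_dB]
    rw [← sum_range_shift (fun k => g (dS ha (dB act (XX w hw' k)))) w.length (by simp only [h0])]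
    apply sum_congr rfl
    intro k _
    rw [e]

theorem chn_sig {W : Set Wd(S)} (hW : SC W) (ha : Act act) (hr : ∀ r ∈ W, ∀ p, pend act p r = p) (p : P) (l : Fi(S))
    (hl : ∀ x ∈ l, x.2 ∈ W) (x) :
    chn act dlt p l (dS ha x) = chn act dlt p l x := by
  have h1 : chn act (fun y => dlt (dS ha y)) p l = chn act dlt p l := by
    unfold chn
    congr 1
    apply map_congr_left
    intro y hy
    exact phs_sig ha dlt ⟨_, _, hW.ne _ (hl y hy), hr _ (hl y hy) _, rfl⟩
  rw [← congrFun h1 (dS ha x), chn_dts, chn_dlt]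
  generalize dts l = ds
  induction ds with
  | nil => rfl
  | cons d ds ih =>
    rw [map_cons, List.sum_cons, Pi.add_apply, ih]
    have : ∀ y, dlt (dS ha y) (dS ha x) = dlt y x := by
      intro y
      by_cases h : y = x
      · rw [h, dlt_self, dlt_self]
      · rw [dlt_ne h, dlt_ne (fun h' => h ((dS ha).injective h'))]
    rw [map_cons, List.sum_cons]
    congr 1
    rw [Pi.sub_apply, this, this]

end

section
variable {S : Type u} {W : Set Wd(S)} {G : Type w} [Group G] (π : FreeGroup S →* G)
  {P : Type v} {act : P → S × Bool → P} {q : G → P} {A : Type*} [AddCommGroup A] {ob : P × Rd(S) → A}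

theorem Fil.conj' (hq : ∀ g s, q (g * π (fgMk [s])) = act (q g) s) {h : G} {v w : FreeGroup S} {c : A}
    (H : Fil W act ob (q (h * π v)) w c) : Fil W act ob (q h) (v * w * v⁻¹) c := by
  obtain ⟨l, rfl⟩ := Quot.exists_rep v
  change Fil W act ob (q h) (fgMk l * w * (fgMk l)⁻¹) c
  apply Fil.conj
  rw [pend_q π hq]
  exact H

theorem Fil.cong {p : P} {w w' : FreeGroup S} {c c' : A} (H : Fil W act ob p w c) (hw : w = w') (hc : c = c') :
    Fil W act ob p w' c' := by subst hw; subst hc; exact H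

theorem fil_powL (hq : ∀ g s, q (g * π (fgMk [s])) = act (q g) s) {X Y : FreeGroup S} {e : G → A}
    (he : ∀ h, Fil W act ob (q h) (X * Y * X⁻¹ * Y⁻¹) (e h)) (m : ℕ) (h : G) :
    Fil W act ob (q h) (X ^ m * Y * (X ^ m)⁻¹ * Y⁻¹) (∑ s ∈ Finset.range m, e (h * π X ^ s)) := by
  induction m with
  | zero => exact Fil.one.cong (by simp) (by simp)
  | succ m ih =>
    have h1 := Fil.conj' π hq (v := X ^ m) (h := h) (he _)
    refine (h1.mul ih).cong ?_ ?_
    · rw [pow_succ]; group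
    · rw [Finset.sum_range_succ, map_pow, add_comm]

theorem fil_powR (hq : ∀ g s, q (g * π (fgMk [s])) = act (q g) s) {X Y : FreeGroup S} {e : G → A}
    (he : ∀ h, Fil W act ob (q h) (X * Y * X⁻¹ * Y⁻¹) (e h)) (m : ℕ) (h : G) :
    Fil W act ob (q h) (X * Y ^ m * X⁻¹ * (Y ^ m)⁻¹) (∑ s ∈ Finset.range m, e (h * π Y ^ s)) := by
  induction m with
  | zero => exact Fil.one.cong (by simp) (by simp)
  | succ m ih =>
    have h1 := Fil.conj' π hq (v := Y ^ m) (h := h) (he _)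
    refine (ih.mul h1).cong ?_ ?_
    · rw [pow_succ]; group
    · rw [Finset.sum_range_succ, map_pow]

theorem fil_mixL (ha : Act act) (hW : SC W) (hr : ∀ r ∈ W, ∀ p, pend act p r = p)
    (hq : ∀ g s, q (g * π (fgMk [s])) = act (q g) s) {X X' Y : FreeGroup S} {e e' : G → A}
    (he : ∀ h, Fil W act ob (q h) (X * Y * X⁻¹ * Y⁻¹) (e h)) (he' : ∀ h, Fil W act ob (q h) (X' * Y * X'⁻¹ * Y⁻¹) (e' h)) (m m' : ℕ) (h : G) :
    Fil W act ob (q h) ((X ^ m * (X' ^ m')⁻¹) * Y * (X ^ m * (X' ^ m')⁻¹)⁻¹ * Y⁻¹)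
      (∑ s ∈ Finset.range m, e (h * π X ^ s) - ∑ s ∈ Finset.range m', e' (h * (π X ^ m * (π X' ^ m')⁻¹) * π X' ^ s)) := by
  have h1 := Fil.conj' π hq (v := X ^ m * (X' ^ m')⁻¹) (h := h) ((fil_powL π hq he' m' _).inv ha hW hr)
  refine (h1.mul (fil_powL π hq he m h)).cong ?_ ?_
  · group
  · simp only [map_mul, map_pow, map_inv]; abel

theorem fil_mixR (ha : Act act) (hW : SC W) (hr : ∀ r ∈ W, ∀ p, pend act p r = p)
    (hq : ∀ g s, q (g * π (fgMk [s])) = act (q g) s) {X Y Y' : FreeGroup S} {e e' : G → A}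
    (he : ∀ h, Fil W act ob (q h) (X * Y * X⁻¹ * Y⁻¹) (e h)) (he' : ∀ h, Fil W act ob (q h) (X * Y' * X⁻¹ * Y'⁻¹) (e' h)) (m m' : ℕ) (h : G) :
    Fil W act ob (q h) (X * (Y ^ m * (Y' ^ m')⁻¹) * X⁻¹ * (Y ^ m * (Y' ^ m')⁻¹)⁻¹)
      (∑ s ∈ Finset.range m, e (h * π Y ^ s) - ∑ s ∈ Finset.range m', e' (h * (π Y ^ m * (π Y' ^ m')⁻¹) * π Y' ^ s)) := by
  have h1 := Fil.conj' π hq (v := Y ^ m * (Y' ^ m')⁻¹) (h := h) ((fil_powR π hq he' m' _).inv ha hW hr)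
  refine ((fil_powR π hq he m h).mul h1).cong ?_ ?_
  · group
  · simp only [map_mul, map_pow, map_inv]; abel

end

abbrev F2 := FreeGroup (Fin 2)

/-- three generators with product one -/
def aa : Fin 3 → F2 := ![FreeGroup.of 0, FreeGroup.of 1, (FreeGroup.of 0 * FreeGroup.of 1)⁻¹]

/-- coordinates -/
def EE : Fin 3 → (F2 →* Multiplicative ℤ) :=
  ![FreeGroup.lift ![Multiplicative.ofAdd 1, 1], FreeGroup.lift ![1, Multiplicative.ofAdd 1], 1]

/-- differences of coordinates -/
def dd (i k : Fin 3) (x : F2) : ℤ := toAdd (EE i x) - toAdd (EE k x)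

theorem EE_aa (i j : Fin 3) : toAdd (EE i (aa j)) = (if i = j then 1 else 0) - (if j = 2 then 1 else 0) := by
  fin_cases i <;> fin_cases j <;> simp [EE, aa]

theorem dd_aa (i k j : Fin 3) : dd i k (aa j) = (if i = j then 1 else 0) - (if k = j then 1 else 0) := by
  unfold dd; rw [EE_aa, EE_aa]; ring

theorem dd_mul (i k : Fin 3) (x y : F2) : dd i k (x * y) = dd i k x + dd i k y := by
  unfold dd; simp only [map_mul, toAdd_mul]; ring

theorem dd_inv (i k : Fin 3) (x : F2) : dd i k x⁻¹ = - dd i k x := by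
  unfold dd; simp only [map_inv, toAdd_inv]; ring

theorem dd_pow (i k : Fin 3) (x : F2) (n : ℕ) : dd i k (x ^ n) = n * dd i k x := by
  unfold dd; simp only [map_pow, toAdd_pow, nsmul_eq_mul]; ring

theorem dd_zpow (i k : Fin 3) (x : F2) (n : ℤ) : dd i k (x ^ n) = n * dd i k x := by
  unfold dd; simp only [map_zpow, toAdd_zpow, smul_eq_mul]; ring

theorem dd_one (i k : Fin 3) : dd i k 1 = 0 := by simp [dd]

theorem third : ∀ i j : Fin 3, i ≠ j → ∃ k, k ≠ i ∧ k ≠ j := by decide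

section
variable {S : Type u} {W : Set Wd(S)} (π : FreeGroup S →* F2 × F2)

/-- the action on the group -/
def ag (g : F2 × F2) (s : S × Bool) : F2 × F2 := g * π (fgMk [s])

theorem mk_linv (s : S × Bool) : fgMk [s] * fgMk [linv s] = 1 := by
  have := mk_ebar [s]
  have e : ebar linv [s] = [linv s] := rfl
  rw [e] at this
  rw [this, mul_inv_cancel]

theorem ag_act : Act (ag π) := ⟨fun p s => by
  unfold ag; rw [mul_assoc, ← map_mul, mk_linv, map_one, mul_one]⟩

theorem pend_ag (g : F2 × F2) (v : Wd(S)) : pend (ag π) g v = g * π (fgMk v) :=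
  pend_q π (q := id) (fun _ _ => rfl) g v

/-- base points -/
def bp (i j : Fin 3) (m : ℕ × ℕ) : F2 × F2 := (aa i ^ m.1, aa j ^ m.2)

/-- quarter planes -/
noncomputable def QQ (l : Fin 3 → Fin 3 → Fi(S)) (i j : Fin 3)
    (x : (F2 × F2) × Rd(S)) : ℤ := ∑ᶠ m : ℕ × ℕ, chn (ag π) dlt (bp i j m) (l i j) x

variable {π} {l : Fin 3 → Fin 3 → Fi(S)}

/-- size bound -/
def Bd (π : FreeGroup S →* F2 × F2) (l : Fin 3 → Fin 3 → Fi(S)) (n : ℕ) (g : F2 × F2) : Prop :=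
  ∀ i j, ∀ v ∈ pos (l i j), ∀ a b, |dd a b g.1 - dd a b (π (fgMk v)).1| < n ∧ |dd a b g.2 - dd a b (π (fgMk v)).2| < n

theorem Bd.ev (π : FreeGroup S →* F2 × F2) (l : Fin 3 → Fin 3 → Fi(S)) (g : F2 × F2) :
    ∀ᶠ n in Filter.atTop, Bd π l n g := by
  unfold Bd
  simp only [Filter.eventually_all]
  intro i j
  rw [Filter.eventually_all_finite (pos_fin _)]
  intro v _
  simp only [Filter.eventually_all]
  intro a b
  have h : ∀ z : ℤ, ∀ᶠ n : ℕ in Filter.atTop, z < n := by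
    intro z
    filter_upwards [Filter.eventually_gt_atTop z.toNat] with n hn
    omega
  exact (h _).and (h _)

theorem chn_bd {n : ℕ} {g : F2 × F2} (h : Bd π l n g) {i j : Fin 3} {m : ℕ × ℕ} {f}
    (hn : chn (ag π) dlt (bp i j m) (l i j) (g, f) ≠ 0) : m.1 < n ∧ m.2 < n := by
  obtain ⟨⟨v, hv, h1⟩, -⟩ := chn_supp hn
  rw [pend_ag] at h1
  obtain ⟨i', hi⟩ : ∃ i', i' ≠ i := exists_ne i
  obtain ⟨j', hj⟩ : ∃ j', j' ≠ j := exists_ne j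
  have hA := (h i j v hv i i').1
  have hB := (h i j v hv j j').2
  simp only at h1
  rw [← h1] at hA hB
  simp only [bp, Prod.fst_mul, Prod.snd_mul, dd_mul, dd_pow, dd_aa, if_neg hi, if_neg hj] at hA hB
  rw [abs_lt] at hA hB
  simp at hA hB
  omega

theorem QQ_fin {n : ℕ} {g : F2 × F2} (h : Bd π l n g) (i j : Fin 3) {m m' : ℕ} (hm : n ≤ m) (hm' : n ≤ m') (f) :
    QQ π l i j (g, f) = ∑ s ∈ Finset.range m, ∑ t ∈ Finset.range m', chn (ag π) dlt (bp i j (s, t)) (l i j) (g, f) := by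
  unfold QQ
  rw [finsum_eq_sum_of_support_subset (s := Finset.range m ×ˢ Finset.range m'), Finset.sum_product]
  intro x hx
  have := chn_bd h hx
  simp only [Finset.coe_product, Finset.coe_range, Set.mem_prod, Set.mem_Iio]
  omega

/-- locality -/
theorem loc {n : ℕ} {g : F2 × F2} (h : Bd π l n g) {i j i' j' : Fin 3} (hi : i ≠ i') (hj : j ≠ j') {v} (hv : v ∈ pos (l i j)) {m : ℕ × ℕ}
    {y z : F2} (hy : ∀ k, k ≠ i → k ≠ i' → (n : ℤ) ≤ |dd i' k y|) (hz : ∀ k, k ≠ j → k ≠ j' → (n : ℤ) ≤ |dd j' k z|) {s t : ℤ}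
    (e : g = (y ^ s, z ^ t) * (bp i j m * π (fgMk v))) : bp i j m * π (fgMk v) = g := by
  obtain ⟨k, k1, k2⟩ := third i i' hi
  obtain ⟨k', k1', k2'⟩ := third j j' hj
  have hA := (h i j v hv i' k).1
  have hB := (h i j v hv j' k').2
  rw [e] at hA hB
  simp only [bp, Prod.fst_mul, Prod.snd_mul, dd_mul, dd_pow, dd_zpow, dd_aa, if_neg hi.symm, if_neg hj.symm, if_neg k1, if_neg k1'] at hA hB
  have h1 : s = 0 := by
    by_contra hs
    have := hy k k1 k2
    have e1 : |s * dd i' k y| < n := by convert hA using 2; ring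
    rw [abs_mul] at e1
    have : 1 ≤ |s| := Int.one_le_abs hs
    nlinarith [abs_nonneg (dd i' k y)]
  have h2 : t = 0 := by
    by_contra hs
    have := hz k' k1' k2'
    have e1 : |t * dd j' k' z| < n := by convert hB using 2; ring
    rw [abs_mul] at e1
    have : 1 ≤ |t| := Int.one_le_abs hs
    nlinarith [abs_nonneg (dd j' k' z)]
  rw [e, h1, h2, zpow_zero, zpow_zero]
  exact (one_mul _).symm

end

/-- translation classes -/
def tst (y z : F2) : Setoid (F2 × F2) where
  r g g' := ∃ s t : ℤ, g' = (y ^ s, z ^ t) * g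
  iseqv := ⟨fun g => ⟨0, 0, by simp [Prod.ext_iff]⟩,
    fun {g g'} ⟨s, t, h⟩ => ⟨-s, -t, by rw [h]; simp [Prod.ext_iff]⟩,
    fun {g g' g''} ⟨s, t, h⟩ ⟨s', t', h'⟩ => ⟨s' + s, t' + t, by rw [h', h]; simp [Prod.ext_iff, zpow_add, mul_assoc]⟩⟩

section
variable {S : Type u} {W : Set Wd(S)} {π : FreeGroup S →* F2 × F2}
  {l : Fin 3 → Fin 3 → Fi(S)}

/-- action on classes -/
def tact (π : FreeGroup S →* F2 × F2) (y z : F2) (p : Quotient (tst y z)) (s : S × Bool) : Quotient (tst y z) :=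
  Quotient.map (sa := tst y z) (sb := tst y z) (fun g => ag π g s) (by
    rintro g g' ⟨a, b, h⟩
    exact ⟨a, b, by unfold ag; rw [h, mul_assoc]⟩) p

theorem tact_act (y z : F2) : Act (tact π y z) := ⟨fun p s => by
  induction p using Quotient.ind with
  | _ g => exact congrArg _ ((ag_act π).back g s)⟩

theorem plane_flat (hW : SC W) (hker : π.ker = Subgroup.normalClosure (fgMk '' W)) {A C : Fin 3 → FreeGroup S}
    (hA : ∀ i, π (A i) = (aa i, 1)) (hC : ∀ i, π (C i) = (1, aa i))
    (hl : ∀ i j, ∀ x ∈ l i j, x.2 ∈ W) (hl' : ∀ i j, fgMk (cjl (l i j)) = A i * C j * (A i)⁻¹ * (C j)⁻¹)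
    {i j k m : Fin 3} (hij : i ≠ j) (hkm : k ≠ m) :
    Flat W (ag_act π) (fun x => QQ π l j m x - QQ π l i m x - QQ π l j k x + QQ π l i k x) := by
  apply Flat.transfer
  intro X hX
  obtain ⟨n, hn⟩ := ((Filter.eventually_all_finite hX).2 (fun g _ => Bd.ev π l g)).exists
  set y0 := aa j ^ (n + 1) * (aa i ^ n)⁻¹ with hy0
  set z0 := aa m ^ (n + 1) * (aa k ^ n)⁻¹ with hz0
  obtain ⟨i3, hi3, hj3⟩ := third i j hij
  obtain ⟨k3, hk3, hm3⟩ := third k m hkm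
  let q : F2 × F2 → Quotient (tst y0 z0) := fun g => ⟦g⟧
  have hq : ∀ g s, q (g * π (fgMk [s])) = tact π y0 z0 (q g) s := fun g s => rfl
  have hqs : Function.Surjective q := Quotient.mk_surjective
  have ha := tact_act (π := π) y0 z0
  have hWk : ∀ r ∈ W, π (fgMk r) = 1 := by
    intro r hr
    have : fgMk r ∈ π.ker := by rw [hker]; exact Subgroup.subset_normalClosure ⟨r, hr, rfl⟩
    exact this
  have hr : ∀ r ∈ W, ∀ p, pend (tact π y0 z0) p r = p := by
    intro r hr p
    obtain ⟨g, rfl⟩ := hqs p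
    rw [pend_q π hq, hWk r hr, mul_one]
  let e : Fin 3 → Fin 3 → F2 × F2 → (Quotient (tst y0 z0) × Rd(S) → ℤ) := fun a b h => chn (tact π y0 z0) dlt (q h) (l a b)
  have he : ∀ a b h, Fil W (tact π y0 z0) dlt (q h) (A a * C b * (A a)⁻¹ * (C b)⁻¹) (e a b h) :=
    fun a b h => ⟨l a b, hl a b, hl' a b, rfl⟩
  have h1 := fun a h => fil_mixR π ha hW hr hq (he a m) (he a k) (n + 1) n h
  have h2 := fil_mixL π ha hW hr hq (h1 j) (h1 i) (n + 1) n 1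
  refine ⟨Quotient (tst y0 z0), tact π y0 z0, ha, q, fun x => ∑ s ∈ Finset.range (n + 1), (∑ t ∈ Finset.range (n + 1), e j m (bp j m (s, t)) x - ∑ t ∈ Finset.range n, e j k (bp j k (s, t)) x)
      - ∑ s ∈ Finset.range n, (∑ t ∈ Finset.range (n + 1), e i m (bp i m (s, t)) x - ∑ t ∈ Finset.range n, e i k (bp i k (s, t)) x),
    fun _ _ => rfl, ?_, ?_⟩
  · obtain ⟨Y, hY⟩ := Quot.exists_rep (A j ^ (n + 1) * (A i ^ n)⁻¹)
    obtain ⟨Z, hZ⟩ := Quot.exists_rep (C m ^ (n + 1) * (C k ^ n)⁻¹)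
    have qE : ∀ s t : ℤ, ∀ g, q ((y0 ^ s, z0 ^ t) * g) = q g := fun s t g =>
      (Quotient.sound (s := tst y0 z0) ⟨s, t, rfl⟩).symm
    have hαp : ∀ a b c : Fin 3, ∀ x : F2, toAdd ((EE a * EE b / (EE c) ^ 2) x) = dd a c x + dd b c x := by
      intro a b c x
      simp [dd]; ring
    refine torus_flat (α := (EE i * EE j / (EE i3) ^ 2).comp (MonoidHom.fst F2 F2)) (β := (EE k * EE m / (EE k3) ^ 2).comp (MonoidHom.snd F2 F2))
      (y := (y0, 1)) (z := (1, z0)) (Y := Y) (Z := Z) π hW hker ha hq hqs ?_ ?_ ?_ ?_ ?_ ?_ ?_ ?_ ?_ ?_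
    · rw [MonoidHom.comp_apply, hαp]
      simp [hy0, dd_mul, dd_inv, dd_pow, dd_aa, hij, hij.symm, hi3, hj3]
    · rw [MonoidHom.comp_apply, hαp]
      simp [dd_one]
    · rw [MonoidHom.comp_apply, hαp]
      simp [dd_one]
    · rw [MonoidHom.comp_apply, hαp]
      simp [hz0, dd_mul, dd_inv, dd_pow, dd_aa, hkm, hkm.symm, hk3, hm3]
    · have := qE 1 0 1
      simpa using this
    · have := qE 0 1 1
      simpa using this
    · intro g g' hgg
      obtain ⟨s, t, h⟩ := (Quotient.exact hgg : (tst y0 z0).r g g')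
      refine ⟨s, t, ?_⟩
      rw [h]; congr 1
      simp [Prod.ext_iff]
    · have : fgMk Y = A j ^ (n + 1) * (A i ^ n)⁻¹ := hY
      rw [this]; simp only [map_mul, map_pow, map_inv, hA]
      simp [Prod.ext_iff, hy0]
    · have : fgMk Z = C m ^ (n + 1) * (C k ^ n)⁻¹ := hZ
      rw [this]; simp only [map_mul, map_pow, map_inv, hC]
      simp [Prod.ext_iff, hz0]
    · have eY : fgMk Y = A j ^ (n + 1) * (A i ^ n)⁻¹ := hY
      have eZ : fgMk Z = C m ^ (n + 1) * (C k ^ n)⁻¹ := hZ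
      refine h2.cong ?_ ?_
      · rw [eY, eZ]
      · have b1 : ∀ a b : Fin 3, ∀ s t : ℕ, 1 * π (A a) ^ s * π (C b) ^ t = bp a b (s, t) := by
          intro a b s t; rw [hA, hC]; simp [bp, Prod.ext_iff]
        have hyy : π (A j) ^ (n + 1) * (π (A i) ^ n)⁻¹ = (y0, 1) := by
          rw [hA, hA]; simp [Prod.ext_iff, hy0]
        have hzz : π (C m) ^ (n + 1) * (π (C k) ^ n)⁻¹ = (1, z0) := by
          rw [hC, hC]; simp [Prod.ext_iff, hz0]
        have eE : ∀ a b : Fin 3, ∀ s t : ℤ, ∀ g, e a b ((y0 ^ s, z0 ^ t) * g) = e a b g := by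
          intro a b s t g
          change chn _ _ (q _) _ = chn _ _ (q _) _
          rw [qE]
        have b2 : ∀ a b : Fin 3, ∀ s t : ℕ, e a b (1 * π (A a) ^ s * (1, z0) * π (C b) ^ t) = e a b (bp a b (s, t)) := by
          intro a b s t
          rw [← eE a b 0 1 (bp a b (s, t)), hA, hC]; congr 1; simp [bp, Prod.ext_iff]
        have b3 : ∀ a b : Fin 3, ∀ s t : ℕ, e a b (1 * (y0, 1) * π (A a) ^ s * π (C b) ^ t) = e a b (bp a b (s, t)) := by
          intro a b s t
          rw [← eE a b 1 0 (bp a b (s, t)), hA, hC]; congr 1; simp [bp, Prod.ext_iff]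
        have b4 : ∀ a b : Fin 3, ∀ s t : ℕ, e a b (1 * (y0, 1) * π (A a) ^ s * (1, z0) * π (C b) ^ t) = e a b (bp a b (s, t)) := by
          intro a b s t
          rw [← eE a b 1 1 (bp a b (s, t)), hA, hC]; congr 1; simp [bp, Prod.ext_iff]
        rw [hyy, hzz]
        simp only [b1, b2, b3, b4]
        funext x
        simp only [Pi.sub_apply, Finset.sum_apply]
  · intro g hg f
    have hb := hn g hg
    have hL : ∀ a b a' b' : Fin 3, a ≠ a' → b ≠ b' → (∀ c, c ≠ a → c ≠ a' → (n : ℤ) ≤ |dd a' c y0|) →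
        (∀ c, c ≠ b → c ≠ b' → (n : ℤ) ≤ |dd b' c z0|) → ∀ s t, chn (ag π) dlt (bp a b (s, t)) (l a b) (g, f) = e a b (bp a b (s, t)) (q g, f) := by
      intro a b a' b' haa hbb hy hz s t
      symm
      apply chn_q (fun _ _ => rfl)
      intro v hv hqq
      rw [pend_ag] at hqq ⊢
      obtain ⟨s', t', h⟩ := (Quotient.exact hqq : (tst y0 z0).r _ g)
      exact loc hb haa hbb hv hy hz h
    have yj : ∀ c, c ≠ i → c ≠ j → (n : ℤ) ≤ |dd j c y0| := by
      intro c h1 h2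
      simp [hy0, dd_mul, dd_inv, dd_pow, dd_aa, hij, hij.symm, h1, h2, abs_of_nonneg (by omega : (0:ℤ) ≤ n + 1)]
    have yi : ∀ c, c ≠ j → c ≠ i → (n : ℤ) ≤ |dd i c y0| := by
      intro c h1 h2
      simp [hy0, dd_mul, dd_inv, dd_pow, dd_aa, hij, hij.symm, h1, h2, abs_of_nonneg (by omega : (0:ℤ) ≤ n + 1)]
    have zj : ∀ c, c ≠ k → c ≠ m → (n : ℤ) ≤ |dd m c z0| := by
      intro c h1 h2
      simp [hz0, dd_mul, dd_inv, dd_pow, dd_aa, hkm, hkm.symm, h1, h2, abs_of_nonneg (by omega : (0:ℤ) ≤ n + 1)]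
    have zi : ∀ c, c ≠ m → c ≠ k → (n : ℤ) ≤ |dd k c z0| := by
      intro c h1 h2
      simp [hz0, dd_mul, dd_inv, dd_pow, dd_aa, hkm, hkm.symm, h1, h2, abs_of_nonneg (by omega : (0:ℤ) ≤ n + 1)]
    rw [QQ_fin hb j m (m := n + 1) (m' := n + 1) (by omega) (by omega), QQ_fin hb i m (m := n) (m' := n + 1) (by omega) (by omega),
      QQ_fin hb j k (m := n + 1) (m' := n) (by omega) (by omega), QQ_fin hb i k (m := n) (m' := n) (by omega) (by omega)]
    simp only [hL j m i k hij.symm hkm.symm yi zi, hL i m j k hij hkm.symm yj zi, hL j k i m hij.symm hkm yi zj, hL i k j m hij hkm yj zj,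
      Finset.sum_sub_distrib]
    ring

end

theorem third' : ∀ i j : Fin 3, i ≠ j → ∃ k, k ≠ i ∧ k ≠ j ∧ ∀ m, m = i ∨ m = j ∨ m = k := by decide

section
variable {S : Type u} {W : Set Wd(S)} {P : Type v} {act : P → S × Bool → P} {ha : Act act}

theorem Flat.le3 {F : P × Rd(S) → ℤ} (h : Flat W ha F) {x a b c} (hx : F x = 1) (hA : F a = 1) (hB : F b = 1) (hc : F c = 1)
    (ea : a.1 = x.1) (eb : b.1 = x.1) (ec : c.1 = x.1) (h1 : a ≠ x) (h2 : b ≠ x) (h3 : c ≠ x) (h4 : a ≠ b) (h5 : a ≠ c) (h6 : b ≠ c) : False := by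
  obtain ⟨y, y1, y2, y3⟩ := h.part x hx
  obtain ⟨y', y1', y2', y3'⟩ := h.part (dS ha y) (by rw [h.sig]; exact y1)
  have H := fun z hz ez => h.conn x y y' z hx y1 y1' hz y2 y3 y2' y3' ez
  rcases H a hA ea with e | e | e <;> rcases H b hB eb with e' | e' | e' <;> rcases H c hc ec with e'' | e'' | e'' <;> simp_all

/-- a system of three chains with flat differences -/
structure Sys (W : Set Wd(S)) (ha : Act act) (Q : Fin 3 → P × Rd(S) → ℤ) : Prop where
  fl : ∀ i j, i ≠ j → Flat W ha (fun x => Q j x - Q i x)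
  sig : ∀ i x, Q i (dS ha x) = Q i x
  bar : ∀ i x, Q i (dB act x) = - Q i x

variable {Q : Fin 3 → P × Rd(S) → ℤ}

theorem Sys.neg (h : Sys W ha Q) : Sys W ha (-Q) where
  fl i j hij := by
    have e : (fun x => (-Q) j x - (-Q) i x) = fun x => Q i x - Q j x := by funext x; simp only [Pi.neg_apply]; ring
    rw [e]; exact h.fl j i hij.symm
  sig i x := by simp only [Pi.neg_apply, h.sig]
  bar i x := by simp only [Pi.neg_apply, h.bar]

def Up (Q : Fin 3 → P × Rd(S) → ℤ) (j : Fin 3) (x : P × Rd(S)) : Prop := ∀ i, i ≠ j → Q j x = Q i x + 1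
def Dn (Q : Fin 3 → P × Rd(S) → ℤ) (j : Fin 3) (x : P × Rd(S)) : Prop := ∀ i, i ≠ j → Q j x = Q i x - 1

theorem Up.pos {i j} {x} (h : Up Q j x) (hij : i ≠ j) : Q j x - Q i x = 1 := by rw [h i hij]; ring

theorem Sys.up_sig (h : Sys W ha Q) {j x} (hx : Up Q j x) : Up Q j (dS ha x) := fun i hi => by rw [h.sig, h.sig]; exact hx i hi

theorem Sys.up_bar (h : Sys W ha Q) {j x} (hx : Up Q j x) : Up (-Q) j (dB act x) := fun i hi => by
  have := hx i hi
  simp only [Pi.neg_apply, h.bar]; omega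

theorem Sys.uniq (h : Sys W ha Q) {i j} (hij : i ≠ j) {x y} (hx : Q j x - Q i x = 1) (hy : Q j y - Q i y = 1) (e : x.1 = y.1 ∧ x.2 0 = y.2 0) : x = y :=
  (h.fl i j hij).uniq x y hx hy e.1 e.2

theorem Sys.ng (h : Sys W ha Q) {i j} (hij : i ≠ j) {x} (hx : Q j x - Q i x = 1) :
    ∃ y, Q i y - Q j y = 1 ∧ y.1 = x.1 ∧ y.2 0 = x.2 0 := by
  obtain ⟨y, y1, y2, y3⟩ := (h.fl i j hij).part x hx
  refine ⟨dB act y, ?_, ?_, ?_⟩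
  · rw [h.bar, h.bar]; omega
  · rw [dB_fst, y2, y3, ha.back]
  · rw [dB_snd0, y3, linv_linv]

theorem Sys.typ (h : Sys W ha Q) {i j} (hij : i ≠ j) {y} (hy : Q i y - Q j y = 1) : Up Q i y ∨ Dn Q j y := by
  obtain ⟨k, k1, k2, k3⟩ := third' i j hij
  have h1 := (h.fl i k k1.symm).one y
  have h2 := (h.fl j k k2.symm).one y
  by_cases e : Q k y = Q j y
  · left; intro m hm
    rcases k3 m with rfl | rfl | rfl
    · exact absurd rfl hm
    · omega
    · omega
  · right; intro m hm
    rcases k3 m with rfl | rfl | rfl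
    · omega
    · exact absurd rfl hm
    · omega

/-- three up darts on one edge -/
structure Tri (Q : Fin 3 → P × Rd(S) → ℤ) (x : Fin 3 → P × Rd(S)) : Prop where
  e : ∀ i j, (x i).1 = (x j).1 ∧ (x i).2 0 = (x j).2 0
  up : ∀ j, Up Q j (x j)

theorem Sys.up_uniq (h : Sys W ha Q) {j} {x y} (hx : Up Q j x) (hy : Up Q j y) (e : x.1 = y.1 ∧ x.2 0 = y.2 0) : x = y := by
  obtain ⟨i, hi⟩ := exists_ne j
  exact h.uniq hi (hx.pos hi) (hy.pos hi) e

theorem Tri.bar (h : Sys W ha Q) {x} (hx : Tri Q x) : Tri (-Q) (fun i => dB act (x i)) where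
  e i j := by
    simp only [dB_fst, dB_snd0]
    rw [(hx.e i j).1, (hx.e i j).2]; exact ⟨rfl, rfl⟩
  up j := h.up_bar (hx.up j)

theorem Tri.mem (h : Sys W ha Q) {x} (hx : Tri Q x) (j) : (x j).2 ∈ Rdg W := by
  obtain ⟨i, hi⟩ := exists_ne j
  exact (h.fl i j hi).mem _ ((hx.up j).pos hi)

theorem Tri.fst (h : Sys W ha Q) {x} (hx : Tri Q x) (i j) : (dS ha (x i)).1 = (dS ha (x j)).1 := by
  rw [dS_fst, dS_fst, (hx.e i j).1, (hx.e i j).2]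

theorem Tri.ne (hW : SC W) (h : Sys W ha Q) {x} (hx : Tri Q x) (i j) : (dS ha (x i)).2 0 ≠ (dB act (x j)).2 0 := by
  rw [dB_snd0, dS_apply, (hx.e j i).2]
  simpa [shf] using rdg_red hW (hx.mem h i) 0

/-- two edges -/
theorem Tri.two (hW : SC W) (h : Sys W ha Q) {x} (hx : Tri Q x) {i j k} (hij : i ≠ j) (hik : i ≠ k) (hjk : j ≠ k)
    (e : (dS ha (x i)).2 0 = (dS ha (x j)).2 0) (hne : (dS ha (x k)).2 0 ≠ (dS ha (x i)).2 0) :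
    ∃ y, Up Q k y ∧ y.1 = (dS ha (x i)).1 ∧ y.2 0 = (dS ha (x i)).2 0 := by
  obtain ⟨y, y1, y2, y3⟩ := h.ng hik.symm ((h.up_sig (hx.up i)).pos hik.symm)
  refine ⟨y, ?_, y2, y3⟩
  rcases h.typ hik.symm y1 with hh | hh
  · exact hh
  · have h1 : y = dS ha (x j) := h.uniq hij (by have := hh j hij.symm; omega) ((h.up_sig (hx.up j)).pos hij)
      ⟨by rw [y2, hx.fst h i j], by rw [y3, e]⟩
    have h2 := h.up_sig (hx.up j)
    rw [← h1] at h2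
    have := h2 k hjk.symm
    have := h2 i hij
    omega

theorem Tri.dn (hW : SC W) (h : Sys W ha Q) {x} (hx : Tri Q x) {i j k} (hij : i ≠ j) (hik : i ≠ k) (hjk : j ≠ k)
    (e1 : (dS ha (x i)).2 0 ≠ (dS ha (x j)).2 0) (e2 : (dS ha (x i)).2 0 ≠ (dS ha (x k)).2 0) (e3 : (dS ha (x j)).2 0 ≠ (dS ha (x k)).2 0) :
    ∃ y, Dn Q i y ∧ y.1 = (dS ha (x i)).1 ∧ y.2 0 = (dS ha (x i)).2 0 := by
  obtain ⟨y, y1, y2, y3⟩ := h.ng hij.symm ((h.up_sig (hx.up i)).pos hij.symm)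
  refine ⟨y, ?_, y2, y3⟩
  rcases h.typ hij.symm y1 with hh | hh
  · exfalso
    obtain ⟨z, z1, z2, z3⟩ := h.ng hjk ((h.up_sig (hx.up k)).pos hjk)
    have p1 : Q j (dB act (x k)) - Q k (dB act (x k)) = 1 := by
      have := hx.up k j hjk
      rw [h.bar, h.bar]; omega
    have ne : ∀ {p q : P × Rd(S)}, p.2 0 ≠ q.2 0 → p ≠ q := fun h h' => h (by rw [h'])
    refine (h.fl k j hjk.symm).le3 (x := dB act (x k)) (a := dS ha (x j)) (b := y) (c := z) p1 ((h.up_sig (hx.up j)).pos hjk.symm) (hh.pos hjk.symm) z1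
      (hx.fst h j k) (by rw [y2]; exact hx.fst h i k) (by rw [z2]; rfl) (ne (hx.ne hW h _ _)) (ne (by rw [y3]; exact hx.ne hW h _ _))
      (ne (by rw [z3]; exact hx.ne hW h _ _)) (ne (by rw [y3]; exact e1.symm)) (ne (by rw [z3]; exact e3)) (ne (by rw [y3, z3]; exact e2))
  · exact hh

theorem Tri.dist (hW : SC W) (h : Sys W ha Q) {x} (hx : Tri Q x)
    (H : ∀ i j, i ≠ j → (dS ha (x i)).2 0 ≠ (dS ha (x j)).2 0) : False := by
  have h1 : ∀ i, ∃ y, Dn Q i y ∧ y.1 = (dS ha (x i)).1 ∧ y.2 0 = (dS ha (x i)).2 0 := by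
    intro i
    obtain ⟨j, hj⟩ := exists_ne i
    obtain ⟨k, k1, k2⟩ := third i j hj.symm
    exact hx.dn hW h hj.symm k1.symm k2.symm (H _ _ hj.symm) (H _ _ k1.symm) (H _ _ k2.symm)
  choose y y1 y2 y3 using h1
  have key : ∀ i j, i ≠ j → y i = dS ha (dB act (y j)) := by
    intro i j hij
    have p1 : Q j (dB act (x i)) - Q i (dB act (x i)) = 1 := by
      have := hx.up i j hij.symm
      rw [h.bar, h.bar]; omega
    have p2 : Q j (dB act (y j)) - Q i (dB act (y j)) = 1 := by
      have := y1 j i hij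
      rw [h.bar, h.bar]; omega
    have p3 : Q j (y i) - Q i (y i) = 1 := by
      have := y1 i j hij.symm; omega
    have ne : ∀ {p q : P × Rd(S)}, p = q → p.2 0 = q.2 0 := fun h => by rw [h]
    have hh := (h.fl i j hij).conn (dB act (x i)) (x j) (dB act (y j)) (y i) p1 ((hx.up j).pos hij) p2 p3
      (by rw [dB_snd0, dB_fst, ha.back, (hx.e j i).1]) (by rw [dB_snd0, linv_linv, (hx.e j i).2])
      (by rw [dB_fst, y2, y3]) (by rw [dB_snd0, y3]) (by rw [y2]; rfl)
    rcases hh with e | e | e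
    · exact absurd (ne e) (by rw [y3]; exact hx.ne hW h _ _)
    · exact absurd (ne e) (by rw [y3]; exact H _ _ hij)
    · exact e
  have e1 := key 0 1 (by decide)
  have e2 := key 0 2 (by decide)
  have e3 : y 1 = y 2 := dB_inj ha ((dS ha).injective (e1.symm.trans e2))
  have a1 := y1 1 2 (by decide)
  have a2 := y1 2 1 (by decide)
  rw [e3] at a1
  omega

/-- one step -/
def Stp (ha : Act act) (Q : Fin 3 → P × Rd(S) → ℤ) (a : Option (Fin 3)) (x y : Fin 3 → P × Rd(S)) : Prop :=
  Tri Q x ∧ Tri Q y ∧ ∀ i, (y i = dS ha (x i) ↔ a ≠ some i)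

theorem Stp.ex (hW : SC W) (h : Sys W ha Q) {x} (hx : Tri Q x) : ∃ a y, Stp ha Q a x y := by
  by_cases H : ∀ i j, (dS ha (x i)).2 0 = (dS ha (x j)).2 0
  · exact ⟨none, fun i => dS ha (x i), hx, ⟨fun i j => ⟨hx.fst h i j, H i j⟩, fun j => h.up_sig (hx.up j)⟩, fun i => by simp⟩
  · have : ∃ i j k, i ≠ j ∧ i ≠ k ∧ j ≠ k ∧ (dS ha (x i)).2 0 = (dS ha (x j)).2 0 ∧ (dS ha (x k)).2 0 ≠ (dS ha (x i)).2 0 := by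
      by_contra hc
      push Not at hc
      by_cases H2 : ∀ i j, i ≠ j → (dS ha (x i)).2 0 ≠ (dS ha (x j)).2 0
      · exact hx.dist hW h H2
      · push Not at H2
        obtain ⟨i, j, hij, e⟩ := H2
        obtain ⟨k, k1, k2, k3⟩ := third' i j hij
        have e2 := hc i j k hij k1.symm k2.symm e
        apply H
        intro a b
        rcases k3 a with rfl | rfl | rfl <;> rcases k3 b with rfl | rfl | rfl <;> simp_all
    obtain ⟨i, j, k, hij, hik, hjk, e, hne⟩ := this
    obtain ⟨y, y1, y2, y3⟩ := hx.two hW h hij hik hjk e hne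
    have k3 : ∀ m, m = i ∨ m = j ∨ m = k := by clear hne e y1 y2 y3; revert i j k; decide
    have c1 : ∀ m, ((if m = k then y else dS ha (x m)).1 = (dS ha (x i)).1 ∧ (if m = k then y else dS ha (x m)).2 0 = (dS ha (x i)).2 0) := by
      intro m
      rcases k3 m with rfl | rfl | rfl
      · simp [hik]
      · simp [hjk, hx.fst h m i, e]
      · simp [y2, y3]
    refine ⟨some k, fun m => if m = k then y else dS ha (x m), hx, ⟨fun a b => ?_, fun a => ?_⟩, fun a => ?_⟩
    · exact ⟨(c1 a).1.trans (c1 b).1.symm, (c1 a).2.trans (c1 b).2.symm⟩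
    · by_cases hh : a = k
      · simp only [hh, if_true]; exact y1
      · simp only [if_neg hh]; exact h.up_sig (hx.up a)
    · by_cases hh : a = k
      · simp only [hh, if_true, ne_eq, not_true, iff_false]
        intro e'
        exact hne (by rw [← e', y3])
      · simp [hh, Ne.symm hh]

theorem Stp.fst (h : Sys W ha Q) {a x y} (hs : Stp ha Q a x y) (i j) : (y i).1 = (dS ha (x j)).1 := by
  obtain ⟨h1, h2, h3⟩ := hs
  obtain ⟨k, hk⟩ : ∃ k, a ≠ some k := by
    rcases a with _ | a
    · exact ⟨0, by simp⟩
    · obtain ⟨k, hk⟩ := exists_ne a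
      exact ⟨k, by simpa using hk.symm⟩
  rw [(h2.e i k).1, (h3 k).2 hk, h1.fst h k j]

theorem Stp.bar (h : Sys W ha Q) {a x y} (hs : Stp ha Q a x y) : Stp ha (-Q) a (fun i => dB act (y i)) (fun i => dB act (x i)) := by
  obtain ⟨h1, h2, h3⟩ := hs
  refine ⟨h2.bar h, h1.bar h, fun i => ?_⟩
  rw [← h3 i]
  constructor
  · intro e
    have : dB act (x i) = dS ha (dB act (dS ha (x i))) := (dS_dB ha _).symm
    change dB act (x i) = _ at e
    rw [this] at e
    exact (dB_inj ha ((dS ha).injective e)).symm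
  · intro e
    simp only [e, dS_dB]

/-- letters agree iff edges agree -/
theorem Stp.edge (h : Sys W ha Q) {a x y} (hs : Stp ha Q a x y) (i j) : (dS ha (x i)).2 0 = (y j).2 0 ↔ a ≠ some i := by
  have hf := hs.fst h
  obtain ⟨h1, h2, h3⟩ := hs
  rw [← h3 i]
  constructor
  · intro e
    exact h.up_uniq (h2.up i) (h.up_sig (h1.up i)) ⟨hf i i, by rw [e, (h2.e i j).2]⟩
  · intro e
    rw [← e, (h2.e i j).2]

theorem Stp.det (h : Sys W ha Q) {a b x y z} (hs : Stp ha Q a x y) (hs' : Stp ha Q b x z) : a = b ∧ y = z := by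
  have two : ∀ a b : Option (Fin 3), ∃ k, a ≠ some k ∧ b ≠ some k := by decide
  obtain ⟨k, k1, k2⟩ := two a b
  have e : y = z := by
    funext i
    refine h.up_uniq (hs.2.1.up i) (hs'.2.1.up i) ?_
    have e1 := (hs.2.2 k).2 k1
    have e2 := (hs'.2.2 k).2 k2
    constructor
    · rw [(hs.2.1.e i k).1, (hs'.2.1.e i k).1, e1, e2]
    · rw [(hs.2.1.e i k).2, (hs'.2.1.e i k).2, e1, e2]
  refine ⟨?_, e⟩
  subst e
  have : ∀ i, a ≠ some i ↔ b ≠ some i := fun i => (hs.2.2 i).symm.trans (hs'.2.2 i)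
  clear hs hs' k1 k2
  revert a b; decide

/-- degree three at the middle vertex -/
theorem Stp.dg (hW : SC W) (h : Sys W ha Q) {a x y} (hs : Stp ha Q a x y) {i j} (hij : i ≠ j) (k) :
    Dg (fun x => Q j x - Q i x) (y k).1 ↔ a = some i ∨ a = some j := by
  have he := hs.edge h
  have hf := hs.fst h
  obtain ⟨h1, h2, h3⟩ := hs
  have p1 : Q j (dB act (x i)) - Q i (dB act (x i)) = 1 := by
    have := h1.up i j hij.symm
    rw [h.bar, h.bar]; omega
  have p2 := (h.up_sig (h1.up j)).pos hij
  have ne : ∀ {p q : P × Rd(S)}, p.2 0 ≠ q.2 0 → p ≠ q := fun h h' => h (by rw [h'])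
  constructor
  · rintro ⟨u, v, w, hu, hv, hw, eu, ev, ew, n1, n2, n3⟩
    by_contra hc
    push Not at hc
    have e1 : y i = dS ha (x i) := (h3 i).2 hc.1
    have e2 : y j = dS ha (x j) := (h3 j).2 hc.2
    have p3 : Q j (dB act (dS ha (x i))) - Q i (dB act (dS ha (x i))) = 1 := by
      have := h.up_sig (h1.up i) j hij.symm
      rw [h.bar, h.bar]; omega
    have H := fun z hz ez => (h.fl i j hij).conn (dB act (x i)) (x j) (dB act (dS ha (x i))) z p1 ((h1.up j).pos hij) p3 hz
      (by rw [dB_snd0, dB_fst, ha.back, (h1.e j i).1]) (by rw [dB_snd0, linv_linv, (h1.e j i).2])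
      (by rw [dB_fst, ← e1, ← e2, (h2.e i j).1, (h2.e i j).2]) (by rw [dB_snd0, ← e1, ← e2, (h2.e i j).2]) ez
    have e3 : ∀ z : P × Rd(S), z.1 = (y k).1 → z.1 = (dB act (x i)).1 := fun z hz => by rw [hz, hf k i]; rfl
    have Hu := H u hu (e3 _ eu)
    have Hv := H v hv (e3 _ ev)
    have Hw := H w hw (e3 _ ew)
    rw [dS_dB] at Hu Hv Hw
    rcases Hu with e | e | e <;> rcases Hv with e' | e' | e' <;> rcases Hw with e'' | e'' | e'' <;> simp_all
  · intro hc
    obtain ⟨z, z1, z2, z3⟩ := h.ng hij.symm ((h.up_sig (h1.up i)).pos hij.symm)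
    have hne : (dS ha (x i)).2 0 ≠ (dS ha (x j)).2 0 := by
      intro e
      have hh := (he i i).symm.trans ((by rw [e] : _ ↔ (dS ha (x j)).2 0 = (y i).2 0).trans (he j i))
      rcases hc with rfl | rfl
      · simp [hij] at hh
      · simp [hij.symm] at hh
    refine ⟨dB act (x i), dS ha (x j), z, p1, p2, z1, ?_, ?_, ?_, (ne (h1.ne hW h _ _)).symm, (ne (by rw [z3]; exact hne.symm)), (ne (by rw [z3]; exact h1.ne hW h _ _)).symm⟩
    · rw [hf k i]; rfl
    · rw [hf k j]
    · rw [z2, hf k i]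

end

section
variable {S : Type u} {W : Set Wd(S)} {P : Type v} {act : P → S × Bool → P} {ha : Act act}
  {Q : Fin 3 → P × Rd(S) → ℤ}

/-- a run with given letters -/
def Run (ha : Act act) (Q : Fin 3 → P × Rd(S) → ℤ) : List (Option (Fin 3)) → (Fin 3 → P × Rd(S)) → (Fin 3 → P × Rd(S)) → Prop
  | [], x, y => Tri Q x ∧ x = y
  | a :: T, x, y => ∃ z, Stp ha Q a x z ∧ Run ha Q T z y

theorem Run.tri {T x y} (h : Run ha Q T x y) : Tri Q x ∧ Tri Q y := by
  induction T generalizing x with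
  | nil => obtain ⟨h, rfl⟩ := h; exact ⟨h, h⟩
  | cons a T ih => obtain ⟨z, h1, h2⟩ := h; exact ⟨h1.1, (ih h2).2⟩

theorem run_append {T T' x y} : Run ha Q (T ++ T') x y ↔ ∃ z, Run ha Q T x z ∧ Run ha Q T' z y := by
  induction T generalizing x with
  | nil => exact ⟨fun h => ⟨x, ⟨h.tri.1, rfl⟩, h⟩, fun ⟨z, ⟨_, e⟩, h⟩ => e ▸ h⟩
  | cons a T ih =>
    constructor
    · rintro ⟨z, h1, h2⟩
      obtain ⟨t, h3, h4⟩ := ih.1 h2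
      exact ⟨t, ⟨z, h1, h3⟩, h4⟩
    · rintro ⟨t, ⟨z, h1, h3⟩, h4⟩
      exact ⟨z, h1, ih.2 ⟨t, h3, h4⟩⟩

theorem Stp.run {a x y} (h : Stp ha Q a x y) : Run ha Q [a] x y := ⟨y, h, h.2.1, rfl⟩

theorem run_one {a x y} (h : Run ha Q [a] x y) : Stp ha Q a x y := by
  obtain ⟨z, h1, _, rfl⟩ := h; exact h1

theorem Run.ex (hW : SC W) (h : Sys W ha Q) {x} (hx : Tri Q x) (n : ℕ) : ∃ T y, T.length = n ∧ Run ha Q T x y := by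
  induction n generalizing x with
  | zero => exact ⟨[], x, rfl, hx, rfl⟩
  | succ n ih =>
    obtain ⟨a, z, h1⟩ := Stp.ex hW h hx
    obtain ⟨T, y, h2, h3⟩ := ih h1.2.1
    exact ⟨a :: T, y, by simp [h2], z, h1, h3⟩

theorem Run.pre (h : Sys W ha Q) {T T' x y y'} (h1 : Run ha Q T x y) (h2 : Run ha Q T' x y') (hl : T.length ≤ T'.length) : T <+: T' := by
  induction T generalizing x T' with
  | nil => exact ⟨_, rfl⟩
  | cons a T ih =>
    rcases T' with _ | ⟨b, T'⟩
    · simp at hl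
    obtain ⟨z, h3, h4⟩ := h1
    obtain ⟨z', h5, h6⟩ := h2
    obtain ⟨rfl, rfl⟩ := h3.det h h5
    rw [List.prefix_cons_inj]
    exact ih h4 h6 (by simpa using hl)

theorem Run.bar (h : Sys W ha Q) {T x y} (h1 : Run ha Q T x y) : Run ha (-Q) T.reverse (fun i => dB act (y i)) (fun i => dB act (x i)) := by
  induction T generalizing x with
  | nil => obtain ⟨h1, rfl⟩ := h1; exact ⟨h1.bar h, rfl⟩
  | cons a T ih =>
    obtain ⟨z, h2, h3⟩ := h1
    rw [List.reverse_cons]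
    exact run_append.2 ⟨_, ih h3, (h2.bar h).run⟩

theorem Run.pow {T x y} (h : Run ha Q T x y) {i} (hi : some i ∉ T) : y i = (dS ha ^ (T.length : ℤ)) (x i) := by
  induction T generalizing x with
  | nil => obtain ⟨h, rfl⟩ := h; simp
  | cons a T ih =>
    obtain ⟨z, h1, h2⟩ := h
    rw [List.mem_cons, not_or] at hi
    rw [ih h2 hi.2, (h1.2.2 i).2 (Ne.symm hi.1), ← mul_apply, ← zpow_add_one]
    simp

theorem Run.dg (hW : SC W) (h : Sys W ha Q) {T x y} (hr : Run ha Q T x y) {k : ℕ} (hk : k < T.length) {i j} (hij : j ≠ i) (hi : some i ∉ T.take k) :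
    Dg (fun x => Q i x - Q j x) ((dS ha ^ (k + 1 : ℤ)) (x i)).1 ↔ T[k] = some i ∨ T[k] = some j := by
  have e : T = T.take k ++ [T[k]] ++ T.drop (k + 1) := by simp
  rw [e] at hr
  obtain ⟨z, hr, -⟩ := run_append.1 hr
  obtain ⟨z', h1, h2⟩ := run_append.1 hr
  have h3 := h1.pow hi
  have h4 := run_one h2
  rw [List.length_take, min_eq_left hk.le] at h3
  have h5 : ((dS ha ^ (k + 1 : ℤ)) (x i)).1 = (z i).1 := by
    rw [h4.fst h i i, h3, ← mul_apply, ← zpow_one_add, add_comm]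
  rw [h5, h4.dg hW h hij i]
  exact or_comm

theorem pat (hW : SC W) (h : Sys W ha Q) {i j c m m' x0 x y} (h0 : Stp ha Q (some i) x0 x) (hij : j ≠ i) (hc : c = i ∨ c = j)
    (hr : Run ha Q (List.replicate m none ++ some j :: (List.replicate m' none ++ [some c])) x y) : False := by
  classical
  obtain ⟨k, k1, k2⟩ := third i j hij.symm
  set T := List.replicate m none ++ some j :: (List.replicate m' none ++ [some c]) with hT
  have hlen : T.length = m + 1 + m' + 1 := by simp [hT]; omega
  have t1 : ∀ q (hq : q < T.length), q < m + 1 + m' → T[q] = if q = m then some j else none := by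
    intro q hq hq'
    simp only [hT, List.getElem_append, List.getElem_cons, List.length_replicate, List.getElem_replicate]
    split_ifs <;> first | rfl | omega
  have t2 : ∀ q, q ≤ m + 1 + m' → some i ∉ T.take q := by
    intro q hq hm
    obtain ⟨r, hr, e⟩ := List.mem_iff_getElem.1 hm
    rw [List.length_take] at hr
    rw [List.getElem_take, t1 r (by omega) (by omega)] at e
    split_ifs at e
    exact hij (Option.some.inj e)
  have hf := h0.2.1.mem h i
  set n := prd W (x i).2 with hn
  have pj := (h0.2.1.up i).pos hij
  have pk := (h0.2.1.up i).pos k1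
  have D0 : Dg (fun x => Q i x - Q j x) ((dS ha ^ (0 : ℤ)) (x i)).1 := (h0.dg hW h hij i).2 (Or.inr rfl)
  have D1 : Dg (fun x => Q i x - Q j x) ((dS ha ^ (m + 1 : ℤ)) (x i)).1 := by
    rw [hr.dg hW h (by omega) hij (t2 _ (by omega)), t1 _ _ (by omega)]; simp
  have D2 : Dg (fun x => Q i x - Q j x) ((dS ha ^ ((m + 1 + m' : ℕ) + 1 : ℤ)) (x i)).1 := by
    rw [hr.dg hW h (by omega) hij (t2 _ (by omega))]
    have : T[m + 1 + m'] = some c := by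
      simp only [hT, List.getElem_append, List.getElem_cons, List.length_replicate, List.getElem_replicate]
      split_ifs <;> first | rfl | omega
    rw [this]
    rcases hc with rfl | rfl <;> simp
  have key := lemQ' hW hf 0 (fun q => ((m + 1 + m' : ℕ) + 1 : ℤ) ≤ q ∧ Dg (fun x => Q i x - Q j x) ((dS ha ^ q) (x i)).1) (by
    intro s t hs hst ht hC
    by_cases c1 : s + t ≤ (m + 1 + m' : ℕ) + 1
    · apply (h.fl k i k1).pc _ pk
      intro q q1 q2
      obtain ⟨r, rfl⟩ : ∃ r : ℕ, q = r + 1 := ⟨(q - 1).toNat, by omega⟩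
      rw [hr.dg hW h (by omega) k1 (t2 _ (by omega)), t1 _ _ (by omega)]
      split_ifs <;> simp [hij, k2.symm]
    · apply (h.fl j i hij).pc _ pj
      intro q q1 q2 hD
      by_cases c2 : ((m + 1 + m' : ℕ) + 1 : ℤ) ≤ q
      · exact hC q q1 q2 ⟨c2, hD⟩
      · exact hC _ (by omega) (by omega) ⟨le_refl _, D2⟩)
  have six := (h.fl j i hij).six _ pj ((Ico (0 : ℤ) n).filter (fun q => Dg (fun x => Q i x - Q j x) ((dS ha ^ q) (x i)).1))
    (by intro q; rw [mem_filter, mem_Ico]; tauto)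
  rw [zero_add, ← hn] at key
  have key : 5 ≤ ((Ioo (0 : ℤ) n).filter (fun q => ((m + 1 + m' : ℕ) + 1 : ℤ) ≤ q ∧ Dg (fun x => Q i x - Q j x) ((dS ha ^ q) (x i)).1)).card := by
    convert key
  by_cases c3 : (m + 1 : ℤ) < n
  · have hpos : (0 : ℤ) < n := by omega
    have hsub : (Ioo (0 : ℤ) n).filter (fun q => ((m + 1 + m' : ℕ) + 1 : ℤ) ≤ q ∧ Dg (fun x => Q i x - Q j x) ((dS ha ^ q) (x i)).1) ⊆
        (((Ico (0 : ℤ) n).filter (fun q => Dg (fun x => Q i x - Q j x) ((dS ha ^ q) (x i)).1)).erase 0).erase (m + 1 : ℤ) := by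
      intro q hq
      simp only [mem_filter, mem_Ioo, Finset.mem_erase, mem_Ico] at hq ⊢
      refine ⟨by omega, by omega, ⟨by omega, by omega⟩, hq.2.2⟩
    have := card_le_card hsub
    rw [Finset.card_erase_of_mem, Finset.card_erase_of_mem, six] at this
    · omega
    · simp only [mem_filter, mem_Ico]; exact ⟨⟨le_refl _, hpos⟩, D0⟩
    · simp only [Finset.mem_erase, mem_filter, mem_Ico]; exact ⟨by omega, ⟨by omega, c3⟩, D1⟩
  · have : (Ioo (0 : ℤ) n).filter (fun q => ((m + 1 + m' : ℕ) + 1 : ℤ) ≤ q ∧ Dg (fun x => Q i x - Q j x) ((dS ha ^ q) (x i)).1) = ∅ := by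
      apply Finset.filter_eq_empty_iff.2
      intro q hq
      rw [mem_Ioo] at hq
      omega
    rw [this] at key
    simp at key

end

/-- nonzero letters -/
def red (T : List (Option (Fin 3))) : List (Fin 3) := T.filterMap id

theorem red_append (T T') : red (T ++ T') = red T ++ red T' := List.filterMap_append

theorem red_split {T : List (Option (Fin 3))} {u v} (h : red T = u ++ v) : ∃ T1 T2, T = T1 ++ T2 ∧ red T1 = u ∧ red T2 = v :=
  List.filterMap_eq_append_iff.1 h

theorem red_cons {T : List (Option (Fin 3))} {a v} (h : red T = a :: v) : ∃ m T2, T = List.replicate m none ++ some a :: T2 ∧ red T2 = v := by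
  induction T with
  | nil => simp [red] at h
  | cons b T ih =>
    rcases b with _ | b
    · obtain ⟨m, T2, rfl, h2⟩ := ih h
      exact ⟨m + 1, T2, rfl, h2⟩
    · have : red (some b :: T) = b :: red T := rfl
      rw [this] at h
      obtain ⟨rfl, rfl⟩ := List.cons.inj h
      exact ⟨0, T, rfl, rfl⟩

/-- after a change of letter comes the third letter -/
def Good (w : List (Fin 3)) : Prop := ∀ u a b c v, w = u ++ a :: b :: c :: v → a ≠ b → c ≠ a ∧ c ≠ b

/-- first difference -/
def DD : List (Fin 3) → Fin 3
  | a :: b :: w => if b = a then DD (b :: w) else b - a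
  | _ => 0

theorem DD_append (u v) (h : DD u ≠ 0) : DD (u ++ v) = DD u := by
  induction u with
  | nil => exact absurd rfl h
  | cons a u ih =>
    rcases u with _ | ⟨b, u⟩
    · exact absurd rfl h
    · simp only [List.cons_append, DD] at h ih ⊢
      split_ifs with hb
      · rw [if_pos hb] at h; exact ih h
      · rfl

theorem DD_zero {w : List (Fin 3)} {a : Fin 3} (h : DD (a :: w) = 0) : ∀ b ∈ w, b = a := by
  induction w generalizing a with
  | nil => simp
  | cons b w ih =>
    simp only [DD] at h
    split_ifs at h with hb
    · intro c hc
      subst hb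
      rcases List.mem_cons.1 hc with rfl | hc
      · rfl
      · exact ih h c hc
    · exact absurd (sub_eq_zero.1 h) hb

theorem DD_rev {w : List (Fin 3)} (h : DD w ≠ 0) : ∃ u v, w = u ++ v ∧ DD u = DD w ∧ DD u.reverse = - DD w := by
  induction w with
  | nil => exact absurd rfl h
  | cons a w ih =>
    rcases w with _ | ⟨b, w⟩
    · exact absurd rfl h
    · simp only [DD] at h ⊢
      split_ifs at h ⊢ with hb
      · subst hb
        obtain ⟨u, v, h1, h2, h3⟩ := ih h
        rcases u with _ | ⟨c, u⟩
        · exact absurd h2.symm h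
        · obtain ⟨rfl, -⟩ := List.cons.inj h1
          refine ⟨b :: b :: u, v, by rw [h1]; rfl, ?_, ?_⟩
          · simpa [DD] using h2
          · rw [List.reverse_cons, DD_append _ _ (by rw [h3]; simpa using h), h3]
      · refine ⟨[a, b], w, rfl, by simp [DD, hb], ?_⟩
        simp [DD, Ne.symm hb]

theorem DD_good {a : Fin 3} {w} (hg : Good (a :: w)) (h : DD w ≠ 0) : DD (a :: w) = DD w := by
  rcases w with _ | ⟨b, w⟩
  · exact absurd rfl h
  rcases w with _ | ⟨c, w⟩
  · exact absurd rfl h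
  by_cases hb : b = a
  · simp only [DD, hb, if_true]
  · obtain ⟨h1, h2⟩ := hg [] a b c w rfl (Ne.symm hb)
    simp only [DD, if_neg hb, if_neg h2]
    clear hg h; revert a b c; decide

theorem good_two {i a : Fin 3} {w} (hg : Good (a :: w)) (hi : i ∉ a :: w) : ∀ j, j ≠ a → (a :: w).count j ≤ 1 := by
  intro j hj
  induction w generalizing a with
  | nil => rw [List.count_cons_of_ne (Ne.symm hj)]; simp
  | cons b w ih =>
    by_cases hb : b = a
    · subst hb
      rw [List.count_cons_of_ne (Ne.symm hj)]
      refine ih (fun u p q c v e => hg (b :: u) p q c v (by rw [e]; rfl)) (fun hh => hi (List.mem_cons_of_mem _ hh)) hj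
    · rcases w with _ | ⟨c, w⟩
      · rw [List.count_cons_of_ne (Ne.symm hj)]
        exact List.count_le_length
      · exfalso
        obtain ⟨h1, h2⟩ := hg [] a b c w rfl (Ne.symm hb)
        simp only [List.mem_cons, not_or] at hi
        obtain ⟨h3, h4, h5, -⟩ := hi
        exact (by decide : ∀ i a b c : Fin 3, b ≠ a → c ≠ a → c ≠ b → i ≠ a → i ≠ b → i ≠ c → False) i a b c hb h1 h2 h3 h4 h5

theorem count_red (T : List (Option (Fin 3))) (j) : (red T).count j = T.count (some j) := by
  induction T with
  | nil => rfl
  | cons a T ih =>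
    rcases a with _ | a
    · have : red (none :: T) = red T := rfl
      rw [this, ih]; simp
    · have : red (some a :: T) = a :: red T := rfl
      rw [this, List.count_cons, List.count_cons, ih]; simp

section
variable {S : Type u} {W : Set Wd(S)} {P : Type v} {act : P → S × Bool → P} {ha : Act act}
  {Q : Fin 3 → P × Rd(S) → ℤ}

theorem Run.good (hW : SC W) (h : Sys W ha Q) {T x y} (hr : Run ha Q T x y) : Good (red T) := by
  intro u a b c v e hab
  obtain ⟨T1, T2, rfl, -, e1⟩ := red_split e
  obtain ⟨m, T3, rfl, e2⟩ := red_cons e1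
  obtain ⟨m1, T4, rfl, e3⟩ := red_cons e2
  obtain ⟨m2, T5, rfl, e4⟩ := red_cons e3
  obtain ⟨z, -, hr⟩ := run_append.1 hr
  obtain ⟨z1, -, z2, h1, hr⟩ := run_append.1 hr
  have e : List.replicate m1 none ++ some b :: (List.replicate m2 none ++ some c :: T5) =
    (List.replicate m1 none ++ some b :: (List.replicate m2 none ++ [some c])) ++ T5 := by simp
  rw [e] at hr
  obtain ⟨z3, hr, -⟩ := run_append.1 hr
  by_contra hc
  exact pat hW h h1 hab.symm (by tauto) hr

theorem Run.rec (hW : SC W) (h : Sys W ha Q) {T x y} (hr : Run ha Q T x y) (i) (hl : prd W (x i).2 ≤ T.length) : some i ∈ T := by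
  classical
  by_contra hi
  have hg := hr.good hW h
  have hi' : i ∉ red T := by
    intro hh
    obtain ⟨a, h1, h2⟩ := List.mem_filterMap.1 hh
    exact hi (by rw [← h2]; exact h1)
  have cnt : ∀ j, j ≠ i → 2 ≤ (red T).count j := by
    intro j hj
    rw [count_red]
    suffices hd : T.Duplicate (some j) by
      have := List.duplicate_iff_two_le_count.1 hd
      convert this
    rw [List.duplicate_iff_exists_distinct_get]
    have pj := (hr.tri.1.up i).pos hj
    have six := (h.fl j i hj).six _ pj ((Ico (0 : ℤ) (prd W (x i).2)).filter (fun q => Dg (fun x => Q i x - Q j x) ((dS ha ^ q) (x i)).1))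
      (by intro q; rw [mem_filter, mem_Ico]; tauto)
    have h5 := Finset.pred_card_le_card_erase (s := ((Ico (0 : ℤ) (prd W (x i).2)).filter (fun q => Dg (fun x => Q i x - Q j x) ((dS ha ^ q) (x i)).1))) (a := 0)
    rw [six] at h5
    obtain ⟨a, hA, b, hB, hab⟩ := Finset.one_lt_card.1 (lt_of_lt_of_le (by norm_num) h5)
    simp only [Finset.mem_erase, mem_filter, mem_Ico] at hA hB
    have key : ∀ q : ℤ, q ≠ 0 → (0 ≤ q ∧ q < prd W (x i).2) → Dg (fun x => Q i x - Q j x) ((dS ha ^ q) (x i)).1 →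
        ∃ r : ℕ, ∃ hr : r < T.length, q = r + 1 ∧ some j = T[r] := by
      intro q q0 q1 q2
      obtain ⟨r, rfl⟩ : ∃ r : ℕ, q = r + 1 := ⟨(q - 1).toNat, by omega⟩
      have hrl : r < T.length := by omega
      rw [hr.dg hW h hrl hj (fun hh => hi (List.mem_of_mem_take hh))] at q2
      refine ⟨r, hrl, rfl, ?_⟩
      rcases q2 with e | e
      · exact absurd (by rw [← e]; exact List.getElem_mem _) hi
      · exact e.symm
    obtain ⟨r, r1, r2, r3⟩ := key a hA.1 hA.2.1 hA.2.2
    obtain ⟨r', r1', r2', r3'⟩ := key b hB.1 hB.2.1 hB.2.2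
    rcases lt_or_gt_of_ne (by omega : r ≠ r') with hlt | hlt
    · exact ⟨⟨r, r1⟩, ⟨r', r1'⟩, hlt, r3, r3'⟩
    · exact ⟨⟨r', r1'⟩, ⟨r, r1⟩, hlt, r3', r3⟩
  rcases hw : red T with _ | ⟨a, w⟩
  · obtain ⟨j, hj⟩ := exists_ne i
    have := cnt j hj
    rw [hw] at this; simp at this
  · rw [hw] at hg hi' cnt
    have hai : a ≠ i := fun e => hi' (by simp [e])
    obtain ⟨j, j1, j2⟩ := third a i hai
    have := good_two hg hi' j j1
    have := cnt j j2
    omega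

/-- chirality exists within a bounded number of steps -/
theorem Run.exD (hW : SC W) (h : Sys W ha Q) {x} (hx : Tri Q x) {n : ℕ} (hn : ∀ i, prd W (x i).2 ≤ n) :
    ∃ T y, T.length = n ∧ Run ha Q T x y ∧ DD (red T) ≠ 0 := by
  obtain ⟨T, y, h1, h2⟩ := Run.ex hW h hx n
  refine ⟨T, y, h1, h2, ?_⟩
  have hm : ∀ i, i ∈ red T := fun i => List.mem_filterMap.2 ⟨some i, h2.rec hW h i (by rw [h1]; exact hn i), rfl⟩
  intro h0
  rcases hw : red T with _ | ⟨a, w⟩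
  · have := hm 0
    rw [hw] at this; simp at this
  · rw [hw] at h0 hm
    have h3 := DD_zero h0
    have h4 : ∀ b, b = a := by
      intro b
      rcases List.mem_cons.1 (hm b) with e | e
      · exact e
      · exact h3 b e
    exact absurd ((h4 0).trans (h4 1).symm) (by decide)

open Classical in
/-- chirality -/
noncomputable def chir (ha : Act act) (Q : Fin 3 → P × Rd(S) → ℤ) (x : Fin 3 → P × Rd(S)) : ℤ :=
  if ∃ T y, Run ha Q T x y ∧ DD (red T) = 1 then 1 else if ∃ T y, Run ha Q T x y ∧ DD (red T) = 2 then -1 else 0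

/-- sign -/
def sg (e : Fin 3) : ℤ := if e = 1 then 1 else if e = 2 then -1 else 0

theorem Run.chir (h : Sys W ha Q) {T x y} (hr : Run ha Q T x y) (hd : DD (red T) ≠ 0) : chir ha Q x = sg (DD (red T)) := by
  have uq : ∀ T' y', Run ha Q T' x y' → DD (red T') ≠ 0 → DD (red T') = DD (red T) := by
    intro T' y' hr' hd'
    rcases le_total T.length T'.length with hl | hl
    · obtain ⟨t, rfl⟩ := hr.pre h hr' hl
      rw [red_append, DD_append _ _ hd]
    · obtain ⟨t, rfl⟩ := hr'.pre h hr hl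
      rw [red_append, DD_append _ _ hd']
  have h3 : ∀ e : Fin 3, e ≠ 0 → e = 1 ∨ e = 2 := by decide
  unfold FC6.chir
  rcases h3 _ hd with e | e
  · rw [if_pos ⟨T, y, hr, e⟩, e]; rfl
  · rw [if_neg, if_pos ⟨T, y, hr, e⟩, e]
    · rfl
    · rintro ⟨T', y', hr', e'⟩
      have := uq T' y' hr' (by rw [e']; decide)
      rw [e, e'] at this
      exact absurd this (by decide)

theorem chir_tri {x} (hx : chir ha Q x ≠ 0) : Tri Q x := by
  unfold chir at hx
  split_ifs at hx with h1 h2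
  · obtain ⟨T, y, h, -⟩ := h1; exact h.tri.1
  · obtain ⟨T, y, h, -⟩ := h2; exact h.tri.1
  · exact absurd rfl hx

theorem exN {x : Fin 3 → P × Rd(S)} : ∃ n : ℕ, ∀ i, prd W (x i).2 ≤ n :=
  ⟨∑ i, prd W (x i).2, fun i => Finset.single_le_sum (f := fun i => prd W (x i).2) (fun _ _ => Nat.zero_le _) (mem_univ i)⟩

theorem chir_abs (hW : SC W) (h : Sys W ha Q) {x} (hx : Tri Q x) : chir ha Q x = 1 ∨ chir ha Q x = -1 := by
  obtain ⟨n, hn⟩ := exN (W := W) (x := x)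
  obtain ⟨T, y, h1, h2, h3⟩ := Run.exD hW h hx hn
  rw [h2.chir h h3]
  revert h3; generalize DD (red T) = e; revert e; decide

theorem Stp.chir (hW : SC W) (h : Sys W ha Q) {a x y} (hs : Stp ha Q a x y) : chir ha Q x = chir ha Q y := by
  obtain ⟨n, hn⟩ := exN (W := W) (x := y)
  obtain ⟨T, z, h1, h2, h3⟩ := Run.exD hW h hs.2.1 hn
  have hr : Run ha Q (a :: T) x z := ⟨y, hs, h2⟩
  have e : DD (red (a :: T)) = DD (red T) := by
    rcases a with _ | a
    · rfl
    · exact DD_good (hr.good hW h) h3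
  rw [h2.chir h h3, hr.chir h (by rw [e]; exact h3), e]

theorem Run.chir_eq (hW : SC W) (h : Sys W ha Q) {T x y} (hs : Run ha Q T x y) : FC6.chir ha Q x = FC6.chir ha Q y := by
  induction T generalizing x with
  | nil => obtain ⟨_, rfl⟩ := hs; rfl
  | cons a T ih => obtain ⟨z, h1, h2⟩ := hs; rw [h1.chir hW h, ih h2]

theorem chir_bar (hW : SC W) (h : Sys W ha Q) {x} (hx : Tri Q x) : chir ha (-Q) (fun i => dB act (x i)) = - chir ha Q x := by
  obtain ⟨n, hn⟩ := exN (W := W) (x := fun i => dB act (x i))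
  obtain ⟨T, z, h1, h2, h3⟩ := Run.exD hW h.neg (hx.bar h) hn
  obtain ⟨u, v, e, e1, e2⟩ := DD_rev h3
  obtain ⟨T1, T2, rfl, rfl, -⟩ := red_split e
  obtain ⟨z', h4, -⟩ := run_append.1 h2
  have h5 := h4.bar h.neg
  simp only [dB_dB ha, neg_neg] at h5
  have e3 : red T1.reverse = (red T1).reverse := List.filterMap_reverse
  rw [h4.chir h.neg (by rw [e1]; exact h3), ← h5.chir_eq hW h, h5.chir h (by rw [e3, e2]; simpa using h3), e3, e2, e1]
  revert h3; generalize DD _ = e; revert e; decide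

/-- locality of runs -/
theorem Run.loc {Q' : Fin 3 → P × Rd(S) → ℤ} {x} {n : ℕ} (H : ∀ T y, T.length ≤ n → Run ha Q T x y → ∀ i j, Q j (y i) = Q' j (y i))
    {T y} (hl : T.length ≤ n) (hr : Run ha Q T x y) : Run ha Q' T x y := by
  have tr : ∀ T y, T.length ≤ n → Run ha Q T x y → Tri Q' y := fun T y hl hr =>
    ⟨hr.tri.2.e, fun j i hi => by rw [← H T y hl hr, ← H T y hl hr]; exact hr.tri.2.up j i hi⟩
  induction T using List.reverseRecOn generalizing y with
  | nil => obtain ⟨h1, rfl⟩ := hr; exact ⟨tr [] x hl ⟨h1, rfl⟩, rfl⟩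
  | append_singleton T a ih =>
    obtain ⟨z, h1, h2⟩ := run_append.1 hr
    have hl' : T.length ≤ n := by simp at hl; omega
    refine run_append.2 ⟨z, ih hl' h1, Stp.run ⟨tr T z hl' h1, tr _ y hl hr, (run_one h2).2.2⟩⟩

theorem chir_loc (hW : SC W) (h : Sys W ha Q) {Q' : Fin 3 → P × Rd(S) → ℤ} (h' : Sys W ha Q') {x} (hx : Tri Q x) {n : ℕ}
    (hn : ∀ i, prd W (x i).2 ≤ n) (H : ∀ T y, T.length ≤ n → Run ha Q T x y → ∀ i j, Q j (y i) = Q' j (y i)) : chir ha Q x = chir ha Q' x := by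
  obtain ⟨T, z, h1, h2, h3⟩ := Run.exD hW h hx hn
  rw [h2.chir h h3, (Run.loc H h1.le h2).chir h' h3]

end

section
variable {S : Type u} {W : Set Wd(S)} {P : Type v} {act : P → S × Bool → P} {ha : Act act}
  {Q : Fin 3 → P × Rd(S) → ℤ}

/-- flux of a potential -/
noncomputable def Ph (ha : Act act) (Q : Fin 3 → P × Rd(S) → ℤ) (ω : P → ℤ) : ℤ :=
  ∑ᶠ x : Fin 3 → P × Rd(S), chir ha Q x * (ω (dS ha (x 0)).1 - ω (x 0).1)

theorem Stp.inj (h : Sys W ha Q) {a b x y z} (hs : Stp ha Q a x y) (hs' : Stp ha Q b z y) : x = z := by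
  have := (Stp.det h.neg (hs.bar h) (hs'.bar h)).2
  funext i
  exact dB_inj ha (congrFun this i)

theorem Ph_zero (hW : SC W) (h : Sys W ha Q) {ω : P → ℤ} (hf : {x | Tri Q x ∧ ω (x 0).1 ≠ 0}.Finite) : Ph ha Q ω = 0 := by
  classical
  have hex : ∀ x, ∃ y, Tri Q x → ∃ a, Stp ha Q a x y := by
    intro x
    by_cases hx : Tri Q x
    · obtain ⟨a, y, hy⟩ := Stp.ex hW h hx
      exact ⟨y, fun _ => ⟨a, hy⟩⟩
    · exact ⟨x, fun hh => absurd hh hx⟩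
  choose N hN using hex
  have hb : Set.BijOn N {x | Tri Q x} {x | Tri Q x} := by
    refine ⟨?_, ?_, ?_⟩
    · intro x hx
      obtain ⟨a, hs⟩ := hN x hx
      exact hs.2.1
    · intro x hx y hy e
      obtain ⟨a, hs⟩ := hN x hx
      obtain ⟨b, hs'⟩ := hN y hy
      rw [← e] at hs'
      exact hs.inj h hs'
    · intro y hy
      obtain ⟨a, z, hz⟩ := Stp.ex hW h.neg (Tri.bar h hy)
      have h2 := hz.bar h.neg
      simp only [dB_dB ha, neg_neg] at h2
      refine ⟨_, h2.1, ?_⟩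
      obtain ⟨b, hs'⟩ := hN _ h2.1
      exact (Stp.det h hs' h2).2
  have hs1 : ∀ f : (Fin 3 → P × Rd(S)) → ℤ, ∑ᶠ x, chir ha Q x * f x = ∑ᶠ x ∈ {x | Tri Q x}, chir ha Q x * f x := by
    intro f
    rw [finsum_mem_def]
    apply finsum_congr
    intro x
    by_cases hx : Tri Q x
    · exact (Set.indicator_of_mem (s := {x | Tri Q x}) hx (fun x => chir ha Q x * f x)).symm
    · rw [Set.indicator_of_notMem (by exact hx)]
      have : chir ha Q x = 0 := by by_contra hc; exact hx (chir_tri hc)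
      rw [this, zero_mul]
  have f1 : (support fun x => chir ha Q x * ω (x 0).1).Finite := hf.subset fun x hx =>
    ⟨chir_tri (left_ne_zero_of_mul hx), right_ne_zero_of_mul hx⟩
  have f2 : (support fun x => chir ha Q x * ω (dS ha (x 0)).1).Finite := by
    refine Set.Finite.of_finite_image (f := N) (hf.subset ?_) (hb.2.1.mono fun x hx => chir_tri (left_ne_zero_of_mul hx))
    rintro _ ⟨x, hx, rfl⟩
    have ht := chir_tri (left_ne_zero_of_mul hx)
    obtain ⟨a, hs⟩ := hN x ht
    refine ⟨hs.2.1, ?_⟩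
    rw [hs.fst h 0 0]
    exact right_ne_zero_of_mul hx
  unfold Ph
  simp only [mul_sub]
  rw [finsum_sub_distrib f2 f1, sub_eq_zero, hs1 (fun x => ω (dS ha (x 0)).1), hs1 (fun x => ω (x 0).1)]
  refine finsum_mem_eq_of_bijOn N hb ?_
  intro x hx
  obtain ⟨a, hs⟩ := hN x hx
  rw [hs.chir hW h, hs.fst h 0 0]

theorem Ph_add {ω ω' : P → ℤ} (hf : (support fun x => chir ha Q x * (ω (dS ha (x 0)).1 - ω (x 0).1)).Finite)
    (hf' : (support fun x => chir ha Q x * (ω' (dS ha (x 0)).1 - ω' (x 0).1)).Finite) :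
    Ph ha Q ω + Ph ha Q ω' = Ph ha Q (fun g => ω g + ω' g - 1) := by
  unfold Ph
  rw [← finsum_add_distrib hf hf']
  apply finsum_congr
  intro x; ring

/-- reversal of triples -/
def bt (ha : Act act) : Perm (Fin 3 → P × Rd(S)) where
  toFun x := fun i => dB act (x i)
  invFun x := fun i => dB act (x i)
  left_inv x := by funext i; simp only [dB_dB ha]
  right_inv x := by funext i; simp only [dB_dB ha]

theorem dS_dB_fst (ha : Act act) (x : P × Rd(S)) : (dS ha (dB act x)).1 = x.1 := by
  rw [dS_fst, dB_fst, dB_snd0, ha.back]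

theorem Ph_neg (hW : SC W) (h : Sys W ha Q) (ω : P → ℤ) : Ph ha (-Q) ω = Ph ha Q ω := by
  unfold Ph
  rw [← finsum_comp_equiv (bt ha)]
  apply finsum_congr
  intro x
  change chir ha (-Q) (fun i => dB act (x i)) * (ω (dS ha (dB act (x 0))).1 - ω (dB act (x 0)).1) = _
  rw [dS_dB_fst, dB_fst, dS_fst]
  by_cases hx : Tri Q x
  · rw [chir_bar hW h hx]; ring
  · have e1 : chir ha Q x = 0 := by by_contra hc; exact hx (chir_tri hc)
    have e2 : chir ha (-Q) (fun i => dB act (x i)) = 0 := by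
      by_contra hc
      have := (chir_tri hc).bar h.neg
      simp only [dB_dB ha, neg_neg] at this
      exact hx this
    rw [e1, e2]; ring

theorem dS_nat_fst (ha : Act act) (p : P) {w : Wd(S)} (hw : w ≠ []) {k : ℕ} (hk : k ≤ w.length) :
    ((dS ha ^ k) (p, rd w hw)).1 = pend act p (w.take k) := by
  induction k with
  | zero => simp [pend]
  | succ k ih =>
    have e : ((dS ha ^ k) (p, rd w hw)).2 0 = w[k] := by
      rw [← zpow_natCast, dS_pow_snd]
      simp only [shf, zero_add]
      rw [rd_natCast _ (by omega)]
    rw [pow_succ', mul_apply, dS_fst, ih (by omega), e, ← List.take_append_getElem (by omega : k < w.length), pend_append]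
    rfl

theorem dS_prd (hW : SC W) (hr : ∀ r ∈ W, ∀ p, pend act p r = p) {x : P × Rd(S)} (hx : x.2 ∈ Rdg W) : (dS ha ^ prd W x.2) x = x := by
  obtain ⟨w, hw, e, e2⟩ := Rdg.elim hW hx
  refine Prod.ext ?_ ?_
  · obtain ⟨p, f⟩ := x
    simp only at e e2 ⊢
    subst e
    rw [e2, dS_nat_fst ha p _ le_rfl, List.take_length, hr w hw]
  · rw [← zpow_natCast, dS_pow_snd, shf_prd hW hx]

end

/-- bounded elements -/
def nb (K : ℤ) (g : F2 × F2) : Prop := ∀ a b, |dd a b g.1| ≤ K ∧ |dd a b g.2| ≤ K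

theorem nb_fin {X : Set (F2 × F2)} (hX : X.Finite) : ∀ᶠ K in Filter.atTop, ∀ g ∈ X, nb K g := by
  refine (Filter.eventually_all_finite hX).2 fun g _ => ?_
  unfold nb
  simp only [Filter.eventually_all]
  intro a b
  exact (Filter.eventually_ge_atTop _).and (Filter.eventually_ge_atTop _)

section
variable {S : Type u} {W : Set Wd(S)} {π : FreeGroup S →* F2 × F2}
  {l : Fin 3 → Fin 3 → Fi(S)} {A C : Fin 3 → FreeGroup S} {K : ℤ} {N : ℕ}

/-- all data -/
structure Dat (W : Set Wd(S)) (π : FreeGroup S →* F2 × F2)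
    (l : Fin 3 → Fin 3 → Fi(S)) (A C : Fin 3 → FreeGroup S) (K : ℤ) (N : ℕ) : Prop where
  hW : SC W
  hker : π.ker = Subgroup.normalClosure (fgMk '' W)
  hA : ∀ i, π (A i) = (aa i, 1)
  hC : ∀ i, π (C i) = (1, aa i)
  hl : ∀ i j, ∀ x ∈ l i j, x.2 ∈ W
  hl' : ∀ i j, fgMk (cjl (l i j)) = A i * C j * (A i)⁻¹ * (C j)⁻¹
  K0 : 0 ≤ K
  hb : ∀ i j, ∀ v ∈ pos (l i j), nb K (π (fgMk v))
  hs : ∀ i j, ∀ f ∈ rds (l i j), nb K (π (fgMk [f 0]))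
  hN : ∀ i j, ∀ f ∈ rds (l i j), prd W f ≤ N
  pA : ∀ i, ∃ w, fgMk w = A i ∧ ∀ u, u <+: w → nb K (π (fgMk u))
  pC : ∀ i, ∃ w, fgMk w = C i ∧ ∀ u, u <+: w → nb K (π (fgMk u))

/-- difference of quarter planes -/
noncomputable def QD (π : FreeGroup S →* F2 × F2) (l : Fin 3 → Fin 3 → Fi(S)) (k m : Fin 3) :
    Fin 3 → (F2 × F2) × Rd(S) → ℤ := fun i x => QQ π l i m x - QQ π l i k x

theorem QD_neg (k m : Fin 3) : QD π l k m = - QD π l m k := by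
  funext i x; simp [QD]

theorem Dat.hr (h : Dat W π l A C K N) : ∀ r ∈ W, ∀ p, pend (ag π) p r = p := by
  intro r hr p
  have : fgMk r ∈ π.ker := by rw [h.hker]; exact Subgroup.subset_normalClosure ⟨r, hr, rfl⟩
  rw [pend_ag, (this : π (fgMk r) = 1), mul_one]

theorem Dat.qsig (h : Dat W π l A C K N) (i j x) : QQ π l i j (dS (ag_act π) x) = QQ π l i j x :=
  finsum_congr fun m => chn_sig h.hW (ag_act π) h.hr _ _ (h.hl i j) x

theorem Dat.qbar (h : Dat W π l A C K N) (i j x) : QQ π l i j (dB (ag π) x) = - QQ π l i j x := by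
  unfold QQ
  rw [← finsum_neg_distrib]
  exact finsum_congr fun m => chn_bar (ag_act π) _ _ x

theorem Dat.sys (h : Dat W π l A C K N) {k m} (hkm : k ≠ m) : Sys W (ag_act π) (QD π l k m) where
  fl i j hij := by
    have := plane_flat h.hW h.hker h.hA h.hC h.hl h.hl' hij hkm
    convert this using 2
    simp only [QD]; ring
  sig i x := by simp only [QD, h.qsig]
  bar i x := by simp only [QD, h.qbar]; ring

/-- finite sets of darts -/
def bx (π : FreeGroup S →* F2 × F2) (l : Fin 3 → Fin 3 → Fi(S)) (n : ℕ) : Set ((F2 × F2) × Rd(S)) :=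
  ⋃ (i : Fin 3) (j : Fin 3), (fun t : (ℕ × ℕ) × (Wd(S) × Rd(S)) => (bp i j t.1 * π (fgMk t.2.1), t.2.2)) ''
    ((Set.Iio n ×ˢ Set.Iio n) ×ˢ (pos (l i j) ×ˢ rds (l i j)))

theorem bx_fin (n : ℕ) : (bx π l n).Finite :=
  Set.finite_iUnion fun i => Set.finite_iUnion fun j => Set.Finite.image _
    (((Set.finite_Iio n).prod (Set.finite_Iio n)).prod ((pos_fin _).prod (rds_fin _)))

theorem dd_aa_le (i k j : Fin 3) : |dd i k (aa j)| ≤ 1 := by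
  rw [dd_aa, abs_le]; split_ifs <;> simp

theorem Dat.chn (h : Dat W π l A C K N) {i j m x} (hx : chn (ag π) dlt (bp i j m) (l i j) x ≠ 0) :
    x.2 ∈ rds (l i j) ∧ (∀ n, m.1 < n → m.2 < n → x ∈ bx π l n) ∧
    ∀ a b, |dd a b x.1.1 - m.1 * dd a b (aa i)| ≤ K ∧ |dd a b x.1.2 - m.2 * dd a b (aa j)| ≤ K := by
  obtain ⟨⟨v, hv, e⟩, hf⟩ := chn_supp hx
  rw [pend_ag] at e
  refine ⟨hf, ?_, ?_⟩
  · intro n h1 h2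
    refine Set.mem_iUnion.2 ⟨i, Set.mem_iUnion.2 ⟨j, ⟨(m, (v, x.2)), ⟨⟨h1, h2⟩, ⟨hv, hf⟩⟩, ?_⟩⟩⟩
    rw [← Prod.mk.eta (p := x), ← e]
  · intro a b
    have := h.hb i j v hv a b
    rw [← e]
    simp only [bp, Prod.fst_mul, Prod.snd_mul, dd_mul, dd_pow, add_sub_cancel_left]
    exact this

theorem Dat.sup (h : Dat W π l A C K N) {i j x} (hx : QQ π l i j x ≠ 0) :
    x.2 ∈ rds (l i j) ∧ ∃ m : ℕ × ℕ, (∀ n, m.1 < n → m.2 < n → x ∈ bx π l n) ∧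
    ∀ a b, |dd a b x.1.1 - m.1 * dd a b (aa i)| ≤ K ∧ |dd a b x.1.2 - m.2 * dd a b (aa j)| ≤ K := by
  obtain ⟨m, hm⟩ : ∃ m, FC6.chn (ag π) dlt (bp i j m) (l i j) x ≠ 0 := by
    by_contra hc
    push Not at hc
    exact hx (by unfold QQ; simp only [hc, finsum_zero])
  exact ⟨(h.chn hm).1, m, (h.chn hm).2⟩

theorem dd_self (i j : Fin 3) (hij : j ≠ i) : dd i j (aa i) = 1 := by simp [dd_aa, hij]
theorem dd_nonpos (i j k : Fin 3) (hij : k ≠ i) : dd i j (aa k) ≤ 0 := by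
  simp [dd_aa, hij.symm]; split_ifs <;> simp

theorem succ_ne : ∀ i : Fin 3, i + 1 ≠ i := by decide

/-- two different directions bound the first coordinate -/
theorem Dat.two (h : Dat W π l A C K N) {i j i' j' x x'} (hi : i ≠ i') (hx : QQ π l i j x ≠ 0) (hx' : QQ π l i' j' x' ≠ 0) (e : x.1 = x'.1) :
    ∀ a b, |dd a b x.1.1| ≤ 3 * K := by
  obtain ⟨-, m, -, h1⟩ := h.sup hx
  obtain ⟨-, m', -, h2⟩ := h.sup hx'
  intro a b
  have a1 := (h1 i i').1
  have a2 := (h2 i i').1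
  rw [← e] at a2
  have a3 := (h1 a b).1
  have d1 := dd_self i i' hi.symm
  have d2 : dd i i' (aa i') = -1 := by simp [dd_aa, hi]
  have d3 := dd_aa_le a b i
  rw [d1] at a1
  rw [d2] at a2
  rw [abs_le] at a1 a2 a3 d3 ⊢
  have m0 : (0 : ℤ) ≤ m.1 := by positivity
  have m0' : (0 : ℤ) ≤ m'.1 := by positivity
  have m1 : (m.1 : ℤ) ≤ 2 * K := by omega
  constructor <;> nlinarith

theorem Dat.bxm (h : Dat W π l A C K N) {i j x} (hx : QQ π l i j x ≠ 0) {n : ℕ} (h1 : dd i (i + 1) x.1.1 + K < n) (h2 : dd j (j + 1) x.1.2 + K < n) :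
    x ∈ bx π l n := by
  obtain ⟨-, m, hm, h3⟩ := h.sup hx
  have a1 := (h3 i (i + 1)).1
  have a2 := (h3 j (j + 1)).2
  rw [dd_self _ _ (succ_ne _)] at a1 a2
  rw [abs_le] at a1 a2
  exact hm n (by omega) (by omega)

theorem Dat.far (h : Dat W π l A C K N) {i j k x} (hjk : j ≠ k) (hx : QQ π l i j x ≠ 0) : dd k (k + 1) x.1.2 ≤ K := by
  obtain ⟨-, m, hm, h3⟩ := h.sup hx
  have a2 := (h3 k (k + 1)).2
  have := dd_nonpos k (k + 1) j hjk
  rw [abs_le] at a2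
  have m0 : (0 : ℤ) ≤ m.2 := by positivity
  nlinarith

/-- nonzero entries at triples -/
theorem Dat.tri (h : Dat W π l A C K N) {k m : Fin 3} {x} (hx : Tri (QD π l k m) x) :
    (∀ s, ∃ i, ∃ j, (j = k ∨ j = m) ∧ QQ π l i j (x s) ≠ 0) ∧ ∀ s a b, |dd a b (x s).1.1| ≤ 3 * K := by
  have key : ∀ i s, QD π l k m i (x s) ≠ 0 → ∃ j, (j = k ∨ j = m) ∧ QQ π l i j (x s) ≠ 0 := by
    intro i s hh
    by_cases h1 : QQ π l i m (x s) = 0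
    · refine ⟨k, Or.inl rfl, fun h2 => hh ?_⟩
      simp [QD, h1, h2]
    · exact ⟨m, Or.inr rfl, h1⟩
  have k1 : ∀ s, ∃ i, QD π l k m i (x s) ≠ 0 := by
    intro s
    obtain ⟨t, ht⟩ := exists_ne s
    have := hx.up s t ht
    by_cases e : QD π l k m s (x s) = 0
    · exact ⟨t, by omega⟩
    · exact ⟨s, e⟩
  have k2 : ∃ i i' s s', i ≠ i' ∧ QD π l k m i (x s) ≠ 0 ∧ QD π l k m i' (x s') ≠ 0 := by
    by_cases e0 : QD π l k m 0 (x 0) = 0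
    · have h1 := hx.up 0 1 (by decide)
      have h2 := hx.up 0 2 (by decide)
      exact ⟨1, 2, 0, 0, by decide, by omega, by omega⟩
    · by_cases e1 : QD π l k m 1 (x 1) = 0
      · have h1 := hx.up 1 0 (by decide)
        have h2 := hx.up 1 2 (by decide)
        exact ⟨0, 2, 1, 1, by decide, by omega, by omega⟩
      · exact ⟨0, 1, 0, 1, by decide, e0, e1⟩
  refine ⟨fun s => ?_, fun s => ?_⟩
  · obtain ⟨i, hi⟩ := k1 s
    exact ⟨i, key i s hi⟩
  · obtain ⟨i, i', t, t', hi, h1, h2⟩ := k2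
    obtain ⟨j, -, hj⟩ := key i t h1
    obtain ⟨j', -, hj'⟩ := key i' t' h2
    rw [(hx.e s t).1]
    exact h.two hi hj hj' (hx.e t t').1

/-- half spaces -/
def om (M : ℤ) (k : Fin 3) (g : F2 × F2) : ℤ := if M ≤ dd k (k + 1) g.2 then 1 else 0

theorem Dat.rdt (h : Dat W π l A C K N) {k m : Fin 3} {x} (hx : Tri (QD π l k m) x) (s) : (∃ i j, (x s).2 ∈ rds (l i j)) := by
  obtain ⟨i, j, -, hj⟩ := (h.tri hx).1 s
  exact ⟨i, j, (h.sup hj).1⟩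

theorem Dat.stp (h : Dat W π l A C K N) {i j} {x : (F2 × F2) × Rd(S)} (hx : x.2 ∈ rds (l i j)) (a b) :
    |dd a b (dS (ag_act π) x).1.1 - dd a b x.1.1| ≤ K ∧ |dd a b (dS (ag_act π) x).1.2 - dd a b x.1.2| ≤ K := by
  rw [dS_fst, ag]
  have := h.hs i j _ hx a b
  simp only [Prod.fst_mul, Prod.snd_mul, dd_mul, add_sub_cancel_left]
  exact this

theorem om_ne {M : ℤ} {k : Fin 3} {g g' : F2 × F2} (h : om M k g' - om M k g ≠ 0) (hK : |dd k (k + 1) g'.2 - dd k (k + 1) g.2| ≤ K) :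
    |dd k (k + 1) g.2 - M| ≤ K := by
  unfold om at h
  rw [abs_le] at hK ⊢
  split_ifs at h <;> first | omega | exact absurd rfl h

/-- finiteness of triples -/
theorem Dat.fin (h : Dat W π l A C K N) {k m : Fin 3} (L : ℤ) :
    {x | Tri (QD π l k m) x ∧ ∀ s i j, (j = k ∨ j = m) → QQ π l i j (x s) ≠ 0 → dd j (j + 1) (x s).1.2 ≤ L}.Finite := by
  obtain ⟨n, hn⟩ : ∃ n : ℕ, 4 * K < n ∧ L + K < n := ⟨(4 * K).toNat + (L + K).toNat + 1, by omega, by omega⟩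
  refine (Set.Finite.pi' fun _ : Fin 3 => bx_fin (π := π) (l := l) n).subset ?_
  rintro x ⟨hx, h2⟩ s
  obtain ⟨i, j, hj, hQ⟩ := (h.tri hx).1 s
  have := (h.tri hx).2 s i (i + 1)
  have h3 := h2 s i j hj hQ
  rw [abs_le] at this
  exact h.bxm hQ (by omega) (by omega)

theorem Dat.near (h : Dat W π l A C K N) {M : ℤ} (hM : 2 * K < M) {k m n : Fin 3} (hkm : k ≠ m) (hn : n = k ∨ n = m) {x} (hx : Tri (QD π l k m) x)
    (h1 : |dd n (n + 1) (x 0).1.2 - M| ≤ K) : ∀ s i j, (j = k ∨ j = m) → QQ π l i j (x s) ≠ 0 → dd j (j + 1) (x s).1.2 ≤ M + K := by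
  intro s i j hj hQ
  rw [(hx.e 0 s).1, abs_le] at h1
  by_cases e : j = n
  · rw [e]; omega
  · have := h.far e hQ
    omega

theorem Dat.om_near (h : Dat W π l A C K N) {M : ℤ} {k m n : Fin 3} {x} (hx : Tri (QD π l k m) x) (s)
    (h1 : om M n (dS (ag_act π) (x s)).1 - om M n (x s).1 ≠ 0) : |dd n (n + 1) (x s).1.2 - M| ≤ K := by
  obtain ⟨i, j, hf⟩ := h.rdt hx s
  exact om_ne h1 (h.stp hf _ _).2

theorem Dat.phfin (h : Dat W π l A C K N) {M : ℤ} (hM : 2 * K < M) {k m n : Fin 3} (hkm : k ≠ m) (hn : n = k ∨ n = m) :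
    {x | Tri (QD π l k m) x ∧ om M n (dS (ag_act π) (x 0)).1 - om M n (x 0).1 ≠ 0}.Finite := by
  refine (h.fin (k := k) (m := m) (M + K)).subset ?_
  intro x hx
  exact ⟨hx.1, h.near hM hkm hn hx.1 (h.om_near hx.1 0 hx.2)⟩

theorem Dat.phfin' (h : Dat W π l A C K N) {M : ℤ} (hM : 2 * K < M) {k m n : Fin 3} (hkm : k ≠ m) (hn : n = k ∨ n = m) :
    (support fun x => chir (ag_act π) (QD π l k m) x * (om M n (dS (ag_act π) (x 0)).1 - om M n (x 0).1)).Finite :=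
  (h.phfin hM hkm hn).subset fun x hx => ⟨chir_tri (left_ne_zero_of_mul hx), right_ne_zero_of_mul hx⟩

theorem Dat.opp (h : Dat W π l A C K N) {M : ℤ} (hM : 2 * K < M) {k m : Fin 3} (hkm : k ≠ m) :
    Ph (ag_act π) (QD π l k m) (om M k) + Ph (ag_act π) (QD π l k m) (om M m) = 0 := by
  rw [Ph_add (h.phfin' hM hkm (Or.inl rfl)) (h.phfin' hM hkm (Or.inr rfl))]
  apply Ph_zero h.hW (h.sys hkm)
  refine (h.fin (k := k) (m := m) M).subset ?_
  rintro x ⟨hx, h1⟩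
  refine ⟨hx, ?_⟩
  intro s i j hj hQ
  by_contra hc
  apply h1
  rw [(hx.e 0 s).1]
  have K0 := h.K0
  unfold om
  rcases hj with rfl | rfl
  · have := h.far hkm hQ
    rw [if_pos (by omega), if_neg (by omega)]; rfl
  · have := h.far hkm.symm hQ
    rw [if_neg (by omega), if_pos (by omega)]; rfl

theorem Dat.run (h : Dat W π l A C K N) {k m : Fin 3} (hkm : k ≠ m) {T x y} (hr : Run (ag_act π) (QD π l k m) T x y) (a b) (i j) :
    |dd a b (y i).1.2 - dd a b (x j).1.2| ≤ T.length * K := by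
  induction T generalizing x j with
  | nil => obtain ⟨h1, rfl⟩ := hr; rw [(h1.e i j).1]; simp
  | cons t T ih =>
    obtain ⟨z, hs, hr⟩ := hr
    have h1 := ih hr j
    obtain ⟨i', j', hf⟩ := h.rdt hs.1 j
    have h2 := (h.stp hf a b).2
    rw [← hs.fst (h.sys hkm) j j] at h2
    rw [abs_le] at h1 h2 ⊢
    push_cast [List.length_cons]
    constructor <;> linarith

theorem Dat.chg (h : Dat W π l A C K N) {M : ℤ} (hM : (N + 3) * K < M) {k m m' : Fin 3} (hm : k ≠ m) (hm' : k ≠ m') {x} (hx : Tri (QD π l k m) x)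
    (h1 : om M k (dS (ag_act π) (x 0)).1 - om M k (x 0).1 ≠ 0) : chir (ag_act π) (QD π l k m) x = chir (ag_act π) (QD π l k m') x := by
  refine chir_loc h.hW (h.sys hm) (h.sys hm') hx (n := N) ?_ ?_
  · intro i
    obtain ⟨i', j', hf⟩ := h.rdt hx i
    exact h.hN _ _ _ hf
  · intro T y hT hr i j
    have h2 := h.om_near hx 0 h1
    have h3 := h.run hm hr k (k + 1) i 0
    have h4 : (T.length : ℤ) * K ≤ N * K := mul_le_mul_of_nonneg_right (by exact_mod_cast hT) h.K0
    have K0 := h.K0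
    rw [abs_le] at h2 h3
    have h5 : K < dd k (k + 1) (y i).1.2 := by linarith
    have z : ∀ n, k ≠ n → QQ π l j n (y i) = 0 := by
      intro n hn
      by_contra hc
      have := h.far hn.symm hc
      omega
    simp only [QD, z m hm, z m' hm']

theorem Dat.eqv (h : Dat W π l A C K N) {M : ℤ} (hM : (N + 3) * K < M) {k m m' : Fin 3} (hm : k ≠ m) (hm' : k ≠ m') :
    Ph (ag_act π) (QD π l k m) (om M k) = Ph (ag_act π) (QD π l k m') (om M k) := by
  unfold Ph
  apply finsum_congr
  intro x
  by_cases e : om M k (dS (ag_act π) (x 0)).1 - om M k (x 0).1 = 0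
  · rw [e, mul_zero, mul_zero]
  · congr 1
    by_cases h1 : Tri (QD π l k m) x
    · exact h.chg hM hm hm' h1 e
    · by_cases h2 : Tri (QD π l k m') x
      · exact (h.chg hM hm' hm h2 e).symm
      · have e1 : chir (ag_act π) (QD π l k m) x = 0 := by by_contra hc; exact h1 (chir_tri hc)
        have e2 : chir (ag_act π) (QD π l k m') x = 0 := by by_contra hc; exact h2 (chir_tri hc)
        rw [e1, e2]

theorem Dat.zero (h : Dat W π l A C K N) {M : ℤ} (hM : (N + 3) * K < M) : Ph (ag_act π) (QD π l 0 1) (om M 0) = 0 := by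
  have hM' : 2 * K < M := by
    have := h.K0
    have : (0 : ℤ) ≤ N * K := by positivity
    linarith
  have sw : ∀ k m n : Fin 3, k ≠ m → Ph (ag_act π) (QD π l k m) (om M n) = Ph (ag_act π) (QD π l m k) (om M n) := by
    intro k m n hkm
    rw [QD_neg, Ph_neg h.hW (h.sys hkm.symm)]
  have o1 := h.opp hM' (k := 0) (m := 1) (by decide)
  have o2 := h.opp hM' (k := 1) (m := 2) (by decide)
  have o3 := h.opp hM' (k := 2) (m := 0) (by decide)
  rw [sw 0 1 1 (by decide), h.eqv hM (k := 1) (m := 0) (m' := 2) (by decide) (by decide)] at o1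
  rw [sw 1 2 2 (by decide), h.eqv hM (k := 2) (m := 1) (m' := 0) (by decide) (by decide)] at o2
  rw [sw 2 0 0 (by decide), h.eqv hM (k := 0) (m := 2) (m' := 1) (by decide) (by decide)] at o3
  omega

end

section
variable {S : Type u} {W : Set Wd(S)} {P : Type v} {act : P → S × Bool → P} {ha : Act act}
  {Q : Fin 3 → P × Rd(S) → ℤ}

/-- median -/
def Zm (Q : Fin 3 → P × Rd(S) → ℤ) (x : P × Rd(S)) : ℤ := max (min (Q 0 x) (Q 1 x)) (min (max (Q 0 x) (Q 1 x)) (Q 2 x))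

theorem fin3 : ∀ i : Fin 3, i ≠ 1 → i = 0 ∨ i = 2 := by decide

theorem up1 {x : P × Rd(S)} : Up Q 1 x ↔ Q 1 x = Q 0 x + 1 ∧ Q 1 x = Q 2 x + 1 := by
  constructor
  · exact fun h => ⟨h 0 (by decide), h 2 (by decide)⟩
  · rintro ⟨h0, h2⟩ i hi
    rcases fin3 i hi with rfl | rfl
    · exact h0
    · exact h2

theorem dn1 {x : P × Rd(S)} : Dn Q 1 x ↔ Q 1 x = Q 0 x - 1 ∧ Q 1 x = Q 2 x - 1 := by
  constructor
  · exact fun h => ⟨h 0 (by decide), h 2 (by decide)⟩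
  · rintro ⟨h0, h2⟩ i hi
    rcases fin3 i hi with rfl | rfl
    · exact h0
    · exact h2

theorem Sys.dn_bar (h : Sys W ha Q) {x} : Up Q 1 (dB act x) ↔ Dn Q 1 x := by
  rw [up1, dn1, h.bar, h.bar, h.bar]; omega

/-- presence of an opposite dart -/
def Eo (Q : Fin 3 → P × Rd(S) → ℤ) (x y : P × Rd(S)) : Prop := Dn Q 1 y ∧ y.1 = x.1 ∧ y.2 0 = x.2 0

theorem Sys.eo_bar (h : Sys W ha Q) {x y} (hx : Up Q 1 x) (hy : Eo Q x y) : Eo Q (dB act y) (dB act x) := by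
  refine ⟨h.dn_bar.1 (by rwa [dB_dB ha]), ?_, ?_⟩
  · rw [dB_fst, dB_fst, hy.2.1, hy.2.2]
  · rw [dB_snd0, dB_snd0, hy.2.2]

theorem Sys.eo_uniq (h : Sys W ha Q) {x y y'} (hy : Eo Q x y) (hy' : Eo Q x y') : y = y' := by
  apply dB_inj ha
  refine h.up_uniq (h.dn_bar.2 hy.1) (h.dn_bar.2 hy'.1) ⟨?_, ?_⟩
  · rw [dB_fst, dB_fst, hy.2.1, hy.2.2, hy'.2.1, hy'.2.2]
  · rw [dB_snd0, dB_snd0, hy.2.2, hy'.2.2]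

theorem eo_sum (h : Sys W ha Q) {η : P × Rd(S) → ℤ} (he : ∀ x y, x.1 = y.1 → x.2 0 = y.2 0 → η x = η y)
    (hb : ∀ x, η (dB act x) = - η x) : ∑ᶠ x ∈ {x | Up Q 1 x ∧ ∃ y, Eo Q x y}, η x = 0 := by
  classical
  have hex : ∀ x, ∃ y, (∃ z, Eo Q x z) → Eo Q x y := by
    intro x
    by_cases hx : ∃ z, Eo Q x z
    · exact ⟨hx.choose, fun _ => hx.choose_spec⟩
    · exact ⟨x, fun hh => absurd hh hx⟩
  choose f hf using hex
  have inv : ∀ x ∈ {x | Up Q 1 x ∧ ∃ y, Eo Q x y}, dB act (f (dB act (f x))) = x := by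
    rintro x ⟨hx, hy⟩
    have h1 := h.eo_bar hx (hf x hy)
    rw [h.eo_uniq (hf _ ⟨_, h1⟩) h1, dB_dB ha]
  have mp : Set.MapsTo (fun x => dB act (f x)) {x | Up Q 1 x ∧ ∃ y, Eo Q x y} {x | Up Q 1 x ∧ ∃ y, Eo Q x y} := by
    rintro x ⟨hx, hy⟩
    exact ⟨h.dn_bar.2 (hf x hy).1, _, h.eo_bar hx (hf x hy)⟩
  have hbij : Set.BijOn (fun x => dB act (f x)) {x | Up Q 1 x ∧ ∃ y, Eo Q x y} {x | Up Q 1 x ∧ ∃ y, Eo Q x y} :=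
    Set.InvOn.bijOn (f' := fun x => dB act (f x)) ⟨inv, inv⟩ mp mp
  have h2 : ∑ᶠ x ∈ {x | Up Q 1 x ∧ ∃ y, Eo Q x y}, η x = ∑ᶠ x ∈ {x | Up Q 1 x ∧ ∃ y, Eo Q x y}, - η x := by
    refine finsum_mem_eq_of_bijOn _ hbij ?_
    rintro x ⟨hx, hy⟩
    have h3 := hf x hy
    change η x = - η (dB act (f x))
    rw [hb, neg_neg]
    exact he _ _ h3.2.1.symm h3.2.2.symm
  simp only [finsum_neg_distrib] at h2
  omega

theorem tri_sum (h : Sys W ha Q) (η : P × Rd(S) → ℤ) :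
    ∑ᶠ x ∈ {x | Tri Q x}, η (x 1) = ∑ᶠ x ∈ {x | Up Q 1 x ∧ ¬ ∃ y, Eo Q x y}, η x := by
  refine finsum_mem_eq_of_bijOn (fun x => x 1) ⟨?_, ?_, ?_⟩ (fun _ _ => rfl)
  · intro x hx
    refine ⟨hx.up 1, ?_⟩
    rintro ⟨y, hy, e1, e2⟩
    obtain ⟨d0, d2⟩ := dn1.1 hy
    have h0 := hx.up 0 1 (by decide)
    have h02 := hx.up 0 2 (by decide)
    have := h.uniq (i := 1) (j := 0) (by decide) (x := y) (y := x 0) (by omega) (by omega)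
      ⟨by rw [e1, (hx.e 0 1).1], by rw [e2, (hx.e 0 1).2]⟩
    rw [← this] at h0 h02
    omega
  · intro x hx y hy e
    simp only at e
    funext i
    refine h.up_uniq (hx.up i) (hy.up i) ⟨?_, ?_⟩
    · rw [(hx.e i 1).1, e, (hy.e 1 i).1]
    · rw [(hx.e i 1).2, e, (hy.e 1 i).2]
  · rintro d ⟨hd, hn⟩
    have key : ∀ i, i ≠ 1 → ∃ y, Up Q i y ∧ y.1 = d.1 ∧ y.2 0 = d.2 0 := by
      intro i hi
      obtain ⟨y, y1, y2, y3⟩ := h.ng hi (hd.pos hi)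
      refine ⟨y, ?_, y2, y3⟩
      rcases h.typ hi y1 with hh | hh
      · exact hh
      · exact absurd ⟨y, hh, y2, y3⟩ hn
    obtain ⟨y0, a0, b0, c0⟩ := key 0 (by decide)
    obtain ⟨y2, a2, b2, c2⟩ := key 2 (by decide)
    have all : ∀ i, (![y0, d, y2] i).1 = d.1 ∧ (![y0, d, y2] i).2 0 = d.2 0 := by
      intro i
      fin_cases i
      · exact ⟨b0, c0⟩
      · exact ⟨rfl, rfl⟩
      · exact ⟨b2, c2⟩
    refine ⟨![y0, d, y2], ⟨fun i j => ⟨(all i).1.trans (all j).1.symm, (all i).2.trans (all j).2.symm⟩, ?_⟩, rfl⟩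
    intro j
    fin_cases j
    · exact a0
    · exact hd
    · exact a2

theorem par_sum (h : Sys W ha Q) {η : P × Rd(S) → ℤ} (he : ∀ x y, x.1 = y.1 → x.2 0 = y.2 0 → η x = η y)
    (hb : ∀ x, η (dB act x) = - η x) (hf : {x | Up Q 1 x ∧ η x ≠ 0}.Finite) :
    ∑ᶠ x, (Q 1 x - Zm Q x) * η x = 2 * ∑ᶠ x ∈ {x | Tri Q x}, η (x 1) := by
  classical
  let f : P × Rd(S) → ℤ := fun x => if Up Q 1 x then η x else 0
  let bp : Perm (P × Rd(S)) := ⟨dB act, dB act, dB_dB ha, dB_dB ha⟩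
  have ff : (support f).Finite := hf.subset fun x hx => by
    by_cases hu : Up Q 1 x
    · exact ⟨hu, by simpa [f, hu] using hx⟩
    · exact absurd (if_neg hu) hx
  have e1 : ∀ x, (Q 1 x - Zm Q x) * η x = f x + f (bp x) := by
    intro x
    change _ = (if Up Q 1 x then η x else 0) + (if Up Q 1 (dB act x) then η (dB act x) else 0)
    rw [hb]
    have o1 := (h.fl 0 1 (by decide)).one x
    have o2 := (h.fl 0 2 (by decide)).one x
    have o3 := (h.fl 1 2 (by decide)).one x
    have h1 := up1 (Q := Q) (x := x)
    have h2 := dn1 (Q := Q) (x := x)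
    rw [← h.dn_bar] at h2
    by_cases c1 : Up Q 1 x
    · have c2 : ¬ Up Q 1 (dB act x) := by rw [h2]; rw [h1] at c1; omega
      rw [if_pos c1, if_neg c2]
      rw [h1] at c1
      have : Q 1 x - Zm Q x = 1 := by unfold Zm; omega
      rw [this]; ring
    · by_cases c2 : Up Q 1 (dB act x)
      · rw [if_neg c1, if_pos c2]
        rw [h2] at c2
        have : Q 1 x - Zm Q x = -1 := by unfold Zm; omega
        rw [this]; ring
      · rw [if_neg c1, if_neg c2]
        rw [h1] at c1; rw [h2] at c2
        have : Q 1 x - Zm Q x = 0 := by unfold Zm; omega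
        rw [this]; ring
  rw [finsum_congr e1, finsum_add_distrib ff (show (support fun x => f (bp x)).Finite from
    ff.preimage (f := bp) bp.injective.injOn), finsum_comp_equiv bp]
  have e2 : ∑ᶠ x, f x = ∑ᶠ x ∈ {x | Tri Q x}, η (x 1) := by
    rw [tri_sum h]
    have e3 : ∀ x, f x = (Set.indicator {x | Up Q 1 x ∧ ¬ ∃ y, Eo Q x y} η x) + (Set.indicator {x | Up Q 1 x ∧ ∃ y, Eo Q x y} η x) := by
      intro x
      by_cases c1 : Up Q 1 x <;> by_cases c2 : ∃ y, Eo Q x y <;> simp [f, Set.indicator, c1, c2, -Prod.exists, -Prod.forall, -not_exists]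
    rw [finsum_congr e3, finsum_add_distrib, ← finsum_mem_def, ← finsum_mem_def, eo_sum h he hb, add_zero]
    · refine hf.subset fun x hx => ?_
      rw [Function.mem_support, Set.indicator_apply_ne_zero] at hx
      exact ⟨hx.1.1, hx.2⟩
    · refine hf.subset fun x hx => ?_
      rw [Function.mem_support, Set.indicator_apply_ne_zero] at hx
      exact ⟨hx.1.1, hx.2⟩
  rw [e2]; ring

theorem per_sum {Z : P × Rd(S) → ℤ} (hZ : ∀ x, Z (dS ha x) = Z x) {n : ℕ} (hn : 0 < n) (hp : ∀ x, Z x ≠ 0 → (dS ha ^ n) x = x)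
    {ω : P → ℤ} (hf : (support fun x => Z x * (ω (dS ha x).1 - ω x.1)).Finite) : ∑ᶠ x, Z x * (ω (dS ha x).1 - ω x.1) = 0 := by
  have hk : ∀ k x, Z ((dS ha ^ k) x) = Z x := by
    intro k; induction k with
    | zero => simp
    | succ k ih => intro x; rw [pow_succ', mul_apply, hZ, ih]
  have h1 : ∀ k : ℕ, ∑ᶠ x, Z x * (ω ((dS ha ^ (k + 1)) x).1 - ω ((dS ha ^ k) x).1) = ∑ᶠ x, Z x * (ω (dS ha x).1 - ω x.1) := by
    intro k
    rw [← finsum_comp_equiv (dS ha ^ k) (f := fun x => Z x * (ω (dS ha x).1 - ω x.1))]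
    apply finsum_congr
    intro x
    rw [hk, pow_succ', mul_apply]
  have h2 : ∑ᶠ x, ∑ k ∈ Finset.range n, Z x * (ω ((dS ha ^ (k + 1)) x).1 - ω ((dS ha ^ k) x).1) = 0 := by
    rw [← finsum_zero (α := P × Rd(S))]
    apply finsum_congr
    intro x
    rw [← Finset.mul_sum, Finset.sum_range_sub (fun k => ω ((dS ha ^ k) x).1)]
    by_cases c : Z x = 0
    · rw [c, zero_mul]
    · rw [hp x c]; simp
  rw [finsum_sum_comm, sum_congr rfl (fun k _ => h1 k)] at h2
  · simp only [Finset.sum_const, Finset.card_range, nsmul_eq_mul, mul_eq_zero] at h2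
    rcases h2 with h2 | h2
    · exact absurd h2 (by exact_mod_cast hn.ne')
    · exact h2
  · intro k _
    refine (hf.preimage (f := dS ha ^ k) (dS ha ^ k).injective.injOn).subset ?_
    intro x hx
    simp only [Set.mem_preimage, Function.mem_support] at hx ⊢
    rw [hk, ← mul_apply, ← pow_succ']
    exact hx

end

section
variable {S : Type u} {W : Set Wd(S)} {P : Type v} {act : P → S × Bool → P} {e : P → S × Bool → ℤ}

/-- integral of an edge function along a path -/
def Jn (act : P → S × Bool → P) (e : P → S × Bool → ℤ) (p : P) (w : Wd(S)) : ℤ :=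
  ((pw act p w).map (fun y => e y.1 y.2)).sum

theorem Jn_app (p : P) (u v : Wd(S)) : Jn act e p (u ++ v) = Jn act e p u + Jn act e (pend act p u) v := by
  simp [Jn, pw_append]

theorem Jn_bar (ha : Act act) (he : ∀ p s, e (act p s) (linv s) = - e p s) (p : P) (w : Wd(S)) :
    Jn act e (pend act p w) (ebar linv w) = - Jn act e p w := by
  unfold Jn
  rw [pw_ebar ha, ebar, List.map_reverse, List.sum_reverse, map_map]
  induction pw act p w with
  | nil => simp
  | cons y t ih =>
    have := he y.1 y.2
    simp only [map_cons, List.sum_cons, ih, Function.comp, einv, this]; ring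

theorem Jn_mk (ha : Act act) (he : ∀ p s, e (act p s) (linv s) = - e p s) (p : P) {w w' : Wd(S)}
    (h : fgMk w = fgMk w') : Jn act e p w = Jn act e p w' := by
  have h1 := Quot.eqvGen_exact h
  clear h
  induction h1 with
  | rel a b hab =>
    obtain ⟨⟩ := hab
    rename_i L1 L2 x b
    have hb : ((x, !b) : S × Bool) = linv (x, b) := rfl
    rw [show L1 ++ (x, b) :: (x, !b) :: L2 = L1 ++ ([(x, b)] ++ ([(x, !b)] ++ L2)) by simp, Jn_app, Jn_app, Jn_app, Jn_app, hb]
    have h1 : ∀ q s, Jn act e q [s] = e q s := by intro q s; simp [Jn, pw]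
    have h2 : ∀ q s, pend act q [s] = act q s := fun q s => rfl
    rw [h1, h1, h2, h2, ha.back, he]; ring
  | refl => rfl
  | symm a b _ ih => exact ih.symm
  | trans a b c _ _ h1 h2 => exact h1.trans h2

theorem Jn_pot {f : P → ℤ} {p : P} {w : Wd(S)} (h : ∀ u s, u ++ [s] <+: w → e (pend act p u) s = f (act (pend act p u) s) - f (pend act p u)) :
    Jn act e p w = f (pend act p w) - f p := by
  induction w using List.reverseRecOn with
  | nil => simp [Jn, pw, pend]
  | append_singleton w s ih =>
    rw [Jn_app, ih fun u t hu => h u t (hu.trans (List.prefix_append _ _)), pend_append]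
    have h1 := h w s (List.prefix_refl _)
    have h2 : Jn act e (pend act p w) [s] = e (pend act p w) s := by simp [Jn, pw]
    have h3 : pend act (pend act p w) [s] = act (pend act p w) s := rfl
    rw [h2, h3, h1]; ring

theorem phs_Jn (he : ∀ p s, e (act p s) (linv s) = - e p s) (w : List (P × (S × Bool))) :
    phs act (fun x => e x.1 (x.2 0)) w = 2 * (w.map (fun y => e y.1 y.2)).sum := by
  by_cases hw : w = []
  · simp [hw, phs]
  have h1 : (w.map (fun y => e y.1 y.2)).sum = ∑ k ∈ Finset.range w.length, e (rd w hw k).1 (rd w hw k).2 := by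
    rw [← lsum_range]
    congr 1
    apply List.ext_getElem
    · simp
    · intro k hk _
      rw [length_map] at hk
      simp [rd_natCast hw hk]
  rw [phs_ne _ hw, h1, Finset.mul_sum]
  apply sum_congr rfl
  intro k _
  rw [dB_fst, dB_snd0, XX_snd0, he, ← XX_snd0 w hw]
  change e (rd w hw k).1 _ - - e (rd w hw k).1 _ = _
  rw [XX_snd0]; ring

theorem chn_Jn (ha : Act act) (he : ∀ p s, e (act p s) (linv s) = - e p s) (hr : ∀ r ∈ W, ∀ p, pend act p r = p) (p : P)
    {l : Fi(S)} (hl : ∀ x ∈ l, x.2 ∈ W) :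
    chn act (fun x => e x.1 (x.2 0)) p l = 2 * Jn act e p (cjl l) := by
  induction l with
  | nil => simp [chn, cjl, Jn, pw]
  | cons x l ih =>
    have ih := ih fun y hy => hl y (List.mem_cons_of_mem _ hy)
    have hx := hr x.2 (hl x List.mem_cons_self)
    have e1 : cjl (x :: l) = x.1 ++ x.2 ++ ebar linv x.1 ++ cjl l := by simp [cjl]
    have e2 : chn act (fun x => e x.1 (x.2 0)) p (x :: l) = phs act (fun x => e x.1 (x.2 0)) (pw act (pend act p x.1) x.2) + chn act (fun x => e x.1 (x.2 0)) p l := by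
      simp [chn]
    rw [e2, e1, ih, phs_Jn he]
    simp only [Jn_app, pend_append, hx, pend_ebar ha, Jn_bar ha he]
    unfold Jn
    ring

theorem chn_pair (η : P × Rd(S) → ℤ) (p : P) (l : Fi(S)) :
    (support fun x => chn act dlt p l x * η x).Finite ∧ ∑ᶠ x, chn act dlt p l x * η x = chn act η p l := by
  classical
  simp only [chn_dlt, chn_dts η]
  induction dts l with
  | nil => simp
  | cons d t ih =>
    have key : ∀ y, (support fun x => dlt y x * η x).Finite ∧ ∑ᶠ x, dlt y x * η x = η y := by
      intro y
      constructor
      · refine (Set.finite_singleton y).subset fun x hx => ?_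
        by_contra hc
        exact hx (by simp only [dlt]; rw [if_neg (fun h => hc h.symm), zero_mul])
      · rw [finsum_eq_single _ y]
        · simp [dlt]
        · intro x hx
          simp only [dlt]; rw [if_neg (fun h => hx h.symm), zero_mul]
    obtain ⟨k1, k2⟩ := key (pend act p d.1, d.2)
    obtain ⟨k3, k4⟩ := key (dB act (pend act p d.1, d.2))
    have k5 : (support fun x => dlt (pend act p d.1, d.2) x * η x - dlt (dB act (pend act p d.1, d.2)) x * η x).Finite :=
      (k1.union k3).subset (Function.support_sub _ _)
    simp only [map_cons, List.sum_cons, add_mul, sub_mul]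
    refine ⟨(k5.union ih.1).subset (Function.support_add _ _), ?_⟩
    rw [finsum_add_distrib k5 ih.1, finsum_sub_distrib k1 k3, k2, k4, ih.2]

end

section
variable {S : Type u} {W : Set Wd(S)} {π : FreeGroup S →* F2 × F2}
  {l : Fin 3 → Fin 3 → Fi(S)} {A C : Fin 3 → FreeGroup S} {K : ℤ} {N : ℕ}

/-- slab -/
def Bo (L : ℤ) (g : F2 × F2) : Prop := ∀ a b, |dd a b g.1| ≤ L

open Classical in
/-- cut off edge function -/
noncomputable def ec (π : FreeGroup S →* F2 × F2) (L M : ℤ) (g : F2 × F2) (s : S × Bool) : ℤ :=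
  if Bo L g ∧ Bo L (ag π g s) then om M 0 (ag π g s) - om M 0 g else 0

theorem ec_anti (L M : ℤ) (g : F2 × F2) (s : S × Bool) : ec π L M (ag π g s) (linv s) = - ec π L M g s := by
  unfold ec
  rw [(ag_act π).back]
  by_cases h : Bo L g ∧ Bo L (ag π g s)
  · rw [if_pos h, if_pos h.symm]; ring
  · rw [if_neg h, if_neg (fun hh => h hh.symm), neg_zero]

/-- the dart version -/
noncomputable def et (π : FreeGroup S →* F2 × F2) (L M : ℤ) (x : (F2 × F2) × Rd(S)) : ℤ := ec π L M x.1 (x.2 0)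

theorem et_bar (L M : ℤ) (x) : et π L M (dB (ag π) x) = - et π L M x := by
  unfold et
  rw [dB_fst, dB_snd0, ec_anti]

theorem et_eq {L M : ℤ} {x : (F2 × F2) × Rd(S)} (h1 : Bo L x.1) (h2 : Bo L (dS (ag_act π) x).1) :
    et π L M x = om M 0 (dS (ag_act π) x).1 - om M 0 x.1 := if_pos ⟨h1, h2⟩

theorem Dat.et_ne (h : Dat W π l A C K N) {L M : ℤ} {i j x} (hx : x.2 ∈ rds (l i j)) (he : et π L M x ≠ 0) :
    Bo L x.1 ∧ |dd 0 1 x.1.2 - M| ≤ K := by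
  unfold et ec at he
  split_ifs at he with hc
  · exact ⟨hc.1, om_ne (k := 0) he (h.stp hx _ _).2⟩
  · exact absurd rfl he

theorem Dat.qd_ne {k m i : Fin 3} {x} (h : QD π l k m i x ≠ 0) : ∃ j, (j = k ∨ j = m) ∧ QQ π l i j x ≠ 0 := by
  by_cases h1 : QQ π l i m x = 0
  · refine ⟨k, Or.inl rfl, fun h2 => h ?_⟩
    simp [QD, h1, h2]
  · exact ⟨m, Or.inr rfl, h1⟩

theorem Dat.et_fin (h : Dat W π l A C K N) {L M : ℤ} (hM : 2 * K < M) :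
    {x | (∃ i, QD π l 0 1 i x ≠ 0) ∧ et π L M x ≠ 0}.Finite := by
  obtain ⟨n, hn⟩ : ∃ n : ℕ, L + K < n ∧ M + 2 * K < n := ⟨(L + K).toNat + (M + 2 * K).toNat + 1, by omega, by omega⟩
  refine (bx_fin (π := π) (l := l) n).subset ?_
  rintro x ⟨⟨i, hi⟩, he⟩
  obtain ⟨j, hj, hQ⟩ := Dat.qd_ne hi
  obtain ⟨h1, h2⟩ := h.et_ne (h.sup hQ).1 he
  rw [abs_le] at h2
  have h3 := (abs_le.1 (h1 i (i + 1))).2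
  rcases hj with rfl | rfl
  · exact h.bxm hQ (by omega) (by simp only [zero_add]; omega)
  · have : dd 0 1 x.1.2 ≤ K := h.far (k := 0) (by decide) hQ
    omega

theorem Zm_ne {P : Type v} {Q : Fin 3 → P × Rd(S) → ℤ} {x} (h : Zm Q x ≠ 0) : ∃ i j, i ≠ j ∧ Q i x ≠ 0 ∧ Q j x ≠ 0 := by
  unfold Zm at h
  by_cases h0 : Q 0 x = 0
  · exact ⟨1, 2, by decide, by omega, by omega⟩
  · by_cases h1 : Q 1 x = 0
    · exact ⟨0, 2, by decide, by omega, by omega⟩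
    · exact ⟨0, 1, by decide, h0, h1⟩

theorem Dat.bo (h : Dat W π l A C K N) {i j x} (hx : x.2 ∈ rds (l i j)) (hb : ∀ a b, |dd a b x.1.1| ≤ 3 * K) :
    Bo (4 * K) x.1 ∧ Bo (4 * K) (dS (ag_act π) x).1 := by
  have K0 := h.K0
  refine ⟨fun a b => (hb a b).trans (by omega), fun a b => ?_⟩
  have h1 := (h.stp hx a b).1
  have h2 := hb a b
  rw [abs_le] at h1 h2 ⊢
  omega

theorem Dat.zsum (h : Dat W π l A C K N) {M : ℤ} (hM : 2 * K < M) : ∑ᶠ x, Zm (QD π l 0 1) x * et π (4 * K) M x = 0 := by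
  have h01 : (0 : Fin 3) ≠ 1 := by decide
  have e1 : ∀ x, Zm (QD π l 0 1) x * et π (4 * K) M x = Zm (QD π l 0 1) x * (om M 0 (dS (ag_act π) x).1 - om M 0 x.1) := by
    intro x
    by_cases hz : Zm (QD π l 0 1) x = 0
    · rw [hz, zero_mul, zero_mul]
    obtain ⟨i, i', hi, h1, h2⟩ := Zm_ne hz
    obtain ⟨j, -, h1⟩ := Dat.qd_ne h1
    obtain ⟨j', -, h2⟩ := Dat.qd_ne h2
    obtain ⟨b1, b2⟩ := h.bo (h.sup h1).1 (h.two hi h1 h2 rfl)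
    rw [et_eq b1 b2]
  rw [finsum_congr e1]
  refine per_sum (n := N.factorial) ?_ (Nat.factorial_pos _) ?_ ?_
  · intro x
    simp only [Zm, (h.sys h01).sig]
  · intro x hz
    obtain ⟨i, i', hi, h1, h2⟩ := Zm_ne hz
    obtain ⟨j, -, h1⟩ := Dat.qd_ne h1
    have hf := (h.sup h1).1
    have hR := rds_mem h.hW (h.hl i j) hf
    obtain ⟨k, hk⟩ := Nat.dvd_factorial (prd_pos h.hW hR) (h.hN i j _ hf)
    rw [hk, pow_mul]
    have := dS_prd (ha := ag_act π) h.hW h.hr hR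
    exact Function.IsFixedPt.perm_pow this k
  · simp only [← e1]
    refine (h.et_fin (L := 4 * K) hM).subset fun x hx => ?_
    obtain ⟨i, i', hi, h1, h2⟩ := Zm_ne (left_ne_zero_of_mul hx)
    exact ⟨⟨i, h1⟩, right_ne_zero_of_mul hx⟩

theorem Dat.sq (h : Dat W π l A C K N) {L M : ℤ} {wA wC : Wd(S)} {i j : Fin 3} (eA : fgMk wA = A i) (eC : fgMk wC = C j) (p q : ℕ) :
    Jn (ag π) (ec π L M) (bp i j (p, q)) (cjl (l i j)) = Jn (ag π) (ec π L M) (bp i j (p, q)) wA - Jn (ag π) (ec π L M) (bp i j (p, q + 1)) wA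
      + (Jn (ag π) (ec π L M) (bp i j (p + 1, q)) wC - Jn (ag π) (ec π L M) (bp i j (p, q)) wC) := by
  have e1 : fgMk (cjl (l i j)) = fgMk (wA ++ wC ++ ebar linv wA ++ ebar linv wC) := by
    rw [h.hl']
    simp only [← mul_mk, mk_ebar, eA, eC]
  have pA : ∀ p q, pend (ag π) (bp i j (p, q)) wA = bp i j (p + 1, q) := by
    intro p q
    rw [pend_ag, eA, h.hA]; simp [bp, pow_succ]
  have pC : ∀ p q, pend (ag π) (bp i j (p, q)) wC = bp i j (p, q + 1) := by
    intro p q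
    rw [pend_ag, eC, h.hC]; simp [bp, pow_succ]
  have bA := Jn_bar (ag_act π) (ec_anti (π := π) L M) (bp i j (p, q + 1)) wA
  have bC := Jn_bar (ag_act π) (ec_anti (π := π) L M) (bp i j (p, q)) wC
  have qA := pend_ebar (ag_act π) (bp i j (p, q + 1)) wA
  rw [pA] at bA qA
  rw [pC] at bC
  rw [Jn_mk (ag_act π) (ec_anti L M) _ e1]
  simp only [Jn_app, pend_append, pA, pC, bA, bC, qA]
  ring

theorem Dat.tele (h : Dat W π l A C K N) {M : ℤ} (hM : K < M) {n : ℕ} (hn : 5 * K + M < n) :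
    ∑ m ∈ Finset.range n ×ˢ Finset.range n, Jn (ag π) (ec π (4 * K) M) (bp 1 0 m) (cjl (l 1 0)) = -1 := by
  have K0 := h.K0
  obtain ⟨wA, eA, hA⟩ := h.pA 1
  obtain ⟨wC, eC, hC⟩ := h.pC 0
  have d0 : dd 0 1 (aa 0) = 1 := by simp [dd_aa]
  have d1 : dd 1 2 (aa 1) = 1 := by simp [dd_aa]
  have pc : ∀ (g : F2 × F2) u s, ag π (pend (ag π) g u) s = pend (ag π) g (u ++ [s]) := by intro g u s; rw [pend_append]; rfl
  -- horizontal sides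
  have a0 : ∀ p, Jn (ag π) (ec π (4 * K) M) (bp 1 0 (p, 0)) wA = 0 := by
    intro p
    rw [Jn_pot (f := fun _ => 0), sub_self]
    intro u s hu
    have om0 : ∀ v, v <+: wA → om M 0 (pend (ag π) (bp 1 0 (p, 0)) v) = 0 := by
      intro v hv
      have := (abs_le.1 (hA v hv 0 1).2).2
      rw [pend_ag]
      refine if_neg ?_
      simp only [bp, Prod.snd_mul, dd_mul, dd_pow, zero_add]
      push_cast; omega
    unfold ec
    rw [pc, om0 _ hu, om0 _ ((List.prefix_append _ _).trans hu)]
    simp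
  have an : ∀ p, Jn (ag π) (ec π (4 * K) M) (bp 1 0 (p, n)) wA = 0 := by
    intro p
    rw [Jn_pot (f := fun _ => 0), sub_self]
    intro u s hu
    have om1 : ∀ v, v <+: wA → om M 0 (pend (ag π) (bp 1 0 (p, n)) v) = 1 := by
      intro v hv
      have := (abs_le.1 (hA v hv 0 1).2).1
      rw [pend_ag]
      refine if_pos ?_
      simp only [bp, Prod.snd_mul, dd_mul, dd_pow, zero_add, d0]
      omega
    unfold ec
    rw [pc, om1 _ hu, om1 _ ((List.prefix_append _ _).trans hu)]
    simp
  have gn : ∀ q, Jn (ag π) (ec π (4 * K) M) (bp 1 0 (n, q)) wC = 0 := by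
    intro q
    rw [Jn_pot (f := fun _ => 0), sub_self]
    intro u s hu
    unfold ec
    rw [if_neg]
    · simp
    · rintro ⟨hb, -⟩
      have h1 := (abs_le.1 (hb 1 2)).2
      have h2 := (abs_le.1 (hC u ((List.prefix_append _ _).trans hu) 1 2).1).1
      rw [pend_ag] at h1
      simp only [bp, Prod.fst_mul, dd_mul, dd_pow, d1] at h1
      omega
  have g0 : ∀ q, Jn (ag π) (ec π (4 * K) M) (bp 1 0 (0, q)) wC = om M 0 (bp 1 0 (0, q + 1)) - om M 0 (bp 1 0 (0, q)) := by
    intro q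
    rw [Jn_pot (f := om M 0)]
    · rw [pend_ag, eC, h.hC]; simp [bp, pow_succ]
    · intro u s hu
      have bo : ∀ v, v <+: wC → Bo (4 * K) (pend (ag π) (bp 1 0 (0, q)) v) := by
        intro v hv a b
        have := (hC v hv a b).1
        rw [pend_ag]
        simp only [bp, Prod.fst_mul, dd_mul, dd_pow, Nat.cast_zero, zero_mul, zero_add]
        omega
      refine if_pos ⟨bo _ ((List.prefix_append _ _).trans hu), ?_⟩
      rw [pc]; exact bo _ hu
  simp only [Finset.sum_product, h.sq eA eC, Finset.sum_add_distrib]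
  rw [sum_congr rfl fun p _ => Finset.sum_range_sub' (fun q => Jn (ag π) (ec π (4 * K) M) (bp 1 0 (p, q)) wA) n,
    Finset.sum_comm, sum_congr rfl fun q _ => Finset.sum_range_sub (fun p => Jn (ag π) (ec π (4 * K) M) (bp 1 0 (p, q)) wC) n]
  simp only [a0, an, gn, g0, sub_self, Finset.sum_const_zero, zero_add, zero_sub, Finset.sum_neg_distrib]
  rw [Finset.sum_range_sub (fun q => om M 0 (bp 1 0 (0, q)))]
  have o1 : om M 0 (bp 1 0 (0, n)) = 1 := if_pos (by simp only [bp, dd_pow, zero_add, d0]; omega)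
  have o0 : om M 0 (bp 1 0 (0, 0)) = 0 := if_neg (by simp only [bp, dd_pow, zero_add]; push_cast; omega)
  rw [o1, o0]; rfl

theorem Dat.qsum (h : Dat W π l A C K N) {M : ℤ} (hM : 2 * K < M) : ∑ᶠ x, QD π l 0 1 1 x * et π (4 * K) M x = 2 := by
  have K0 := h.K0
  obtain ⟨n, hn⟩ : ∃ n : ℕ, 5 * K + M < n := ⟨(5 * K + M).toNat + 1, by omega⟩
  have e1 : ∀ x, QD π l 0 1 1 x * et π (4 * K) M x = ∑ m ∈ Finset.range n ×ˢ Finset.range n, -(FC6.chn (ag π) dlt (bp 1 0 m) (l 1 0) x * et π (4 * K) M x) := by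
    intro x
    by_cases he : et π (4 * K) M x = 0
    · simp [he]
    have z1 : QQ π l 1 1 x = 0 := by
      by_contra hc
      have h1 := (abs_le.1 (h.et_ne (h.sup hc).1 he).2).1
      have h2 : dd 0 1 x.1.2 ≤ K := h.far (k := 0) (by decide) hc
      omega
    have z2 : QQ π l 1 0 x = ∑ m ∈ Finset.range n ×ˢ Finset.range n, FC6.chn (ag π) dlt (bp 1 0 m) (l 1 0) x := by
      refine finsum_eq_sum_of_support_subset _ ?_
      intro m hm
      obtain ⟨h1, -, h2⟩ := h.chn hm
      obtain ⟨h3, h4⟩ := h.et_ne h1 he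
      have h5 := (abs_le.1 (h2 1 2).1).1
      have h6 := (abs_le.1 (h2 0 1).2).1
      have h7 := (abs_le.1 (h3 1 2)).2
      have h8 := (abs_le.1 h4).2
      have d0 : dd 0 1 (aa 0) = 1 := by simp [dd_aa]
      have d1 : dd 1 2 (aa 1) = 1 := by simp [dd_aa]
      rw [d1] at h5
      rw [d0] at h6
      simp only [Finset.coe_product, Finset.coe_range, Set.mem_prod, Set.mem_Iio]
      omega
    rw [Finset.sum_neg_distrib, ← Finset.sum_mul, ← z2, QD, z1]; ring
  rw [finsum_congr e1, finsum_sum_comm]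
  · simp only [finsum_neg_distrib, Finset.sum_neg_distrib]
    have e2 : ∀ m, ∑ᶠ x, FC6.chn (ag π) dlt (bp 1 0 m) (l 1 0) x * et π (4 * K) M x = 2 * Jn (ag π) (ec π (4 * K) M) (bp 1 0 m) (cjl (l 1 0)) := by
      intro m
      rw [(chn_pair _ _ _).2]
      exact chn_Jn (ag_act π) (ec_anti _ _) h.hr _ (h.hl 1 0)
    simp only [e2]
    rw [← Finset.mul_sum, h.tele (by omega) hn]; rfl
  · intro m _
    refine ((chn_pair (act := ag π) (et π (4 * K) M) (bp 1 0 m) (l 1 0)).1).subset fun x hx => ?_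
    exact neg_ne_zero.1 hx

theorem Dat.tsum (h : Dat W π l A C K N) {M : ℤ} (hM : 2 * K < M) :
    ∑ᶠ x ∈ {x | Tri (QD π l 0 1) x}, (om M 0 (dS (ag_act π) (x 0)).1 - om M 0 (x 0).1) = 1 := by
  have h01 : (0 : Fin 3) ≠ 1 := by decide
  have hs := h.sys h01
  have fin := h.et_fin (L := 4 * K) hM
  have f1 : (support fun x => QD π l 0 1 1 x * et π (4 * K) M x).Finite :=
    fin.subset fun x hx => ⟨⟨1, left_ne_zero_of_mul hx⟩, right_ne_zero_of_mul hx⟩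
  have f2 : (support fun x => Zm (QD π l 0 1) x * et π (4 * K) M x).Finite :=
    fin.subset fun x hx => by
      obtain ⟨i, i', hi, h1, h2⟩ := Zm_ne (left_ne_zero_of_mul hx)
      exact ⟨⟨i, h1⟩, right_ne_zero_of_mul hx⟩
  have f3 : {x | Up (QD π l 0 1) 1 x ∧ et π (4 * K) M x ≠ 0}.Finite := fin.subset fun x hx => by
    refine ⟨?_, hx.2⟩
    have := hx.1 0 (by decide)
    by_cases e : QD π l 0 1 1 x = 0
    · exact ⟨0, by omega⟩
    · exact ⟨1, e⟩
  have p := par_sum hs (η := et π (4 * K) M) (fun x y e1 e2 => by unfold et; rw [e1, e2]) (et_bar _ _) f3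
  simp only [sub_mul] at p
  rw [finsum_sub_distrib f1 f2, h.qsum hM, h.zsum hM] at p
  rw [finsum_mem_congr rfl (g := fun x => et π (4 * K) M (x 1))]
  · omega
  · intro x hx
    obtain ⟨i, j, hf⟩ := h.rdt hx 1
    obtain ⟨b1, b2⟩ := h.bo hf ((h.tri hx).2 1)
    have e3 := hx.e 0 1
    rw [et_eq b1 b2, dS_fst, dS_fst, e3.1, e3.2]

theorem Dat.false (h : Dat W π l A C K N) : False := by
  have K0 := h.K0
  have nk : (0 : ℤ) ≤ N * K := by positivity
  obtain ⟨M, hM⟩ : ∃ M : ℤ, (N + 3) * K < M := ⟨_, lt_add_one _⟩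
  have hM' : 2 * K < M := by linarith
  have h01 : (0 : Fin 3) ≠ 1 := by decide
  have z := h.zero hM
  have o := h.tsum hM'
  have fin := h.phfin hM' h01 (Or.inl rfl)
  have e1 : ∑ᶠ x ∈ {x | Tri (QD π l 0 1) x}, (om M 0 (dS (ag_act π) (x 0)).1 - om M 0 (x 0).1) = ∑ x ∈ fin.toFinset, (om M 0 (dS (ag_act π) (x 0)).1 - om M 0 (x 0).1) := by
    refine finsum_mem_eq_sum_of_inter_support_eq _ ?_
    ext x
    simp only [Set.mem_inter_iff, Set.mem_setOf_eq, Function.mem_support, Set.Finite.coe_toFinset]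
    tauto
  have e2 : Ph (ag_act π) (QD π l 0 1) (om M 0) = ∑ x ∈ fin.toFinset, chir (ag_act π) (QD π l 0 1) x * (om M 0 (dS (ag_act π) (x 0)).1 - om M 0 (x 0).1) := by
    refine finsum_eq_sum_of_support_subset _ fun x hx => ?_
    rw [Set.Finite.coe_toFinset]
    exact ⟨chir_tri (left_ne_zero_of_mul hx), right_ne_zero_of_mul hx⟩
  rw [e1] at o
  rw [e2] at z
  have d : (2 : ℤ) ∣ ∑ x ∈ fin.toFinset, (chir (ag_act π) (QD π l 0 1) x * (om M 0 (dS (ag_act π) (x 0)).1 - om M 0 (x 0).1) - (om M 0 (dS (ag_act π) (x 0)).1 - om M 0 (x 0).1)) := by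
    refine Finset.dvd_sum fun x hx => ?_
    rw [Set.Finite.mem_toFinset] at hx
    rcases chir_abs h.hW (h.sys h01) hx.1 with hc | hc
    · rw [hc]; simp
    · rw [hc]; exact ⟨-(om M 0 (dS (ag_act π) (x 0)).1 - om M 0 (x 0).1), by ring⟩
  rw [Finset.sum_sub_distrib, z, o] at d
  omega

end

theorem no_sc {S : Type u} {W : Set Wd(S)} (hW : SC W) {π : FreeGroup S →* F2 × F2} (hs : Function.Surjective π)
    (hker : π.ker = Subgroup.normalClosure (fgMk '' W)) : False := by
  choose A hA using fun i : Fin 3 => hs (aa i, 1)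
  choose C hC using fun i : Fin 3 => hs (1, aa i)
  have hex : ∀ i j, ∃ l : Fi(S), (∀ x ∈ l, x.2 ∈ W) ∧ fgMk (cjl l) = A i * C j * (A i)⁻¹ * (C j)⁻¹ := by
    intro i j
    apply exists_fill hW
    rw [← hker, MonoidHom.mem_ker]
    simp [hA, hC]
  choose l hl hl' using hex
  choose wA eA using fun i => Quot.exists_rep (A i)
  choose wC eC using fun i => Quot.exists_rep (C i)
  let X : Set (F2 × F2) :=
    (⋃ i, ⋃ j, (fun v => π (fgMk v)) '' pos (l i j)) ∪ (⋃ i, ⋃ j, (fun f => π (fgMk [f 0])) '' rds (l i j)) ∪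
    ((⋃ i, (fun v => π (fgMk v)) '' {v | v ∈ (wA i).inits}) ∪ (⋃ i, (fun v => π (fgMk v)) '' {v | v ∈ (wC i).inits}))
  have hX : X.Finite := by
    refine Set.Finite.union (Set.Finite.union ?_ ?_) (Set.Finite.union ?_ ?_)
    · exact Set.finite_iUnion fun i => Set.finite_iUnion fun j => (pos_fin _).image _
    · exact Set.finite_iUnion fun i => Set.finite_iUnion fun j => (rds_fin _).image _
    · exact Set.finite_iUnion fun i => (List.finite_toSet _).image _
    · exact Set.finite_iUnion fun i => (List.finite_toSet _).image _
  obtain ⟨K, hK, K0⟩ := ((nb_fin hX).and (Filter.eventually_ge_atTop 0)).exists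
  have hY : (⋃ i, ⋃ j, (prd W) '' rds (l i j)).Finite :=
    Set.finite_iUnion fun i => Set.finite_iUnion fun j => (rds_fin _).image _
  obtain ⟨N, hN⟩ := hY.bddAbove
  refine Dat.false (W := W) (π := π) (l := l) (A := A) (C := C) (K := K) (N := N) ⟨hW, hker, hA, hC, hl, hl', K0, ?_, ?_, ?_, ?_, ?_⟩
  · intro i j v hv
    exact hK _ (Or.inl (Or.inl (Set.mem_iUnion.2 ⟨i, Set.mem_iUnion.2 ⟨j, v, hv, rfl⟩⟩)))
  · intro i j f hf
    exact hK _ (Or.inl (Or.inr (Set.mem_iUnion.2 ⟨i, Set.mem_iUnion.2 ⟨j, f, hf, rfl⟩⟩)))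
  · intro i j f hf
    exact hN (Set.mem_iUnion.2 ⟨i, Set.mem_iUnion.2 ⟨j, f, hf, rfl⟩⟩)
  · intro i
    refine ⟨wA i, eA i, fun u hu => hK _ (Or.inr (Or.inl (Set.mem_iUnion.2 ⟨i, u, (List.mem_inits _ _).2 hu, rfl⟩)))⟩
  · intro i
    refine ⟨wC i, eC i, fun u hu => hK _ (Or.inr (Or.inr (Set.mem_iUnion.2 ⟨i, u, (List.mem_inits _ _).2 hu, rfl⟩)))⟩

end FC6

/-- `F₂ × F₂` admits no C(6) small-cancellation presentation. -/
theorem F2_prod_F2_not_C6_presented {S : Type*} [DecidableEq S]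
    (R : Set (FreeGroup S)) (hSym : FG.Symmetrized R) (hC6 : FG.C6 R) :
    ¬ Nonempty (PresentedGroup R ≃* (FreeGroup (Fin 2) × FreeGroup (Fin 2))) := by
  rintro ⟨φ⟩
  refine FC6.no_sc (FC6.sc_of hSym hC6) (π := φ.toMonoidHom.comp (PresentedGroup.mk R)) ?_ ?_
  · exact φ.surjective.comp (QuotientGroup.mk'_surjective _)
  · have e : FreeGroup.mk '' {w | ∃ r ∈ R, r.toWord = w} = R := by
      ext r
      constructor
      · rintro ⟨w, ⟨r', hr, rfl⟩, rfl⟩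
        rwa [FreeGroup.mk_toWord]
      · intro hr
        exact ⟨r.toWord, ⟨r, hr, rfl⟩, FreeGroup.mk_toWord⟩
    rw [e]
    ext g
    rw [MonoidHom.mem_ker]
    change φ (PresentedGroup.mk R g) = 1 ↔ _
    rw [map_eq_one_iff φ φ.injective, PresentedGroup.mk_eq_one_iff]
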